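/- Fix θ₀ = (σ₀,δ₀,α₀) with σ₀ > 0, δ₀ > 0 and α₀ ∈ (0,2). There exists a sequence of Borel measurable maps θ̂_n : ℝⁿ → ℝ³ such that: (i) ℙ_n( θ̂_n is a local maximum of θ ↦ ln L_n(θ) ) → 1 as n → ∞; (ii) θ̂_n converges to θ₀ in ℙ_n-probability; and (iii) the law of u_n(θ₀)^{-1}(θ̂_n − θ₀) under ℙ_n converges weakly to the centered Gaussian distribution on ℝ³ with covariance matrix I(θ₀)^{-1}. -/

import Mathlib

open MeasureTheory Filter Set Topology Matrix

noncomputable section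

namespace LevyLAN

/-- Standard Gaussian density `φ`. -/
def gauss (y : ℝ) : ℝ := (Real.sqrt (2 * Real.pi))⁻¹ * Real.exp (-(y ^ 2) / 2)

/-- Symmetric `α`-stable density `φ_α`, defined by Fourier inversion. -/
def stableDensity (α z : ℝ) : ℝ :=
  (2 * Real.pi)⁻¹ * ∫ u : ℝ, Real.cos (z * u) * Real.exp (-(|u| ^ α))

/-- `∂_α φ_α`. -/
def stableDensityDalpha (α z : ℝ) : ℝ :=
  -(2 * Real.pi)⁻¹ * ∫ u : ℝ, Real.cos (z * u) * |u| ^ α * Real.log |u| * Real.exp (-(|u| ^ α))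

/-- The operator `(D f) y = (y * f y)' = f y + y * f' y`. -/
def Dop (f : ℝ → ℝ) (y : ℝ) : ℝ := f y + y * deriv f y

/-- `f_α(y, w)`. -/
def fFun (α y w : ℝ) : ℝ := ∫ z : ℝ, gauss (y - w * z) * stableDensity α z

/-- `g_α(y, w)`. -/
def gFun (α y w : ℝ) : ℝ := ∫ z : ℝ, Dop gauss (y - w * z) * stableDensity α z

/-- `h_α(y, w)`. -/
def hFun (α y w : ℝ) : ℝ := ∫ z : ℝ, gauss (y - w * z) * Dop (stableDensity α) z

/-- `k_α(y, w)`. -/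
def kFun (α y w : ℝ) : ℝ := ∫ z : ℝ, gauss (y - w * z) * stableDensityDalpha α z

/-- `c_α`. -/
def cAlpha (α : ℝ) : ℝ :=
  if α = 1 then 1 / Real.pi
  else -(α * (α - 1)) / (2 * Real.Gamma (2 - α) * Real.cos (Real.pi * α / 2))

/-- `w_n(θ) = n^{1/2 - 1/α} δ / σ`. -/
def wn (n : ℕ) (σ δ α : ℝ) : ℝ := (n : ℝ) ^ ((1 : ℝ) / 2 - 1 / α) * δ / σ

/-- `l_α(y, w)` (it depends on `n`). -/
def lFun (n : ℕ) (α y w : ℝ) : ℝ :=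
  ((Real.log n - Real.log (Real.log n)) / (2 * α) - Real.log n / α ^ 2) * hFun α y w
    + kFun α y w

def kappa0 (σ δ α : ℝ) : ℝ := 2 * cAlpha α / (α * (2 - α) ^ (α / 2)) * (δ / σ) ^ α

def kappa1 (σ δ α : ℝ) : ℝ :=
  Real.log (δ / σ) + deriv cAlpha α / cAlpha α - Real.log (2 - α) / 2 - 1 / α

/-- The density `p_{1/n}(y, θ)`, with parameter `θ = (σ, δ, α) : Fin 3 → ℝ`. -/
def pdens (n : ℕ) (θ : Fin 3 → ℝ) (y : ℝ) : ℝ :=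
  Real.sqrt n / θ 0 * fFun (θ 2) (Real.sqrt n * y / θ 0) (wn n (θ 0) (θ 1) (θ 2))

/-- The log-likelihood `ln L_n(θ)`. -/
def logLik (n : ℕ) (θ : Fin 3 → ℝ) (x : Fin n → ℝ) : ℝ :=
  ∑ i, Real.log (pdens n θ (x i))

/-- Partial derivative in the `j`-th parameter coordinate. -/
def pderiv (j : Fin 3) (F : (Fin 3 → ℝ) → ℝ) (θ : Fin 3 → ℝ) : ℝ :=
  deriv (fun t => F (Function.update θ j t)) (θ j)

/-- The score `G_n(θ) = ∇_θ ln L_n(θ)`. -/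
def scoreVec (n : ℕ) (θ : Fin 3 → ℝ) (x : Fin n → ℝ) : Fin 3 → ℝ :=
  fun j => pderiv j (fun θ' => logLik n θ' x) θ

/-- The Hessian matrix `J_n(θ)` of the log-likelihood. -/
def hessMat (n : ℕ) (θ : Fin 3 → ℝ) (x : Fin n → ℝ) : Matrix (Fin 3) (Fin 3) ℝ :=
  Matrix.of fun i j => pderiv i (fun θ' => pderiv j (fun θ'' => logLik n θ'' x) θ') θ

def rate (n : ℕ) (α : ℝ) : ℝ := Real.log n ^ (α / 4) / (n : ℝ) ^ (α / 4)

/-- The rate matrix `u_n(θ)`. -/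
def un (n : ℕ) (θ : Fin 3 → ℝ) : Matrix (Fin 3) (Fin 3) ℝ :=
  !![1 / Real.sqrt n, 0, 0;
     0, rate n (θ 2), -(rate n (θ 2) * (θ 1 / (2 * θ 2)) * (Real.log n - Real.log (Real.log n)));
     0, 0, rate n (θ 2)]

/-- The information matrix `I(θ)`. -/
def Imat (θ : Fin 3 → ℝ) : Matrix (Fin 3) (Fin 3) ℝ :=
  !![2 / θ 0 ^ 2, 0, 0;
     0, θ 2 ^ 2 / θ 1 ^ 2 * kappa0 (θ 0) (θ 1) (θ 2),
        θ 2 / θ 1 * kappa0 (θ 0) (θ 1) (θ 2) * kappa1 (θ 0) (θ 1) (θ 2);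
     0, θ 2 / θ 1 * kappa0 (θ 0) (θ 1) (θ 2) * kappa1 (θ 0) (θ 1) (θ 2),
        kappa0 (θ 0) (θ 1) (θ 2) * (kappa1 (θ 0) (θ 1) (θ 2) ^ 2 + 1 / θ 2 ^ 2)]

/-- `ℙ_n`, the `n`-fold product of the law with Lebesgue density `p_{1/n}(·, θ)`. -/
def Pn (n : ℕ) (θ : Fin 3 → ℝ) : Measure (Fin n → ℝ) :=
  Measure.pi fun _ => MeasureTheory.volume.withDensity fun y => ENNReal.ofReal (pdens n θ y)

/-- The standard Gaussian measure on `ℝ³`. -/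
def stdGauss3 : Measure (Fin 3 → ℝ) :=
  Measure.pi fun _ => ProbabilityTheory.gaussianReal 0 1

/-- Euclidean (Frobenius) norm of a real 3×3 matrix. -/
def frobNorm (M : Matrix (Fin 3) (Fin 3) ℝ) : ℝ := Real.sqrt (∑ i, ∑ j, M i j ^ 2)

/-- Euclidean norm of a vector of `ℝ³`. -/
def vecNorm (v : Fin 3 → ℝ) : ℝ := Real.sqrt (∑ j, v j ^ 2)

/-- The admissible families of functions `ψ_α^{(p)}`. -/
structure IsPsiFamily (ψ : ℝ → ℕ → ℝ → ℝ) : Prop where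
  contDiff : ∀ α ∈ Set.Ioo (0 : ℝ) 2, ∀ p : ℕ, ContDiff ℝ 2 (ψ α p)
  pos : ∀ α ∈ Set.Ioo (0 : ℝ) 2, ∀ p : ℕ, ∀ y : ℝ, 0 < ψ α p y
  even : ∀ α ∈ Set.Ioo (0 : ℝ) 2, ∀ p : ℕ, ∀ y : ℝ, ψ α p (-y) = ψ α p y
  eq_one : ∀ α ∈ Set.Ioo (0 : ℝ) 2, ∀ p : ℕ, ∀ y : ℝ, |y| ≤ 1 → ψ α p y = 1
  eq_tail : ∀ α ∈ Set.Ioo (0 : ℝ) 2, ∀ p : ℕ, ∀ y : ℝ, 3 ≤ |y| →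
    ψ α p y = Real.log |y| ^ p / |y| ^ (α + 1)
  unifBound : ∀ K : Set ℝ, K ⊆ Set.Ioo (0 : ℝ) 2 → IsCompact K → ∀ p : ℕ,
    ∃ c > (0 : ℝ), ∃ C : ℝ, ∀ α ∈ K, ∀ y : ℝ, 1 ≤ |y| → |y| ≤ 3 →
      c ≤ ψ α p y ∧ ψ α p y ≤ C

/-- `𝓘_α^{(k,l)}`. -/
def Ical (ψ : ℝ → ℕ → ℝ → ℝ) (α : ℝ) (k l : ℕ) (y : ℝ) : ℝ :=
  ∫ z in {z : ℝ | 1 < |z|}, Dop^[k] gauss (y - z) * ψ α l z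

/-- `f_α^{(k,l,m)}`. -/
def fklm (α : ℝ) (k l m : ℕ) (y w : ℝ) : ℝ :=
  ∫ z : ℝ, Dop^[k] gauss (y - w * z)
    * Dop^[l] (fun z' => iteratedDeriv m (fun a => stableDensity a z') α) z

def Gamman (n : ℕ) (α : ℝ) : ℝ := Real.sqrt ((1 - α / 2) * Real.log n)

def Mn (n : ℕ) (α : ℝ) : ℝ := Real.sqrt ((2 - α) * Real.log n)

def Kconst (σ δ α : ℝ) : ℝ := deriv cAlpha α + cAlpha α * Real.log (δ / σ)
section PartA

/-! ### Part A: Fourier representation of the density -/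

/-- Fourier representation of the density of `σ B + λ^{1/α} S`. -/
def qF (σ l α y : ℝ) : ℝ :=
  (2 * Real.pi)⁻¹ * ∫ u : ℝ, Real.cos (y * u) * Real.exp (-(σ ^ 2 * u ^ 2 / 2) - l * |u| ^ α)

lemma integrable_comp_abs_of {f : ℝ → ℝ} (hf : IntegrableOn f (Ioi 0)) :
    Integrable (fun x => f |x|) := by
  have h1 : IntegrableOn (fun x => f |x|) (Ioi 0) :=
    hf.congr_fun (fun x hx => by simp [abs_of_pos (show (0:ℝ) < x from hx)]) measurableSet_Ioi
  have h2 : IntegrableOn (fun x => f |x|) (Iic 0) := by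
    rw [integrableOn_Iic_iff_integrableOn_Iio]
    have := (Measure.measurePreserving_neg (volume : Measure ℝ)).integrableOn_comp_preimage
      (Homeomorph.neg ℝ).measurableEmbedding (f := fun x => f |x|) (s := Ioi 0)
    have h3 := this.2 h1
    refine (h3.congr_fun (fun x hx => by simp) ?_).mono_set ?_
    · exact measurable_neg measurableSet_Ioi
    · intro x hx; simpa using hx
  rw [← integrableOn_univ, ← Iic_union_Ioi (a := (0:ℝ))]
  exact h2.union h1

lemma integrable_exp_neg_abs_rpow {α : ℝ} (hα : 0 < α) :
    Integrable (fun u : ℝ => Real.exp (-(|u| ^ α))) := by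
  have := integrableOn_rpow_mul_exp_neg_rpow (p := α) (s := 0) (by norm_num) hα
  simp only [Real.rpow_zero, one_mul] at this
  exact integrable_comp_abs_of this

lemma continuous_abs_rpow {α : ℝ} (hα : 0 < α) : Continuous (fun u : ℝ => |u| ^ α) :=
  continuous_abs.rpow_const (fun _ => Or.inr hα.le)

lemma integral_gauss_cos (u w y : ℝ) (hw : 0 < w) :
    ∫ z : ℝ, gauss (y - w * z) * Real.cos (z * u)
      = w⁻¹ * (Real.cos (y * (u / w)) * Real.exp (-((u / w) ^ 2) / 2)) := by
  have h0 : ∫ z : ℝ, gauss (y - w * z) * Real.cos (z * u)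
      = w⁻¹ * ∫ x : ℝ, gauss x * Real.cos ((y - x) / w * u) := by
    have := Measure.integral_comp_mul_left (fun x => gauss (y - x) * Real.cos (x / w * u)) w
    rw [abs_of_pos (inv_pos.2 hw), smul_eq_mul] at this
    rw [integral_sub_left_eq_self (fun x => gauss x * Real.cos ((y - x) / w * u)) volume y |>.symm]
    simp only [sub_sub_cancel]
    rw [← this]
    congr 1; ext z
    rw [mul_div_cancel_left₀ _ hw.ne']
  rw [h0]
  congr 1
  have hb : (0:ℝ) < (1/2 : ℂ).re := by norm_num
  have hF := fourierIntegral_gaussian (b := 1/2) hb ((-(u / w) : ℝ) : ℂ)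
  have hintegr : Integrable (fun x : ℝ => Complex.exp (Complex.I * ((-(u / w) : ℝ) : ℂ) * x) *
      Complex.exp (-(1/2) * (x:ℂ) ^ 2)) := by
    have := integrable_cexp_quadratic (b := 1/2) (by norm_num) (Complex.I * ((-(u / w) : ℝ) : ℂ)) 0
    refine this.congr (Eventually.of_forall fun x => ?_)
    simp only
    rw [← Complex.exp_add]; congr 1; ring
  have key : (∫ x : ℝ, gauss x * Real.cos ((y - x) / w * u)) =
      (((Real.sqrt (2 * Real.pi))⁻¹ : ℂ) * Complex.exp (Complex.I * (y * (u / w) : ℝ)) *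
        ∫ x : ℝ, Complex.exp (Complex.I * ((-(u / w) : ℝ) : ℂ) * x) *
      Complex.exp (-(1/2) * (x:ℂ) ^ 2)).re := by
    rw [← integral_const_mul, ← RCLike.re_eq_complex_re, ← integral_re]
    · congr 1; ext x
      have : ((Real.sqrt (2 * Real.pi))⁻¹ : ℂ) * Complex.exp (Complex.I * (y * (u / w) : ℝ)) *
          (Complex.exp (Complex.I * ((-(u / w) : ℝ) : ℂ) * x) * Complex.exp (-(1/2) * (x:ℂ) ^ 2))
          = ((gauss x : ℝ) : ℂ) * Complex.exp (((y - x) / w * u : ℝ) * Complex.I) := by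
        rw [gauss]; push_cast
        rw [show (-(x:ℂ)^2/2) = -(1/2) * (x:ℂ)^2 by ring]
        rw [show (((y:ℂ) - x) / w * u * Complex.I) = Complex.I * (y * (u / w)) +
          Complex.I * (-(u / w)) * x by ring, Complex.exp_add]
        ring
      rw [this, RCLike.re_eq_complex_re, Complex.re_ofReal_mul, Complex.exp_ofReal_mul_I_re]
    · exact hintegr.const_mul _
  rw [key, hF]
  have e1 : ((Real.pi : ℂ) / (1/2)) ^ (1/2 : ℂ) = ((Real.sqrt (2 * Real.pi) : ℝ) : ℂ) := by
    rw [Real.sqrt_eq_rpow, Complex.ofReal_cpow (by positivity)]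
    congr 1
    · push_cast; ring
    · norm_num
  rw [e1]
  have hs : ((Real.sqrt (2 * Real.pi) : ℝ) : ℂ) ≠ 0 := by
    exact_mod_cast (Real.sqrt_pos.2 (by positivity)).ne'
  have e2 : ((Real.sqrt (2 * Real.pi) : ℝ) : ℂ)⁻¹ * Complex.exp (Complex.I * (y * (u / w) : ℝ)) *
     (((Real.sqrt (2 * Real.pi) : ℝ) : ℂ) *
        Complex.exp (-((-(u / w) : ℝ) : ℂ) ^ 2 / (4 * (1 / 2)))) =
      ((Real.exp (-((u / w) ^ 2) / 2) : ℝ) : ℂ) * Complex.exp ((y * (u / w) : ℝ) * Complex.I) := by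
    have : (-((-(u / w) : ℝ) : ℂ) ^ 2 / (4 * (1 / 2))) = ((-((u / w) ^ 2) / 2 : ℝ) : ℂ) := by
      push_cast; ring
    rw [this, Complex.ofReal_exp, mul_comm Complex.I]
    field_simp
  rw [e2, Complex.re_ofReal_mul, Complex.exp_ofReal_mul_I_re]
  ring

lemma continuous_gauss : Continuous gauss := by unfold gauss; fun_prop

lemma integrable_gauss : Integrable gauss := by
  have := (integrable_exp_neg_mul_sq (b := 1/2) (by norm_num)).const_mul ((Real.sqrt (2 * Real.pi))⁻¹)
  refine this.congr (Eventually.of_forall fun x => ?_)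
  simp only [gauss]; congr 2; ring

lemma fFun_eq (α y w : ℝ) (hα : 0 < α) (hw : 0 < w) : fFun α y w = qF 1 (w ^ α) α y := by
  unfold fFun stableDensity qF
  have h1 : ∀ z : ℝ, gauss (y - w * z) * ((2 * Real.pi)⁻¹ * ∫ u : ℝ, Real.cos (z * u) * Real.exp (-(|u| ^ α)))
     = (2 * Real.pi)⁻¹ * ∫ u : ℝ, gauss (y - w * z) * (Real.cos (z * u) * Real.exp (-(|u| ^ α))) := by
    intro z; rw [integral_const_mul]; ring
  simp_rw [h1]
  rw [integral_const_mul]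
  congr 1
  rw [integral_integral_swap]
  · have h2 : ∀ u : ℝ, (∫ z : ℝ, gauss (y - w * z) * (Real.cos (z * u) * Real.exp (-(|u| ^ α))))
      = w⁻¹ * ((Real.cos (y * (u / w)) * Real.exp (-((u / w) ^ 2) / 2)) * Real.exp (-(|w * (u/w)| ^ α))) := by
      intro u
      simp_rw [← mul_assoc]
      rw [integral_mul_const, integral_gauss_cos u w y hw, mul_div_cancel₀ _ hw.ne']
      ring
    simp_rw [h2]
    rw [integral_const_mul, Measure.integral_comp_div (fun v => (Real.cos (y * v) * Real.exp (-(v ^ 2) / 2)) * Real.exp (-(|w * v| ^ α)))]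
    rw [abs_of_pos hw, smul_eq_mul, ← mul_assoc, inv_mul_cancel₀ hw.ne', one_mul]
    congr 1; ext v
    rw [mul_assoc, ← Real.exp_add, abs_mul, abs_of_pos hw, Real.mul_rpow hw.le (abs_nonneg _)]
    congr 2; ring
  · have hg : Integrable (fun z : ℝ => gauss (y - w * z)) :=
      (integrable_gauss.comp_sub_left y).comp_mul_left' hw.ne'
    have := hg.mul_prod (integrable_exp_neg_abs_rpow hα)
    refine (this.bdd_mul (c := 1) (f := fun p : ℝ × ℝ => Real.cos (p.1 * p.2)) ?_ ?_).congr ?_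
    · exact (Real.continuous_cos.comp (continuous_fst.mul continuous_snd)).aestronglyMeasurable
    · exact Eventually.of_forall fun p => by simpa using Real.abs_cos_le_one _
    · refine Eventually.of_forall fun p => ?_
      simp only [Function.uncurry]; ring

lemma qF_scale (σ l α y : ℝ) (hσ : 0 < σ) :
    σ⁻¹ * qF 1 l α (y / σ) = qF σ (l * σ ^ α) α y := by
  unfold qF
  have := Measure.integral_comp_mul_left (fun u => Real.cos (y / σ * u) * Real.exp (-(1 ^ 2 * u ^ 2 / 2) - l * |u| ^ α)) σ
  rw [abs_of_pos (inv_pos.2 hσ), smul_eq_mul] at this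
  rw [mul_left_comm, ← this]
  congr 2; ext u
  rw [abs_mul, abs_of_pos hσ, Real.mul_rpow hσ.le (abs_nonneg _)]
  congr 2
  · field_simp
  · ring

/-- the intensity parameter `λ_n = n^{α/2-1} δ^α`. -/
def lam (n : ℕ) (δ α : ℝ) : ℝ := (n : ℝ) ^ (α / 2 - 1) * δ ^ α

lemma lam_pos {n : ℕ} (hn : 1 ≤ n) {δ : ℝ} (hδ : 0 < δ) (α : ℝ) : 0 < lam n δ α := by
  have : (0:ℝ) < n := by exact_mod_cast hn
  unfold lam; positivity

lemma pdens_eq (n : ℕ) (hn : 1 ≤ n) (θ : Fin 3 → ℝ) (h0 : 0 < θ 0) (h1 : 0 < θ 1) (h2 : 0 < θ 2) (x : ℝ) :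
    pdens n θ x = Real.sqrt n * qF (θ 0) (lam n (θ 1) (θ 2)) (θ 2) (Real.sqrt n * x) := by
  have hn' : (0:ℝ) < n := by exact_mod_cast hn
  have hw : 0 < wn n (θ 0) (θ 1) (θ 2) := by unfold wn; positivity
  unfold pdens
  rw [fFun_eq _ _ _ h2 hw, div_eq_mul_inv, mul_assoc, qF_scale _ _ _ _ h0]
  congr 2
  unfold wn lam
  rw [Real.div_rpow (by positivity) h0.le, Real.mul_rpow (by positivity) h1.le, ← Real.rpow_mul hn'.le]
  rw [show (1 / 2 - 1 / θ 2) * θ 2 = θ 2 / 2 - 1 by field_simp]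
  have : (θ 0) ^ (θ 2) ≠ 0 := (Real.rpow_pos_of_pos h0 _).ne'
  field_simp

end PartA

section PartB

/-! ### Part B: contour rotation -/

lemma contour_shift {F : ℂ → ℂ} (hF : Differentiable ℂ F) (θ : ℝ) {g : ℝ → ℝ} (hg : Integrable g)
    (hgt : Tendsto g atTop (𝓝 0)) (hgb : Tendsto g atBot (𝓝 0))
    (hb : ∀ x : ℝ, ∀ t ∈ uIcc 0 θ, ‖F (x + t * Complex.I)‖ ≤ g x) :
    ∫ x : ℝ, F x = ∫ x : ℝ, F (x + θ * Complex.I) := by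
  have hintegr : ∀ t ∈ uIcc 0 θ, Integrable (fun x : ℝ => F (x + t * Complex.I)) := by
    intro t ht
    refine hg.mono' ?_ (Eventually.of_forall fun x => hb x t ht)
    exact (hF.continuous.comp (by fun_prop)).aestronglyMeasurable
  have h0 : ∀ T : ℝ, ((∫ x : ℝ in (-T)..T, F x) - ∫ x : ℝ in (-T)..T, F (x + θ * Complex.I))
      = Complex.I * (∫ t : ℝ in (0:ℝ)..θ, F ((-T : ℝ) + t * Complex.I)) -
        Complex.I * (∫ t : ℝ in (0:ℝ)..θ, F (T + t * Complex.I)) := by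
    intro T
    have := Complex.integral_boundary_rect_eq_zero_of_differentiableOn F (-T : ℝ) (T + θ * Complex.I)
      hF.differentiableOn
    simp only [Complex.ofReal_re, Complex.add_re, Complex.mul_re, Complex.I_re, Complex.I_im,
      Complex.ofReal_im, Complex.add_im, Complex.mul_im, mul_zero, mul_one, zero_mul, sub_zero,
      add_zero, zero_add, smul_eq_mul, Complex.ofReal_zero] at this
    linear_combination this
  have v0 : ∀ T : ℝ, ‖∫ t : ℝ in (0:ℝ)..θ, F (T + t * Complex.I)‖ ≤ g T * |θ - 0| := by
    intro T
    refine intervalIntegral.norm_integral_le_of_norm_le_const fun t ht => hb T t ?_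
    exact uIoc_subset_uIcc ht
  have v1 : Tendsto (fun T : ℝ => ∫ t : ℝ in (0:ℝ)..θ, F (T + t * Complex.I)) atTop (𝓝 0) := by
    refine squeeze_zero_norm v0 ?_
    simpa using hgt.mul_const |θ - 0|
  have v2 : Tendsto (fun T : ℝ => ∫ t : ℝ in (0:ℝ)..θ, F ((-T : ℝ) + t * Complex.I)) atTop (𝓝 0) := by
    refine squeeze_zero_norm (fun T => v0 (-T)) ?_
    simpa using (hgb.comp tendsto_neg_atTop_atBot).mul_const |θ - 0|
  have i0 := intervalIntegral_tendsto_integral (by simpa using hintegr 0 left_mem_uIcc)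
    tendsto_neg_atTop_atBot tendsto_id
  have i1 := intervalIntegral_tendsto_integral (hintegr θ right_mem_uIcc) tendsto_neg_atTop_atBot tendsto_id
  have i2 := i0.sub i1
  simp only [id] at i2
  simp_rw [h0] at i2
  have i3 : Tendsto (fun T : ℝ => Complex.I * (∫ t : ℝ in (0:ℝ)..θ, F ((-T : ℝ) + t * Complex.I)) -
        Complex.I * (∫ t : ℝ in (0:ℝ)..θ, F (T + t * Complex.I))) atTop (𝓝 0) := by
    simpa using (v2.const_mul Complex.I).sub (v1.const_mul Complex.I)
  exact sub_eq_zero.1 (tendsto_nhds_unique i2 i3)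

lemma exp_image_univ : Real.exp '' univ = Ioi 0 := by rw [image_univ, Real.range_exp]

lemma integral_Ioi_eq_exp (f : ℝ → ℂ) :
    ∫ v in Ioi (0:ℝ), f v = ∫ x : ℝ, (Real.exp x : ℂ) * f (Real.exp x) := by
  rw [← exp_image_univ, integral_image_eq_integral_abs_deriv_smul MeasurableSet.univ
    (fun x _ => (Real.hasDerivAt_exp x).hasDerivWithinAt) Real.exp_injective.injOn]
  simp [abs_of_pos (Real.exp_pos _)]

lemma integrable_exp_of_Ioi {f : ℝ → ℝ} (hf : IntegrableOn f (Ioi 0)) :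
    Integrable (fun x : ℝ => Real.exp x * f (Real.exp x)) := by
  rw [← exp_image_univ, integrableOn_image_iff_integrableOn_abs_deriv_smul MeasurableSet.univ
    (fun x _ => (Real.hasDerivAt_exp x).hasDerivWithinAt) Real.exp_injective.injOn] at hf
  simpa [abs_of_pos (Real.exp_pos _)] using hf

lemma norm_exp_neg_sub_one_le {w : ℂ} (hw : 0 ≤ w.re) : ‖Complex.exp (-w) - 1‖ ≤ ‖w‖ := by
  have hc : Convex ℝ {z : ℂ | 0 ≤ z.re} := convex_halfSpace_re_ge 0
  have := hc.norm_image_sub_le_of_norm_hasDerivWithin_le (f := fun z : ℂ => Complex.exp (-z))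
    (f' := fun z => -Complex.exp (-z)) (C := 1) (x := 0) (y := w) ?_ ?_ (by simp) hw
  · simpa using this
  · intro z _
    have := ((hasDerivAt_id z).neg.cexp).hasDerivWithinAt (s := {z : ℂ | 0 ≤ z.re})
    simpa using this
  · intro z hz
    rw [norm_neg, Complex.norm_exp]
    simpa using hz

lemma norm_exp_neg_sub_one_add_le {w : ℂ} (hw : 0 ≤ w.re) : ‖Complex.exp (-w) - 1 + w‖ ≤ ‖w‖ ^ 2 := by
  have hc : Convex ℝ ({z : ℂ | 0 ≤ z.re} ∩ Metric.closedBall 0 ‖w‖) :=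
    (convex_halfSpace_re_ge 0).inter (convex_closedBall _ _)
  have := hc.norm_image_sub_le_of_norm_hasDerivWithin_le (f := fun z : ℂ => Complex.exp (-z) + z)
    (f' := fun z => -Complex.exp (-z) + 1) (C := ‖w‖) (x := 0) (y := w) ?_ ?_ (by simp) (by simpa using hw)
  · simp only [neg_zero, Complex.exp_zero, add_zero, sub_zero] at this
    rw [sq]
    convert! this using 2
    ring
  · intro z _
    have h1 : HasDerivAt (fun z : ℂ => Complex.exp (-z)) (-Complex.exp (-z)) z := by
      simpa using (hasDerivAt_id z).neg.cexp
    exact (h1.fun_add (hasDerivAt_id' z)).hasDerivWithinAt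
  · intro z hz
    rw [neg_add_eq_sub, norm_sub_rev]
    exact (norm_exp_neg_sub_one_le hz.1).trans (by simpa using hz.2)

/-- logarithm on the rotated ray. -/
def lg (v : ℝ) : ℂ := (Real.log v : ℂ) + ((Real.pi / 8 : ℝ) : ℂ) * Complex.I

def om : ℂ := Complex.exp (((Real.pi / 8 : ℝ) : ℂ) * Complex.I)

/-- the rotated kernel -/
def kk (σ l α v : ℝ) : ℂ :=
  Complex.exp (-((σ ^ 2 / 2 : ℝ) * Complex.exp (2 * lg v))) * (Complex.exp (-(l * Complex.exp (α * lg v))) - 1)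

/-- the rotated Fourier operator -/
def Bop (k : ℝ → ℂ) (y : ℝ) : ℝ :=
  Real.pi⁻¹ * (∫ v in Ioi (0:ℝ), Complex.exp (Complex.I * y * Complex.exp (lg v)) * k v * om).re

def gaussS (σ y : ℝ) : ℝ := (σ * Real.sqrt (2 * Real.pi))⁻¹ * Real.exp (-(y ^ 2 / (2 * σ ^ 2)))

/-- the integrand as entire function -/
def FF (σ l α y : ℝ) (z : ℂ) : ℂ :=
  Complex.exp z * (Complex.exp (Complex.I * y * Complex.exp z) * (Complex.exp (-((σ ^ 2 / 2 : ℝ) * Complex.exp (2 * z))) *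
    (Complex.exp (-(l * Complex.exp (α * z))) - 1)))

lemma cos_two_ge {t : ℝ} (h0 : 0 ≤ t) (h1 : t ≤ Real.pi / 8) : 1 / 2 ≤ Real.cos (2 * t) := by
  have := Real.cos_le_cos_of_nonneg_of_le_pi (x := 2 * t) (y := Real.pi / 3) (by linarith)
    (by linarith [Real.pi_pos]) (by linarith [Real.pi_pos])
  rwa [Real.cos_pi_div_three] at this

lemma exp_re_mul (c x t : ℝ) : (Complex.exp (c * (x + t * Complex.I))).re
    = Real.exp (c * x) * Real.cos (c * t) := by
  rw [Complex.exp_re]; simp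

lemma exp_im_mul (c x t : ℝ) : (Complex.exp (c * (x + t * Complex.I))).im
    = Real.exp (c * x) * Real.sin (c * t) := by
  rw [Complex.exp_im]; simp

lemma FF_bound {σ l α y x t : ℝ} (hl : 0 ≤ l) (hα : 0 < α) (hα2 : α < 2) (hy : 0 ≤ y)
    (h0 : 0 ≤ t) (h1 : t ≤ Real.pi / 8) :
    ‖FF σ l α y (x + t * Complex.I)‖ ≤
      Real.exp x * (l * (Real.exp x ^ α * Real.exp (-(σ ^ 2 / 4) * Real.exp x ^ (2:ℝ)))) := by
  have hpi := Real.pi_pos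
  unfold FF
  rw [norm_mul, norm_mul, norm_mul, Complex.norm_exp, Complex.norm_exp, Complex.norm_exp]
  have e1 : ((x:ℂ) + t * Complex.I).re = x := by simp
  have e2 : (Complex.I * y * Complex.exp (x + t * Complex.I)).re ≤ 0 := by
    have : (Complex.exp (x + t * Complex.I)).im = Real.exp x * Real.sin t := by
      rw [Complex.exp_im]; simp
    have h : (Complex.I * y * Complex.exp (x + t * Complex.I)).re = - (y * (Real.exp x * Real.sin t)) := by
      rw [mul_assoc, Complex.I_mul_re, Complex.im_ofReal_mul, this]
    rw [h]
    have : 0 ≤ Real.sin t := Real.sin_nonneg_of_nonneg_of_le_pi h0 (by linarith)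
    have := Real.exp_pos x
    have : 0 ≤ y * (Real.exp x * Real.sin t) := by positivity
    linarith
  have e3 : (-(((σ ^ 2 / 2 : ℝ) : ℂ) * Complex.exp (2 * (x + t * Complex.I)))).re ≤ -(σ ^ 2 / 4) * Real.exp x ^ (2:ℝ) := by
    rw [Complex.neg_re, Complex.re_ofReal_mul]
    have := exp_re_mul 2 x t
    push_cast at this
    rw [this, ← Real.exp_mul, mul_comm x 2]
    have h3 := mul_le_mul_of_nonneg_left (cos_two_ge h0 h1) (Real.exp_pos (2 * x)).le
    nlinarith [sq_nonneg σ]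
  have e4 : ‖Complex.exp (-(l * Complex.exp (α * (x + t * Complex.I)))) - 1‖ ≤ l * Real.exp x ^ α := by
    refine (norm_exp_neg_sub_one_le ?_).trans ?_
    · rw [Complex.re_ofReal_mul, exp_re_mul]
      have : 0 ≤ Real.cos (α * t) := Real.cos_nonneg_of_neg_pi_div_two_le_of_le
        (by nlinarith) (by nlinarith)
      positivity
    · rw [norm_mul, Complex.norm_exp]
      simp [abs_of_nonneg hl, ← Real.exp_mul, mul_comm]
  rw [e1]
  have : Real.exp (Complex.I * y * Complex.exp (x + t * Complex.I)).re ≤ 1 := Real.exp_le_one_iff.2 e2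
  refine mul_le_mul_of_nonneg_left ?_ (Real.exp_pos x).le
  calc _ ≤ 1 * (Real.exp (-(σ ^ 2 / 4) * Real.exp x ^ (2:ℝ)) * (l * Real.exp x ^ α)) :=
        mul_le_mul this (mul_le_mul (Real.exp_le_exp.2 e3) e4 (norm_nonneg _) (Real.exp_pos _).le)
          (by positivity) zero_le_one
    _ = _ := by ring

lemma FF_diff (σ l α y : ℝ) : Differentiable ℂ (FF σ l α y) := by
  unfold FF; fun_prop

lemma FF_shift {σ l α y : ℝ} (hσ : 0 < σ) (hl : 0 ≤ l) (hα : 0 < α) (hα2 : α < 2) (hy : 0 ≤ y) :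
    ∫ x : ℝ, FF σ l α y x = ∫ x : ℝ, FF σ l α y (x + (Real.pi / 8 : ℝ) * Complex.I) := by
  have hpi := Real.pi_pos
  have hc : 0 < σ ^ 2 / 4 := by positivity
  have hI : IntegrableOn (fun v : ℝ => l * (v ^ α * Real.exp (-(σ ^ 2 / 4) * v ^ (2:ℝ)))) (Ioi 0) :=
    (integrableOn_rpow_mul_exp_neg_mul_rpow (by linarith) (by norm_num) hc).const_mul l
  refine contour_shift (FF_diff σ l α y) (Real.pi / 8) (integrable_exp_of_Ioi hI) ?_ ?_ ?_
  · have h1 := (tendsto_rpow_mul_exp_neg_mul_atTop_nhds_zero (1 + α) 1 (by norm_num)).comp Real.tendsto_exp_atTop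
    have h2 : Tendsto (fun x : ℝ => l * ((Real.exp x) ^ (1 + α) * Real.exp (-1 * Real.exp x))) atTop (𝓝 0) := by
      simpa using h1.const_mul l
    refine squeeze_zero' (Eventually.of_forall fun x => by positivity) ?_ h2
    filter_upwards [Real.tendsto_exp_atTop.eventually_ge_atTop (4 / σ ^ 2)] with x hx
    have : Real.exp (-(σ ^ 2 / 4) * Real.exp x ^ (2:ℝ)) ≤ Real.exp (-1 * Real.exp x) := by
      rw [Real.exp_le_exp, Real.rpow_two]
      have h4 : 1 ≤ σ ^ 2 / 4 * Real.exp x := by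
        have : σ ^ 2 / 4 * (4 / σ ^ 2) = 1 := by field_simp
        rw [← this]; gcongr
      nlinarith [Real.exp_pos x]
    rw [Real.rpow_add (Real.exp_pos x), Real.rpow_one]
    calc _ = l * (Real.exp x * Real.exp x ^ α * Real.exp (-(σ ^ 2 / 4) * Real.exp x ^ (2:ℝ))) := by ring
      _ ≤ _ := by gcongr
  · have h2 : Tendsto (fun x : ℝ => Real.exp x * (l * (Real.exp (α * x) * 1))) atBot (𝓝 0) := by
      have ha : Tendsto (fun x : ℝ => Real.exp (α * x)) atBot (𝓝 0) :=
        Real.tendsto_exp_atBot.comp ((tendsto_const_mul_atBot_of_pos hα).2 tendsto_id)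
      simpa using Real.tendsto_exp_atBot.mul ((ha.mul_const 1).const_mul l)
    refine squeeze_zero (fun x => by positivity) (fun x => ?_) h2
    have : Real.exp (-(σ ^ 2 / 4) * Real.exp x ^ (2:ℝ)) ≤ 1 := by
      rw [Real.exp_le_one_iff]
      have : 0 ≤ Real.exp x ^ (2:ℝ) := by positivity
      have := mul_nonneg hc.le this
      linarith
    rw [← Real.exp_mul, mul_comm x α]
    gcongr
  · intro x t ht
    rw [uIcc_of_le (by positivity)] at ht
    exact FF_bound hl hα hα2 hy ht.1 ht.2

lemma integral_cos_gaussS {σ : ℝ} (hσ : 0 < σ) (y : ℝ) :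
    (2 * Real.pi)⁻¹ * ∫ u : ℝ, Real.cos (y * u) * Real.exp (-(σ ^ 2 * u ^ 2 / 2)) = gaussS σ y := by
  have h := integral_gauss_cos y σ 0 hσ
  simp only [gauss, zero_sub, neg_sq, zero_mul, Real.cos_zero, one_mul] at h
  have h2 : ∫ u : ℝ, Real.cos (y * u) * Real.exp (-(σ ^ 2 * u ^ 2 / 2)) =
      Real.sqrt (2 * Real.pi) * (σ⁻¹ * Real.exp (-((y / σ) ^ 2) / 2)) := by
    rw [← h, ← integral_const_mul]
    congr 1; ext z
    have hs : Real.sqrt (2 * Real.pi) ≠ 0 := (Real.sqrt_pos.2 (by positivity)).ne'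
    rw [show (-(σ * z) ^ 2 / 2) = -(σ ^ 2 * z ^ 2 / 2) by ring, mul_comm z y]
    field_simp
  rw [h2, gaussS]
  have hs : Real.sqrt (2 * Real.pi) ≠ 0 := (Real.sqrt_pos.2 (by positivity)).ne'
  have hs2 : Real.sqrt (2 * Real.pi) ^ 2 = 2 * Real.pi := Real.sq_sqrt (by positivity)
  rw [show -((y / σ) ^ 2) / 2 = -(y ^ 2 / (2 * σ ^ 2)) by field_simp, mul_inv]
  field_simp
  linarith

lemma qF_rot {σ l α y : ℝ} (hσ : 0 < σ) (hl : 0 ≤ l) (hα : 0 < α) (hα2 : α < 2) (hy : 0 ≤ y) :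
    qF σ l α y = gaussS σ y + Bop (kk σ l α) y := by
  have hgi : Integrable (fun u : ℝ => Real.exp (-(σ ^ 2 * u ^ 2 / 2))) := by
    refine (integrable_exp_neg_mul_sq (b := σ ^ 2 / 2) (by positivity)).congr
      (Eventually.of_forall fun x => ?_)
    simp only; congr 1; ring
  have hcI : Integrable (fun u : ℝ => Real.cos (y * u) * Real.exp (-(σ ^ 2 * u ^ 2 / 2))) := by
    refine hgi.bdd_mul (c := 1) (by fun_prop) (Eventually.of_forall fun u => by
      simpa using Real.abs_cos_le_one _)
  have hdI : Integrable (fun u : ℝ => Real.cos (y * u) * Real.exp (-(σ ^ 2 * u ^ 2 / 2)) * (Real.exp (-(l * |u| ^ α)) - 1)) := by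
    refine hcI.mul_bdd (c := 1) ?_ ?_
    · exact ((Real.continuous_exp.comp ((continuous_const.mul (continuous_abs_rpow hα)).neg)).sub
        continuous_const).aestronglyMeasurable
    · refine Eventually.of_forall fun u => ?_
      have h1 : Real.exp (-(l * |u| ^ α)) ≤ 1 := by
        rw [Real.exp_le_one_iff]; have : 0 ≤ l * |u| ^ α := by positivity
        linarith
      rw [Real.norm_eq_abs, abs_le]; constructor <;> linarith [Real.exp_pos (-(l * |u| ^ α))]
  have h1 : qF σ l α y = gaussS σ y + (2 * Real.pi)⁻¹ * ∫ u : ℝ,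
      Real.cos (y * u) * Real.exp (-(σ ^ 2 * u ^ 2 / 2)) * (Real.exp (-(l * |u| ^ α)) - 1) := by
    rw [← integral_cos_gaussS hσ, ← mul_add, ← integral_add hcI hdI, qF]
    congr 2; ext u
    rw [sub_eq_add_neg, Real.exp_add]; ring
  rw [h1]
  congr 1
  have h2 : ∫ u : ℝ, Real.cos (y * u) * Real.exp (-(σ ^ 2 * u ^ 2 / 2)) * (Real.exp (-(l * |u| ^ α)) - 1)
     = 2 * ∫ u in Ioi (0:ℝ), Real.cos (y * u) * Real.exp (-(σ ^ 2 * u ^ 2 / 2)) * (Real.exp (-(l * |u| ^ α)) - 1) := by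
    rw [← integral_comp_abs]
    congr 1; ext u
    rw [abs_abs, sq_abs]
    congr 2
    rcases abs_cases u with ⟨h, _⟩ | ⟨h, _⟩ <;> rw [h]
    rw [mul_neg, Real.cos_neg]
  have h3 : ∫ u in Ioi (0:ℝ), Real.cos (y * u) * Real.exp (-(σ ^ 2 * u ^ 2 / 2)) * (Real.exp (-(l * |u| ^ α)) - 1)
     = (∫ u in Ioi (0:ℝ), Complex.exp (Complex.I * y * u) * (Real.exp (-(σ ^ 2 * u ^ 2 / 2)) * (Real.exp (-(l * |u| ^ α)) - 1) : ℝ)).re := by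
    rw [← RCLike.re_eq_complex_re, ← integral_re]
    · congr 1; ext u
      rw [RCLike.re_eq_complex_re, mul_comm (Complex.exp _), Complex.re_ofReal_mul,
        show Complex.I * y * u = ((y * u : ℝ) : ℂ) * Complex.I by push_cast; ring,
        Complex.exp_ofReal_mul_I_re]
      ring
    · have hJ : Integrable (fun u : ℝ => ((Real.exp (-(σ ^ 2 * u ^ 2 / 2)) * (Real.exp (-(l * |u| ^ α)) - 1) : ℝ) : ℂ)) := by
        refine Integrable.ofReal ?_
        refine hgi.mul_bdd (c := 1) ?_ ?_
        · exact ((Real.continuous_exp.comp ((continuous_const.mul (continuous_abs_rpow hα)).neg)).sub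
            continuous_const).aestronglyMeasurable
        · refine Eventually.of_forall fun u => ?_
          have h1 : Real.exp (-(l * |u| ^ α)) ≤ 1 := by
            rw [Real.exp_le_one_iff]; have : 0 ≤ l * |u| ^ α := by positivity
            linarith
          rw [Real.norm_eq_abs, abs_le]; constructor <;> linarith [Real.exp_pos (-(l * |u| ^ α))]
      refine (hJ.bdd_mul (c := 1) (by fun_prop) (Eventually.of_forall fun u => ?_)).integrableOn
      rw [Complex.norm_exp]
      simp [mul_assoc]
  have h4 : ∫ u in Ioi (0:ℝ), Complex.exp (Complex.I * y * u) * (Real.exp (-(σ ^ 2 * u ^ 2 / 2)) * (Real.exp (-(l * |u| ^ α)) - 1) : ℝ)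
     = ∫ x : ℝ, FF σ l α y x := by
    rw [integral_Ioi_eq_exp]
    congr 1; ext x
    unfold FF
    rw [abs_of_pos (Real.exp_pos x), ← Real.exp_mul, mul_comm x α]
    rw [show Real.exp x ^ 2 = Real.exp (2 * x) by rw [← Real.exp_nat_mul]; norm_num]
    push_cast
    rw [show -((σ:ℂ) ^ 2 / 2 * Complex.exp (2 * x)) = -((σ:ℂ) ^ 2 * Complex.exp (2 * x) / 2) by ring]
  have h5 : ∫ x : ℝ, FF σ l α y (x + (Real.pi / 8 : ℝ) * Complex.I) =
      ∫ v in Ioi (0:ℝ), Complex.exp (Complex.I * y * Complex.exp (lg v)) * kk σ l α v * om := by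
    rw [integral_Ioi_eq_exp]
    congr 1; ext x
    unfold FF kk lg om
    rw [Real.log_exp, Complex.exp_add, Complex.ofReal_exp]
    ring
  rw [h2, h3, h4, FF_shift hσ hl hα hα2 hy, h5, Bop, ← mul_assoc]
  congr 1
  field_simp

end PartB

section PartC

/-! ### Part C: kernel bounds -/

lemma taylor3 {g : ℂ → ℂ} (hg : Differentiable ℂ g) {M ρ : ℝ} (hρ : 2 ≤ ρ) (hM : 0 ≤ M)
    (hb : ∀ z, ‖z‖ = ρ → ‖g z‖ ≤ M) {g1 g2 : ℂ} (h1 : deriv g 0 = g1) (h2 : deriv (deriv g) 0 = g2) :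
    ‖g1‖ ≤ M / ρ ∧ ‖g2‖ ≤ 2 * M / ρ ^ 2 ∧ ‖g 1 - g 0 - g1 - (1 / 2) * g2‖ ≤ 2 * M / ρ ^ 3 := by
  have hρ0 : 0 < ρ := by linarith
  have hc : ∀ n : ℕ, ‖iteratedDeriv n g 0‖ ≤ n.factorial * M / ρ ^ n := fun n =>
    Complex.norm_iteratedDeriv_le_of_forall_mem_sphere_norm_le n hρ0 hg.diffContOnCl
      (fun z hz => hb z (by simpa using hz))
  have e1 : iteratedDeriv 1 g 0 = g1 := by rw [iteratedDeriv_one, h1]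
  have e2 : iteratedDeriv 2 g 0 = g2 := by rw [iteratedDeriv_succ, iteratedDeriv_one, h2]
  refine ⟨by simpa [e1] using hc 1, by simpa [e2] using hc 2, ?_⟩
  have hs := Complex.hasSum_taylorSeries_of_entire hg 0 1
  have hs3 := (hasSum_nat_add_iff' 3).2 hs
  have e : g 1 - ∑ i ∈ Finset.range 3, ((i.factorial : ℂ)⁻¹ • (1 - 0 : ℂ) ^ i • iteratedDeriv i g 0)
      = g 1 - g 0 - g1 - (1 / 2) * g2 := by
    simp [Finset.sum_range_succ, e1, e2]
    ring
  rw [e] at hs3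
  have hgeo : HasSum (fun n : ℕ => M / ρ ^ 3 * (1 / 2 : ℝ) ^ n) (M / ρ ^ 3 * 2) :=
    (hasSum_geometric_two).mul_left _
  have := tsum_of_norm_bounded hgeo (f := fun n : ℕ => (((n + 3).factorial : ℂ)⁻¹ • (1 - 0 : ℂ) ^ (n + 3) • iteratedDeriv (n + 3) g 0)) ?_
  · rw [hs3.tsum_eq] at this
    refine this.trans (le_of_eq (by ring))
  · intro n
    have hf : (0 : ℝ) < (n + 3).factorial := by exact_mod_cast Nat.factorial_pos _
    rw [norm_smul, norm_smul, norm_inv, Complex.norm_natCast]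
    simp only [sub_zero, one_pow, norm_one, one_mul]
    calc _ ≤ ((n + 3).factorial : ℝ)⁻¹ * ((n + 3).factorial * M / ρ ^ (n + 3)) := by
          gcongr; exact hc _
      _ = M / ρ ^ 3 * (1 / ρ) ^ n := by rw [one_div, inv_pow, pow_add]; field_simp
      _ ≤ _ := by
          gcongr

lemma exp_lg {v : ℝ} (hv : 0 < v) : Complex.exp (lg v) = v * om := by
  rw [lg, Complex.exp_add, ← Complex.ofReal_exp, Real.exp_log hv, om]

lemma norm_om : ‖om‖ = 1 := by rw [om, Complex.norm_exp]; simp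

lemma lg_re (v : ℝ) : (lg v).re = Real.log v := by simp [lg]
lemma lg_im (v : ℝ) : (lg v).im = Real.pi / 8 := by simp [lg]

lemma norm_exp_mul_lg {v : ℝ} (hv : 0 < v) (c : ℝ) : ‖Complex.exp (c * lg v)‖ = v ^ c := by
  rw [Complex.norm_exp, Complex.re_ofReal_mul, lg_re, Real.rpow_def_of_pos hv, mul_comm]

lemma norm_lg_le (v : ℝ) : ‖lg v‖ ≤ |Real.log v| + 1 := by
  have := Complex.norm_le_abs_re_add_abs_im (lg v)
  rw [lg_re, lg_im, abs_of_pos (by positivity : 0 < Real.pi / 8)] at this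
  linarith [Real.pi_le_four]

def s8 : ℝ := Real.sin (Real.pi / 8)

lemma s8_pos : 0 < s8 := Real.sin_pos_of_pos_of_lt_pi (by positivity) (by linarith [Real.pi_pos])
lemma s8_le : s8 ≤ 1 := Real.sin_le_one _

lemma norm_osc {v : ℝ} (hv : 0 < v) (y : ℝ) :
    ‖Complex.exp (Complex.I * y * Complex.exp (lg v))‖ = Real.exp (-(y * (s8 * v))) := by
  rw [Complex.norm_exp, mul_assoc, Complex.I_mul_re, Complex.im_ofReal_mul, Complex.exp_im, lg_re,
    lg_im, Real.exp_log hv, s8]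
  ring_nf

lemma measurable_lg : Measurable lg := by
  unfold lg
  exact (Complex.measurable_ofReal.comp Real.measurable_log).add measurable_const

/-- integrability of Bop integrand from bound -/
lemma Bop_integrable {k : ℝ → ℂ} (hk : Measurable k) {g : ℝ → ℝ} {y : ℝ}
    (hg : IntegrableOn (fun v => Real.exp (-(y * (s8 * v))) * g v) (Ioi 0))
    (hb : ∀ v, 0 < v → ‖k v‖ ≤ g v) :
    IntegrableOn (fun v : ℝ => Complex.exp (Complex.I * y * Complex.exp (lg v)) * k v * om) (Ioi 0) := by
  refine Integrable.mono' hg ?_ ?_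
  · have := measurable_lg
    exact (Measurable.mul (by fun_prop) measurable_const).aestronglyMeasurable
  · refine (ae_restrict_iff' measurableSet_Ioi).2 (Eventually.of_forall fun v hv => ?_)
    rw [norm_mul, norm_mul, norm_om, mul_one, norm_osc hv]
    exact mul_le_mul_of_nonneg_left (hb v hv) (Real.exp_pos _).le

lemma Bop_le {k : ℝ → ℂ} {g : ℝ → ℝ} {y : ℝ}
    (hg : IntegrableOn (fun v => Real.exp (-(y * (s8 * v))) * g v) (Ioi 0))
    (hb : ∀ v, 0 < v → ‖k v‖ ≤ g v) :
    |Bop k y| ≤ ∫ v in Ioi (0:ℝ), Real.exp (-(y * (s8 * v))) * g v := by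
  have h1 : ‖∫ v in Ioi (0:ℝ), Complex.exp (Complex.I * y * Complex.exp (lg v)) * k v * om‖ ≤
      ∫ v in Ioi (0:ℝ), Real.exp (-(y * (s8 * v))) * g v := by
    refine norm_integral_le_of_norm_le hg ?_
    refine (ae_restrict_iff' measurableSet_Ioi).2 (Eventually.of_forall fun v hv => ?_)
    rw [norm_mul, norm_mul, norm_om, mul_one, norm_osc hv]
    exact mul_le_mul_of_nonneg_left (hb v hv) (Real.exp_pos _).le
  unfold Bop
  rw [abs_mul, abs_of_pos (by positivity : 0 < Real.pi⁻¹)]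
  have h2 := (Complex.abs_re_le_norm (∫ v in Ioi (0:ℝ), Complex.exp (Complex.I * y * Complex.exp (lg v)) * k v * om)).trans h1
  have h3 : Real.pi⁻¹ ≤ 1 := inv_le_one_of_one_le₀ (by linarith [Real.pi_gt_three])
  calc _ ≤ 1 * |_| := mul_le_mul_of_nonneg_right h3 (abs_nonneg _)
    _ ≤ _ := by rw [one_mul]; exact h2

/-- crude kernel class -/
structure KB (β M : ℝ) (k : ℝ → ℂ) : Prop where
  meas : Measurable k
  bound : ∀ v, 0 < v → ‖k v‖ ≤ M * (v ^ β * Real.exp (-v))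

lemma integrableOn_rpow_exp {β r : ℝ} (hβ : 0 < β) (hr : 0 < r) :
    IntegrableOn (fun v : ℝ => v ^ β * Real.exp (-(r * v))) (Ioi 0) := by
  have key := Real.integral_rpow_mul_exp_neg_mul_Ioi (a := β + 1) (by linarith) hr
  rw [add_sub_cancel_right] at key
  refine .of_integral_ne_zero ?_
  rw [key]
  have := Real.Gamma_pos_of_pos (s := β + 1) (by linarith)
  positivity

lemma KB.gi {β M : ℝ} (hβ : 0 < β) {y : ℝ} (hy : 0 ≤ y) :
    IntegrableOn (fun v => Real.exp (-(y * (s8 * v))) * (M * (v ^ β * Real.exp (-v)))) (Ioi 0) := by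
  have h := (integrableOn_rpow_exp (β := β) (r := y * s8 + 1) hβ (by have := s8_pos; positivity)).const_mul M
  refine h.congr (Eventually.of_forall fun v => ?_)
  simp only
  rw [show -((y * s8 + 1) * v) = -(y * (s8 * v)) + -v by ring, Real.exp_add]; ring

lemma KB.integrable {β M : ℝ} {k : ℝ → ℂ} (h : KB β M k) (hβ : 0 < β) {y : ℝ} (hy : 0 ≤ y) :
    IntegrableOn (fun v : ℝ => Complex.exp (Complex.I * y * Complex.exp (lg v)) * k v * om) (Ioi 0) :=
  Bop_integrable h.meas (KB.gi hβ hy) h.bound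

def CB (β : ℝ) : ℝ := Real.Gamma (β + 1) * (1 / s8) ^ (β + 1)

lemma CB_pos {β : ℝ} (hβ : 0 < β) : 0 < CB β := by
  have := Real.Gamma_pos_of_pos (s := β + 1) (by linarith)
  have := s8_pos
  unfold CB; positivity

lemma KB.Bop_le {β M : ℝ} {k : ℝ → ℂ} (h : KB β M k) (hβ : 0 < β) (hM : 0 ≤ M) {y : ℝ} (hy : 0 ≤ y) :
    |Bop k y| ≤ CB β * M * (1 + y) ^ (-1 - β) := by
  have hs := s8_pos
  refine (LevyLAN.Bop_le (KB.gi hβ hy) h.bound).trans ?_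
  have key := Real.integral_rpow_mul_exp_neg_mul_Ioi (a := β + 1) (r := s8 * (1 + y)) (by linarith) (by positivity)
  rw [add_sub_cancel_right] at key
  have hi := integrableOn_rpow_exp (β := β) (r := s8 * (1 + y)) hβ (by positivity)
  calc _ ≤ ∫ v in Ioi (0:ℝ), M * (v ^ β * Real.exp (-(s8 * (1 + y) * v))) := by
        refine setIntegral_mono_on (KB.gi hβ hy) (hi.const_mul M) measurableSet_Ioi fun v hv => ?_
        have hv' : 0 < v := hv
        have : Real.exp (-(y * (s8 * v))) * Real.exp (-v) ≤ Real.exp (-(s8 * (1 + y) * v)) := by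
          rw [← Real.exp_add, Real.exp_le_exp]
          nlinarith [mul_le_mul_of_nonneg_right s8_le hv'.le]
        calc _ = M * (v ^ β * (Real.exp (-(y * (s8 * v))) * Real.exp (-v))) := by ring
          _ ≤ _ := by gcongr
    _ = CB β * M * (1 + y) ^ (-1 - β) := by
        rw [integral_const_mul, key, CB, one_div, one_div, mul_inv,
          Real.mul_rpow (by positivity) (by positivity), show (-1 - β) = -(β + 1) by ring,
          Real.rpow_neg (by positivity), Real.inv_rpow (by positivity) (β + 1) (x := 1 + y)]
        ring

lemma KB.add {β M M' : ℝ} {k k' : ℝ → ℂ} (h : KB β M k) (h' : KB β M' k') :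
    KB β (M + M') (fun v => k v + k' v) :=
  ⟨h.meas.add h'.meas, fun v hv => (norm_add_le _ _).trans (by
    rw [add_mul]; exact add_le_add (h.bound v hv) (h'.bound v hv))⟩

lemma KB.const_mul {β M : ℝ} {k : ℝ → ℂ} (h : KB β M k) (c : ℝ) :
    KB β (|c| * M) (fun v => (c : ℂ) * k v) :=
  ⟨measurable_const.mul h.meas, fun v hv => by
    rw [norm_mul, Complex.norm_real, Real.norm_eq_abs, mul_assoc]
    exact mul_le_mul_of_nonneg_left (h.bound v hv) (abs_nonneg _)⟩

lemma Bop_add {β M M' : ℝ} {k k' : ℝ → ℂ} (h : KB β M k) (h' : KB β M' k') (hβ : 0 < β) {y : ℝ}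
    (hy : 0 ≤ y) : Bop (fun v => k v + k' v) y = Bop k y + Bop k' y := by
  unfold Bop
  rw [← mul_add, ← Complex.add_re, ← integral_add (h.integrable hβ hy) (h'.integrable hβ hy)]
  congr 3; ext v; ring

lemma Bop_const_mul (k : ℝ → ℂ) (c y : ℝ) : Bop (fun v => (c : ℂ) * k v) y = c * Bop k y := by
  unfold Bop
  rw [show c * (Real.pi⁻¹ * (∫ v in Ioi (0:ℝ), Complex.exp (Complex.I * y * Complex.exp (lg v)) * k v * om).re)
    = Real.pi⁻¹ * (c * (∫ v in Ioi (0:ℝ), Complex.exp (Complex.I * y * Complex.exp (lg v)) * k v * om).re) by ring]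
  congr 1
  rw [← Complex.re_ofReal_mul, ← integral_const_mul]
  refine congrArg Complex.re (integral_congr_ae (Eventually.of_forall fun v => ?_))
  simp only; ring

/-! kernel family -/

def XX (σ v : ℝ) : ℂ := (σ ^ 2 / 2 : ℝ) * Complex.exp (2 * lg v)
def WW (l α v : ℝ) : ℂ := l * Complex.exp (α * lg v)

lemma norm_XX {σ v : ℝ} (hv : 0 < v) : ‖XX σ v‖ = σ ^ 2 / 2 * v ^ 2 := by
  have := norm_exp_mul_lg hv 2
  push_cast at this
  rw [XX, norm_mul, this, Complex.norm_real, Real.norm_of_nonneg (by positivity)]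
  norm_num

lemma norm_WW {l α v : ℝ} (hl : 0 ≤ l) (hv : 0 < v) : ‖WW l α v‖ = l * v ^ α := by
  rw [WW, norm_mul, norm_exp_mul_lg hv, Complex.norm_real, Real.norm_of_nonneg hl]

lemma XX_re {σ v : ℝ} (hv : 0 < v) : (XX σ v).re = σ ^ 2 / 2 * v ^ 2 * (Real.sqrt 2 / 2) := by
  have h := exp_re_mul 2 (Real.log v) (Real.pi / 8)
  push_cast at h
  rw [XX, Complex.re_ofReal_mul]
  unfold lg; push_cast
  rw [h, show 2 * (Real.pi / 8) = Real.pi / 4 by ring, Real.cos_pi_div_four]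
  have : Real.exp (2 * Real.log v) = v ^ 2 := by
    rw [← Real.exp_log (pow_pos hv 2), Real.log_pow]; norm_num
  rw [this]; ring

lemma WW_re_nonneg {l α v : ℝ} (hl : 0 ≤ l) (hα : 0 < α) (hα2 : α < 2) : 0 ≤ (WW l α v).re := by
  rw [WW, Complex.re_ofReal_mul]
  unfold lg
  rw [exp_re_mul]
  have hpi := Real.pi_pos
  have : 0 ≤ Real.cos (α * (Real.pi / 8)) := Real.cos_nonneg_of_neg_pi_div_two_le_of_le
        (by nlinarith) (by nlinarith)
  positivity

def KK (σ l α : ℝ) (h b : ℂ) (v : ℝ) : ℂ :=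
  Complex.exp (-(XX σ v * Complex.exp (2 * h))) * (Complex.exp (-(WW l α v * Complex.exp b)) - 1)

def r0 (α : ℝ) : ℝ := α * (2 - α) / 100

lemma r0_pos {α : ℝ} (h0 : 0 < α) (h2 : α < 2) : 0 < r0 α := by
  unfold r0; have : 0 < 2 - α := by linarith
  positivity

lemma r0_le {α : ℝ} (h0 : 0 < α) (h2 : α < 2) : r0 α ≤ 1 / 100 ∧ r0 α ≤ α / 50 ∧ α + r0 α ≤ 2 := by
  unfold r0
  refine ⟨?_, ?_, ?_⟩ <;> nlinarith [sq_nonneg (α - 1)]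

def MK (σ : ℝ) : ℝ := 4 * Real.exp (1 + 18 / σ ^ 2)

lemma rpow_le_of_exp {v e : ℝ} (hv : 0 < v) (h0 : 0 ≤ e) (h2 : e ≤ 2) : v ^ e ≤ (1 + v) ^ 2 := by
  calc v ^ e ≤ (1 + v) ^ e := Real.rpow_le_rpow hv.le (by linarith) h0
    _ ≤ (1 + v) ^ (2:ℝ) := Real.rpow_le_rpow_of_exponent_le (by linarith) h2
    _ = _ := by norm_num

lemma KK_bound {σ l α : ℝ} (hσ : 0 < σ) (hl : 0 ≤ l) (hα : 0 < α) (hα2 : α < 2)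
    (hl1 : 8 * l ≤ 1) (hl2 : 8 * l ≤ σ ^ 2 / 8) {h b a : ℂ} (hh : ‖h‖ ≤ r0 α) (hb : ‖b‖ ≤ r0 α)
    (ha : ‖a‖ ≤ r0 α) {v : ℝ} (hv : 0 < v) :
    ‖KK σ l α h (b + a * lg v) v‖ ≤ MK σ * l * (v ^ (7 * α / 8) * Real.exp (-v)) := by
  obtain ⟨hr1, hr2, hr3⟩ := r0_le hα hα2
  have hr0 := r0_pos hα hα2
  set r := r0 α
  set β := 7 * α / 8 with hβ
  have e1 : ‖Complex.exp (-(XX σ v * Complex.exp (2 * h)))‖ ≤ Real.exp (-(σ ^ 2 / 4 * v ^ 2)) := by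
    rw [Complex.norm_exp, Real.exp_le_exp, Complex.neg_re, neg_le_neg_iff]
    have h1 : ‖Complex.exp (2 * h) - 1‖ ≤ 2 * ‖2 * h‖ := Complex.norm_exp_sub_one_le (by
      rw [norm_mul]; norm_num; linarith)
    have h1' : ‖Complex.exp (2 * h) - 1‖ ≤ 1 / 25 := by
      rw [norm_mul] at h1; norm_num at h1; linarith
    have h2 : (XX σ v * Complex.exp (2 * h)).re = (XX σ v).re + (XX σ v * (Complex.exp (2 * h) - 1)).re := by
      rw [← Complex.add_re]; congr 1; ring
    have h3 : |(XX σ v * (Complex.exp (2 * h) - 1)).re| ≤ σ ^ 2 / 2 * v ^ 2 * (1 / 25) := by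
      refine (Complex.abs_re_le_norm _).trans ?_
      rw [norm_mul, norm_XX hv]; gcongr
    rw [h2, XX_re hv]
    have h4 := (abs_le.1 h3).1
    have h5 : 1.4 ≤ Real.sqrt 2 := Real.le_sqrt_of_sq_le (by norm_num)
    have h6 : 0 ≤ σ ^ 2 / 2 * v ^ 2 := by positivity
    nlinarith
  set w := WW l α v * Complex.exp (b + a * lg v) with hw
  have hP1 : ‖w‖ ≤ 2 * l * (v ^ (α + r) + v ^ (α - r)) := by
    rw [hw, norm_mul, norm_WW hl hv, Complex.norm_exp]
    have h1 : (b + a * lg v).re ≤ 2 * r + r * |Real.log v| := by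
      refine (Complex.re_le_norm _).trans ((norm_add_le _ _).trans ?_)
      rw [norm_mul]
      have := mul_le_mul ha (norm_lg_le v) (norm_nonneg _) hr0.le
      linarith
    have h2 : Real.exp (2 * r + r * |Real.log v|) ≤ 2 * (v ^ r + v ^ (-r)) := by
      rw [Real.exp_add]
      refine mul_le_mul ?_ ?_ (Real.exp_pos _).le (by norm_num)
      · have := Real.exp_bound_div_one_sub_of_interval' (x := 2 * r) (by linarith) (by linarith)
        refine this.le.trans ?_
        rw [div_le_iff₀ (by linarith)]; linarith
      · rw [Real.rpow_def_of_pos hv, Real.rpow_def_of_pos hv]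
        rcases abs_cases (Real.log v) with ⟨h, _⟩ | ⟨h, _⟩ <;> rw [h]
        · rw [mul_comm r]; linarith [Real.exp_pos (Real.log v * -r)]
        · rw [show r * -Real.log v = Real.log v * -r by ring]; linarith [Real.exp_pos (Real.log v * r)]
    rw [Real.rpow_add hv, sub_eq_add_neg, Real.rpow_add hv]
    calc _ ≤ l * v ^ α * (2 * (v ^ r + v ^ (-r))) := by
          gcongr; exact (Real.exp_le_exp.2 h1).trans h2
      _ = _ := by ring
  have hP2 : ‖w‖ ≤ 4 * l * (v ^ β * (1 + v) ^ 2) := by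
    refine hP1.trans ?_
    have h1 : v ^ (α + r) ≤ v ^ β * (1 + v) ^ 2 := by
      rw [show α + r = β + (α + r - β) by ring, Real.rpow_add hv]
      gcongr; exact rpow_le_of_exp hv (by rw [hβ]; linarith) (by rw [hβ]; linarith)
    have h2 : v ^ (α - r) ≤ v ^ β * (1 + v) ^ 2 := by
      rw [show α - r = β + (α - r - β) by ring, Real.rpow_add hv]
      gcongr; exact rpow_le_of_exp hv (by rw [hβ]; linarith) (by rw [hβ]; linarith)
    nlinarith
  have hP3 : ‖w‖ ≤ 1 + σ ^ 2 / 8 * v ^ 2 := by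
    refine hP1.trans ?_
    have h1 := rpow_le_of_exp (e := α + r) hv (by linarith) (by linarith)
    have h2 := rpow_le_of_exp (e := α - r) hv (by linarith) (by linarith)
    have h3 : (1 + v) ^ 2 ≤ 2 * (1 + v ^ 2) := by nlinarith [sq_nonneg (1 - v)]
    have h4 : v ^ (α + r) + v ^ (α - r) ≤ 4 * (1 + v ^ 2) := by linarith
    calc _ ≤ 2 * l * (4 * (1 + v ^ 2)) := by gcongr
      _ = 8 * l + 8 * l * v ^ 2 := by ring
      _ ≤ _ := by gcongr
  have e2 : ‖Complex.exp (-w) - 1‖ ≤ ‖w‖ * Real.exp ‖w‖ := by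
    have := Complex.norm_exp_sub_sum_le_norm_mul_exp (-w) 1
    simpa using this
  rw [KK, norm_mul]
  have hq : (1 + v) ^ 2 ≤ Real.exp (2 * v) := by
    have := Real.add_one_le_exp v
    calc (1 + v) ^ 2 ≤ Real.exp v ^ 2 := by gcongr; linarith
      _ = _ := by rw [← Real.exp_nat_mul]; norm_num
  calc _ ≤ Real.exp (-(σ ^ 2 / 4 * v ^ 2)) * ((4 * l * (v ^ β * (1 + v) ^ 2)) * Real.exp (1 + σ ^ 2 / 8 * v ^ 2)) := by
        refine mul_le_mul e1 (e2.trans ?_) (norm_nonneg _) (Real.exp_pos _).le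
        refine mul_le_mul hP2 (Real.exp_le_exp.2 hP3) (Real.exp_pos _).le (by positivity)
    _ ≤ Real.exp (-(σ ^ 2 / 4 * v ^ 2)) * ((4 * l * (v ^ β * Real.exp (2 * v))) * Real.exp (1 + σ ^ 2 / 8 * v ^ 2)) := by
        gcongr
    _ = 4 * l * v ^ β * (Real.exp (-(σ ^ 2 / 4 * v ^ 2) + 2 * v + (1 + σ ^ 2 / 8 * v ^ 2))) := by
        rw [Real.exp_add (-(σ ^ 2 / 4 * v ^ 2) + 2 * v), Real.exp_add (-(σ ^ 2 / 4 * v ^ 2))]; ring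
    _ ≤ 4 * l * v ^ β * (Real.exp ((1 + 18 / σ ^ 2) + -v)) := by
        have : -(σ ^ 2 / 4 * v ^ 2) + 2 * v + (1 + σ ^ 2 / 8 * v ^ 2) ≤ (1 + 18 / σ ^ 2) + -v := by
          have h9 : 0 ≤ (σ * v - 12 / σ) ^ 2 := sq_nonneg _
          have : (σ * v - 12 / σ) ^ 2 = σ ^ 2 * v ^ 2 - 24 * v + 8 * (18 / σ ^ 2) := by
            field_simp; ring
          linarith
        gcongr
    _ = _ := by rw [Real.exp_add, MK]; ring

end PartC

section PartD

/-! ### Part D: expansions -/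

def bb (p : Fin 3 → ℝ) (v : ℝ) : ℂ := p 1 + p 2 * lg v

def gK (σ l α : ℝ) (p : Fin 3 → ℝ) (v : ℝ) (z : ℂ) : ℂ := KK σ l α (z * p 0) (z * bb p v) v

def Th (σ l α v : ℝ) : ℂ :=
  -(2 * XX σ v * Complex.exp (-XX σ v) * (Complex.exp (-WW l α v) - 1))
def Tb (σ l α v : ℝ) : ℂ := -(WW l α v * Complex.exp (-XX σ v) * Complex.exp (-WW l α v))
def Thh (σ l α v : ℝ) : ℂ :=
  4 * (XX σ v ^ 2 - XX σ v) * Complex.exp (-XX σ v) * (Complex.exp (-WW l α v) - 1)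
def Thb (σ l α v : ℝ) : ℂ := 4 * XX σ v * WW l α v * Complex.exp (-XX σ v) * Complex.exp (-WW l α v)
def Tbb (σ l α v : ℝ) : ℂ :=
  (WW l α v ^ 2 - WW l α v) * Complex.exp (-XX σ v) * Complex.exp (-WW l α v)

def k1 (σ l α : ℝ) (p : Fin 3 → ℝ) (v : ℝ) : ℂ := p 0 * Th σ l α v + bb p v * Tb σ l α v
def k2 (σ l α : ℝ) (p : Fin 3 → ℝ) (v : ℝ) : ℂ :=
  p 0 ^ 2 * Thh σ l α v + p 0 * bb p v * Thb σ l α v + bb p v ^ 2 * Tbb σ l α v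

lemma measurable_XX (σ : ℝ) : Measurable (XX σ) := by
  have := measurable_lg
  unfold XX; fun_prop
lemma measurable_WW (l α : ℝ) : Measurable (WW l α) := by
  have := measurable_lg
  unfold WW; fun_prop
lemma measurable_bb (p : Fin 3 → ℝ) : Measurable (bb p) := by
  have := measurable_lg
  unfold bb; fun_prop

lemma measurable_k1 (σ l α : ℝ) (p : Fin 3 → ℝ) : Measurable (k1 σ l α p) := by
  have := measurable_XX σ
  have := measurable_WW l α
  have := measurable_bb p
  unfold k1 Th Tb; fun_prop
lemma measurable_k2 (σ l α : ℝ) (p : Fin 3 → ℝ) : Measurable (k2 σ l α p) := by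
  have := measurable_XX σ
  have := measurable_WW l α
  have := measurable_bb p
  unfold k2 Thh Thb Tbb; fun_prop
lemma measurable_kk (σ l α : ℝ) : Measurable (kk σ l α) := by
  have := measurable_lg
  unfold kk; fun_prop

lemma gK_diff (σ l α : ℝ) (p : Fin 3 → ℝ) (v : ℝ) : Differentiable ℂ (gK σ l α p v) := by
  unfold gK KK; fun_prop

lemma gK_zero (σ l α : ℝ) (p : Fin 3 → ℝ) (v : ℝ) : gK σ l α p v 0 = kk σ l α v := by
  simp [gK, KK, kk, XX, WW]

lemma gK_one (σ l α : ℝ) (p : Fin 3 → ℝ) (v : ℝ) :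
    gK σ l α p v 1 = kk (σ * Real.exp (p 0)) (l * Real.exp (p 1)) (α + p 2) v := by
  simp only [gK, KK, kk, XX, WW, bb, one_mul]
  congr 3
  · push_cast
    rw [show (2 * (p 0 : ℂ)) = p 0 + p 0 by ring, Complex.exp_add]; ring_nf
  · push_cast
    rw [add_mul, Complex.exp_add, Complex.exp_add]; ring_nf

lemma deriv_slice (X W h b : ℂ) :
    let g : ℂ → ℂ := fun z => Complex.exp (-(X * Complex.exp (2 * (z * h)))) * (Complex.exp (-(W * Complex.exp (z * b))) - 1)
    deriv g 0 = h * (-(2 * X * Complex.exp (-X) * (Complex.exp (-W) - 1))) + b * (-(W * Complex.exp (-X) * Complex.exp (-W)))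
    ∧ deriv (deriv g) 0 = h ^ 2 * (4 * (X ^ 2 - X) * Complex.exp (-X) * (Complex.exp (-W) - 1))
      + h * b * (4 * X * W * Complex.exp (-X) * Complex.exp (-W))
      + b ^ 2 * ((W ^ 2 - W) * Complex.exp (-X) * Complex.exp (-W)) := by
  intro g
  have hX : ∀ z : ℂ, HasDerivAt (fun z : ℂ => X * Complex.exp (2 * (z * h))) (2 * h * (X * Complex.exp (2 * (z * h)))) z := by
    intro z
    have := ((((hasDerivAt_id' z).mul_const h).const_mul 2).cexp).const_mul X
    convert! this using 1; ring
  have hW : ∀ z : ℂ, HasDerivAt (fun z : ℂ => W * Complex.exp (z * b)) (b * (W * Complex.exp (z * b))) z := by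
    intro z
    have := ((((hasDerivAt_id' z).mul_const b)).cexp).const_mul W
    convert! this using 1; ring
  have heX : ∀ z : ℂ, HasDerivAt (fun z : ℂ => Complex.exp (-(X * Complex.exp (2 * (z * h)))))
      (Complex.exp (-(X * Complex.exp (2 * (z * h)))) * (-(2 * h * (X * Complex.exp (2 * (z * h)))))) z :=
    fun z => (hX z).fun_neg.cexp
  have heW : ∀ z : ℂ, HasDerivAt (fun z : ℂ => Complex.exp (-(W * Complex.exp (z * b))))
      (Complex.exp (-(W * Complex.exp (z * b))) * (-(b * (W * Complex.exp (z * b))))) z :=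
    fun z => (hW z).fun_neg.cexp
  have h1 : ∀ z : ℂ, HasDerivAt g (Complex.exp (-(X * Complex.exp (2 * (z * h)))) * (-(2 * h * (X * Complex.exp (2 * (z * h)))))
      * (Complex.exp (-(W * Complex.exp (z * b))) - 1) + Complex.exp (-(X * Complex.exp (2 * (z * h)))) *
      (Complex.exp (-(W * Complex.exp (z * b))) * (-(b * (W * Complex.exp (z * b)))))) z :=
    fun z => (heX z).fun_mul ((heW z).sub_const 1)
  constructor
  · rw [(h1 0).deriv]; simp; ring
  · rw [show deriv g = _ from funext fun z => (h1 z).deriv]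
    have h2 := ((((heX 0).fun_mul (((hX 0).const_mul (2 * h)).fun_neg)).fun_mul ((heW 0).sub_const 1)).fun_add
      ((heX 0).fun_mul ((heW 0).fun_mul ((hW 0).const_mul b).fun_neg))
      )
    rw [h2.deriv]; simp; ring

lemma gK_taylor {σ l α : ℝ} (hσ : 0 < σ) (hl : 0 ≤ l) (hα : 0 < α) (hα2 : α < 2)
    (hl1 : 8 * l ≤ 1) (hl2 : 8 * l ≤ σ ^ 2 / 8) {p : Fin 3 → ℝ} {s : ℝ} (hs : 0 < s) (hs2 : s ≤ r0 α / 2)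
    (hp : ∀ i, |p i| ≤ s) {v : ℝ} (hv : 0 < v) :
    ‖k1 σ l α p v‖ ≤ MK σ * l * (s / r0 α) * (v ^ (7 * α / 8) * Real.exp (-v)) ∧
    ‖k2 σ l α p v‖ ≤ 2 * MK σ * l * (s / r0 α) ^ 2 * (v ^ (7 * α / 8) * Real.exp (-v)) ∧
    ‖gK σ l α p v 1 - gK σ l α p v 0 - k1 σ l α p v - (1 / 2) * k2 σ l α p v‖ ≤
      2 * MK σ * l * (s / r0 α) ^ 3 * (v ^ (7 * α / 8) * Real.exp (-v)) := by
  have hr := r0_pos hα hα2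
  have hd := deriv_slice (XX σ v) (WW l α v) (p 0) (bb p v)
  have hMK : 0 ≤ MK σ := by unfold MK; positivity
  have h := taylor3 (gK_diff σ l α p v) (M := MK σ * l * (v ^ (7 * α / 8) * Real.exp (-v))) (ρ := r0 α / s)
    (by rw [le_div_iff₀ hs]; linarith) (by positivity) ?_ hd.1 hd.2
  · obtain ⟨h1, h2, h3⟩ := h
    refine ⟨h1.trans (le_of_eq ?_), h2.trans (le_of_eq ?_), h3.trans (le_of_eq ?_)⟩ <;> field_simp
  · intro z hz
    have hb : ∀ i, ‖z * (p i : ℂ)‖ ≤ r0 α := by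
      intro i
      rw [norm_mul, hz, Complex.norm_real, Real.norm_eq_abs]
      calc r0 α / s * |p i| ≤ r0 α / s * s := by gcongr; exact hp i
        _ = r0 α := by field_simp
    have := KK_bound hσ hl hα hα2 hl1 hl2 (hb 0) (hb 1) (hb 2) hv
    rw [gK, bb]
    rwa [show z * ((p 1 : ℂ) + p 2 * lg v) = z * p 1 + z * p 2 * lg v by ring]

lemma kk_KB {σ l α : ℝ} (hσ : 0 < σ) (hl : 0 ≤ l) (hα : 0 < α) (hα2 : α < 2)
    (hl1 : 8 * l ≤ 1) (hl2 : 8 * l ≤ σ ^ 2 / 8) {p : Fin 3 → ℝ} (hp : ∀ i, |p i| ≤ r0 α) :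
    KB (7 * α / 8) (MK σ * l) (kk (σ * Real.exp (p 0)) (l * Real.exp (p 1)) (α + p 2)) := by
  refine ⟨measurable_kk _ _ _, fun v hv => ?_⟩
  have hb : ∀ i, ‖(p i : ℂ)‖ ≤ r0 α := by
    intro i; rw [Complex.norm_real]; exact hp i
  have := KK_bound hσ hl hα hα2 hl1 hl2 (hb 0) (hb 1) (hb 2) hv
  rw [← gK_one, gK, one_mul, one_mul]
  exact this

/-- Gaussian exponent -/
def YY (σ y : ℝ) : ℝ := y ^ 2 / (2 * σ ^ 2)

def Env1 (σ y : ℝ) : ℝ := Real.exp (-(7 / 8 * YY σ y))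
def Env2 (l α y : ℝ) : ℝ := l * (1 + |y|) ^ (-1 - 7 * α / 8)

lemma YY_nonneg (σ y : ℝ) : 0 ≤ YY σ y := by unfold YY; positivity

def gG (h Y : ℝ) (z : ℂ) : ℂ := Complex.exp (-(z * h) - Y * Complex.exp (-(2 * (z * h))))

lemma gG_deriv (h Y : ℝ) : deriv (gG h Y) 0 = ((h * (2 * Y - 1) * Real.exp (-Y) : ℝ) : ℂ) ∧
    deriv (deriv (gG h Y)) 0 = ((h ^ 2 * (4 * Y ^ 2 - 8 * Y + 1) * Real.exp (-Y) : ℝ) : ℂ) := by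
  have hE : ∀ z : ℂ, HasDerivAt (fun z : ℂ => (Y : ℂ) * Complex.exp (-(2 * (z * h))))
      (-(2 * h * (Y * Complex.exp (-(2 * (z * h)))))) z := by
    intro z
    have := ((((hasDerivAt_id' z).mul_const (h : ℂ)).const_mul 2).fun_neg.cexp).const_mul (Y : ℂ)
    convert! this using 1; ring
  have hA : ∀ z : ℂ, HasDerivAt (fun z : ℂ => -(z * h)) (-(h : ℂ)) z := by
    intro z
    have := ((hasDerivAt_id' z).mul_const (h : ℂ)).fun_neg
    convert! this using 1; ring
  have h1 : ∀ z : ℂ, HasDerivAt (gG h Y) (gG h Y z * (-(h : ℂ) - (-(2 * h * (Y * Complex.exp (-(2 * (z * h)))))))) z :=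
    fun z => ((hA z).fun_sub (hE z)).cexp
  constructor
  · rw [(h1 0).deriv]; simp [gG]; ring
  · rw [show deriv (gG h Y) = _ from funext fun z => (h1 z).deriv]
    have h2 := (h1 0).fun_mul (((hE 0).const_mul (2 * (h : ℂ))).fun_neg.const_sub (-(h : ℂ)))

    rw [h2.deriv]; simp [gG]; ring

lemma gG_taylor {h Y s r : ℝ} (hY : 0 ≤ Y) (hr : 0 < r) (hr1 : r ≤ 1 / 100) (hs : 0 < s) (hs2 : s ≤ r / 2) (hh : |h| ≤ s) :
    |h * (2 * Y - 1) * Real.exp (-Y)| ≤ 2 * Real.exp (-(7 / 8 * Y)) * (s / r) ∧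
    |h ^ 2 * (4 * Y ^ 2 - 8 * Y + 1) * Real.exp (-Y)| ≤ 4 * Real.exp (-(7 / 8 * Y)) * (s / r) ^ 2 ∧
    |Real.exp (-h - Y * Real.exp (-(2 * h))) - Real.exp (-Y) - h * (2 * Y - 1) * Real.exp (-Y)
      - (1 / 2) * (h ^ 2 * (4 * Y ^ 2 - 8 * Y + 1) * Real.exp (-Y))| ≤ 4 * Real.exp (-(7 / 8 * Y)) * (s / r) ^ 3 := by
  have hd := gG_deriv h Y
  have h := taylor3 (g := gG h Y) (by unfold gG; fun_prop) (M := 2 * Real.exp (-(7 / 8 * Y))) (ρ := r / s)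
    (by rw [le_div_iff₀ hs]; linarith) (by positivity) ?_ hd.1 hd.2
  · obtain ⟨h1, h2, h3⟩ := h
    rw [Complex.norm_real, Real.norm_eq_abs] at h1 h2
    refine ⟨h1.trans (le_of_eq ?_), h2.trans (le_of_eq ?_), ?_⟩
    · field_simp
    · field_simp; norm_num
    · have e : gG h Y 1 - gG h Y 0 - ((h * (2 * Y - 1) * Real.exp (-Y) : ℝ) : ℂ) - (1 / 2) * ((h ^ 2 * (4 * Y ^ 2 - 8 * Y + 1) * Real.exp (-Y) : ℝ) : ℂ)
        = ((Real.exp (-h - Y * Real.exp (-(2 * h))) - Real.exp (-Y) - h * (2 * Y - 1) * Real.exp (-Y)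
      - (1 / 2) * (h ^ 2 * (4 * Y ^ 2 - 8 * Y + 1) * Real.exp (-Y)) : ℝ) : ℂ) := by
        simp [gG]
      rw [e, Complex.norm_real, Real.norm_eq_abs] at h3
      refine h3.trans (le_of_eq ?_)
      field_simp; norm_num
  · intro z hz
    have hb : ‖z * (h : ℂ)‖ ≤ r := by
      rw [norm_mul, hz, Complex.norm_real, Real.norm_eq_abs]
      calc r / s * |h| ≤ r / s * s := by gcongr
        _ = r := by field_simp
    rw [gG, sub_eq_add_neg, Complex.exp_add, norm_mul]
    refine mul_le_mul ?_ ?_ (norm_nonneg _) (by norm_num)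
    · rw [Complex.norm_exp]
      have : (-(z * h)).re ≤ r := (Complex.re_le_norm _).trans (by rwa [norm_neg])
      refine (Real.exp_le_exp.2 this).trans ?_
      refine (Real.exp_bound_div_one_sub_of_interval' (x := r) hr (by linarith)).le.trans ?_
      rw [div_le_iff₀ (by linarith)]; linarith
    · rw [Complex.norm_exp, Real.exp_le_exp, Complex.neg_re, neg_le_neg_iff, Complex.re_ofReal_mul]
      have h1 : ‖Complex.exp (-(2 * (z * h))) - 1‖ ≤ 2 * ‖-(2 * (z * h))‖ := Complex.norm_exp_sub_one_le (by
        rw [norm_neg, norm_mul]; norm_num at *; linarith)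
      have h1' : ‖Complex.exp (-(2 * (z * h))) - 1‖ ≤ 1 / 25 := by
        rw [norm_neg, norm_mul] at h1; norm_num at *; linarith
      have h2 := (abs_le.1 ((Complex.abs_re_le_norm _).trans h1')).1
      rw [Complex.sub_re, Complex.one_re] at h2
      nlinarith

end PartD

section PartE

/-! ### Part E: density level expansion -/

def qP (σ l α : ℝ) (p : Fin 3 → ℝ) (y : ℝ) : ℝ :=
  qF (σ * Real.exp (p 0)) (l * Real.exp (p 1)) (α + p 2) y

def Q1 (σ l α : ℝ) (p : Fin 3 → ℝ) (y : ℝ) : ℝ :=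
  gaussS σ y * (p 0 * (2 * YY σ y - 1)) + Bop (k1 σ l α p) |y|

def Q2 (σ l α : ℝ) (p : Fin 3 → ℝ) (y : ℝ) : ℝ :=
  gaussS σ y * (p 0 ^ 2 * (4 * YY σ y ^ 2 - 8 * YY σ y + 1)) + Bop (k2 σ l α p) |y|

lemma qF_abs (σ l α y : ℝ) : qF σ l α |y| = qF σ l α y := by
  unfold qF
  congr 2; ext u; congr 1
  rcases abs_cases y with ⟨h, _⟩ | ⟨h, _⟩ <;> rw [h]
  rw [neg_mul, Real.cos_neg]

lemma gaussS_abs (σ y : ℝ) : gaussS σ |y| = gaussS σ y := by simp [gaussS]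

lemma qF_rot' {σ l α : ℝ} (hσ : 0 < σ) (hl : 0 ≤ l) (hα : 0 < α) (hα2 : α < 2) (y : ℝ) :
    qF σ l α y = gaussS σ y + Bop (kk σ l α) |y| := by
  rw [← qF_abs, qF_rot hσ hl hα hα2 (abs_nonneg y), gaussS_abs]

lemma gaussS_exp {σ : ℝ} (hσ : 0 < σ) (h y : ℝ) : gaussS (σ * Real.exp h) y =
    (σ * Real.sqrt (2 * Real.pi))⁻¹ * Real.exp (-h - YY σ y * Real.exp (-(2 * h))) := by
  have e1 : y ^ 2 / (2 * (σ * Real.exp h) ^ 2) = YY σ y * Real.exp (-(2 * h)) := by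
    rw [YY, Real.exp_neg, show Real.exp (2 * h) = Real.exp h ^ 2 by rw [← Real.exp_nat_mul]; norm_num]
    field_simp
  rw [gaussS, e1, sub_eq_add_neg, Real.exp_add, Real.exp_neg h]
  field_simp

lemma gaussS_eq (σ y : ℝ) : gaussS σ y = (σ * Real.sqrt (2 * Real.pi))⁻¹ * Real.exp (-YY σ y) := rfl

lemma p2_range {α : ℝ} (hα : 0 < α) (hα2 : α < 2) {a : ℝ} (h : |a| ≤ r0 α / 2) : 0 < α + a ∧ α + a < 2 := by
  obtain ⟨h1, h2, h3⟩ := r0_le hα hα2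
  have := r0_pos hα hα2
  have := abs_le.1 h
  constructor <;> linarith

/-- smallness of `l` -/
structure Sm (σ l : ℝ) : Prop where
  pos : 0 < l
  h1 : 8 * l ≤ 1
  h2 : 8 * l ≤ σ ^ 2 / 8

def CE (σ α : ℝ) : ℝ :=
  (2 * CB (7 * α / 8) * MK σ + 4 * (σ * Real.sqrt (2 * Real.pi))⁻¹) * (1 / r0 α + (1 / r0 α) ^ 2 + (1 / r0 α) ^ 3)

lemma CE_nonneg {σ α : ℝ} (hσ : 0 < σ) (hα : 0 < α) (hα2 : α < 2) : 0 ≤ CE σ α := by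
  have := CB_pos (β := 7 * α / 8) (by positivity)
  have := r0_pos hα hα2
  have : 0 ≤ MK σ := by unfold MK; positivity
  unfold CE; positivity

lemma expand {σ l α : ℝ} (hσ : 0 < σ) (hS : Sm σ l) (hα : 0 < α) (hα2 : α < 2)
    {p : Fin 3 → ℝ} {x s : ℝ} (hx : 0 < x) (hxs : x ≤ s) (hs2 : s ≤ r0 α / 2)
    (hp0 : |p 0| ≤ x) (hp1 : |p 1| ≤ s) (hp2 : |p 2| ≤ s) (y : ℝ) :
    |Q1 σ l α p y| ≤ CE σ α * (x * Env1 σ y + s * Env2 l α y) ∧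
    |Q2 σ l α p y| ≤ CE σ α * (x ^ 2 * Env1 σ y + s ^ 2 * Env2 l α y) ∧
    |qP σ l α p y - qF σ l α y - Q1 σ l α p y - (1 / 2) * Q2 σ l α p y| ≤
      CE σ α * (x ^ 3 * Env1 σ y + s ^ 3 * Env2 l α y) := by
  have hl := hS.pos.le
  have hs : 0 < s := hx.trans_le hxs
  have hr := r0_pos hα hα2
  obtain ⟨hr1, -, -⟩ := r0_le hα hα2
  have hβ : 0 < 7 * α / 8 := by positivity
  have hy := abs_nonneg y
  have hMK : 0 ≤ MK σ := by unfold MK; positivity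
  have hCB := CB_pos hβ
  have hp : ∀ i, |p i| ≤ s := by
    intro i; fin_cases i
    · exact hp0.trans hxs
    · exact hp1
    · exact hp2
  have hT := fun v hv => gK_taylor hσ hl hα hα2 hS.h1 hS.h2 hs hs2 hp (v := v) hv
  have hG := gG_taylor (YY_nonneg σ y) hr hr1 hx (hxs.trans hs2) hp0
  set c0 := (σ * Real.sqrt (2 * Real.pi))⁻¹ with hc0
  have hc0' : 0 ≤ c0 := by rw [hc0]; positivity
  have K1 : KB (7 * α / 8) (MK σ * l * (s / r0 α)) (k1 σ l α p) := ⟨measurable_k1 _ _ _ _, fun v hv => (hT v hv).1⟩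
  have K2 : KB (7 * α / 8) (2 * MK σ * l * (s / r0 α) ^ 2) (k2 σ l α p) := ⟨measurable_k2 _ _ _ _, fun v hv => (hT v hv).2.1⟩
  have K0 : KB (7 * α / 8) (MK σ * l) (kk σ l α) := by
    have := kk_KB hσ hl hα hα2 hS.h1 hS.h2 (p := 0) (by intro i; simp; exact hr.le)
    simpa using this
  have Kp := kk_KB hσ hl hα hα2 hS.h1 hS.h2 (p := p) (fun i => (hp i).trans (by linarith))
  have hr3 : 1 / r0 α ≤ 1 / r0 α + (1 / r0 α) ^ 2 + (1 / r0 α) ^ 3 := by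
    have : 0 ≤ (1 / r0 α) ^ 2 + (1 / r0 α) ^ 3 := by positivity
    linarith
  have hr4 : (1 / r0 α) ^ 2 ≤ 1 / r0 α + (1 / r0 α) ^ 2 + (1 / r0 α) ^ 3 := by
    have : 0 ≤ (1 / r0 α) + (1 / r0 α) ^ 3 := by positivity
    linarith
  have hr5 : (1 / r0 α) ^ 3 ≤ 1 / r0 α + (1 / r0 α) ^ 2 + (1 / r0 α) ^ 3 := by
    have : 0 ≤ (1 / r0 α) + (1 / r0 α) ^ 2 := by positivity
    linarith
  have hE1 : 0 ≤ Env1 σ y := (Real.exp_pos _).le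
  have hE2 : 0 ≤ (1 + |y|) ^ (-1 - 7 * α / 8) := by positivity
  have fin : ∀ (j : ℕ) (a b : ℝ), a ≤ 4 * c0 * Env1 σ y * (x / r0 α) ^ j →
      b ≤ CB (7 * α / 8) * (2 * MK σ * l * (s / r0 α) ^ j) * (1 + |y|) ^ (-1 - 7 * α / 8) →
      (1 / r0 α) ^ j ≤ 1 / r0 α + (1 / r0 α) ^ 2 + (1 / r0 α) ^ 3 →
      a + b ≤ CE σ α * (x ^ j * Env1 σ y + s ^ j * Env2 l α y) := by
    intro j a b ha hb hj
    have e1 : CE σ α * (x ^ j * Env1 σ y + s ^ j * Env2 l α y) =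
      (1 / r0 α + (1 / r0 α) ^ 2 + (1 / r0 α) ^ 3) * ((2 * CB (7 * α / 8) * MK σ + 4 * c0) * (x ^ j * Env1 σ y + s ^ j * Env2 l α y)) := by
      rw [CE]; ring
    have e2 : 4 * c0 * Env1 σ y * (x / r0 α) ^ j + CB (7 * α / 8) * (2 * MK σ * l * (s / r0 α) ^ j) * (1 + |y|) ^ (-1 - 7 * α / 8)
       = (1 / r0 α) ^ j * (4 * c0 * (x ^ j * Env1 σ y) + 2 * CB (7 * α / 8) * MK σ * (s ^ j * Env2 l α y)) := by
      rw [Env2, div_pow, div_pow, div_pow]; ring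
    refine (add_le_add ha hb).trans ?_
    rw [e1, e2]
    have hE2' : 0 ≤ Env2 l α y := by unfold Env2; positivity
    refine mul_le_mul hj ?_ (by positivity) (by positivity)
    have h1 : 0 ≤ 4 * c0 * (s ^ j * Env2 l α y) := by positivity
    have h2 : 0 ≤ 2 * CB (7 * α / 8) * MK σ * (x ^ j * Env1 σ y) := by positivity
    nlinarith
  refine ⟨?_, ?_, ?_⟩
  · rw [Q1]
    have e1 : CE σ α * (x * Env1 σ y + s * Env2 l α y) = CE σ α * (x ^ 1 * Env1 σ y + s ^ 1 * Env2 l α y) := by simp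
    rw [e1]
    refine (abs_add_le _ _).trans (fin 1 _ _ ?_ ((K1.Bop_le hβ (by positivity) hy).trans ?_) (by simpa using hr3))
    · rw [gaussS_eq, ← hc0, show c0 * Real.exp (-YY σ y) * (p 0 * (2 * YY σ y - 1)) = c0 * (p 0 * (2 * YY σ y - 1) * Real.exp (-YY σ y)) by ring, abs_mul, abs_of_nonneg hc0']
      refine (mul_le_mul_of_nonneg_left hG.1 hc0').trans ?_
      rw [pow_one, ← Env1]
      have : 0 ≤ c0 * Env1 σ y * (x / r0 α) := by positivity
      linarith
    · rw [pow_one]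
      have : 0 ≤ CB (7 * α / 8) * (MK σ * l * (s / r0 α)) * (1 + |y|) ^ (-1 - 7 * α / 8) := by positivity
      linarith
  · rw [Q2]
    refine (abs_add_le _ _).trans (fin 2 _ _ ?_ (K2.Bop_le hβ (by positivity) hy) hr4)
    · rw [gaussS_eq, ← hc0, show c0 * Real.exp (-YY σ y) * (p 0 ^ 2 * (4 * YY σ y ^ 2 - 8 * YY σ y + 1)) = c0 * (p 0 ^ 2 * (4 * YY σ y ^ 2 - 8 * YY σ y + 1) * Real.exp (-YY σ y)) by ring, abs_mul, abs_of_nonneg hc0']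
      refine (mul_le_mul_of_nonneg_left hG.2.1 hc0').trans (le_of_eq ?_)
      rw [← Env1]; ring
  · have hrg := p2_range hα hα2 (hp2.trans hs2)
    have K3 : KB (7 * α / 8) (2 * MK σ * l * (s / r0 α) ^ 3)
        (fun v => gK σ l α p v 1 - gK σ l α p v 0 - k1 σ l α p v - (1 / 2) * k2 σ l α p v) := by
      refine ⟨?_, fun v hv => (hT v hv).2.2⟩
      simp only [gK_one, gK_zero]
      exact ((((measurable_kk _ _ _).sub (measurable_kk _ _ _)).sub (measurable_k1 _ _ _ _))).sub ((measurable_k2 _ _ _ _).const_mul _)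
    have hB : Bop (fun v => gK σ l α p v 1 - gK σ l α p v 0 - k1 σ l α p v - (1 / 2) * k2 σ l α p v) |y| =
       Bop (kk (σ * Real.exp (p 0)) (l * Real.exp (p 1)) (α + p 2)) |y| - Bop (kk σ l α) |y| - Bop (k1 σ l α p) |y| - (1 / 2) * Bop (k2 σ l α p) |y| := by
      have e : Bop (kk (σ * Real.exp (p 0)) (l * Real.exp (p 1)) (α + p 2)) |y| =
          Bop (fun v => (gK σ l α p v 1 - gK σ l α p v 0 - k1 σ l α p v - (1 / 2) * k2 σ l α p v) + ((kk σ l α v + k1 σ l α p v) + ((1 / 2 : ℝ) : ℂ) * k2 σ l α p v)) |y| := by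
        congr 1; ext v; rw [gK_one, gK_zero]; push_cast; ring
      rw [e, Bop_add K3 ((K0.add K1).add (K2.const_mul (1 / 2))) hβ hy, Bop_add (K0.add K1) (K2.const_mul (1 / 2)) hβ hy,
        Bop_add K0 K1 hβ hy, Bop_const_mul]
      ring
    have e : qP σ l α p y - qF σ l α y - Q1 σ l α p y - (1 / 2) * Q2 σ l α p y =
       c0 * (Real.exp (-p 0 - YY σ y * Real.exp (-(2 * p 0))) - Real.exp (-YY σ y) - p 0 * (2 * YY σ y - 1) * Real.exp (-YY σ y)
      - (1 / 2) * (p 0 ^ 2 * (4 * YY σ y ^ 2 - 8 * YY σ y + 1) * Real.exp (-YY σ y))) +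
       Bop (fun v => gK σ l α p v 1 - gK σ l α p v 0 - k1 σ l α p v - (1 / 2) * k2 σ l α p v) |y| := by
      rw [hB, qP, qF_rot' (by positivity) (by positivity) hrg.1 hrg.2, qF_rot' hσ hl hα hα2, gaussS_exp hσ, Q1, Q2, gaussS_eq]
      ring
    rw [e]
    refine (abs_add_le _ _).trans (fin 3 _ _ ?_ (K3.Bop_le hβ (by positivity) hy) hr5)
    · rw [abs_mul, abs_of_nonneg hc0']
      refine (mul_le_mul_of_nonneg_left hG.2.2 hc0').trans (le_of_eq ?_)
      rw [← Env1]; ring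

end PartE

section PartF

/-! ### Part F: linearity, measurability, integrals -/

lemma k1_smul (σ l α c : ℝ) (p : Fin 3 → ℝ) (v : ℝ) : k1 σ l α (c • p) v = (c : ℂ) * k1 σ l α p v := by
  simp only [k1, bb, Pi.smul_apply, smul_eq_mul]; push_cast; ring

lemma k2_smul (σ l α c : ℝ) (p : Fin 3 → ℝ) (v : ℝ) :
    k2 σ l α (c • p) v = ((c ^ 2 : ℝ) : ℂ) * k2 σ l α p v := by
  simp only [k2, bb, Pi.smul_apply, smul_eq_mul]; push_cast; ring

lemma k12_KB {σ l α : ℝ} (hσ : 0 < σ) (hS : Sm σ l) (hα : 0 < α) (hα2 : α < 2) (p : Fin 3 → ℝ) :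
    (∃ M, KB (7 * α / 8) M (k1 σ l α p)) ∧ (∃ M, KB (7 * α / 8) M (k2 σ l α p)) := by
  have hr := r0_pos hα hα2
  set B := 1 + ‖p‖ with hB
  have hB0 : 0 < B := by have := norm_nonneg p; linarith
  set c := (r0 α / 2) / B with hc
  have hc0 : 0 < c := by positivity
  have hp : ∀ i, |(c • p) i| ≤ r0 α / 2 := by
    intro i
    simp only [Pi.smul_apply, smul_eq_mul]
    rw [abs_mul, abs_of_pos hc0]
    have h1 : |p i| ≤ B := by have := norm_le_pi_norm p i; rw [Real.norm_eq_abs] at this; linarith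
    calc c * |p i| ≤ c * B := mul_le_mul_of_nonneg_left h1 hc0.le
      _ = r0 α / 2 := by rw [hc]; field_simp
  have hT := fun v hv => gK_taylor hσ hS.pos.le hα hα2 hS.h1 hS.h2 (s := r0 α / 2) (by positivity) le_rfl hp (v := v) hv
  have e : p = c⁻¹ • (c • p) := by rw [smul_smul, inv_mul_cancel₀ hc0.ne', one_smul]
  have K1 : KB (7 * α / 8) _ (k1 σ l α (c • p)) := ⟨measurable_k1 _ _ _ _, fun v hv => (hT v hv).1⟩
  have K2 : KB (7 * α / 8) _ (k2 σ l α (c • p)) := ⟨measurable_k2 _ _ _ _, fun v hv => (hT v hv).2.1⟩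
  have E1 : k1 σ l α p = fun v => ((c⁻¹ : ℝ) : ℂ) * k1 σ l α (c • p) v := funext fun v => by
    conv_lhs => rw [e]
    exact k1_smul _ _ _ _ _ _
  have E2 : k2 σ l α p = fun v => (((c⁻¹) ^ 2 : ℝ) : ℂ) * k2 σ l α (c • p) v := funext fun v => by
    conv_lhs => rw [e]
    exact k2_smul _ _ _ _ _ _
  have H1 := K1.const_mul c⁻¹
  have H2 := K2.const_mul (c⁻¹ ^ 2)
  rw [← E1] at H1
  rw [← E2] at H2
  exact ⟨⟨_, H1⟩, ⟨_, H2⟩⟩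

lemma Q1_add {σ l α : ℝ} (hσ : 0 < σ) (hS : Sm σ l) (hα : 0 < α) (hα2 : α < 2) (p q : Fin 3 → ℝ) (y : ℝ) :
    Q1 σ l α (p + q) y = Q1 σ l α p y + Q1 σ l α q y := by
  obtain ⟨M, hM⟩ := (k12_KB hσ hS hα hα2 p).1
  obtain ⟨M', hM'⟩ := (k12_KB hσ hS hα hα2 q).1
  have := Bop_add hM hM' (by positivity) (abs_nonneg y)
  simp only [Q1]
  rw [show k1 σ l α (p + q) = fun v => k1 σ l α p v + k1 σ l α q v from funext fun v => by
    simp only [k1, bb, Pi.add_apply]; push_cast; ring, this, Pi.add_apply]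
  ring

lemma Q1_smul (σ l α c : ℝ) (p : Fin 3 → ℝ) (y : ℝ) :
    Q1 σ l α (c • p) y = c * Q1 σ l α p y := by
  simp only [Q1]
  rw [show k1 σ l α (c • p) = fun v => (c : ℂ) * k1 σ l α p v from funext fun v => k1_smul _ _ _ _ _ _, Bop_const_mul]
  simp; ring

lemma Q2_smul (σ l α c : ℝ) (p : Fin 3 → ℝ) (y : ℝ) :
    Q2 σ l α (c • p) y = c ^ 2 * Q2 σ l α p y := by
  simp only [Q2]
  rw [show k2 σ l α (c • p) = fun v => ((c ^ 2 : ℝ) : ℂ) * k2 σ l α p v from funext fun v => k2_smul _ _ _ _ _ _, Bop_const_mul]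
  simp; ring

lemma Q1_lin {σ l α : ℝ} (hσ : 0 < σ) (hS : Sm σ l) (hα : 0 < α) (hα2 : α < 2) (p : Fin 3 → ℝ) (y : ℝ) :
    Q1 σ l α p y = p 0 * Q1 σ l α ![1, 0, 0] y + p 1 * Q1 σ l α ![0, 1, 0] y + p 2 * Q1 σ l α ![0, 0, 1] y := by
  have e : p = (p 0 • ![1, 0, 0] + p 1 • ![0, 1, 0]) + p 2 • ![0, 0, 1] := by
    ext i; fin_cases i <;> simp
  conv_lhs => rw [e]
  rw [Q1_add hσ hS hα hα2, Q1_add hσ hS hα hα2, Q1_smul, Q1_smul, Q1_smul]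

lemma Q2_polar {σ l α : ℝ} (hσ : 0 < σ) (hS : Sm σ l) (hα : 0 < α) (hα2 : α < 2) (x s a b c : ℝ) (y : ℝ) :
    Q2 σ l α ![x * a, s * b, s * c] y = (a ^ 2 - a * b - a * c) * Q2 σ l α ![x, 0, 0] y
      + (b ^ 2 - a * b - b * c) * Q2 σ l α ![0, s, 0] y + (c ^ 2 - a * c - b * c) * Q2 σ l α ![0, 0, s] y
      + a * b * Q2 σ l α ![x, s, 0] y + a * c * Q2 σ l α ![x, 0, s] y + b * c * Q2 σ l α ![0, s, s] y := by
  have hβ : 0 < 7 * α / 8 := by positivity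
  have hy := abs_nonneg y
  choose M hM using fun p => (k12_KB hσ hS hα hα2 p).2
  have e : k2 σ l α ![x * a, s * b, s * c] = fun v =>
      ((((((a ^ 2 - a * b - a * c : ℝ) : ℂ) * k2 σ l α ![x, 0, 0] v
      + ((b ^ 2 - a * b - b * c : ℝ) : ℂ) * k2 σ l α ![0, s, 0] v) + ((c ^ 2 - a * c - b * c : ℝ) : ℂ) * k2 σ l α ![0, 0, s] v)
      + ((a * b : ℝ) : ℂ) * k2 σ l α ![x, s, 0] v) + ((a * c : ℝ) : ℂ) * k2 σ l α ![x, 0, s] v) + ((b * c : ℝ) : ℂ) * k2 σ l α ![0, s, s] v := by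
    ext v
    simp [k2, bb]
    ring
  have h1 := (hM ![x, 0, 0]).const_mul (a ^ 2 - a * b - a * c)
  have h2 := (hM ![0, s, 0]).const_mul (b ^ 2 - a * b - b * c)
  have h3 := (hM ![0, 0, s]).const_mul (c ^ 2 - a * c - b * c)
  have h4 := (hM ![x, s, 0]).const_mul (a * b)
  have h5 := (hM ![x, 0, s]).const_mul (a * c)
  have h6 := (hM ![0, s, s]).const_mul (b * c)
  simp only [Q2]
  rw [e, Bop_add ((((h1.add h2).add h3).add h4).add h5) h6 hβ hy, Bop_add (((h1.add h2).add h3).add h4) h5 hβ hy,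
    Bop_add ((h1.add h2).add h3) h4 hβ hy, Bop_add (h1.add h2) h3 hβ hy, Bop_add h1 h2 hβ hy]
  simp only [Bop_const_mul]
  simp
  ring

/-! measurability -/

lemma measurable_Bop {k : ℝ → ℂ} (hk : Measurable k) : Measurable (fun y => Bop k y) := by
  unfold Bop
  refine measurable_const.mul (Complex.measurable_re.comp ?_)
  have h : StronglyMeasurable (Function.uncurry fun (y v : ℝ) => Complex.exp (Complex.I * y * Complex.exp (lg v)) * k v * om) := by
    have := measurable_lg
    refine Measurable.stronglyMeasurable ?_
    unfold Function.uncurry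
    fun_prop
  exact (h.integral_prod_right (ν := volume.restrict (Ioi 0))).measurable

lemma measurable_gaussS (σ : ℝ) : Measurable (gaussS σ) := by
  unfold gaussS; fun_prop
lemma measurable_YY (σ : ℝ) : Measurable (YY σ) := by
  unfold YY; fun_prop

lemma measurable_Q1 (σ l α : ℝ) (p : Fin 3 → ℝ) : Measurable (Q1 σ l α p) := by
  have h := (measurable_Bop (measurable_k1 σ l α p)).comp measurable_abs
  have := measurable_gaussS σ
  have := measurable_YY σ
  unfold Q1
  exact Measurable.add (by fun_prop) h
lemma measurable_Q2 (σ l α : ℝ) (p : Fin 3 → ℝ) : Measurable (Q2 σ l α p) := by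
  have h := (measurable_Bop (measurable_k2 σ l α p)).comp measurable_abs
  have := measurable_gaussS σ
  have := measurable_YY σ
  unfold Q2
  exact Measurable.add (by fun_prop) h

/-- joint continuity of `qP` in `(p, y)` -/
lemma continuous_qP (σ l α : ℝ) (hσ : 0 < σ) (hl : 0 ≤ l) :
    Continuous (fun z : (Fin 3 → ℝ) × ℝ => qP σ l α z.1 z.2) := by
  rw [continuous_iff_continuousAt]
  rintro ⟨p₀, y₀⟩
  unfold qP qF
  refine ContinuousAt.mul continuousAt_const ?_
  set s := σ * Real.exp (p₀ 0 - 1) with hs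
  have hs0 : 0 < s := by positivity
  refine continuousAt_of_dominated (bound := fun u => Real.exp (-(s ^ 2 / 2) * u ^ 2)) ?_ ?_ ?_ ?_
  · refine Eventually.of_forall fun z => Measurable.aestronglyMeasurable ?_
    fun_prop
  · have : ∀ᶠ z : (Fin 3 → ℝ) × ℝ in 𝓝 (p₀, y₀), p₀ 0 - 1 < z.1 0 := by
      have hc : Continuous (fun z : (Fin 3 → ℝ) × ℝ => z.1 0) := by fun_prop
      exact hc.continuousAt.eventually (lt_mem_nhds (by simp))
    filter_upwards [this] with z hz
    refine Eventually.of_forall fun u => ?_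
    rw [norm_mul, Real.norm_eq_abs, Real.norm_eq_abs, Real.abs_exp]
    have h1 : 0 ≤ l * Real.exp (z.1 1) * |u| ^ (α + z.1 2) := by positivity
    have h2 : s ≤ σ * Real.exp (z.1 0) := mul_le_mul_of_nonneg_left (Real.exp_le_exp.2 hz.le) hσ.le
    have h3 : s ^ 2 ≤ (σ * Real.exp (z.1 0)) ^ 2 := by gcongr
    calc _ ≤ 1 * Real.exp (-((σ * Real.exp (z.1 0)) ^ 2 * u ^ 2 / 2) - l * Real.exp (z.1 1) * |u| ^ (α + z.1 2)) :=
          mul_le_mul_of_nonneg_right (Real.abs_cos_le_one _) (Real.exp_pos _).le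
      _ ≤ _ := by
          rw [one_mul]; apply Real.exp_le_exp.2
          nlinarith [mul_le_mul_of_nonneg_right h3 (sq_nonneg u)]
  · exact integrable_exp_neg_mul_sq (by positivity)
  · have : ∀ᵐ u : ℝ, u ≠ 0 := by
      simp [ae_iff, measure_singleton]
    filter_upwards [this] with u hu
    have : 0 < |u| := abs_pos.2 hu
    have hc : Continuous (fun z : (Fin 3 → ℝ) × ℝ => |u| ^ (α + z.1 2)) :=
      Continuous.rpow continuous_const (by fun_prop) (fun z => Or.inl this.ne')
    exact Continuous.continuousAt (by fun_prop)

lemma continuous_qF {σ l : ℝ} (α : ℝ) (hσ : 0 < σ) (hl : 0 ≤ l) : Continuous (qF σ l α) := by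
  have h := (continuous_qP σ l α hσ hl).comp (f := fun y : ℝ => ((0 : Fin 3 → ℝ), y)) (by fun_prop)
  convert h using 1
  ext y; simp [qP]

end PartF

section PartG

/-! ### Part G: integrals of densities -/

lemma integrable_Env1 {σ : ℝ} (hσ : 0 < σ) : Integrable (Env1 σ) := by
  have := integrable_exp_neg_mul_sq (b := 7 / 8 / (2 * σ ^ 2)) (by positivity)
  refine this.congr (Eventually.of_forall fun y => ?_)
  simp only [Env1, YY]
  congr 1; ring

lemma integrable_Env2 {α : ℝ} (l : ℝ) (hα : 0 < α) : Integrable (Env2 l α) := by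
  have := (integrable_one_add_norm (E := ℝ) (μ := volume) (r := 1 + 7 * α / 8) (by simp; positivity)).const_mul l
  refine this.congr (Eventually.of_forall fun y => ?_)
  simp only [Env2, Real.norm_eq_abs]
  congr 2; ring

lemma integrable_gaussS {σ : ℝ} (hσ : 0 < σ) : Integrable (gaussS σ) := by
  have := (integrable_exp_neg_mul_sq (b := 1 / (2 * σ ^ 2)) (by positivity)).const_mul ((σ * Real.sqrt (2 * Real.pi))⁻¹)
  refine this.congr (Eventually.of_forall fun y => ?_)
  simp only [gaussS]
  congr 2; ring

lemma Env2_nonneg {l : ℝ} (α : ℝ) (hl : 0 ≤ l) (y : ℝ) : 0 ≤ Env2 l α y := by unfold Env2; positivity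
lemma Env1_nonneg (σ y : ℝ) : 0 ≤ Env1 σ y := (Real.exp_pos _).le

lemma integrable_qP {σ l α : ℝ} (hσ : 0 < σ) (hS : Sm σ l) (hα : 0 < α) (hα2 : α < 2) {p : Fin 3 → ℝ}
    (hp : ∀ i, |p i| ≤ r0 α / 2) : Integrable (qP σ l α p) := by
  have hr := r0_pos hα hα2
  have hrg := p2_range hα hα2 (hp 2)
  have K := kk_KB hσ hS.pos.le hα hα2 hS.h1 hS.h2 (p := p) (fun i => (hp i).trans (by linarith))
  have hMK : 0 ≤ MK σ := by unfold MK; positivity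
  have e : qP σ l α p = fun y => gaussS (σ * Real.exp (p 0)) y + Bop (kk (σ * Real.exp (p 0)) (l * Real.exp (p 1)) (α + p 2)) |y| := by
    ext y
    exact qF_rot' (by positivity) (by have := hS.pos; positivity) hrg.1 hrg.2 y
  rw [e]
  refine (integrable_gaussS (by positivity)).add ?_
  refine Integrable.mono' ((integrable_Env2 (α := α) l hα).const_mul (CB (7 * α / 8) * MK σ)) ?_ ?_
  · exact ((measurable_Bop (measurable_kk _ _ _)).comp measurable_abs).aestronglyMeasurable
  · refine Eventually.of_forall fun y => ?_
    refine (K.Bop_le (by positivity) (by have := hS.pos; positivity) (abs_nonneg y)).trans (le_of_eq ?_)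
    rw [Env2]; ring

open FourierTransform in
lemma integral_qF_of_integrable {σ l α : ℝ} (hσ : 0 < σ) (hl : 0 ≤ l) (hα : 0 < α)
    (hi : Integrable (qF σ l α)) : ∫ y, qF σ l α y = 1 := by
  set g : ℝ → ℝ := fun u => Real.exp (-(σ ^ 2 * u ^ 2 / 2) - l * |u| ^ α) with hg
  have hgc : Continuous g := by
    have := continuous_abs_rpow hα
    rw [hg]; fun_prop
  have hgi : Integrable g := by
    refine Integrable.mono' (integrable_exp_neg_mul_sq (b := σ ^ 2 / 2) (by positivity)) hgc.aestronglyMeasurable ?_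
    refine Eventually.of_forall fun u => ?_
    rw [Real.norm_eq_abs, hg, Real.abs_exp]
    apply Real.exp_le_exp.2
    have : 0 ≤ l * |u| ^ α := by positivity
    linarith
  set f : ℝ → ℂ := fun u => ((g ((2 * Real.pi) * u) : ℝ) : ℂ) with hf
  have hpi : (2 * Real.pi) ≠ 0 := by positivity
  have hfi : Integrable f := (hgi.comp_mul_left' hpi).ofReal
  have hfc : Continuous f := by rw [hf]; fun_prop
  have hF : 𝓕 f = fun w => ((qF σ l α w : ℝ) : ℂ) := by
    ext w
    rw [Real.fourier_real_eq_integral_exp_smul]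
    have e1 : (fun v : ℝ => Complex.exp (((-2 * Real.pi * v * w : ℝ) : ℂ) * Complex.I) • f v) =
        fun v => (fun u : ℝ => ((Real.cos (w * u) * g u : ℝ) : ℂ) - ((Real.sin (w * u) * g u : ℝ) : ℂ) * Complex.I) ((2 * Real.pi) * v) := by
      ext v
      simp only [hf, smul_eq_mul]
      rw [show (((-2 * Real.pi * v * w : ℝ) : ℂ) * Complex.I) = ((-(w * (2 * Real.pi * v)) : ℝ) : ℂ) * Complex.I by push_cast; ring,
        Complex.exp_mul_I, ← Complex.ofReal_cos, ← Complex.ofReal_sin, Real.cos_neg, Real.sin_neg]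
      push_cast; ring
    rw [e1, Measure.integral_comp_mul_left (fun u : ℝ => ((Real.cos (w * u) * g u : ℝ) : ℂ) - ((Real.sin (w * u) * g u : ℝ) : ℂ) * Complex.I) (2 * Real.pi)]
    have i1 : Integrable (fun u : ℝ => Real.cos (w * u) * g u) := by
      refine Integrable.mono' hgi (by fun_prop) (Eventually.of_forall fun u => ?_)
      rw [norm_mul]
      refine (mul_le_mul_of_nonneg_right (Real.abs_cos_le_one _) (norm_nonneg _)).trans ?_
      rw [one_mul, Real.norm_eq_abs, abs_of_pos (Real.exp_pos _)]
    have i2 : Integrable (fun u : ℝ => Real.sin (w * u) * g u) := by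
      refine Integrable.mono' hgi (by fun_prop) (Eventually.of_forall fun u => ?_)
      rw [norm_mul]
      refine (mul_le_mul_of_nonneg_right (Real.abs_sin_le_one _) (norm_nonneg _)).trans ?_
      rw [one_mul, Real.norm_eq_abs, abs_of_pos (Real.exp_pos _)]
    have z : ∫ u : ℝ, Real.sin (w * u) * g u = 0 := by
      have h1 : ∫ u : ℝ, Real.sin (w * -u) * g (-u) = ∫ u : ℝ, Real.sin (w * u) * g u :=
        integral_neg_eq_self (fun u => Real.sin (w * u) * g u) volume
      have h2 : ∫ u : ℝ, Real.sin (w * -u) * g (-u) = -∫ u : ℝ, Real.sin (w * u) * g u := by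
        rw [← integral_neg]
        congr 1; ext u
        simp [hg]
      linarith
    rw [integral_sub i1.ofReal (i2.ofReal.mul_const _), integral_mul_const, integral_complex_ofReal, integral_complex_ofReal, z,
      abs_of_pos (by positivity)]
    simp [qF, hg]
  have hinv := hfi.fourierInv_fourier_eq (v := 0) (by rw [hF]; exact hi.ofReal) hfc.continuousAt
  rw [hF, Real.fourierInv_eq'] at hinv
  simp [integral_complex_ofReal, hf, hg, hα.ne'] at hinv
  exact_mod_cast hinv

lemma integral_qP {σ l α : ℝ} (hσ : 0 < σ) (hS : Sm σ l) (hα : 0 < α) (hα2 : α < 2) {p : Fin 3 → ℝ}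
    (hp : ∀ i, |p i| ≤ r0 α / 2) : ∫ y, qP σ l α p y = 1 := by
  have hrg := p2_range hα hα2 (hp 2)
  exact integral_qF_of_integrable (by positivity) (by have := hS.pos; positivity) hrg.1 (integrable_qP hσ hS hα hα2 hp)

lemma qP_zero (σ l α y : ℝ) : qP σ l α 0 y = qF σ l α y := by simp [qP]

lemma integrable_qF {σ l α : ℝ} (hσ : 0 < σ) (hS : Sm σ l) (hα : 0 < α) (hα2 : α < 2) : Integrable (qF σ l α) := by
  have := integrable_qP hσ hS hα hα2 (p := 0) (by intro i; have := r0_pos hα hα2; simp; positivity)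
  simpa only [show qP σ l α 0 = qF σ l α from funext fun y => qP_zero _ _ _ y] using this

lemma integral_qF {σ l α : ℝ} (hσ : 0 < σ) (hS : Sm σ l) (hα : 0 < α) (hα2 : α < 2) : ∫ y, qF σ l α y = 1 :=
  integral_qF_of_integrable hσ hS.pos.le hα (integrable_qF hσ hS hα hα2)

lemma lin_quad_zero {A B C : ℝ} (h : ∀ t : ℝ, 0 < t → t ≤ 1 → |t * A + (1 / 2) * (t ^ 2 * B)| ≤ C * t ^ 3) : A = 0 ∧ B = 0 := by
  have h1 : ∀ t : ℝ, 0 < t → t ≤ 1 → |A + (1 / 2) * (t * B)| ≤ C * t ^ 2 := by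
    intro t ht ht1
    have := h t ht ht1
    rw [show t * A + (1 / 2) * (t ^ 2 * B) = t * (A + (1 / 2) * (t * B)) by ring, abs_mul, abs_of_pos ht,
      show C * t ^ 3 = t * (C * t ^ 2) by ring] at this
    exact le_of_mul_le_mul_left this ht
  have hev : ∀ᶠ t : ℝ in 𝓝[>] 0, 0 < t ∧ t ≤ 1 := by
    have := Ioc_mem_nhdsGT (zero_lt_one' ℝ)
    filter_upwards [this] with t ht using ⟨ht.1, ht.2⟩
  have hA : A = 0 := by
    have l1 : Tendsto (fun t : ℝ => |A + (1 / 2) * (t * B)|) (𝓝[>] 0) (𝓝 |A|) := by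
      have : Continuous (fun t : ℝ => |A + (1 / 2) * (t * B)|) := by fun_prop
      have := this.tendsto 0
      simp at this
      simpa using this.mono_left nhdsWithin_le_nhds
    have l2 : Tendsto (fun t : ℝ => C * t ^ 2) (𝓝[>] 0) (𝓝 0) := by
      have : Continuous (fun t : ℝ => C * t ^ 2) := by fun_prop
      have := this.tendsto 0
      simp at this
      exact this.mono_left nhdsWithin_le_nhds
    have := le_of_tendsto_of_tendsto l1 l2 (hev.mono fun t ht => h1 t ht.1 ht.2)
    exact abs_eq_zero.1 (le_antisymm this (abs_nonneg _))
  refine ⟨hA, ?_⟩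
  subst hA
  have h2 : ∀ t : ℝ, 0 < t → t ≤ 1 → |B| ≤ 2 * C * t := by
    intro t ht ht1
    have := h1 t ht ht1
    rw [zero_add, abs_mul, abs_mul, abs_of_pos ht, abs_of_pos (by norm_num : (0:ℝ) < 1 / 2)] at this
    have h3 : t * |B| ≤ t * (2 * C * t) := by nlinarith
    exact le_of_mul_le_mul_left h3 ht
  have l2 : Tendsto (fun t : ℝ => 2 * C * t) (𝓝[>] 0) (𝓝 0) := by
    have : Continuous (fun t : ℝ => 2 * C * t) := by fun_prop
    have := this.tendsto 0
    simp at this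
    simpa using this.mono_left nhdsWithin_le_nhds
  have := ge_of_tendsto l2 (hev.mono fun t ht => h2 t ht.1 ht.2)
  exact abs_eq_zero.1 (le_antisymm this (abs_nonneg _))

lemma integrable_Q {σ l α : ℝ} (hσ : 0 < σ) (hS : Sm σ l) (hα : 0 < α) (hα2 : α < 2)
    {p : Fin 3 → ℝ} {x s : ℝ} (hx : 0 < x) (hxs : x ≤ s) (hs2 : s ≤ r0 α / 2)
    (hp0 : |p 0| ≤ x) (hp1 : |p 1| ≤ s) (hp2 : |p 2| ≤ s) :
    Integrable (Q1 σ l α p) ∧ Integrable (Q2 σ l α p) := by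
  have hE := expand hσ hS hα hα2 hx hxs hs2 hp0 hp1 hp2
  have i1 := integrable_Env1 hσ
  have i2 := integrable_Env2 (α := α) l hα
  constructor
  · exact Integrable.mono' (((i1.const_mul x).add (i2.const_mul s)).const_mul (CE σ α)) (measurable_Q1 _ _ _ _).aestronglyMeasurable
      (Eventually.of_forall fun y => (hE y).1)
  · exact Integrable.mono' (((i1.const_mul (x ^ 2)).add (i2.const_mul (s ^ 2))).const_mul (CE σ α)) (measurable_Q2 _ _ _ _).aestronglyMeasurable
      (Eventually.of_forall fun y => (hE y).2.1)

lemma integral_Q {σ l α : ℝ} (hσ : 0 < σ) (hS : Sm σ l) (hα : 0 < α) (hα2 : α < 2)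
    {p : Fin 3 → ℝ} {x s : ℝ} (hx : 0 < x) (hxs : x ≤ s) (hs2 : s ≤ r0 α / 2)
    (hp0 : |p 0| ≤ x) (hp1 : |p 1| ≤ s) (hp2 : |p 2| ≤ s) :
    ∫ y, Q1 σ l α p y = 0 ∧ ∫ y, Q2 σ l α p y = 0 := by
  obtain ⟨j1, j2⟩ := integrable_Q hσ hS hα hα2 hx hxs hs2 hp0 hp1 hp2
  have i1 := integrable_Env1 hσ
  have i2 := integrable_Env2 (α := α) l hα
  have hs0 := hx.trans_le hxs
  refine lin_quad_zero (C := CE σ α * (x ^ 3 * (∫ y, Env1 σ y) + s ^ 3 * ∫ y, Env2 l α y)) fun t ht ht1 => ?_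
  have hb : ∀ {a b : ℝ}, 0 < b → |a| ≤ b → |t * a| ≤ t * b := fun {a b} _ h => by
    rw [abs_mul, abs_of_pos ht]; exact mul_le_mul_of_nonneg_left h ht.le
  have q0 : |(t • p) 0| ≤ t * x := hb hx hp0
  have q1 : |(t • p) 1| ≤ t * s := hb hs0 hp1
  have q2 : |(t • p) 2| ≤ t * s := hb hs0 hp2
  have hts : t * s ≤ r0 α / 2 := (by nlinarith : t * s ≤ s).trans hs2
  have htx : t * x ≤ t * s := by gcongr
  have hE := expand hσ hS hα hα2 (p := t • p) (by positivity) htx hts q0 q1 q2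
  have hq := integrable_qP hσ hS hα hα2 (p := t • p) (by
    intro i; fin_cases i
    · exact (q0.trans htx).trans hts
    · exact q1.trans hts
    · exact q2.trans hts)
  have hqi := integral_qP hσ hS hα hα2 (p := t • p) (by
    intro i; fin_cases i
    · exact (q0.trans htx).trans hts
    · exact q1.trans hts
    · exact q2.trans hts)
  have hF := integrable_qF hσ hS hα hα2
  have hFi := integral_qF hσ hS hα hα2
  have key : ‖∫ y, (qP σ l α (t • p) y - qF σ l α y - t * Q1 σ l α p y - (1 / 2) * (t ^ 2 * Q2 σ l α p y))‖ ≤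
      ∫ y, CE σ α * ((t * x) ^ 3 * Env1 σ y + (t * s) ^ 3 * Env2 l α y) := by
    refine norm_integral_le_of_norm_le (((i1.const_mul _).add (i2.const_mul _)).const_mul _) (Eventually.of_forall fun y => ?_)
    have := (hE y).2.2
    rwa [Q1_smul, Q2_smul] at this
  have a1 : Integrable (fun y => qP σ l α (t • p) y - qF σ l α y) := hq.sub hF
  have a2 : Integrable (fun y => qP σ l α (t • p) y - qF σ l α y - t * Q1 σ l α p y) := a1.sub (j1.const_mul t)
  rw [integral_sub a2 ((j2.const_mul _).const_mul _), integral_sub a1 (j1.const_mul _),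
    integral_sub hq hF, hqi, hFi, integral_const_mul, integral_const_mul, integral_const_mul, integral_const_mul,
    integral_add (i1.const_mul _) (i2.const_mul _), integral_const_mul, integral_const_mul, Real.norm_eq_abs, ← abs_neg] at key
  refine le_trans (le_of_eq ?_) (key.trans (le_of_eq ?_))
  · congr 1; ring
  · ring

end PartG

section PartH

/-! ### Part H: the constants `c_α` -/

def cc (α : ℝ) : ℝ := Bop (fun v => -Complex.exp (α * lg v)) 1
def cd (α : ℝ) : ℝ := Bop (fun v => -(lg v * Complex.exp (α * lg v))) 1

lemma cc_eq {α : ℝ} (hα : 0 < α) : cc α = Real.Gamma (α + 1) * Real.sin (Real.pi * α / 2) / Real.pi := by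
  have hs := s8_pos
  set F : ℂ → ℂ := fun z => Complex.exp (-Complex.exp z + (α + 1 : ℝ) * (z + (Real.pi / 2 : ℝ) * Complex.I)) with hF
  set g : ℝ → ℝ := fun x => Real.exp x ^ (α + 1) * Real.exp (-s8 * Real.exp x) with hg
  have hshift : ∫ x : ℝ, F x = ∫ x : ℝ, F (x + (-(3 * Real.pi / 8) : ℝ) * Complex.I) := by
    refine contour_shift (g := g) ?_ _ ?_ ?_ ?_ ?_
    · rw [hF]; fun_prop
    · refine (integrable_exp_of_Ioi (integrableOn_rpow_exp hα hs)).congr (Eventually.of_forall fun x => ?_)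
      simp only [hg]
      rw [Real.rpow_add (Real.exp_pos x), Real.rpow_one, neg_mul]; ring
    · exact (tendsto_rpow_mul_exp_neg_mul_atTop_nhds_zero (α + 1) s8 hs).comp Real.tendsto_exp_atTop
    · have h1 : Tendsto (fun x : ℝ => Real.exp x ^ (α + 1)) atBot (𝓝 0) := by
        have := Real.tendsto_exp_atBot.rpow_const (p := α + 1) (Or.inr (by positivity))
        rwa [Real.zero_rpow (by positivity)] at this
      refine squeeze_zero (fun x => by simp only [hg]; positivity) (fun x => ?_) h1
      simp only [hg]
      refine mul_le_of_le_one_right (by positivity) (Real.exp_le_one_iff.2 ?_)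
      have := Real.exp_pos x
      nlinarith
    · intro x t ht
      have hpi := Real.pi_pos
      rw [uIcc_of_ge (by linarith)] at ht
      simp only [hF, hg]
      rw [Complex.norm_exp]
      have e1 : (-Complex.exp (x + t * Complex.I) + (α + 1 : ℝ) * (x + t * Complex.I + (Real.pi / 2 : ℝ) * Complex.I)).re
          = -(Real.exp x * Real.cos t) + (α + 1) * x := by
        have := exp_re_mul 1 x t
        simp only [Complex.ofReal_one, one_mul] at this
        rw [Complex.add_re, Complex.neg_re, this, Complex.re_ofReal_mul]
        simp
      rw [e1, Real.exp_add, ← Real.exp_mul, mul_comm (Real.exp (-_)), mul_comm x]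
      refine mul_le_mul_of_nonneg_left (Real.exp_le_exp.2 ?_) (Real.exp_pos _).le
      have hc : s8 ≤ Real.cos t := by
        rw [s8, ← Real.cos_pi_div_two_sub, ← Real.cos_neg t]
        exact Real.cos_le_cos_of_nonneg_of_le_pi (by linarith [ht.2]) (by linarith) (by linarith [ht.1])
      have := mul_le_mul_of_nonneg_left hc (Real.exp_pos x).le
      linarith
  have hL : ∫ x : ℝ, F x = Complex.exp ((α + 1 : ℝ) * ((Real.pi / 2 : ℝ) * Complex.I)) * (Real.Gamma (α + 1) : ℂ) := by
    rw [Real.Gamma_eq_integral (by positivity), ← integral_complex_ofReal, integral_Ioi_eq_exp, ← integral_const_mul]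
    congr 1; ext x
    simp only [hF]
    rw [mul_add, ← add_assoc, Complex.exp_add, mul_comm, add_sub_cancel_right]
    congr 1
    rw [← Real.exp_mul, ← Real.exp_add, ← Complex.ofReal_exp, ← Complex.ofReal_mul, ← Complex.ofReal_neg,
      ← Complex.ofReal_add, ← Complex.ofReal_exp, ← Complex.ofReal_mul, ← Real.exp_add]
    congr 2; ring
  have hR : ∫ v in Ioi (0:ℝ), Complex.exp (Complex.I * (1 : ℝ) * Complex.exp (lg v)) * (-Complex.exp (α * lg v)) * om
      = -∫ x : ℝ, F (x + (-(3 * Real.pi / 8) : ℝ) * Complex.I) := by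
    rw [integral_Ioi_eq_exp, ← integral_neg]
    congr 1; ext x
    have e0 : lg (Real.exp x) = x + (Real.pi / 8 : ℝ) * Complex.I := by rw [lg, Real.log_exp]
    have e1 : Complex.exp (x + (-(3 * Real.pi / 8) : ℝ) * Complex.I) = -(Complex.I * Complex.exp (lg (Real.exp x))) := by
      rw [e0, show ((x : ℂ) + (-(3 * Real.pi / 8) : ℝ) * Complex.I) = (x + (Real.pi / 8 : ℝ) * Complex.I) + -((Real.pi / 2 : ℂ) * Complex.I) by
        push_cast; ring, Complex.exp_add, Complex.exp_neg, Complex.exp_pi_div_two_mul_I, Complex.inv_I]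
      ring
    simp only [hF]
    rw [Complex.exp_add (-_), e1, neg_neg, om, e0]
    have e3 : Complex.exp (((α + 1 : ℝ) : ℂ) * (x + (-(3 * Real.pi / 8) : ℝ) * Complex.I + (Real.pi / 2 : ℝ) * Complex.I))
      = Complex.exp x * Complex.exp (α * (x + (Real.pi / 8 : ℝ) * Complex.I)) * Complex.exp ((Real.pi / 8 : ℝ) * Complex.I) := by
      rw [← Complex.exp_add, ← Complex.exp_add]; congr 1; push_cast; ring
    rw [e3, Complex.ofReal_exp]
    simp only [Complex.ofReal_one, mul_one]
    ring
  rw [cc, Bop, hR, ← hshift, hL]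
  rw [← mul_assoc, ← Complex.ofReal_mul, Complex.neg_re, Complex.re_mul_ofReal, Complex.exp_ofReal_mul_I_re]
  rw [show (α + 1) * (Real.pi / 2) = Real.pi * α / 2 + Real.pi / 2 by ring, Real.cos_add_pi_div_two]
  ring

lemma cc_pos {α : ℝ} (hα : 0 < α) (hα2 : α < 2) : 0 < cc α := by
  rw [cc_eq hα]
  have h1 := Real.Gamma_pos_of_pos (s := α + 1) (by linarith)
  have hpi := Real.pi_pos
  have h2 : 0 < Real.sin (Real.pi * α / 2) := Real.sin_pos_of_pos_of_lt_pi (by positivity) (by nlinarith)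
  positivity

lemma cAlpha_eq {α : ℝ} (hα : 0 < α) (hα2 : α < 2) : cAlpha α = cc α := by
  rw [cc_eq hα, cAlpha]
  have hpi := Real.pi_pos
  split_ifs with h
  · subst h
    norm_num [Real.Gamma_two]
  · have hg : Real.Gamma (α - 1) * Real.Gamma (2 - α) = Real.pi / Real.sin (Real.pi * (α - 1)) := by
      have := Real.Gamma_mul_Gamma_one_sub (α - 1)
      rwa [show 1 - (α - 1) = 2 - α by ring] at this
    have hs : Real.sin (Real.pi * (α - 1)) = -(2 * Real.sin (Real.pi * α / 2) * Real.cos (Real.pi * α / 2)) := by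
      rw [show Real.pi * (α - 1) = 2 * (Real.pi * α / 2) - Real.pi by ring, Real.sin_sub_pi, Real.sin_two_mul]
    have h1 : α - 1 ≠ 0 := sub_ne_zero.2 h
    have hG1 : Real.Gamma (α + 1) = α * ((α - 1) * Real.Gamma (α - 1)) := by
      rw [Real.Gamma_add_one hα.ne', ← Real.Gamma_add_one h1, sub_add_cancel]
    have hG2 : 0 < Real.Gamma (2 - α) := Real.Gamma_pos_of_pos (by linarith)
    have h2 : 0 < Real.sin (Real.pi * α / 2) := Real.sin_pos_of_pos_of_lt_pi (by positivity) (by nlinarith)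
    have h3 : Real.cos (Real.pi * α / 2) ≠ 0 := by
      intro h0
      rw [Real.cos_eq_zero_iff] at h0
      obtain ⟨k, hk⟩ := h0
      have hk' : α = 2 * k + 1 := by
        have : Real.pi * α = Real.pi * (2 * k + 1) := by linarith
        exact mul_left_cancel₀ hpi.ne' this
      have a1 : (-1 : ℝ) < k := by linarith
      have a2 : (k : ℝ) < 1 := by linarith
      have a3 : (-1 : ℤ) < k := by exact_mod_cast a1
      have a4 : k < (1 : ℤ) := by exact_mod_cast a2
      have : k = 0 := by omega
      subst this; simp at hk'; exact h hk'
    have hG3 : Real.Gamma (α - 1) = Real.pi / (-(2 * Real.sin (Real.pi * α / 2) * Real.cos (Real.pi * α / 2))) / Real.Gamma (2 - α) := by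
      rw [← hs, ← hg]; field_simp
    rw [hG1, hG3]
    generalize Real.sin (Real.pi * α / 2) = S at *
    generalize Real.cos (Real.pi * α / 2) = C at *
    field_simp

lemma abs_log_le {w ε : ℝ} (hw : 0 < w) (hε : 0 < ε) : |Real.log w| ≤ (w ^ ε + w ^ (-ε)) / ε := by
  have h1 := Real.log_le_rpow_div hw.le hε
  have h2 := Real.log_le_rpow_div (inv_pos.2 hw).le hε
  rw [Real.log_inv, Real.inv_rpow hw.le, ← Real.rpow_neg hw.le] at h2
  have h3 : 0 ≤ w ^ ε / ε := by positivity
  have h4 : 0 ≤ w ^ (-ε) / ε := by positivity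
  rw [add_div]
  exact abs_le.2 ⟨by linarith, by linarith⟩

lemma integrableOn_log_rpow_exp {β r : ℝ} (hβ : 0 < β) (hr : 0 < r) :
    IntegrableOn (fun v : ℝ => (|Real.log v| + 1) * v ^ β * Real.exp (-(r * v))) (Ioi 0) := by
  have hε : 0 < β / 2 := by positivity
  have i1 := (integrableOn_rpow_exp (β := β + β / 2) (by positivity) hr).const_mul (β / 2)⁻¹
  have i2 := (integrableOn_rpow_exp (β := β + -(β / 2)) (by linarith) hr).const_mul (β / 2)⁻¹
  have i3 := integrableOn_rpow_exp hβ hr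
  refine Integrable.mono' ((i1.add i2).add i3) ?_ ?_
  · exact Measurable.aestronglyMeasurable (by fun_prop)
  · refine (ae_restrict_iff' measurableSet_Ioi).2 (Eventually.of_forall fun v (hv : 0 < v) => ?_)
    rw [Real.norm_of_nonneg (by positivity)]
    simp only [Pi.add_apply]
    rw [Real.rpow_add hv, Real.rpow_add hv]
    have := mul_le_mul_of_nonneg_right (abs_log_le hv hε) (by positivity : 0 ≤ v ^ β * Real.exp (-(r * v)))
    calc _ = |Real.log v| * (v ^ β * Real.exp (-(r * v))) + v ^ β * Real.exp (-(r * v)) := by ring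
      _ ≤ (v ^ (β / 2) + v ^ (-(β / 2))) / (β / 2) * (v ^ β * Real.exp (-(r * v))) + v ^ β * Real.exp (-(r * v)) := by linarith
      _ = _ := by field_simp

lemma cc_hasDerivAt {α : ℝ} (hα : 0 < α) : HasDerivAt cc (cd α) α := by
  have hs := s8_pos
  have hml := measurable_lg
  have hmeas : ∀ a : ℝ, Measurable fun v : ℝ => Complex.exp (Complex.I * (1:ℝ) * Complex.exp (lg v)) * (-Complex.exp (a * lg v)) * om := by
    intro a; fun_prop
  have key := hasDerivAt_integral_of_dominated_loc_of_deriv_le (μ := volume.restrict (Ioi (0:ℝ))) (𝕜 := ℝ)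
    (F := fun a v => Complex.exp (Complex.I * (1:ℝ) * Complex.exp (lg v)) * (-Complex.exp (a * lg v)) * om)
    (F' := fun a v => Complex.exp (Complex.I * (1:ℝ) * Complex.exp (lg v)) * (-(lg v * Complex.exp (a * lg v))) * om)
    (x₀ := α) (s := Ioo (α / 2) (2 * α))
    (bound := fun v => (|Real.log v| + 1) * v ^ (α / 2) * Real.exp (-(s8 * v)) + (|Real.log v| + 1) * v ^ (2 * α) * Real.exp (-(s8 * v)))
    (Ioo_mem_nhds (by linarith) (by linarith)) (Eventually.of_forall fun a => (hmeas a).aestronglyMeasurable) ?_ ?_ ?_ ?_ ?_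
  · have h2 := key.2
    have hc := (Complex.reCLM.hasFDerivAt (x := ∫ v in Ioi (0:ℝ), Complex.exp (Complex.I * (1:ℝ) * Complex.exp (lg v)) * (-Complex.exp (α * lg v)) * om)).comp_hasDerivAt α h2
    exact hc.const_mul Real.pi⁻¹
  · refine Bop_integrable (k := fun v => -Complex.exp (α * lg v)) (by fun_prop) (g := fun v => v ^ α) ?_ ?_
    · refine (integrableOn_rpow_exp hα hs).congr (Eventually.of_forall fun v => ?_)
      simp only [one_mul]; ring
    · intro v hv; rw [norm_neg, norm_exp_mul_lg hv]
  · exact Measurable.aestronglyMeasurable (by fun_prop)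
  · refine (ae_restrict_iff' measurableSet_Ioi).2 (Eventually.of_forall fun v (hv : 0 < v) a ha => ?_)
    rw [norm_mul, norm_mul, norm_om, mul_one, norm_osc hv, norm_neg, norm_mul, norm_exp_mul_lg hv, one_mul]
    have h1 : v ^ a ≤ v ^ (α / 2) + v ^ (2 * α) := by
      rcases le_total v 1 with h | h
      · have := Real.rpow_le_rpow_of_exponent_ge hv h ha.1.le
        have : 0 ≤ v ^ (2 * α) := by positivity
        linarith
      · have := Real.rpow_le_rpow_of_exponent_le h ha.2.le
        have : 0 ≤ v ^ (α / 2) := by positivity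
        linarith
    have h2 := mul_le_mul (norm_lg_le v) h1 (by positivity) (by positivity)
    have h3 := mul_le_mul_of_nonneg_left h2 (Real.exp_pos (-(s8 * v))).le
    refine h3.trans (le_of_eq ?_)
    ring
  · exact (integrableOn_log_rpow_exp (by positivity) hs).add (integrableOn_log_rpow_exp (by positivity) hs)
  · refine Eventually.of_forall fun v a _ => ?_
    have h1 : HasDerivAt (fun a : ℝ => (a : ℂ) * lg v) (lg v) a := by
      simpa using (Complex.ofRealCLM.hasDerivAt (x := a)).mul_const (lg v)
    have h2 := ((h1.cexp.neg).const_mul (Complex.exp (Complex.I * (1:ℝ) * Complex.exp (lg v)))).mul_const om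
    convert! h2 using 1
    ring

lemma deriv_cAlpha {α : ℝ} (hα : 0 < α) (hα2 : α < 2) : deriv cAlpha α = cd α := by
  have : cAlpha =ᶠ[𝓝 α] cc := by
    filter_upwards [Ioo_mem_nhds hα hα2] with a ha using cAlpha_eq ha.1 ha.2
  rw [this.deriv_eq, (cc_hasDerivAt hα).deriv]

end PartH

section PartI

/-! ### Part I: tail asymptotics -/

lemma lg_mul {y v : ℝ} (hy : 0 < y) (hv : 0 < v) : lg (y * v) = lg v + Real.log y := by
  rw [lg, lg, Real.log_mul hy.ne' hv.ne']; push_cast; ring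

lemma Bop_congr {k k' : ℝ → ℂ} (h : ∀ v, 0 < v → k v = k' v) (y : ℝ) : Bop k y = Bop k' y := by
  unfold Bop
  congr 2
  refine setIntegral_congr_fun measurableSet_Ioi fun v hv => ?_
  have hv' : 0 < v := hv
  show _ * k v * om = _ * k' v * om
  rw [h v hv']

lemma Bop_scale (k : ℝ → ℂ) {y : ℝ} (hy : 0 < y) : Bop (fun v => k (y * v)) y = y⁻¹ * Bop k 1 := by
  unfold Bop
  have h1 := integral_comp_mul_left_Ioi (fun w : ℝ => Complex.exp (Complex.I * (1 : ℝ) * Complex.exp (lg w)) * k w * om) 0 hy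
  rw [mul_zero] at h1
  have h2 : ∫ v in Ioi (0:ℝ), Complex.exp (Complex.I * y * Complex.exp (lg v)) * k (y * v) * om =
      ∫ v in Ioi (0:ℝ), Complex.exp (Complex.I * (1 : ℝ) * Complex.exp (lg (y * v))) * k (y * v) * om := by
    refine setIntegral_congr_fun measurableSet_Ioi fun v (hv : 0 < v) => ?_
    rw [lg_mul hy hv, Complex.exp_add, ← Complex.ofReal_exp, Real.exp_log hy]
    congr 3; push_cast; ring
  rw [h2, h1, Complex.smul_re, smul_eq_mul]
  ring

lemma Bop_le_scale {k : ℝ → ℂ} {g : ℝ → ℝ} {y : ℝ} (hy : 0 < y)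
    (hg : IntegrableOn (fun w => Real.exp (-(s8 * w)) * g w) (Ioi 0))
    (hb : ∀ v, 0 < v → ‖k v‖ ≤ g (y * v)) :
    |Bop k y| ≤ y⁻¹ * ∫ w in Ioi (0:ℝ), Real.exp (-(s8 * w)) * g w := by
  have h0 := (integrableOn_Ioi_comp_mul_left_iff (fun w => Real.exp (-(s8 * w)) * g w) 0 hy).2 (by simpa using hg)
  have e : ∀ v, Real.exp (-(s8 * (y * v))) * g (y * v) = Real.exp (-(y * (s8 * v))) * g (y * v) := by
    intro v; congr 2; ring
  simp only [e] at h0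
  refine (Bop_le h0 hb).trans (le_of_eq ?_)
  have h1 := integral_comp_mul_left_Ioi (fun w => Real.exp (-(s8 * w)) * g w) 0 hy
  simp only [e, mul_zero, smul_eq_mul] at h1
  exact h1

lemma Bop_integrable_scale {k : ℝ → ℂ} (hk : Measurable k) {g : ℝ → ℝ} {y : ℝ} (hy : 0 < y)
    (hg : IntegrableOn (fun w => Real.exp (-(s8 * w)) * g w) (Ioi 0))
    (hb : ∀ v, 0 < v → ‖k v‖ ≤ g (y * v)) :
    IntegrableOn (fun v : ℝ => Complex.exp (Complex.I * y * Complex.exp (lg v)) * k v * om) (Ioi 0) := by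
  have h0 := (integrableOn_Ioi_comp_mul_left_iff (fun w => Real.exp (-(s8 * w)) * g w) 0 hy).2 (by simpa using hg)
  have e : ∀ v, Real.exp (-(s8 * (y * v))) * g (y * v) = Real.exp (-(y * (s8 * v))) * g (y * v) := by
    intro v; congr 2; ring
  simp only [e] at h0
  exact Bop_integrable hk h0 hb

lemma Bop_add' {k k' : ℝ → ℂ} {y : ℝ}
    (h : IntegrableOn (fun v : ℝ => Complex.exp (Complex.I * y * Complex.exp (lg v)) * k v * om) (Ioi 0))
    (h' : IntegrableOn (fun v : ℝ => Complex.exp (Complex.I * y * Complex.exp (lg v)) * k' v * om) (Ioi 0)) :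
    Bop (fun v => k v + k' v) y = Bop k y + Bop k' y := by
  unfold Bop
  rw [← mul_add, ← Complex.add_re, ← integral_add h h']
  congr 3; ext v; ring

def JJ (β : ℝ) : ℝ := ∫ w in Ioi (0:ℝ), (|Real.log w| + 1) * w ^ β * Real.exp (-(s8 * w))

lemma JJ_nonneg (β : ℝ) : 0 ≤ JJ β := setIntegral_nonneg measurableSet_Ioi fun v (hv : 0 < v) => by positivity

def CA (σ α : ℝ) : ℝ := JJ (2 * α) + σ ^ 2 / 2 * JJ (α + 2)

lemma CA_nonneg (σ α : ℝ) : 0 ≤ CA σ α := by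
  have := JJ_nonneg (2 * α)
  have := JJ_nonneg (α + 2)
  unfold CA; positivity

/-- generic tail estimate -/
lemma tail_generic {σ l α : ℝ} (hl : 0 < l) (hα : 0 < α) {y : ℝ} (hy : 0 < y)
    {k K : ℝ → ℂ} (hk : Measurable k) (hK : Measurable K)
    (hKb : ∀ w, 0 < w → ‖K w‖ ≤ (|Real.log w| + 1) * w ^ α)
    (hb : ∀ v, 0 < v → ‖k v - l * (y ^ (-α) : ℝ) * K (y * v)‖ ≤
      (|Real.log (y * v)| + 1) * (l * v ^ α * (σ ^ 2 / 2 * v ^ 2 + l * v ^ α))) :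
    |Bop k y - l * Bop K 1 * y ^ (-1 - α)| ≤ CA σ α * (l * y ^ (-1 - α) * (l * y ^ (-α) + y ^ (-2 : ℝ))) := by
  have hs := s8_pos
  set g : ℝ → ℝ := fun w => (l ^ 2 * y ^ (-(2 * α))) * ((|Real.log w| + 1) * w ^ (2 * α)) +
    (l * (σ ^ 2 / 2) * y ^ (-(α + 2))) * ((|Real.log w| + 1) * w ^ (α + 2)) with hg
  have i1 := integrableOn_log_rpow_exp (β := 2 * α) (by positivity) hs
  have i2 := integrableOn_log_rpow_exp (β := α + 2) (by positivity) hs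
  have i3 := integrableOn_log_rpow_exp (β := α) (by positivity) hs
  have ge : (fun w => Real.exp (-(s8 * w)) * g w) = fun w => (l ^ 2 * y ^ (-(2 * α))) * ((|Real.log w| + 1) * w ^ (2 * α) * Real.exp (-(s8 * w))) +
    (l * (σ ^ 2 / 2) * y ^ (-(α + 2))) * ((|Real.log w| + 1) * w ^ (α + 2) * Real.exp (-(s8 * w))) := by
    ext w; simp only [hg]; ring
  have hgi : IntegrableOn (fun w => Real.exp (-(s8 * w)) * g w) (Ioi 0) := by
    rw [ge]; exact (i1.const_mul _).add (i2.const_mul _)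
  set c : ℝ := l * y ^ (-α) with hc
  have hc' : ((l : ℂ) * (y ^ (-α) : ℝ)) = (c : ℂ) := by rw [hc]; push_cast; ring
  simp only [hc'] at hb
  have hb' : ∀ v, 0 < v → ‖k v - c * K (y * v)‖ ≤ g (y * v) := by
    intro v hv
    refine (hb v hv).trans (le_of_eq ?_)
    simp only [hg]
    rw [Real.mul_rpow hy.le hv.le, Real.mul_rpow hy.le hv.le, Real.rpow_neg hy.le, Real.rpow_neg hy.le]
    have h1 : v ^ (2 * α) = v ^ α * v ^ α := by rw [← Real.rpow_add hv]; congr 1; ring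
    have h2 : v ^ (α + 2) = v ^ α * v ^ 2 := by rw [Real.rpow_add hv]; norm_num
    rw [h1, h2]
    field_simp
    ring
  have hKm : Measurable (fun v => (c : ℂ) * K (y * v)) := by fun_prop
  have I1 := Bop_integrable_scale (k := fun v => k v - c * K (y * v)) (hk.sub hKm) hy hgi hb'
  have I2 : IntegrableOn (fun v : ℝ => Complex.exp (Complex.I * y * Complex.exp (lg v)) * (c * K (y * v)) * om) (Ioi 0) := by
    refine Bop_integrable_scale (g := fun w => |c| * ((|Real.log w| + 1) * w ^ α)) hKm hy ?_ ?_
    · refine (i3.const_mul |c|).congr (Eventually.of_forall fun v => ?_)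
      simp only; ring
    · intro v hv
      rw [norm_mul, Complex.norm_real, Real.norm_eq_abs]
      exact mul_le_mul_of_nonneg_left (hKb _ (by positivity)) (abs_nonneg _)
  have e1 : Bop k y = Bop (fun v => k v - c * K (y * v)) y + Bop (fun v => c * K (y * v)) y := by
    rw [← Bop_add' I1 I2]; congr 1; ext v; ring
  have e2 : Bop (fun v => c * K (y * v)) y = l * Bop K 1 * y ^ (-1 - α) := by
    rw [Bop_const_mul, Bop_scale K hy, hc, Real.rpow_sub hy, Real.rpow_neg hy.le, Real.rpow_neg hy.le, Real.rpow_one]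
    field_simp
  rw [e1, e2, add_sub_cancel_right]
  refine (Bop_le_scale hy hgi hb').trans ?_
  rw [ge, integral_add (i1.const_mul _) (i2.const_mul _), integral_const_mul, integral_const_mul]
  change y⁻¹ * (l ^ 2 * y ^ (-(2 * α)) * JJ (2 * α) + l * (σ ^ 2 / 2) * y ^ (-(α + 2)) * JJ (α + 2)) ≤ _
  have j1 := JJ_nonneg (2 * α)
  have j2 := JJ_nonneg (α + 2)
  have p1 : y⁻¹ * y ^ (-(2 * α)) = y ^ (-1 - α) * y ^ (-α) := by
    rw [← Real.rpow_neg_one, ← Real.rpow_add hy, ← Real.rpow_add hy]; congr 1; ring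
  have p2 : y⁻¹ * y ^ (-(α + 2)) = y ^ (-1 - α) * y ^ (-2 : ℝ) := by
    rw [← Real.rpow_neg_one, ← Real.rpow_add hy, ← Real.rpow_add hy]; congr 1; ring
  have q1 : 0 ≤ l * y ^ (-1 - α) * (l * y ^ (-α)) := by positivity
  have q2 : 0 ≤ l * y ^ (-1 - α) * y ^ (-2 : ℝ) := by positivity
  calc _ = l ^ 2 * (y⁻¹ * y ^ (-(2 * α))) * JJ (2 * α) + l * (σ ^ 2 / 2) * (y⁻¹ * y ^ (-(α + 2))) * JJ (α + 2) := by ring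
    _ = JJ (2 * α) * (l * y ^ (-1 - α) * (l * y ^ (-α))) + σ ^ 2 / 2 * JJ (α + 2) * (l * y ^ (-1 - α) * y ^ (-2 : ℝ)) := by
        rw [p1, p2]; ring
    _ ≤ _ := by
        rw [CA]
        have r1 : 0 ≤ σ ^ 2 / 2 * JJ (α + 2) := by positivity
        nlinarith [mul_nonneg r1 q1, mul_nonneg j1 q2]

lemma WW_scale {l α y v : ℝ} (hy : 0 < y) (hv : 0 < v) :
    WW l α v = l * (y ^ (-α) : ℝ) * Complex.exp (α * lg (y * v)) := by
  have h1 : Complex.exp ((α : ℂ) * (Real.log y : ℂ)) = ((y ^ α : ℝ) : ℂ) := by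
    rw [← Complex.ofReal_mul, ← Complex.ofReal_exp, mul_comm, ← Real.rpow_def_of_pos hy]
  have h2 : ((y ^ (-α) : ℝ) : ℂ) * ((y ^ α : ℝ) : ℂ) = 1 := by
    rw [← Complex.ofReal_mul, ← Real.rpow_add hy]; simp
  rw [WW, lg_mul hy hv, mul_add, Complex.exp_add, h1]
  linear_combination (-(l : ℂ) * Complex.exp (α * lg v)) * h2

lemma kk_add_WW {σ l α v : ℝ} (hl : 0 < l) (hα : 0 < α) (hα2 : α < 2) (hv : 0 < v) :
    ‖kk σ l α v + WW l α v‖ ≤ l * v ^ α * (σ ^ 2 / 2 * v ^ 2 + l * v ^ α) := by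
  have hX : 0 ≤ (XX σ v).re := by rw [XX_re hv]; positivity
  have hW := WW_re_nonneg (v := v) hl.le hα hα2
  have e : kk σ l α v + WW l α v = Complex.exp (-XX σ v) * (Complex.exp (-WW l α v) - 1 + WW l α v)
      - WW l α v * (Complex.exp (-XX σ v) - 1) := by simp only [kk, XX, WW]; ring
  rw [e]
  refine (norm_sub_le _ _).trans ?_
  rw [norm_mul, norm_mul]
  have h1 : ‖Complex.exp (-XX σ v)‖ ≤ 1 := by
    rw [Complex.norm_exp, Complex.neg_re]; exact Real.exp_le_one_iff.2 (by linarith)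
  have h2 := norm_exp_neg_sub_one_add_le hW
  have h3 := norm_exp_neg_sub_one_le hX
  rw [norm_WW hl.le hv] at *
  rw [norm_XX hv] at h3
  have h4 := mul_le_mul h1 h2 (norm_nonneg _) zero_le_one
  have h5 := mul_le_mul_of_nonneg_left h3 (by positivity : 0 ≤ l * v ^ α)
  nlinarith

lemma Tb_add_WW {σ l α v : ℝ} (hl : 0 < l) (hα : 0 < α) (hα2 : α < 2) (hv : 0 < v) :
    ‖Tb σ l α v + WW l α v‖ ≤ l * v ^ α * (σ ^ 2 / 2 * v ^ 2 + l * v ^ α) := by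
  have hX : 0 ≤ (XX σ v).re := by rw [XX_re hv]; positivity
  have hW := WW_re_nonneg (v := v) hl.le hα hα2
  have e : Tb σ l α v + WW l α v = -(WW l α v * (Complex.exp (-(XX σ v + WW l α v)) - 1)) := by
    rw [neg_add, Complex.exp_add, Tb]; ring
  rw [e, norm_neg, norm_mul, norm_WW hl.le hv]
  refine mul_le_mul_of_nonneg_left ?_ (by positivity)
  refine (norm_exp_neg_sub_one_le (by rw [Complex.add_re]; linarith)).trans ((norm_add_le _ _).trans ?_)
  rw [norm_WW hl.le hv, norm_XX hv]

/-- tail asymptotics of the density and of the scores -/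
lemma tails {σ l α : ℝ} (hσ : 0 < σ) (hS : Sm σ l) (hα : 0 < α) (hα2 : α < 2) {y : ℝ} (hy : 0 < y) :
    |Bop (kk σ l α) y - l * cc α * y ^ (-1 - α)| ≤ CA σ α * (l * y ^ (-1 - α) * (l * y ^ (-α) + y ^ (-2 : ℝ))) ∧
    |Q1 σ l α ![0, 1, 0] y - l * cc α * y ^ (-1 - α)| ≤ CA σ α * (l * y ^ (-1 - α) * (l * y ^ (-α) + y ^ (-2 : ℝ))) ∧
    |Q1 σ l α ![0, 0, 1] y + Real.log y * Q1 σ l α ![0, 1, 0] y - l * cd α * y ^ (-1 - α)| ≤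
      CA σ α * (l * y ^ (-1 - α) * (l * y ^ (-α) + y ^ (-2 : ℝ))) := by
  have hl := hS.pos
  have hml := measurable_lg
  have one_le : ∀ w : ℝ, 1 ≤ |Real.log w| + 1 := fun w => by linarith [abs_nonneg (Real.log w)]
  have E0 : Measurable (fun w => -Complex.exp (α * lg w)) := by fun_prop
  have E0b : ∀ w, 0 < w → ‖-Complex.exp (α * lg w)‖ ≤ (|Real.log w| + 1) * w ^ α := by
    intro w hw
    rw [norm_neg, norm_exp_mul_lg hw]
    exact le_mul_of_one_le_left (by positivity) (one_le w)
  have hk1 : k1 σ l α ![0, 1, 0] = Tb σ l α := by ext v; simp [k1, bb]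
  have hk2 : k1 σ l α ![0, 0, 1] = fun v => lg v * Tb σ l α v := by ext v; simp [k1, bb]
  have hTm : Measurable (Tb σ l α) := by rw [← hk1]; exact measurable_k1 _ _ _ _
  have hQ1 : Q1 σ l α ![0, 1, 0] y = Bop (Tb σ l α) y := by simp [Q1, hk1, abs_of_pos hy]
  have hQ2 : Q1 σ l α ![0, 0, 1] y = Bop (fun v => lg v * Tb σ l α v) y := by simp [Q1, hk2, abs_of_pos hy]
  refine ⟨?_, ?_, ?_⟩
  · refine tail_generic hl hα hy (measurable_kk _ _ _) E0 E0b fun v hv => ?_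
    rw [mul_neg, ← WW_scale hy hv, sub_neg_eq_add]
    exact (kk_add_WW hl hα hα2 hv).trans (le_mul_of_one_le_left (by positivity) (one_le _))
  · rw [hQ1]
    refine tail_generic hl hα hy hTm E0 E0b fun v hv => ?_
    rw [mul_neg, ← WW_scale hy hv, sub_neg_eq_add]
    exact (Tb_add_WW hl hα hα2 hv).trans (le_mul_of_one_le_left (by positivity) (one_le _))
  · have e : Q1 σ l α ![0, 0, 1] y + Real.log y * Q1 σ l α ![0, 1, 0] y = Bop (fun v => (lg v + Real.log y) * Tb σ l α v) y := by
      rw [hQ1, hQ2]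
      obtain ⟨M, hM⟩ := (k12_KB hσ hS hα hα2 ![0, 0, 1]).1
      obtain ⟨M', hM'⟩ := (k12_KB hσ hS hα hα2 ![0, 1, 0]).1
      rw [hk2] at hM
      rw [hk1] at hM'
      have := Bop_add hM (hM'.const_mul (Real.log y)) (by positivity) hy.le
      rw [Bop_const_mul] at this
      rw [← this]
      congr 1; ext v; ring
    rw [e]
    refine tail_generic (K := fun w => -(lg w * Complex.exp (α * lg w))) hl hα hy (by fun_prop) (by fun_prop) ?_ fun v hv => ?_
    · intro w hw
      rw [norm_neg, norm_mul, norm_exp_mul_lg hw]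
      exact mul_le_mul_of_nonneg_right (norm_lg_le w) (by positivity)
    · have : (lg v + Real.log y) * Tb σ l α v - l * (y ^ (-α) : ℝ) * -(lg (y * v) * Complex.exp (α * lg (y * v)))
         = lg (y * v) * (Tb σ l α v + WW l α v) := by
        rw [WW_scale hy hv, ← lg_mul hy hv]; ring
      rw [this, norm_mul]
      exact mul_le_mul (norm_lg_le _) (Tb_add_WW hl hα hα2 hv) (norm_nonneg _) (by positivity)

end PartI

section PartJ

/-! ### Part J: lower bound on the density and moment bounds -/

structure LB (σ α c l : ℝ) : Prop where
  sm : Sm σ l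
  cpos : 0 < c
  lb : ∀ y, c * (Real.exp (-YY σ y) + l * (1 + |y|) ^ (-1 - α)) ≤ qF σ l α y

lemma exists_LB {σ α : ℝ} (hσ : 0 < σ) (hα : 0 < α) (hα2 : α < 2) :
    ∃ c l1 : ℝ, 0 < l1 ∧ ∀ l, 0 < l → l ≤ l1 → LB σ α c l := by
  have hcc := cc_pos hα hα2
  have hCA := CA_nonneg σ α
  have hCB := CB_pos (β := 7 * α / 8) (by positivity)
  have hMK : 0 ≤ MK σ := by unfold MK; positivity
  set g := (σ * Real.sqrt (2 * Real.pi))⁻¹ with hg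
  have hgp : 0 < g := by positivity
  -- threshold
  obtain ⟨Y, hY1, hY2⟩ : ∃ Y : ℝ, 1 ≤ Y ∧ CA σ α * Y ^ (-2 : ℝ) ≤ cc α / 4 := by
    refine ⟨1 + 4 * CA σ α / cc α, by have : 0 ≤ 4 * CA σ α / cc α := by positivity
                                      linarith, ?_⟩
    set Y := 1 + 4 * CA σ α / cc α with hYd
    have hY : 1 ≤ Y := by have : 0 ≤ 4 * CA σ α / cc α := by positivity
                          linarith
    have h1 : 4 * CA σ α / cc α ≤ Y := by linarith
    have h2 : Y ^ (-2 : ℝ) ≤ Y⁻¹ := by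
      rw [← Real.rpow_neg_one]; exact Real.rpow_le_rpow_of_exponent_le hY (by norm_num)
    have h3 : 4 * CA σ α ≤ Y * cc α := by rwa [div_le_iff₀ hcc] at h1
    have hYp : 0 < Y := by linarith
    calc CA σ α * Y ^ (-2 : ℝ) ≤ CA σ α * Y⁻¹ := mul_le_mul_of_nonneg_left h2 hCA
      _ ≤ _ := by rw [← div_eq_mul_inv, div_le_iff₀ hYp]; linarith
  set g0 := g * Real.exp (-YY σ Y) with hg0
  have hg0p : 0 < g0 := by positivity
  set K := CB (7 * α / 8) * MK σ with hK
  have hK0 : 0 ≤ K := by positivity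
  refine ⟨min (g / 4) (min (cc α / 2) (1 / 4)), min (min (1 / 8) (σ ^ 2 / 64)) (min (cc α / (4 * (CA σ α + 1))) (min (g0 / (2 * (K + 1))) g0)), by positivity, ?_⟩
  intro l hl hle
  simp only [le_min_iff] at hle
  obtain ⟨⟨a1, a2⟩, a3, a4, a5⟩ := hle
  have hS : Sm σ l := ⟨hl, by linarith, by linarith⟩
  refine ⟨hS, by positivity, fun y => ?_⟩
  set c := min (g / 4) (min (cc α / 2) (1 / 4)) with hc
  have c1 : c ≤ g / 4 := min_le_left _ _
  have c2 : c ≤ cc α / 2 := (min_le_right _ _).trans (min_le_left _ _)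
  have c3 : c ≤ 1 / 4 := (min_le_right _ _).trans (min_le_right _ _)
  have hcp : 0 < c := by positivity
  rw [qF_rot' hσ hl.le hα hα2]
  have ge : gaussS σ y = g * Real.exp (-YY σ y) := rfl
  have hey : 0 < Real.exp (-YY σ y) := Real.exp_pos _
  have hb : 0 ≤ l * (1 + |y|) ^ (-1 - α) := by positivity
  rw [ge]
  rcases le_total Y |y| with h | h
  · have hy : 0 < |y| := by linarith
    have T := (tails hσ hS hα hα2 hy).1
    have b1 : |y| ^ (-2 : ℝ) ≤ Y ^ (-2 : ℝ) := Real.rpow_le_rpow_of_nonpos (by linarith) h (by norm_num)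
    have b2 : |y| ^ (-α) ≤ 1 := Real.rpow_le_one_of_one_le_of_nonpos (by linarith) (by linarith)
    have b3 : CA σ α * (l * |y| ^ (-α)) ≤ cc α / 4 := by
      rw [le_div_iff₀ (by positivity)] at a3
      have := mul_le_mul_of_nonneg_left b2 hl.le
      nlinarith
    have b4 : CA σ α * |y| ^ (-2 : ℝ) ≤ cc α / 4 := (mul_le_mul_of_nonneg_left b1 hCA).trans hY2
    have p : 0 < l * |y| ^ (-1 - α) := by positivity
    have T2 : CA σ α * (l * |y| ^ (-1 - α) * (l * |y| ^ (-α) + |y| ^ (-2 : ℝ))) ≤ l * |y| ^ (-1 - α) * (cc α / 2) := by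
      have := mul_le_mul_of_nonneg_left (add_le_add b3 b4) p.le
      nlinarith
    have T3 := (abs_le.1 (T.trans T2)).1
    have b5 : (1 + |y|) ^ (-1 - α) ≤ |y| ^ (-1 - α) := Real.rpow_le_rpow_of_nonpos hy (by linarith) (by linarith)
    have b6 := mul_le_mul_of_nonneg_left b5 hl.le
    nlinarith [mul_le_mul_of_nonneg_right c1 hey.le, mul_le_mul_of_nonneg_right c2 hb, mul_pos hgp hey,
      mul_le_mul_of_nonneg_left b6 hcc.le]
  · have hKB := kk_KB hσ hl.le hα hα2 hS.h1 hS.h2 (p := 0) (by intro i; have := r0_pos hα hα2; simp; positivity)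
    have := hKB.Bop_le (by positivity) (by positivity) (abs_nonneg y)
    simp only [Pi.zero_apply, Real.exp_zero, mul_one, add_zero] at this
    have b1 : (1 + |y|) ^ (-1 - 7 * α / 8) ≤ 1 := Real.rpow_le_one_of_one_le_of_nonpos (by linarith [abs_nonneg y]) (by linarith)
    have b1' : (1 + |y|) ^ (-1 - α) ≤ 1 := Real.rpow_le_one_of_one_le_of_nonpos (by linarith [abs_nonneg y]) (by linarith)
    have b2 : |Bop (kk σ l α) (|y|)| ≤ K * l := this.trans (by
      calc _ = K * l * (1 + |y|) ^ (-1 - 7 * α / 8) := by rw [hK]; ring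
        _ ≤ _ := mul_le_of_le_one_right (by positivity) b1)
    have b3 : K * l ≤ g0 / 2 := by
      rw [le_div_iff₀ (by positivity)] at a4
      nlinarith
    have b4 : g0 ≤ g * Real.exp (-YY σ y) := by
      rw [hg0]
      refine mul_le_mul_of_nonneg_left (Real.exp_le_exp.2 (neg_le_neg ?_)) hgp.le
      unfold YY
      have : y ^ 2 ≤ Y ^ 2 := by rw [← sq_abs]; exact pow_le_pow_left₀ (abs_nonneg _) h 2
      gcongr
    have b5 := (abs_le.1 b2).1
    have b6 : l * (1 + |y|) ^ (-1 - α) ≤ g0 := (mul_le_of_le_one_right hl.le b1').trans a5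
    have b7 := mul_le_mul_of_nonneg_right c1 hey.le
    have b8 := mul_le_mul_of_nonneg_right c3 hb
    rw [mul_add]
    linarith

variable {σ α c l : ℝ}

lemma LB.qpos (h : LB σ α c l) (y : ℝ) : 0 < qF σ l α y := by
  have := h.sm.pos; have := h.cpos
  exact lt_of_lt_of_le (by positivity) (h.lb y)

lemma LB.q1 (h : LB σ α c l) (y : ℝ) : c * Real.exp (-YY σ y) ≤ qF σ l α y := by
  have h1 := h.sm.pos
  have h2 : 0 ≤ c * (l * (1 + |y|) ^ (-1 - α)) := by have := h.cpos; positivity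
  have := h.lb y; linarith

lemma LB.q2 (h : LB σ α c l) (y : ℝ) : c * (l * (1 + |y|) ^ (-1 - α)) ≤ qF σ l α y := by
  have h1 := h.sm.pos
  have h2 : 0 ≤ c * Real.exp (-YY σ y) := by have := h.cpos; positivity
  have := h.lb y; linarith

def g1 (σ y : ℝ) : ℝ := Real.exp (-(1 / 8 * YY σ y))
def g2 (α y : ℝ) : ℝ := (1 + |y|) ^ (-1 - α / 2)

lemma integrable_g1 (hσ : 0 < σ) : Integrable (g1 σ) := by
  have := integrable_exp_neg_mul_sq (b := 1 / 8 / (2 * σ ^ 2)) (by positivity)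
  refine this.congr (Eventually.of_forall fun y => ?_)
  simp only [g1, YY]
  congr 1; ring

lemma integrable_g2 (hα : 0 < α) : Integrable (g2 α) := by
  have := (integrable_one_add_norm (E := ℝ) (μ := volume) (r := 1 + α / 2) (by simp; positivity))
  refine this.congr (Eventually.of_forall fun y => ?_)
  simp only [g2, Real.norm_eq_abs]
  congr 1; ring

lemma g1_pos (σ y : ℝ) : 0 < g1 σ y := Real.exp_pos _
lemma g2_pos (α y : ℝ) : 0 < g2 α y := by unfold g2; positivity

lemma LB.m1 (h : LB σ α c l) (y : ℝ) {k : ℕ} (hk : k ≤ 3) :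
    Env1 σ y ^ (k + 1) / qF σ l α y ^ k ≤ (c⁻¹) ^ k * g1 σ y := by
  have hc := h.cpos
  have hY := YY_nonneg σ y
  have hq := pow_le_pow_left₀ (by positivity) (h.q1 y) k
  rw [div_le_iff₀ (pow_pos (h.qpos y) k)]
  have hk' : (k : ℝ) ≤ 3 := by exact_mod_cast hk
  calc Env1 σ y ^ (k + 1) = Real.exp (-((k + 1) * (7 / 8 * YY σ y))) := by
        rw [Env1, ← Real.exp_nat_mul]; congr 1; push_cast; ring
    _ ≤ Real.exp (-(1 / 8 * YY σ y) + -(k * YY σ y)) := by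
        apply Real.exp_le_exp.2; nlinarith
    _ = g1 σ y * Real.exp (-YY σ y) ^ k := by
        rw [Real.exp_add, g1, ← Real.exp_nat_mul (-YY σ y)]; congr 2; ring
    _ = (c⁻¹) ^ k * g1 σ y * (c * Real.exp (-YY σ y)) ^ k := by
        rw [mul_pow, inv_pow]; field_simp
    _ ≤ _ := mul_le_mul_of_nonneg_left hq (by have := g1_pos σ y; positivity)

lemma LB.m2 (h : LB σ α c l) (hα : 0 < α) (y : ℝ) {k : ℕ} (hk : k ≤ 3) :
    Env2 l α y ^ (k + 1) / qF σ l α y ^ k ≤ (c⁻¹) ^ k * (l * g2 α y) := by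
  have hc := h.cpos
  have hl := h.sm.pos
  have hq := pow_le_pow_left₀ (by positivity) (h.q2 y) k
  rw [div_le_iff₀ (pow_pos (h.qpos y) k)]
  have hk' : (k : ℝ) ≤ 3 := by exact_mod_cast hk
  have h1 : 1 ≤ 1 + |y| := by linarith [abs_nonneg y]
  have h0 : 0 < 1 + |y| := by linarith [abs_nonneg y]
  calc Env2 l α y ^ (k + 1) = l ^ (k + 1) * (1 + |y|) ^ ((-1 - 7 * α / 8) * (k + 1)) := by
        rw [Env2, mul_pow, ← Real.rpow_mul_natCast h0.le]; push_cast; ring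
    _ ≤ l ^ (k + 1) * (1 + |y|) ^ ((-1 - α / 2) + (-1 - α) * k) := by
        refine mul_le_mul_of_nonneg_left (Real.rpow_le_rpow_of_exponent_le h1 ?_) (by positivity)
        nlinarith
    _ = l * g2 α y * (l * (1 + |y|) ^ (-1 - α)) ^ k := by
        rw [Real.rpow_add h0, g2, mul_pow, ← Real.rpow_mul_natCast h0.le]; ring
    _ = (c⁻¹) ^ k * (l * g2 α y) * (c * (l * (1 + |y|) ^ (-1 - α))) ^ k := by
        rw [mul_pow c, inv_pow]; field_simp
    _ ≤ _ := mul_le_mul_of_nonneg_left hq (by have := g2_pos α y; positivity)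

lemma LB.m12 (h : LB σ α c l) (hα : 0 < α) (y : ℝ) :
    Env1 σ y * Env2 l α y / qF σ l α y ≤ c⁻¹ * (l ^ (3 / 4 : ℝ) * g1 σ y) := by
  have hc := h.cpos
  have hl := h.sm.pos
  have hY := YY_nonneg σ y
  rw [div_le_iff₀ (h.qpos y)]
  have h1 : 1 ≤ 1 + |y| := by linarith [abs_nonneg y]
  have h0 : 0 < 1 + |y| := by linarith [abs_nonneg y]
  have ag := Real.geom_mean_le_arith_mean2_weighted (w₁ := 3 / 4) (w₂ := 1 / 4) (p₁ := Real.exp (-YY σ y)) (p₂ := l * (1 + |y|) ^ (-1 - α))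
    (by norm_num) (by norm_num) (by positivity) (by positivity) (by norm_num)
  have ag2 : Real.exp (-YY σ y) ^ (3 / 4 : ℝ) * (l * (1 + |y|) ^ (-1 - α)) ^ (1 / 4 : ℝ) ≤ Real.exp (-YY σ y) + l * (1 + |y|) ^ (-1 - α) := by
    have e1 := Real.exp_pos (-YY σ y)
    have e2 : 0 < l * (1 + |y|) ^ (-1 - α) := by positivity
    linarith
  have ll : l = l ^ (3 / 4 : ℝ) * l ^ (1 / 4 : ℝ) := by rw [← Real.rpow_add hl]; norm_num
  have i1 : Env1 σ y ≤ g1 σ y * Real.exp (-YY σ y) ^ (3 / 4 : ℝ) := by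
    rw [g1, ← Real.exp_mul, ← Real.exp_add, Env1]; apply Real.exp_le_exp.2; nlinarith
  have i2 : Env2 l α y ≤ l ^ (3 / 4 : ℝ) * (l * (1 + |y|) ^ (-1 - α)) ^ (1 / 4 : ℝ) := by
    rw [Real.mul_rpow hl.le (by positivity), ← mul_assoc, ← ll, ← Real.rpow_mul h0.le, Env2]
    exact mul_le_mul_of_nonneg_left (Real.rpow_le_rpow_of_exponent_le h1 (by nlinarith)) hl.le
  calc Env1 σ y * Env2 l α y ≤ (g1 σ y * Real.exp (-YY σ y) ^ (3 / 4 : ℝ)) * (l ^ (3 / 4 : ℝ) * (l * (1 + |y|) ^ (-1 - α)) ^ (1 / 4 : ℝ)) :=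
        mul_le_mul i1 i2 (Env2_nonneg α hl.le y) (by have := g1_pos σ y; positivity)
    _ = (l ^ (3 / 4 : ℝ) * g1 σ y) * (Real.exp (-YY σ y) ^ (3 / 4 : ℝ) * (l * (1 + |y|) ^ (-1 - α)) ^ (1 / 4 : ℝ)) := by ring
    _ ≤ (l ^ (3 / 4 : ℝ) * g1 σ y) * (c⁻¹ * qF σ l α y) := by
        refine mul_le_mul_of_nonneg_left ?_ (by have := g1_pos σ y; positivity)
        rw [inv_mul_eq_div, le_div_iff₀ hc]
        have := h.lb y
        nlinarith
    _ = _ := by ring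

end PartJ

section PartK

/-! ### Part K: score bounds, information for σ, cross information -/

variable {σ α c l : ℝ}

def CQ (σ α : ℝ) : ℝ := CB (7 * α / 8) * MK σ / r0 α

lemma CQ_nonneg (hα : 0 < α) (hα2 : α < 2) : 0 ≤ CQ σ α := by
  have := CB_pos (β := 7 * α / 8) (by positivity)
  have := r0_pos hα hα2
  unfold CQ MK; positivity

lemma Bop_k1_le (hσ : 0 < σ) (hS : Sm σ l) (hα : 0 < α) (hα2 : α < 2) {p : Fin 3 → ℝ} (hp : ∀ i, |p i| ≤ 1) (y : ℝ) :
    |Bop (k1 σ l α p) (|y|)| ≤ CQ σ α * Env2 l α y := by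
  have hr := r0_pos hα hα2
  have hl := hS.pos
  have hMK : 0 ≤ MK σ := by unfold MK; positivity
  have K : KB (7 * α / 8) (MK σ * l / r0 α) (k1 σ l α p) := by
    refine ⟨measurable_k1 _ _ _ _, fun v hv => ?_⟩
    have h := (gK_taylor hσ hl.le hα hα2 hS.h1 hS.h2 (s := r0 α / 2) (p := (r0 α / 2) • p) (by positivity) le_rfl
      (by intro i; simp only [Pi.smul_apply, smul_eq_mul, abs_mul, abs_of_pos (half_pos hr)]
          exact mul_le_of_le_one_right (by positivity) (hp i)) hv).1
    rw [k1_smul, norm_mul, Complex.norm_real, Real.norm_of_nonneg (by positivity)] at h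
    have h2 := (le_div_iff₀' (half_pos hr)).2 h
    refine h2.trans (le_of_eq ?_)
    field_simp
  refine (K.Bop_le (by positivity) (by positivity) (abs_nonneg y)).trans (le_of_eq ?_)
  rw [CQ, Env2]; ring

lemma Q1e_le (hσ : 0 < σ) (hS : Sm σ l) (hα : 0 < α) (hα2 : α < 2) (y : ℝ) :
    |Q1 σ l α ![1, 0, 0] y - gaussS σ y * (2 * YY σ y - 1)| ≤ CQ σ α * Env2 l α y ∧
    |Q1 σ l α ![0, 1, 0] y| ≤ CQ σ α * Env2 l α y ∧
    |Q1 σ l α ![0, 0, 1] y| ≤ CQ σ α * Env2 l α y := by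
  refine ⟨?_, ?_, ?_⟩
  · have := Bop_k1_le hσ hS hα hα2 (p := ![1, 0, 0]) (by intro i; fin_cases i <;> simp) y
    simpa [Q1] using this
  · have := Bop_k1_le hσ hS hα hα2 (p := ![0, 1, 0]) (by intro i; fin_cases i <;> simp) y
    simpa [Q1] using this
  · have := Bop_k1_le hσ hS hα hα2 (p := ![0, 0, 1]) (by intro i; fin_cases i <;> simp) y
    simpa [Q1] using this

def CG (σ : ℝ) : ℝ := 17 * (σ * Real.sqrt (2 * Real.pi))⁻¹

lemma gauss_score_le (hσ : 0 < σ) (y : ℝ) : |gaussS σ y * (2 * YY σ y - 1)| ≤ CG σ * Env1 σ y := by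
  have hY := YY_nonneg σ y
  have e : gaussS σ y = (σ * Real.sqrt (2 * Real.pi))⁻¹ * (Env1 σ y * Real.exp (-(YY σ y / 8))) := by
    rw [Env1, ← Real.exp_add, gaussS]; congr 2; rw [YY]; ring
  have hE := Env1_nonneg σ y
  have h1 : |2 * YY σ y - 1| ≤ 17 * Real.exp (YY σ y / 8) := by
    have h2 := Real.add_one_le_exp (YY σ y / 8)
    rw [abs_le]; constructor <;> nlinarith
  have h3 : Real.exp (-(YY σ y / 8)) * Real.exp (YY σ y / 8) = 1 := by rw [← Real.exp_add]; simp
  rw [abs_mul, e, abs_of_nonneg (by positivity), CG]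
  calc _ ≤ (σ * Real.sqrt (2 * Real.pi))⁻¹ * (Env1 σ y * Real.exp (-(YY σ y / 8))) * (17 * Real.exp (YY σ y / 8)) :=
        mul_le_mul_of_nonneg_left h1 (by positivity)
    _ = 17 * (σ * Real.sqrt (2 * Real.pi))⁻¹ * Env1 σ y * (Real.exp (-(YY σ y / 8)) * Real.exp (YY σ y / 8)) := by ring
    _ = _ := by rw [h3, mul_one]

lemma Q1e0_le (hσ : 0 < σ) (hS : Sm σ l) (hα : 0 < α) (hα2 : α < 2) (y : ℝ) :
    |Q1 σ l α ![1, 0, 0] y| ≤ CG σ * Env1 σ y + CQ σ α * Env2 l α y := by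
  have h1 := (Q1e_le hσ hS hα hα2 y).1
  have h2 := gauss_score_le hσ y
  have := abs_add_le (Q1 σ l α ![1, 0, 0] y - gaussS σ y * (2 * YY σ y - 1)) (gaussS σ y * (2 * YY σ y - 1))
  rw [sub_add_cancel] at this
  linarith

lemma qF_sub_gaussS (hσ : 0 < σ) (hS : Sm σ l) (hα : 0 < α) (hα2 : α < 2) (y : ℝ) :
    |qF σ l α y - gaussS σ y| ≤ CB (7 * α / 8) * MK σ * Env2 l α y := by
  have hl := hS.pos
  have hMK : 0 ≤ MK σ := by unfold MK; positivity
  have hKB := kk_KB hσ hl.le hα hα2 hS.h1 hS.h2 (p := 0) (by intro i; have := r0_pos hα hα2; simp; positivity)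
  have := hKB.Bop_le (by positivity) (by positivity) (abs_nonneg y)
  simp only [Pi.zero_apply, Real.exp_zero, mul_one, add_zero] at this
  rw [qF_rot' hσ hl.le hα hα2, add_sub_cancel_left]
  refine this.trans (le_of_eq ?_)
  rw [Env2]; ring

lemma integral_gaussS (hσ : 0 < σ) : ∫ y, gaussS σ y = 1 := by
  have h := integral_gaussian (1 / (2 * σ ^ 2))
  have e : ∀ y, gaussS σ y = (σ * Real.sqrt (2 * Real.pi))⁻¹ * Real.exp (-(1 / (2 * σ ^ 2)) * y ^ 2) := by
    intro y; rw [gaussS]; congr 2; ring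
  simp only [e]
  rw [integral_const_mul, h]
  have : Real.pi / (1 / (2 * σ ^ 2)) = σ ^ 2 * (2 * Real.pi) := by field_simp
  rw [this, Real.sqrt_mul (sq_nonneg σ), Real.sqrt_sq hσ.le]
  exact inv_mul_cancel₀ (by positivity)

lemma integrable_pow_gaussS (hσ : 0 < σ) (k : ℕ) : Integrable (fun y => y ^ k * gaussS σ y) := by
  have := (integrable_rpow_mul_exp_neg_mul_sq (b := 1 / (2 * σ ^ 2)) (by positivity) (s := k) (by have := Nat.cast_nonneg (α := ℝ) k; linarith)).const_mul ((σ * Real.sqrt (2 * Real.pi))⁻¹)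
  refine this.congr (Eventually.of_forall fun y => ?_)
  simp only [gaussS, Real.rpow_natCast]
  have : -(1 / (2 * σ ^ 2)) * y ^ 2 = -(y ^ 2 / (2 * σ ^ 2)) := by ring
  rw [this]; ring

lemma gaussS_hasDeriv (hσ : 0 < σ) (y : ℝ) : HasDerivAt (gaussS σ) (-(y / σ ^ 2) * gaussS σ y) y := by
  have h1 : HasDerivAt (fun y : ℝ => -(y ^ 2 / (2 * σ ^ 2))) (-(2 * y / (2 * σ ^ 2))) y := by
    have := ((hasDerivAt_pow 2 y).div_const (2 * σ ^ 2)).fun_neg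
    convert! this using 1; simp
  have h2 := (h1.exp).const_mul ((σ * Real.sqrt (2 * Real.pi))⁻¹)
  convert! h2 using 1
  rw [gaussS]; field_simp

lemma integral_gauss_score (hσ : 0 < σ) : ∫ y, gaussS σ y * (2 * YY σ y - 1) ^ 2 = 2 := by
  have hi := integrable_pow_gaussS hσ
  have hd : ∀ y, HasDerivAt (fun y => -((σ ^ 2)⁻¹ * (y ^ 3 * gaussS σ y)) - y * gaussS σ y) (gaussS σ y * (2 * YY σ y - 1) ^ 2 - 2 * gaussS σ y) y := by
    intro y
    have h0 := gaussS_hasDeriv hσ y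
    have h1 := (((hasDerivAt_pow 3 y).fun_mul h0).const_mul ((σ ^ 2)⁻¹)).fun_neg.fun_sub ((hasDerivAt_id' y).fun_mul h0)
    convert! h1 using 1
    rw [YY]; push_cast; field_simp; ring
  have e : (fun y => gaussS σ y * (2 * YY σ y - 1) ^ 2) = fun y => (σ ^ 2)⁻¹ ^ 2 * (y ^ 4 * gaussS σ y) - (2 * (σ ^ 2)⁻¹) * (y ^ 2 * gaussS σ y) + y ^ 0 * gaussS σ y := by
    ext y; rw [YY]; field_simp; ring
  have I0 : Integrable (fun y => gaussS σ y * (2 * YY σ y - 1) ^ 2) := by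
    rw [e]; exact (((hi 4).const_mul _).sub ((hi 2).const_mul _)).add (hi 0)
  have I1 : Integrable (fun y => 2 * gaussS σ y) := (integrable_gaussS hσ).const_mul 2
  have I2 : Integrable (fun y => -((σ ^ 2)⁻¹ * (y ^ 3 * gaussS σ y)) - y * gaussS σ y) := by
    refine (((hi 3).const_mul _).neg).sub ?_
    simpa using hi 1
  have := integral_eq_zero_of_hasDerivAt_of_integrable hd (I0.sub I1) I2
  rw [integral_sub I0 I1, integral_const_mul, integral_gaussS hσ] at this
  linarith

lemma Env2_tendsto (α y : ℝ) : Tendsto (fun l => Env2 l α y) (𝓝[>] 0) (𝓝 0) := by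
  have : Tendsto (fun l : ℝ => l * (1 + |y|) ^ (-1 - 7 * α / 8)) (𝓝 0) (𝓝 (0 * (1 + |y|) ^ (-1 - 7 * α / 8))) :=
    tendsto_id.mul_const _
  rw [zero_mul] at this
  exact this.mono_left nhdsWithin_le_nhds

lemma tendsto_of_abs_le {ι : Type*} {F : Filter ι} {f g : ι → ℝ} {a C : ℝ} (h : ∀ᶠ i in F, |f i - a| ≤ C * g i)
    (hg : Tendsto g F (𝓝 0)) : Tendsto f F (𝓝 a) := by
  rw [tendsto_iff_norm_sub_tendsto_zero]
  refine squeeze_zero' (Eventually.of_forall fun _ => norm_nonneg _) h ?_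
  simpa using hg.const_mul C

lemma measurable_qF (hσ : 0 < σ) (hl : 0 ≤ l) : Measurable (qF σ l α) := (continuous_qF α hσ hl).measurable

lemma eventually_LB {c l1 : ℝ} (hl1 : 0 < l1) (h : ∀ l, 0 < l → l ≤ l1 → LB σ α c l) :
    ∀ᶠ l in 𝓝[>] (0:ℝ), LB σ α c l := by
  have : Ioc (0:ℝ) l1 ∈ 𝓝[>] (0:ℝ) := Ioc_mem_nhdsGT hl1
  filter_upwards [this] with l hl
  exact h l hl.1 hl.2

lemma info11 (hσ : 0 < σ) (hα : 0 < α) (hα2 : α < 2) :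
    Tendsto (fun l => ∫ y, Q1 σ l α ![1, 0, 0] y ^ 2 / qF σ l α y) (𝓝[>] 0) (𝓝 2) := by
  obtain ⟨c, l1, hl1, h⟩ := exists_LB hσ hα hα2
  have hLB := eventually_LB hl1 h
  have hCQ := CQ_nonneg (σ := σ) hα hα2
  have hCG : 0 ≤ CG σ := by unfold CG; positivity
  have lim : (2 : ℝ) = ∫ y, gaussS σ y * (2 * YY σ y - 1) ^ 2 := (integral_gauss_score hσ).symm
  rw [lim]
  set C := 2 * (CG σ ^ 2 + CQ σ α ^ 2) * c⁻¹ with hC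
  refine tendsto_integral_filter_of_dominated_convergence (fun y => C * (g1 σ y + g2 α y)) ?_ ?_ ?_ ?_
  · filter_upwards [hLB] with l hl
    exact (((measurable_Q1 _ _ _ _).pow_const 2).div (measurable_qF hσ hl.sm.pos.le)).aestronglyMeasurable
  · filter_upwards [hLB] with l hl
    refine Eventually.of_forall fun y => ?_
    have hq := hl.qpos y
    have hc := hl.cpos
    have m1 := hl.m1 y (k := 1) (by norm_num)
    have m2 := hl.m2 hα y (k := 1) (by norm_num)
    have q := Q1e0_le hσ hl.sm hα hα2 y
    have hll : l ≤ 1 := by linarith [hl.sm.h1, hl.sm.pos]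
    have e1 := Env1_nonneg σ y
    have e2 := Env2_nonneg α hl.sm.pos.le y
    simp only [pow_one, Nat.reduceAdd] at m1 m2
    have gg1 := g1_pos σ y
    have gg2 := g2_pos α y
    have m3 : c⁻¹ * (l * g2 α y) ≤ c⁻¹ * g2 α y := by
      refine mul_le_mul_of_nonneg_left (mul_le_of_le_one_left gg2.le hll) (by positivity)
    rw [Real.norm_of_nonneg (by positivity), ← sq_abs]
    calc |Q1 σ l α ![1, 0, 0] y| ^ 2 / qF σ l α y ≤ (2 * (CG σ ^ 2 + CQ σ α ^ 2) * (Env1 σ y ^ 2 + Env2 l α y ^ 2)) / qF σ l α y := by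
          refine div_le_div_of_nonneg_right ?_ hq.le
          refine (pow_le_pow_left₀ (abs_nonneg _) q 2).trans ?_
          have t1 : 0 ≤ (CG σ * Env2 l α y) ^ 2 := by positivity
          have t2 : 0 ≤ (CQ σ α * Env1 σ y) ^ 2 := by positivity
          nlinarith [sq_nonneg (CG σ * Env1 σ y - CQ σ α * Env2 l α y)]
      _ = 2 * (CG σ ^ 2 + CQ σ α ^ 2) * (Env1 σ y ^ 2 / qF σ l α y + Env2 l α y ^ 2 / qF σ l α y) := by ring
      _ ≤ 2 * (CG σ ^ 2 + CQ σ α ^ 2) * (c⁻¹ * g1 σ y + c⁻¹ * g2 α y) :=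
          mul_le_mul_of_nonneg_left (add_le_add m1 (m2.trans m3)) (by positivity)
      _ = _ := by rw [hC]; ring
  · exact ((integrable_g1 hσ).add (integrable_g2 hα)).const_mul C
  · refine Eventually.of_forall fun y => ?_
    have t1 : Tendsto (fun l => Q1 σ l α ![1, 0, 0] y) (𝓝[>] 0) (𝓝 (gaussS σ y * (2 * YY σ y - 1))) :=
      tendsto_of_abs_le (hLB.mono fun l hl => (Q1e_le hσ hl.sm hα hα2 y).1) (Env2_tendsto α y)
    have t2 : Tendsto (fun l => qF σ l α y) (𝓝[>] 0) (𝓝 (gaussS σ y)) :=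
      tendsto_of_abs_le (hLB.mono fun l hl => qF_sub_gaussS hσ hl.sm hα hα2 y) (Env2_tendsto α y)
    have hg : 0 < gaussS σ y := by unfold gaussS; positivity
    have := (t1.pow 2).div t2 hg.ne'
    convert! this using 2
    field_simp

/-- combination of the scores for the jump parameters -/
def EE (σ l α a b : ℝ) (y : ℝ) : ℝ := a * Q1 σ l α ![0, 1, 0] y + b * Q1 σ l α ![0, 0, 1] y

lemma EE_le (hσ : 0 < σ) (hS : Sm σ l) (hα : 0 < α) (hα2 : α < 2) (a b y : ℝ) :
    |EE σ l α a b y| ≤ CQ σ α * (|a| + |b|) * Env2 l α y := by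
  obtain ⟨-, h1, h2⟩ := Q1e_le hσ hS hα hα2 y
  have := abs_add_le (a * Q1 σ l α ![0, 1, 0] y) (b * Q1 σ l α ![0, 0, 1] y)
  rw [abs_mul, abs_mul] at this
  have h3 := mul_le_mul_of_nonneg_left h1 (abs_nonneg a)
  have h4 := mul_le_mul_of_nonneg_left h2 (abs_nonneg b)
  rw [EE]; linarith

lemma measurable_EE (σ l α a b : ℝ) : Measurable (EE σ l α a b) :=
  ((measurable_Q1 _ _ _ _).const_mul a).add ((measurable_Q1 _ _ _ _).const_mul b)

def CX (σ α c : ℝ) : ℝ := (CG σ + CQ σ α) * CQ σ α * c⁻¹ * ((∫ y, g1 σ y) + ∫ y, g2 α y)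

lemma cross (hσ : 0 < σ) (hα : 0 < α) (hα2 : α < 2) (h : LB σ α c l) (a b : ℝ) :
    Integrable (fun y => Q1 σ l α ![1, 0, 0] y * EE σ l α a b y / qF σ l α y) ∧
    |∫ y, Q1 σ l α ![1, 0, 0] y * EE σ l α a b y / qF σ l α y| ≤ CX σ α c * (|a| + |b|) * l ^ (3 / 4 : ℝ) := by
  have hCQ := CQ_nonneg (σ := σ) hα hα2
  have hCG : 0 ≤ CG σ := by unfold CG; positivity
  have hc := h.cpos
  have hl := h.sm.pos
  have hl1 : l ≤ 1 := by linarith [h.sm.h1]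
  have hll : l ≤ l ^ (3 / 4 : ℝ) := by
    have := Real.rpow_le_rpow_of_exponent_ge hl hl1 (by norm_num : (3 / 4 : ℝ) ≤ 1)
    rwa [Real.rpow_one] at this
  set K := (CG σ + CQ σ α) * CQ σ α * c⁻¹ * (|a| + |b|) * l ^ (3 / 4 : ℝ) with hK
  have hb : ∀ y, ‖Q1 σ l α ![1, 0, 0] y * EE σ l α a b y / qF σ l α y‖ ≤ K * (g1 σ y + g2 α y) := by
    intro y
    have hq := h.qpos y
    have e1 := Env1_nonneg σ y
    have e2 := Env2_nonneg α hl.le y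
    have gg1 := g1_pos σ y
    have gg2 := g2_pos α y
    have m2 := h.m2 hα y (k := 1) (by norm_num)
    have m12 := h.m12 hα y
    simp only [pow_one, Nat.reduceAdd] at m2
    have m3 : c⁻¹ * (l * g2 α y) ≤ c⁻¹ * (l ^ (3 / 4 : ℝ) * g2 α y) := by gcongr
    rw [norm_div, norm_mul, Real.norm_eq_abs, Real.norm_eq_abs, Real.norm_of_nonneg hq.le]
    calc _ ≤ ((CG σ * Env1 σ y + CQ σ α * Env2 l α y) * (CQ σ α * (|a| + |b|) * Env2 l α y)) / qF σ l α y := by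
          refine div_le_div_of_nonneg_right (mul_le_mul (Q1e0_le hσ h.sm hα hα2 y) (EE_le hσ h.sm hα hα2 a b y) (abs_nonneg _) (by positivity)) hq.le
      _ = CQ σ α * (|a| + |b|) * (CG σ * (Env1 σ y * Env2 l α y / qF σ l α y) + CQ σ α * (Env2 l α y ^ 2 / qF σ l α y)) := by ring
      _ ≤ CQ σ α * (|a| + |b|) * (CG σ * (c⁻¹ * (l ^ (3 / 4 : ℝ) * g1 σ y)) + CQ σ α * (c⁻¹ * (l ^ (3 / 4 : ℝ) * g2 α y))) := by
          refine mul_le_mul_of_nonneg_left (add_le_add (mul_le_mul_of_nonneg_left m12 hCG) (mul_le_mul_of_nonneg_left (m2.trans m3) hCQ)) (by positivity)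
      _ ≤ _ := by
          rw [hK]
          have t : 0 ≤ CQ σ α * (|a| + |b|) * c⁻¹ * l ^ (3 / 4 : ℝ) := by positivity
          have t1 := mul_nonneg t (mul_nonneg hCG gg2.le)
          have t2 := mul_nonneg t (mul_nonneg hCQ gg1.le)
          nlinarith
  have hI : Integrable (fun y => K * (g1 σ y + g2 α y)) := ((integrable_g1 hσ).add (integrable_g2 hα)).const_mul K
  refine ⟨hI.mono' (((measurable_Q1 _ _ _ _).mul (measurable_EE _ _ _ _ _)).div (measurable_qF hσ hl.le)).aestronglyMeasurable (Eventually.of_forall hb), ?_⟩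
  have := norm_integral_le_of_norm_le hI (Eventually.of_forall hb)
  rw [integral_const_mul, integral_add (integrable_g1 hσ) (integrable_g2 hα)] at this
  refine this.trans (le_of_eq ?_)
  rw [hK, CX]; ring

end PartK

section PartL

/-! ### Part L: information for the jump parameters -/

variable {σ α c l : ℝ}

lemma integrableOn_lim (hα : 0 < α) : IntegrableOn (fun r : ℝ => r ^ (-1 - α) * (1 + |Real.log r|) ^ 2) (Ioi (1 / 2)) := by
  have i1 := (integrableOn_Ioi_rpow_of_lt (a := -1 - α) (c := 1 / 2) (by linarith) (by norm_num)).const_mul 8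
  have i2 := (integrableOn_Ioi_rpow_of_lt (a := -1 - α / 2) (c := 1 / 2) (by linarith) (by norm_num)).const_mul (2 * (4 / α) ^ 2)
  refine (i1.add i2).mono' ?_ ?_
  · have := Real.measurable_log
    exact Measurable.aestronglyMeasurable (by fun_prop)
  · refine (ae_restrict_mem measurableSet_Ioi).mono fun r (hr : 1 / 2 < r) => ?_
    have hr0 : 0 < r := by linarith
    have h1 := Real.log_le_rpow_div hr0.le (ε := α / 4) (by positivity)
    have h2 : -1 ≤ Real.log r := by
      have := Real.one_sub_inv_le_log_of_pos hr0
      have h3 : r⁻¹ ≤ 2 := by rw [inv_le_comm₀ hr0 (by norm_num)]; linarith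
      linarith
    have hp : 0 < r ^ (α / 4) := by positivity
    have e4 : r ^ (α / 4) / (α / 4) = 4 / α * r ^ (α / 4) := by field_simp
    rw [e4] at h1
    have hq : 0 ≤ 4 / α * r ^ (α / 4) := by positivity
    have h3 : 1 + |Real.log r| ≤ 2 + 4 / α * r ^ (α / 4) := by
      have : |Real.log r| ≤ 1 + 4 / α * r ^ (α / 4) := abs_le.2 ⟨by linarith, by linarith⟩
      linarith
    have h4 : (1 + |Real.log r|) ^ 2 ≤ 8 + 2 * (4 / α) ^ 2 * (r ^ (α / 4) * r ^ (α / 4)) := by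
      have := pow_le_pow_left₀ (by positivity) h3 2
      nlinarith [sq_nonneg (2 - 4 / α * r ^ (α / 4))]
    have e1 : r ^ (-1 - α) * (r ^ (α / 4) * r ^ (α / 4)) = r ^ (-1 - α / 2) := by
      rw [← Real.rpow_add hr0, ← Real.rpow_add hr0]; congr 1; ring
    rw [Real.norm_of_nonneg (by positivity)]
    calc _ ≤ r ^ (-1 - α) * (8 + 2 * (4 / α) ^ 2 * (r ^ (α / 4) * r ^ (α / 4))) := mul_le_mul_of_nonneg_left h4 (by positivity)
      _ = 8 * r ^ (-1 - α) + 2 * (4 / α) ^ 2 * (r ^ (-1 - α) * (r ^ (α / 4) * r ^ (α / 4))) := by ring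
      _ = _ := by rw [e1]; rfl

lemma integrableOn_quad (hα : 0 < α) (a b : ℝ) :
    IntegrableOn (fun r : ℝ => α * r ^ (-1 - α) * (a + b / α - b * Real.log r) ^ 2) (Ioi 1) := by
  have := ((integrableOn_lim hα).mono_set (Ioi_subset_Ioi (by norm_num : (1 / 2 : ℝ) ≤ 1))).const_mul (α * (|a + b / α| + |b|) ^ 2)
  refine this.mono' ?_ ?_
  · have := Real.measurable_log
    exact Measurable.aestronglyMeasurable (by fun_prop)
  · refine (ae_restrict_mem measurableSet_Ioi).mono fun r (hr : 1 < r) => ?_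
    have hr0 : 0 < r := by linarith
    rw [Real.norm_of_nonneg (by positivity), ← sq_abs]
    have h1 : |a + b / α - b * Real.log r| ≤ (|a + b / α| + |b|) * (1 + |Real.log r|) := by
      refine (abs_sub _ _).trans ?_
      rw [abs_mul]
      nlinarith [abs_nonneg (a + b / α), abs_nonneg b, abs_nonneg (Real.log r), mul_nonneg (abs_nonneg (a + b / α)) (abs_nonneg (Real.log r))]
    have h2 := pow_le_pow_left₀ (abs_nonneg _) h1 2
    calc _ ≤ α * r ^ (-1 - α) * ((|a + b / α| + |b|) * (1 + |Real.log r|)) ^ 2 := mul_le_mul_of_nonneg_left h2 (by positivity)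
      _ = _ := by ring

lemma integral_quad (hα : 0 < α) (a b : ℝ) :
    ∫ r in Ioi (1:ℝ), α * r ^ (-1 - α) * (a + b / α - b * Real.log r) ^ 2 = a ^ 2 + b ^ 2 / α ^ 2 := by
  set B := -2 * (a + b / α) * b + 2 * b ^ 2 / α with hB
  set A := a ^ 2 + b ^ 2 / α ^ 2 with hA
  have key := integral_Ioi_of_hasDerivAt_of_tendsto' (a := (1:ℝ)) (m := 0)
    (f := fun r => -(r ^ (-α) * (A + B * Real.log r + b ^ 2 * Real.log r ^ 2)))
    (f' := fun r => α * r ^ (-1 - α) * (a + b / α - b * Real.log r) ^ 2) ?_ (integrableOn_quad hα a b) ?_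
  · rw [key]; simp
  · intro r (hr : 1 ≤ r)
    have hr0 : 0 < r := by linarith
    have h1 := Real.hasDerivAt_rpow_const (x := r) (p := -α) (Or.inl hr0.ne')
    have h2 := Real.hasDerivAt_log hr0.ne'
    have h3 := (h1.fun_mul (((h2.const_mul B).const_add A).fun_add ((h2.fun_pow 2).const_mul (b ^ 2)))).fun_neg
    convert! h3 using 1
    have e1 : r ^ (-α - 1) = r ^ (-1 - α) := by congr 1; ring
    have e2 : r ^ (-α) = r ^ (-1 - α) * r := by rw [← Real.rpow_add_one hr0.ne']; congr 1; ring
    rw [e1, e2, hB, hA]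
    push_cast
    field_simp
    ring
  · have t : ∀ k : ℕ, Tendsto (fun r : ℝ => r ^ (-α) * Real.log r ^ k) atTop (𝓝 0) := by
      intro k
      have := (isLittleO_log_rpow_rpow_atTop (s := α) k hα).tendsto_div_nhds_zero
      refine this.congr' ?_
      filter_upwards [eventually_gt_atTop 0] with r hr
      rw [Real.rpow_natCast, Real.rpow_neg hr.le]; field_simp
    have := ((((t 0).const_mul A).add ((t 1).const_mul B)).add ((t 2).const_mul (b ^ 2))).neg
    simp only [mul_zero, add_zero, neg_zero] at this
    refine this.congr fun r => ?_
    simp; ring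

lemma Q1_even (σ l α : ℝ) (p : Fin 3 → ℝ) (y : ℝ) : Q1 σ l α p |y| = Q1 σ l α p y := by
  simp [Q1, gaussS_abs, YY]

lemma EE_even (σ l α a b y : ℝ) : EE σ l α a b |y| = EE σ l α a b y := by simp [EE, Q1_even]

/-- pointwise representation -/
lemma far_pointwise (hσ : 0 < σ) (hS : Sm σ l) (hα : 0 < α) (hα2 : α < 2) {T r ε a b m : ℝ} (hT : 0 < T) (hr : 1 / 2 < r)
    (hε : CA σ α * (l * (T / 2) ^ (-α) + (T / 2) ^ (-2 : ℝ)) ≤ ε) (hm : m = Real.log T - cd α / cc α + 1 / α) :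
    ∃ d bt : ℝ, EE σ l α (a + b * m) b (T * r) ^ 2 / qF σ l α (T * r) =
        (l * T ^ (-1 - α)) * (r ^ (-1 - α) * (d ^ 2 / (gaussS σ (T * r) / (l * T ^ (-1 - α)) / r ^ (-1 - α) + bt))) ∧
      |bt - cc α| ≤ ε ∧
      |d - cc α * (a + b / α - b * Real.log r)| ≤ (|a| + |b| * (1 + 1 / α + |cd α / cc α|)) * (1 + |Real.log r|) * ε := by
  have hr0 : 0 < r := by linarith
  have hy : 0 < T * r := by positivity
  have hl := hS.pos
  obtain ⟨t1, t2, t3⟩ := tails hσ hS hα hα2 hy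
  set y := T * r with hyd
  set P := l * y ^ (-1 - α) with hP
  have hPp : 0 < P := by positivity
  have hPe : P = (l * T ^ (-1 - α)) * r ^ (-1 - α) := by rw [hP, hyd, Real.mul_rpow hT.le hr0.le]; ring
  have hyT : T / 2 ≤ y := by rw [hyd]; nlinarith
  have hεb : CA σ α * (l * y ^ (-α) + y ^ (-2 : ℝ)) ≤ ε := by
    refine le_trans (mul_le_mul_of_nonneg_left (add_le_add (mul_le_mul_of_nonneg_left ?_ hl.le) ?_) (CA_nonneg σ α)) hε
    · exact Real.rpow_le_rpow_of_nonpos (by positivity) hyT (by linarith)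
    · exact Real.rpow_le_rpow_of_nonpos (by positivity) hyT (by norm_num)
  have hε0 : 0 ≤ ε := le_trans (by have := CA_nonneg σ α; positivity) hεb
  have conv : ∀ {X k : ℝ}, |X - l * k * y ^ (-1 - α)| ≤ CA σ α * (P * (l * y ^ (-α) + y ^ (-2 : ℝ))) → |X / P - k| ≤ ε := by
    intro X k hX
    have e : X / P - k = (X - l * k * y ^ (-1 - α)) / P := by
      rw [hP]; field_simp
    rw [e, abs_div, abs_of_pos hPp, div_le_iff₀ hPp]
    nlinarith
  have u1 := conv t1
  have u2 := conv t2
  have u3 := conv t3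
  have hcc := cc_pos hα hα2
  refine ⟨EE σ l α (a + b * m) b y / P, Bop (kk σ l α) y / P, ?_, u1, ?_⟩
  · rw [qF_rot' hσ hl.le hα hα2, abs_of_pos hy]
    have e : gaussS σ y / (l * T ^ (-1 - α)) / r ^ (-1 - α) = gaussS σ y / P := by rw [hPe, div_div]
    rw [e, ← mul_assoc, ← hPe, ← add_div]
    field_simp
  · set D1 := Q1 σ l α ![0, 1, 0] y / P with hD1
    have e1 : EE σ l α (a + b * m) b y / P = a * D1 + b * ((Q1 σ l α ![0, 0, 1] y + Real.log y * Q1 σ l α ![0, 1, 0] y) / P)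
        + b * (1 / α - cd α / cc α - Real.log r) * D1 := by
      rw [EE, hD1, hm, hyd, Real.log_mul hT.ne' hr0.ne']
      field_simp; ring
    set D2 := (Q1 σ l α ![0, 0, 1] y + Real.log y * Q1 σ l α ![0, 1, 0] y) / P with hD2
    have e2 : a * D1 + b * D2 + b * (1 / α - cd α / cc α - Real.log r) * D1 - cc α * (a + b / α - b * Real.log r) =
        a * (D1 - cc α) + b * (D2 - cd α) + b * (1 / α - cd α / cc α - Real.log r) * (D1 - cc α) := by
      field_simp; ring
    rw [e1, e2]
    have v1 : |a * (D1 - cc α)| ≤ |a| * ε := by rw [abs_mul]; exact mul_le_mul_of_nonneg_left u2 (abs_nonneg _)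
    have v2 : |b * (D2 - cd α)| ≤ |b| * ε := by rw [abs_mul]; exact mul_le_mul_of_nonneg_left u3 (abs_nonneg _)
    have v3 : |b * (1 / α - cd α / cc α - Real.log r) * (D1 - cc α)| ≤ |b| * (1 / α + |cd α / cc α| + |Real.log r|) * ε := by
      rw [abs_mul, abs_mul]
      refine mul_le_mul (mul_le_mul_of_nonneg_left ?_ (abs_nonneg _)) u2 (abs_nonneg _) (by positivity)
      have := abs_sub (1 / α - cd α / cc α) (Real.log r)
      have := abs_sub (1 / α) (cd α / cc α)
      rw [abs_of_pos (by positivity : 0 < 1 / α)] at this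
      linarith
    refine (abs_add_three _ _ _).trans ((add_le_add (add_le_add v1 v2) v3).trans ?_)
    have hL := abs_nonneg (Real.log r)
    have w1 : 0 ≤ |a| * |Real.log r| * ε := by positivity
    have w2 : 0 ≤ |b| * (1 / α) * |Real.log r| * ε := by positivity
    have w3 : 0 ≤ |b| * |cd α / cc α| * |Real.log r| * ε := by positivity
    nlinarith

end PartL

section PartM

/-! ### Part M: limit of the information for the jump parameters -/

variable {σ α : ℝ}

lemma far_limit (hσ : 0 < σ) (hα : 0 < α) (hα2 : α < 2) {l T pref m : ℕ → ℝ} (a b : ℝ)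
    (hl : Tendsto l atTop (𝓝[>] 0)) (hT : Tendsto T atTop atTop)
    (hm : ∀ n, m n = Real.log (T n) - cd α / cc α + 1 / α)
    (hpref : ∀ᶠ n in atTop, pref n * (2 * T n) * (l n * T n ^ (-1 - α)) = α / cc α)
    (hφ1 : ∀ r, 1 / 2 < r → r < 1 → Tendsto (fun n => gaussS σ (T n * r) / (l n * T n ^ (-1 - α))) atTop atTop)
    (hφ2 : ∀ r, 1 < r → Tendsto (fun n => gaussS σ (T n * r) / (l n * T n ^ (-1 - α))) atTop (𝓝 0)) :
    Tendsto (fun n => ∫ r in Ioi (1 / 2 : ℝ), pref n * (2 * T n) * (EE σ (l n) α (a + b * m n) b (T n * r) ^ 2 / qF σ (l n) α (T n * r)))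
      atTop (𝓝 (a ^ 2 + b ^ 2 / α ^ 2)) := by
  have hcc := cc_pos hα hα2
  obtain ⟨c, l1, hl1, h⟩ := exists_LB hσ hα hα2
  have hLB : ∀ᶠ n in atTop, LB σ α c (l n) := hl.eventually (eventually_LB hl1 h)
  have hl0 : Tendsto l atTop (𝓝 0) := hl.mono_right nhdsWithin_le_nhds
  set ε : ℕ → ℝ := fun n => CA σ α * (l n * (T n / 2) ^ (-α) + (T n / 2) ^ (-2 : ℝ)) with hε
  have hT2 : Tendsto (fun n => T n / 2) atTop atTop := hT.atTop_div_const (by norm_num)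
  have hεt : Tendsto ε atTop (𝓝 0) := by
    have := ((hl0.mul ((tendsto_rpow_neg_atTop hα).comp hT2)).add ((tendsto_rpow_neg_atTop (by norm_num : (0:ℝ) < 2)).comp hT2)).const_mul (CA σ α)
    simp only [zero_mul, add_zero, mul_zero] at this
    exact this
  have hε1 : ∀ᶠ n in atTop, ε n ≤ 1 := hεt.eventually_le_const (by norm_num)
  have hε2 : ∀ᶠ n in atTop, ε n ≤ cc α / 2 := hεt.eventually_le_const (by positivity)
  have hTp : ∀ᶠ n in atTop, 0 < T n := hT.eventually_gt_atTop 0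
  set K := |a| + |b| * (1 + 1 / α + |cd α / cc α|) with hK
  have hK0 : 0 ≤ K := by positivity
  have lim : a ^ 2 + b ^ 2 / α ^ 2 = ∫ r in Ioi (1 / 2 : ℝ), (Ioi (1:ℝ)).indicator (fun r => α * r ^ (-1 - α) * (a + b / α - b * Real.log r) ^ 2) r := by
    rw [setIntegral_indicator measurableSet_Ioi, Ioi_inter_Ioi, ← integral_quad hα]
    norm_num
  rw [lim]
  set K2 := cc α * (|a + b / α| + |b|) + K with hK2
  refine tendsto_integral_filter_of_dominated_convergence
    (fun r => α / cc α * (2 / cc α) * K2 ^ 2 * (r ^ (-1 - α) * (1 + |Real.log r|) ^ 2)) ?_ ?_ ((integrableOn_lim hα).const_mul _) ?_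
  · filter_upwards [hLB] with n hn
    have h1 := measurable_EE σ (l n) α (a + b * m n) b
    have h2 := measurable_qF (α := α) hσ hn.sm.pos.le
    exact Measurable.aestronglyMeasurable (by fun_prop)
  · filter_upwards [hLB, hε1, hε2, hTp, hpref] with n hn e1 e2 hTn hpr
    refine (ae_restrict_mem measurableSet_Ioi).mono fun r (hr : 1 / 2 < r) => ?_
    have hr0 : 0 < r := by linarith
    have hln := hn.sm.pos
    obtain ⟨d, bt, hd, hb, hdd⟩ := far_pointwise (a := a) (b := b) hσ hn.sm hα hα2 hTn hr (le_refl (ε n)) (hm n)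
    rw [hd, ← mul_assoc, hpr]
    have hbt : cc α / 2 ≤ bt := by have := (abs_le.1 hb).1; linarith
    have hg : 0 ≤ gaussS σ (T n * r) / (l n * T n ^ (-1 - α)) / r ^ (-1 - α) := by
      have : 0 < gaussS σ (T n * r) := by unfold gaussS; positivity
      positivity
    set G := gaussS σ (T n * r) / (l n * T n ^ (-1 - α)) / r ^ (-1 - α)
    have hden : cc α / 2 ≤ G + bt := by linarith
    have hL := abs_nonneg (Real.log r)
    have hd2 : |d| ≤ K2 * (1 + |Real.log r|) := by
      have t := abs_add_le (d - cc α * (a + b / α - b * Real.log r)) (cc α * (a + b / α - b * Real.log r))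
      rw [sub_add_cancel, abs_mul, abs_of_pos hcc] at t
      have t1 : |a + b / α - b * Real.log r| ≤ (|a + b / α| + |b|) * (1 + |Real.log r|) := by
        refine (abs_sub _ _).trans ?_
        rw [abs_mul]
        nlinarith [abs_nonneg (a + b / α), abs_nonneg b, abs_nonneg (Real.log r), mul_nonneg (abs_nonneg (a + b / α)) (abs_nonneg (Real.log r))]
      have t2 := mul_le_mul_of_nonneg_left t1 hcc.le
      have t3 : K * (1 + |Real.log r|) * ε n ≤ K * (1 + |Real.log r|) * 1 := mul_le_mul_of_nonneg_left e1 (by positivity)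
      rw [hK2]; linarith
    have hd3 := pow_le_pow_left₀ (abs_nonneg _) hd2 2
    rw [sq_abs] at hd3
    rw [Real.norm_of_nonneg (by have : 0 < G + bt := by linarith [half_pos hcc]
                                positivity)]
    have hq : d ^ 2 / (G + bt) ≤ (K2 * (1 + |Real.log r|)) ^ 2 / (cc α / 2) := by
      exact div_le_div₀ (by positivity) hd3 (by positivity) hden
    calc _ ≤ α / cc α * (r ^ (-1 - α) * ((K2 * (1 + |Real.log r|)) ^ 2 / (cc α / 2))) := by
          refine mul_le_mul_of_nonneg_left (mul_le_mul_of_nonneg_left hq (by positivity)) (by positivity)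
      _ = _ := by field_simp
  · have hne : ∀ᵐ r ∂(volume.restrict (Ioi (1 / 2 : ℝ))), r ≠ 1 := by
      refine ae_restrict_of_ae ?_
      exact (measure_eq_zero_iff_ae_notMem.1 (measure_singleton (1:ℝ))).mono fun r hr => by simpa using hr
    filter_upwards [ae_restrict_mem measurableSet_Ioi, hne] with r hr hr1
    have hr : 1 / 2 < r := hr
    have hr0 : 0 < r := by linarith
    -- choose sequences
    have hex : ∀ n, ∃ d bt : ℝ, (LB σ α c (l n) ∧ 0 < T n) →
        (EE σ (l n) α (a + b * m n) b (T n * r) ^ 2 / qF σ (l n) α (T n * r) =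
        (l n * T n ^ (-1 - α)) * (r ^ (-1 - α) * (d ^ 2 / (gaussS σ (T n * r) / (l n * T n ^ (-1 - α)) / r ^ (-1 - α) + bt))) ∧
      |bt - cc α| ≤ ε n ∧
      |d - cc α * (a + b / α - b * Real.log r)| ≤ K * (1 + |Real.log r|) * ε n) := by
      intro n
      by_cases hn : LB σ α c (l n) ∧ 0 < T n
      · obtain ⟨d, bt, hd⟩ := far_pointwise (a := a) (b := b) hσ hn.1.sm hα hα2 hn.2 hr (le_refl (ε n)) (hm n)
        exact ⟨d, bt, fun _ => hd⟩
      · exact ⟨0, 0, fun h => absurd h hn⟩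
    choose d bt hdb using hex
    have hev : ∀ᶠ n in atTop, LB σ α c (l n) ∧ 0 < T n := hLB.and hTp
    have td : Tendsto d atTop (𝓝 (cc α * (a + b / α - b * Real.log r))) :=
      tendsto_of_abs_le (hev.mono fun n hn => (hdb n hn).2.2) hεt
    have tb : Tendsto bt atTop (𝓝 (cc α)) := by
      refine tendsto_of_abs_le (C := 1) (hev.mono fun n hn => ?_) hεt
      rw [one_mul]; exact (hdb n hn).2.1
    have heq : ∀ᶠ n in atTop, α / cc α * (r ^ (-1 - α) * (d n ^ 2 / (gaussS σ (T n * r) / (l n * T n ^ (-1 - α)) / r ^ (-1 - α) + bt n))) =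
        pref n * (2 * T n) * (EE σ (l n) α (a + b * m n) b (T n * r) ^ 2 / qF σ (l n) α (T n * r)) := by
      filter_upwards [hev, hpref] with n hn hp
      rw [(hdb n hn).1, ← mul_assoc (pref n * (2 * T n)), hp]
    refine Tendsto.congr' heq ?_
    have hrp : 0 < r ^ (-1 - α) := by positivity
    rcases lt_or_gt_of_ne hr1 with hlt | hgt
    · rw [indicator_of_notMem (by simp; linarith)]
      have t1 := ((hφ1 r hr hlt).atTop_div_const hrp).atTop_add tb
      have t2 := (td.pow 2).div_atTop t1
      have := (t2.const_mul (r ^ (-1 - α))).const_mul (α / cc α)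
      simpa using this
    · rw [indicator_of_mem (by simpa using hgt)]
      have t1 := ((hφ2 r hgt).div_const (r ^ (-1 - α))).add tb
      rw [zero_div, zero_add] at t1
      have t2 := (td.pow 2).div t1 hcc.ne'
      have := (t2.const_mul (r ^ (-1 - α))).const_mul (α / cc α)
      convert! this using 2
      field_simp

lemma infoJ (hσ : 0 < σ) (hα : 0 < α) (hα2 : α < 2) {l T pref m : ℕ → ℝ} (a b : ℝ)
    (hl : Tendsto l atTop (𝓝[>] 0)) (hT : Tendsto T atTop atTop)
    (hm : ∀ n, m n = Real.log (T n) - cd α / cc α + 1 / α)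
    (hp0 : ∀ᶠ n in atTop, 0 ≤ pref n)
    (hpref : ∀ᶠ n in atTop, pref n * (2 * T n) * (l n * T n ^ (-1 - α)) = α / cc α)
    (hφ1 : ∀ r, 1 / 2 < r → r < 1 → Tendsto (fun n => gaussS σ (T n * r) / (l n * T n ^ (-1 - α))) atTop atTop)
    (hφ2 : ∀ r, 1 < r → Tendsto (fun n => gaussS σ (T n * r) / (l n * T n ^ (-1 - α))) atTop (𝓝 0))
    (hnear : Tendsto (fun n => pref n * T n * (1 + |m n|) ^ 2 * l n ^ 2 * Real.exp (T n ^ 2 / (8 * σ ^ 2))) atTop (𝓝 0)) :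
    Tendsto (fun n => pref n * ∫ y, EE σ (l n) α (a + b * m n) b y ^ 2 / qF σ (l n) α y)
      atTop (𝓝 (a ^ 2 + b ^ 2 / α ^ 2)) := by
  have hfar := far_limit hσ hα hα2 a b hl hT hm hpref hφ1 hφ2
  obtain ⟨c, l1, hl1, h⟩ := exists_LB hσ hα hα2
  have hLB : ∀ᶠ n in atTop, LB σ α c (l n) := hl.eventually (eventually_LB hl1 h)
  have hTp : ∀ᶠ n in atTop, 0 < T n := hT.eventually_gt_atTop 0
  have hCQ := CQ_nonneg (σ := σ) hα hα2
  set C := (CQ σ α * (|a| + |b|)) ^ 2 * c⁻¹ with hC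
  set N : ℕ → ℝ := fun n => ∫ r in Ioc (0:ℝ) (1 / 2), pref n * (2 * T n) * (EE σ (l n) α (a + b * m n) b (T n * r) ^ 2 / qF σ (l n) α (T n * r)) with hN
  -- pointwise bound near zero
  have hnb : ∀ᶠ n in atTop, ∀ r ∈ Ioc (0:ℝ) (1 / 2), ‖pref n * (2 * T n) * (EE σ (l n) α (a + b * m n) b (T n * r) ^ 2 / qF σ (l n) α (T n * r))‖
      ≤ 2 * C * (pref n * T n * (1 + |m n|) ^ 2 * l n ^ 2 * Real.exp (T n ^ 2 / (8 * σ ^ 2))) := by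
    filter_upwards [hLB, hTp, hp0] with n hn hTn hpn r hr
    have hln := hn.sm.pos
    have hc := hn.cpos
    have hq := hn.qpos (T n * r)
    have q1 := hn.q1 (T n * r)
    have hE := EE_le hσ hn.sm hα hα2 (a + b * m n) b (T n * r)
    have hE2 : Env2 (l n) α (T n * r) ≤ l n := by
      rw [Env2]
      exact mul_le_of_le_one_right hln.le (Real.rpow_le_one_of_one_le_of_nonpos (by linarith [abs_nonneg (T n * r)]) (by linarith))
    have hab : |a + b * m n| + |b| ≤ (|a| + |b|) * (1 + |m n|) := by
      have := abs_add_le a (b * m n)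
      rw [abs_mul] at this
      nlinarith [mul_nonneg (abs_nonneg a) (abs_nonneg (m n))]
    have hE3 : |EE σ (l n) α (a + b * m n) b (T n * r)| ≤ CQ σ α * ((|a| + |b|) * (1 + |m n|)) * l n := by
      refine hE.trans ?_
      exact mul_le_mul (mul_le_mul_of_nonneg_left hab hCQ) hE2 (Env2_nonneg α hln.le _) (by positivity)
    have hE4 := pow_le_pow_left₀ (abs_nonneg _) hE3 2
    rw [sq_abs] at hE4
    have hY : YY σ (T n * r) ≤ T n ^ 2 / (8 * σ ^ 2) := by
      have : (T n * r) ^ 2 ≤ T n ^ 2 / 4 := by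
        have h3 : r ^ 2 ≤ 1 / 4 := by nlinarith [hr.1, hr.2]
        nlinarith [sq_nonneg (T n)]
      rw [YY, div_le_div_iff₀ (by positivity) (by positivity)]
      nlinarith [sq_nonneg σ, mul_le_mul_of_nonneg_right this (by positivity : 0 ≤ 8 * σ ^ 2)]
    have hden : c * Real.exp (-(T n ^ 2 / (8 * σ ^ 2))) ≤ qF σ (l n) α (T n * r) :=
      le_trans (mul_le_mul_of_nonneg_left (Real.exp_le_exp.2 (neg_le_neg hY)) hc.le) q1
    have hdiv : EE σ (l n) α (a + b * m n) b (T n * r) ^ 2 / qF σ (l n) α (T n * r) ≤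
        (CQ σ α * ((|a| + |b|) * (1 + |m n|)) * l n) ^ 2 / (c * Real.exp (-(T n ^ 2 / (8 * σ ^ 2)))) :=
      div_le_div₀ (by positivity) hE4 (by positivity) hden
    rw [Real.norm_of_nonneg (by positivity)]
    calc _ ≤ pref n * (2 * T n) * ((CQ σ α * ((|a| + |b|) * (1 + |m n|)) * l n) ^ 2 / (c * Real.exp (-(T n ^ 2 / (8 * σ ^ 2))))) :=
          mul_le_mul_of_nonneg_left hdiv (by positivity)
      _ = _ := by rw [Real.exp_neg, hC]; field_simp
  have hNt : Tendsto N atTop (𝓝 0) := by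
    have hz : Tendsto (fun n => 2 * C * (pref n * T n * (1 + |m n|) ^ 2 * l n ^ 2 * Real.exp (T n ^ 2 / (8 * σ ^ 2))) * (1 / 2)) atTop (𝓝 0) := by
      simpa using (hnear.const_mul (2 * C)).mul_const (1 / 2 : ℝ)
    refine squeeze_zero_norm' ?_ hz
    filter_upwards [hnb] with n hn
    have := norm_setIntegral_le_of_norm_le_const (μ := volume) (s := Ioc (0:ℝ) (1 / 2)) (by simp) hn
    refine this.trans (le_of_eq ?_)
    congr 1
    simp
  have := hNt.add hfar
  rw [zero_add] at this
  refine this.congr' ?_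
  filter_upwards [hLB, hTp, hnb] with n hn hTn hb
  set f : ℝ → ℝ := fun y => EE σ (l n) α (a + b * m n) b y ^ 2 / qF σ (l n) α y with hf
  have hfm : Measurable f := ((measurable_EE _ _ _ _ _).pow_const 2).div (measurable_qF hσ hn.sm.pos.le)
  have hln := hn.sm.pos
  have hc := hn.cpos
  have hfi : Integrable f := by
    refine (((integrable_g2 hα).const_mul (l n)).const_mul ((CQ σ α * (|a + b * m n| + |b|)) ^ 2 * c⁻¹)).mono' hfm.aestronglyMeasurable (Eventually.of_forall fun y => ?_)
    have hq := hn.qpos y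
    have m2 := hn.m2 hα y (k := 1) (by norm_num)
    simp only [pow_one, Nat.reduceAdd] at m2
    have hE := pow_le_pow_left₀ (abs_nonneg _) (EE_le hσ hn.sm hα hα2 (a + b * m n) b y) 2
    rw [sq_abs] at hE
    rw [hf, Real.norm_of_nonneg (by positivity)]
    calc _ ≤ (CQ σ α * (|a + b * m n| + |b|) * Env2 (l n) α y) ^ 2 / qF σ (l n) α y := div_le_div_of_nonneg_right hE hq.le
      _ = (CQ σ α * (|a + b * m n| + |b|)) ^ 2 * (Env2 (l n) α y ^ 2 / qF σ (l n) α y) := by ring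
      _ ≤ (CQ σ α * (|a + b * m n| + |b|)) ^ 2 * (c⁻¹ * (l n * g2 α y)) := mul_le_mul_of_nonneg_left m2 (by positivity)
      _ = _ := by ring
  have he : ∀ y, f y = f |y| := by intro y; simp only [hf, EE_even, qF_abs]
  have hi2 : Integrable (fun r => f (T n * r)) := (integrable_comp_mul_left_iff f hTn.ne').2 hfi
  have s1 : ∫ y, f y = 2 * ∫ y in Ioi (0:ℝ), f y := by
    rw [← integral_comp_abs]; exact integral_congr_ae (Eventually.of_forall he)
  have s2 := integral_comp_mul_left_Ioi f 0 hTn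
  rw [mul_zero, smul_eq_mul] at s2
  have s3 : ∫ r in Ioi (0:ℝ), f (T n * r) = (∫ r in Ioc (0:ℝ) (1 / 2), f (T n * r)) + ∫ r in Ioi (1 / 2 : ℝ), f (T n * r) := by
    rw [← setIntegral_union (Ioc_disjoint_Ioi le_rfl) measurableSet_Ioi hi2.integrableOn hi2.integrableOn, Ioc_union_Ioi_eq_Ioi (by norm_num)]
  simp only [hN]
  rw [integral_const_mul, integral_const_mul, ← mul_add]
  change pref n * (2 * T n) * ((∫ r in Ioc (0:ℝ) (1 / 2), f (T n * r)) + ∫ r in Ioi (1 / 2 : ℝ), f (T n * r)) = pref n * ∫ y, f y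
  rw [← s3, s2, s1]
  field_simp

end PartM

section PartN

/-! ### Part N: concrete sequences -/

/-- `ln n` as a real number. -/
def LL (n : ℕ) : ℝ := Real.log n

/-- the critical scale -/
def TT (σ α : ℝ) (n : ℕ) : ℝ := σ * Mn n α

/-- the drift of the `α`-score -/
def mm (σ α : ℝ) (n : ℕ) : ℝ := Real.log (TT σ α n) - cd α / cc α + 1 / α

lemma tendsto_LL : Tendsto LL atTop atTop :=
  Real.tendsto_log_atTop.comp tendsto_natCast_atTop_atTop

lemma exp_LL {n : ℕ} (hn : 0 < n) : Real.exp (LL n) = n := Real.exp_log (by exact_mod_cast hn)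

lemma n_rpow {n : ℕ} (hn : 0 < n) (a : ℝ) : (n : ℝ) ^ a = Real.exp (a * LL n) := by
  rw [← exp_LL hn, ← Real.exp_mul, mul_comm]

lemma pow_exp_zero (a : ℝ) {c : ℝ} (hc : 0 < c) :
    Tendsto (fun n => LL n ^ a * Real.exp (-c * LL n)) atTop (𝓝 0) :=
  (tendsto_rpow_mul_exp_neg_mul_atTop_nhds_zero a c hc).comp tendsto_LL

lemma lam_exp {n : ℕ} (hn : 0 < n) (δ α : ℝ) : lam n δ α = δ ^ α * Real.exp (-(1 - α / 2) * LL n) := by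
  unfold lam
  rw [n_rpow hn, mul_comm]
  congr 2; ring

lemma rate_exp {n : ℕ} (hn : 0 < n) (α : ℝ) : rate n α = LL n ^ (α / 4) * Real.exp (-(α / 4) * LL n) := by
  unfold rate
  rw [n_rpow hn, div_eq_mul_inv, ← Real.exp_neg]
  congr 2; ring

variable {σ δ α : ℝ}

lemma TT_rpow (hσ : 0 < σ) (hα2 : α < 2) {n : ℕ} (hn : 0 < LL n) (a : ℝ) :
    TT σ α n ^ a = (σ * (2 - α) ^ (1 / 2 : ℝ)) ^ a * LL n ^ (a / 2) := by
  have h2 : 0 < 2 - α := by linarith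
  unfold TT Mn
  change (σ * √((2 - α) * LL n)) ^ a = _
  rw [Real.sqrt_eq_rpow, Real.mul_rpow h2.le hn.le, ← mul_assoc, Real.mul_rpow (by positivity) (by positivity),
    ← Real.rpow_mul hn.le]
  congr 2; ring

lemma tendsto_TT (hσ : 0 < σ) (hα2 : α < 2) : Tendsto (TT σ α) atTop atTop := by
  have h2 : 0 < 2 - α := by linarith
  refine Tendsto.const_mul_atTop hσ ?_
  exact Real.tendsto_sqrt_atTop.comp (tendsto_LL.const_mul_atTop h2)

lemma TT_exp_zero (hσ : 0 < σ) (hα2 : α < 2) (a : ℝ) {c : ℝ} (hc : 0 < c) :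
    Tendsto (fun n => TT σ α n ^ a * Real.exp (-c * LL n)) atTop (𝓝 0) := by
  have := (pow_exp_zero (a / 2) hc).const_mul ((σ * (2 - α) ^ (1 / 2 : ℝ)) ^ a)
  rw [mul_zero] at this
  refine this.congr' ?_
  filter_upwards [tendsto_LL.eventually_gt_atTop 0] with n hn
  rw [TT_rpow hσ hα2 hn]; ring

lemma tendsto_lam (hδ : 0 < δ) (hα2 : α < 2) : Tendsto (fun n => lam n δ α) atTop (𝓝[>] 0) := by
  rw [tendsto_nhdsWithin_iff]
  have h0 : ∀ᶠ n : ℕ in atTop, 0 < n := eventually_gt_atTop 0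
  constructor
  · have := (pow_exp_zero 0 (show 0 < 1 - α / 2 by linarith)).const_mul (δ ^ α)
    rw [mul_zero] at this
    refine this.congr' ?_
    filter_upwards [h0] with n hn
    rw [lam_exp hn, Real.rpow_zero, one_mul]
  · filter_upwards [h0] with n hn
    rw [lam_exp hn]
    exact mul_pos (Real.rpow_pos_of_pos hδ _) (Real.exp_pos _)

lemma mm_le (hσ : 0 < σ) (hα2 : α < 2) : ∀ᶠ n in atTop, 1 + |mm σ α n| ≤ TT σ α n := by
  have h1 : Tendsto (fun n => Real.log (TT σ α n) / TT σ α n) atTop (𝓝 0) :=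
    (Real.isLittleO_log_id_atTop.tendsto_div_nhds_zero).comp (tendsto_TT hσ hα2)
  filter_upwards [(tendsto_TT hσ hα2).eventually_ge_atTop 1, h1.eventually_le_const (show (0:ℝ) < 1 / 2 by norm_num),
    (tendsto_TT hσ hα2).eventually_ge_atTop (2 * (1 + |cd α / cc α| + |1 / α|))] with n h1 h2 h3
  rw [div_le_iff₀ (by linarith)] at h2
  have : |mm σ α n| ≤ Real.log (TT σ α n) + |cd α / cc α| + |1 / α| := by
    unfold mm
    refine (abs_add_le _ _).trans ?_
    gcongr
    refine (abs_sub _ _).trans ?_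
    gcongr
    rw [abs_of_nonneg (Real.log_nonneg h1)]
  linarith

lemma kappa0_pos (hσ : 0 < σ) (hδ : 0 < δ) (hα : 0 < α) (hα2 : α < 2) : 0 < kappa0 σ δ α := by
  unfold kappa0
  rw [cAlpha_eq hα hα2]
  have := cc_pos hα hα2
  have : 0 < 2 - α := by linarith
  positivity

/-- prefactor -/
def pref (σ δ α : ℝ) (n : ℕ) : ℝ := n * rate n α ^ 2 / kappa0 σ δ α

lemma pref_eq (hσ : 0 < σ) (hδ : 0 < δ) (hα : 0 < α) (hα2 : α < 2) {n : ℕ} (hn : 0 < LL n) (h0 : 0 < n) :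
    pref σ δ α n * lam n δ α = α / (2 * cc α) * TT σ α n ^ α := by
  have hc := cc_pos hα hα2
  have h2 : 0 < 2 - α := by linarith
  unfold pref kappa0
  rw [TT_rpow hσ hα2 hn, cAlpha_eq hα hα2, rate_exp h0, lam_exp h0, Real.mul_rpow hσ.le (by positivity),
    ← Real.rpow_mul h2.le, Real.div_rpow hδ.le hσ.le, mul_pow, ← Real.exp_nat_mul, ← Real.rpow_natCast, ← Real.rpow_mul hn.le]
  have e1 : α / 4 * ((2:ℕ):ℝ) = α / 2 := by push_cast; ring
  have e2 : (1/2:ℝ) * α = α / 2 := by ring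
  rw [e1, e2]
  have e3 : (n:ℝ) * Real.exp (((2:ℕ):ℝ) * (-(α / 4) * LL n)) * Real.exp (-(1 - α / 2) * LL n) = 1 := by
    rw [← exp_LL h0, ← Real.exp_add, ← Real.exp_add, Real.exp_eq_one_iff]
    push_cast; ring
  have hd : 0 < δ ^ α := by positivity
  have hs : 0 < σ ^ α := by positivity
  have h3 : 0 < (2 - α) ^ (α / 2) := by positivity
  have hl : 0 < LL n ^ (α / 2) := by positivity
  calc _ = ((n:ℝ) * Real.exp (((2:ℕ):ℝ) * (-(α / 4) * LL n)) * Real.exp (-(1 - α / 2) * LL n)) * (LL n ^ (α / 2) / (2 * cc α / (α * (2 - α) ^ (α / 2)) * (δ ^ α / σ ^ α)) * δ ^ α) := by ring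
    _ = _ := by rw [e3]; field_simp

lemma TT_pos (hσ : 0 < σ) (hα2 : α < 2) {n : ℕ} (hn : 0 < LL n) : 0 < TT σ α n := by
  have h2 : 0 < 2 - α := by linarith
  unfold TT Mn
  change 0 < σ * √((2 - α) * LL n)
  positivity

lemma TT_sq (hα2 : α < 2) {n : ℕ} (hn : 0 < LL n) : TT σ α n ^ 2 = σ ^ 2 * ((2 - α) * LL n) := by
  have h2 : 0 < 2 - α := by linarith
  unfold TT Mn
  change (σ * √((2 - α) * LL n)) ^ 2 = _
  rw [mul_pow, Real.sq_sqrt (by positivity)]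

lemma phi_eq (hσ : 0 < σ) (hδ : 0 < δ) (hα2 : α < 2) {n : ℕ} (hn : 0 < LL n) (h0 : 0 < n) (r : ℝ) :
    gaussS σ (TT σ α n * r) / (lam n δ α * TT σ α n ^ (-1 - α))
     = (σ * √(2 * Real.pi))⁻¹ / δ ^ α * (TT σ α n ^ (1 + α) * Real.exp (-((1 - α / 2) * (r ^ 2 - 1)) * LL n)) := by
  have hT := TT_pos hσ hα2 hn
  unfold gaussS
  rw [lam_exp h0, show -1 - α = -(1 + α) by ring, Real.rpow_neg hT.le, mul_pow, TT_sq hα2 hn]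
  have hd : 0 < δ ^ α := by positivity
  have e : Real.exp (-(σ ^ 2 * ((2 - α) * LL n) * r ^ 2 / (2 * σ ^ 2))) =
     Real.exp (-((1 - α / 2) * (r ^ 2 - 1)) * LL n) * Real.exp (-(1 - α / 2) * LL n) := by
    rw [← Real.exp_add]; congr 1; field_simp; ring
  rw [e]
  have := (Real.exp_pos (-(1 - α / 2) * LL n)).ne'
  have : TT σ α n ^ (1 + α) ≠ 0 := by positivity
  field_simp

lemma infoJ' (hσ : 0 < σ) (hδ : 0 < δ) (hα : 0 < α) (hα2 : α < 2) (a b : ℝ) :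
    Tendsto (fun n => pref σ δ α n * ∫ y, EE σ (lam n δ α) α (a + b * mm σ α n) b y ^ 2 / qF σ (lam n δ α) α y)
      atTop (𝓝 (a ^ 2 + b ^ 2 / α ^ 2)) := by
  have h0 : ∀ᶠ n : ℕ in atTop, 0 < n := eventually_gt_atTop 0
  have hL : ∀ᶠ n : ℕ in atTop, 0 < LL n := tendsto_LL.eventually_gt_atTop 0
  have hc := cc_pos hα hα2
  have hC : 0 < (σ * √(2 * Real.pi))⁻¹ / δ ^ α := by positivity
  have h2 : 0 < 2 - α := by linarith
  refine infoJ hσ hα hα2 (m := mm σ α) a b (tendsto_lam hδ hα2) (tendsto_TT hσ hα2) (fun n => rfl) ?_ ?_ ?_ ?_ ?_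
  · refine Eventually.of_forall fun n => ?_
    have := kappa0_pos hσ hδ hα hα2
    unfold pref; positivity
  · filter_upwards [h0, hL] with n h0 hn
    have hT := TT_pos hσ hα2 hn
    have := pref_eq hσ hδ hα hα2 hn h0
    calc _ = (pref σ δ α n * lam n δ α) * (2 * (TT σ α n * TT σ α n ^ (-1 - α))) := by ring
      _ = _ := by
        rw [this, show -1 - α = -(1 + α) by ring, Real.rpow_neg hT.le, Real.rpow_add hT, Real.rpow_one]
        have : TT σ α n ^ α ≠ 0 := by positivity
        field_simp
  · intro r hr hr1
    have hk : 0 < -((1 - α / 2) * (r ^ 2 - 1)) := by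
      have h3 : 0 < 1 - r ^ 2 := by nlinarith
      have h4 : 0 < 1 - α / 2 := by linarith
      have := mul_pos h4 h3
      linarith
    have t1 : Tendsto (fun n => Real.exp (-((1 - α / 2) * (r ^ 2 - 1)) * LL n)) atTop atTop :=
      Real.tendsto_exp_atTop.comp (tendsto_LL.const_mul_atTop hk)
    have t2 : Tendsto (fun n => TT σ α n ^ (1 + α)) atTop atTop :=
      (tendsto_rpow_atTop (by linarith)).comp (tendsto_TT hσ hα2)
    refine ((t2.atTop_mul_atTop₀ t1).const_mul_atTop hC).congr' ?_
    filter_upwards [h0, hL] with n h0 hn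
    rw [phi_eq hσ hδ hα2 hn h0]
  · intro r hr
    have hk : 0 < (1 - α / 2) * (r ^ 2 - 1) := by
      have : 0 < r ^ 2 - 1 := by nlinarith
      have : 0 < 1 - α / 2 := by linarith
      positivity
    have t := (TT_exp_zero hσ hα2 (1 + α) hk).const_mul ((σ * √(2 * Real.pi))⁻¹ / δ ^ α)
    rw [mul_zero] at t
    refine t.congr' ?_
    filter_upwards [h0, hL] with n h0 hn
    rw [phi_eq hσ hδ hα2 hn h0]
  · have t := (TT_exp_zero hσ hα2 (3 + α) (show 0 < 3 / 8 * (2 - α) by positivity)).const_mul (α / (2 * cc α) * δ ^ α)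
    rw [mul_zero] at t
    refine squeeze_zero' ?_ ?_ t
    · filter_upwards [h0, hL] with n h0 hn
      have hT := TT_pos hσ hα2 hn
      have := kappa0_pos hσ hδ hα hα2
      unfold pref; positivity
    · filter_upwards [h0, hL, mm_le hσ hα2] with n h0 hn hm
      have hT := TT_pos hσ hα2 hn
      have e1 := pref_eq hσ hδ hα hα2 hn h0
      have e2 : TT σ α n ^ (3 + α) = TT σ α n ^ α * TT σ α n * TT σ α n ^ 2 := by
        rw [add_comm, Real.rpow_add hT]; norm_cast; ring
      have e3 : lam n δ α * Real.exp (TT σ α n ^ 2 / (8 * σ ^ 2)) = δ ^ α * Real.exp (-(3 / 8 * (2 - α)) * LL n) := by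
        rw [lam_exp h0, TT_sq hα2 hn, mul_assoc, ← Real.exp_add]; congr 2; field_simp; ring
      calc _ = (pref σ δ α n * lam n δ α) * TT σ α n * (lam n δ α * Real.exp (TT σ α n ^ 2 / (8 * σ ^ 2))) * (1 + |mm σ α n|) ^ 2 := by ring
        _ ≤ (pref σ δ α n * lam n δ α) * TT σ α n * (lam n δ α * Real.exp (TT σ α n ^ 2 / (8 * σ ^ 2))) * (TT σ α n) ^ 2 := by
          have : 0 ≤ (pref σ δ α n * lam n δ α) * TT σ α n * (lam n δ α * Real.exp (TT σ α n ^ 2 / (8 * σ ^ 2))) := by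
            rw [e1, e3]; positivity
          gcongr
        _ = _ := by rw [e1, e3, e2]; ring

end PartN

section PartO

/-! ### Part O: moments, Gram matrix, the observation measure -/

section
variable {σ α c l : ℝ}

lemma mom (hσ : 0 < σ) (hα : 0 < α) (h : LB σ α c l) {f : ℝ → ℝ} (hf : Measurable f) {A B : ℝ} (hA : 0 ≤ A) (hB : 0 ≤ B)
    (hb : ∀ y, |f y| ≤ A * Env1 σ y + B * Env2 l α y) {k : ℕ} (hk : k ≤ 3) :
    Integrable (fun y => |f y| ^ (k + 1) / qF σ l α y ^ k) ∧
    ∫ y, |f y| ^ (k + 1) / qF σ l α y ^ k ≤ 2 ^ k * (c⁻¹) ^ k * (A ^ (k + 1) * (∫ y, g1 σ y) + B ^ (k + 1) * (l * ∫ y, g2 α y)) := by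
  have hl := h.sm.pos
  have hc := h.cpos
  have bound : ∀ y, |f y| ^ (k + 1) / qF σ l α y ^ k ≤ 2 ^ k * (c⁻¹) ^ k * (A ^ (k + 1) * g1 σ y + B ^ (k + 1) * (l * g2 α y)) := by
    intro y
    have hq := h.qpos y
    have m1 := h.m1 y hk
    have m2 := h.m2 hα y hk
    have e1 := Env1_nonneg σ y
    have e2 := Env2_nonneg α hl.le y
    calc |f y| ^ (k + 1) / qF σ l α y ^ k ≤ (A * Env1 σ y + B * Env2 l α y) ^ (k + 1) / qF σ l α y ^ k := by
          gcongr; exact hb y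
      _ ≤ 2 ^ k * ((A * Env1 σ y) ^ (k + 1) + (B * Env2 l α y) ^ (k + 1)) / qF σ l α y ^ k := by
          gcongr
          have := add_pow_le (mul_nonneg hA e1) (mul_nonneg hB e2) (k + 1)
          simpa using this
      _ = 2 ^ k * (A ^ (k + 1) * (Env1 σ y ^ (k + 1) / qF σ l α y ^ k) + B ^ (k + 1) * (Env2 l α y ^ (k + 1) / qF σ l α y ^ k)) := by
          rw [mul_pow, mul_pow]; ring
      _ ≤ 2 ^ k * (A ^ (k + 1) * ((c⁻¹) ^ k * g1 σ y) + B ^ (k + 1) * ((c⁻¹) ^ k * (l * g2 α y))) := by gcongr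
      _ = _ := by ring
  have i1 := (integrable_g1 hσ).const_mul (A ^ (k + 1))
  have i2 := ((integrable_g2 hα).const_mul l).const_mul (B ^ (k + 1))
  have ib := (i1.add i2).const_mul (2 ^ k * (c⁻¹) ^ k)
  have hm : Measurable fun y => |f y| ^ (k + 1) / qF σ l α y ^ k := by
    have := measurable_qF (α := α) hσ hl.le
    fun_prop
  have hi : Integrable (fun y => |f y| ^ (k + 1) / qF σ l α y ^ k) := by
    refine ib.mono' hm.aestronglyMeasurable (Eventually.of_forall fun y => ?_)
    have hq := h.qpos y
    rw [Real.norm_of_nonneg (by positivity)]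
    exact bound y
  refine ⟨hi, (integral_mono hi ib bound).trans ?_⟩
  simp only [Pi.add_apply]
  rw [integral_const_mul, integral_add i1 i2, integral_const_mul, integral_const_mul, integral_const_mul]

lemma mom_sq (hσ : 0 < σ) (hα : 0 < α) (h : LB σ α c l) {f : ℝ → ℝ} (hf : Measurable f) {A B : ℝ} (hA : 0 ≤ A) (hB : 0 ≤ B)
    (hb : ∀ y, |f y| ≤ A * Env1 σ y + B * Env2 l α y) : Integrable (fun y => f y ^ 2 / qF σ l α y) := by
  have := (mom hσ hα h hf hA hB hb (k := 1) (by norm_num)).1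
  simpa using this

end

variable {σ δ α : ℝ}

/-- local parametrisation (linear) -/
def pz (σ δ α : ℝ) (n : ℕ) (ζ : Fin 3 → ℝ) : Fin 3 → ℝ :=
  ![ζ 0 / √(2 * n), rate n α / √(kappa0 σ δ α) * (ζ 1 + α * ζ 2 * mm σ α n), rate n α / √(kappa0 σ δ α) * (α * ζ 2)]

lemma gram (hσ : 0 < σ) (hδ : 0 < δ) (hα : 0 < α) (hα2 : α < 2) (ζ : Fin 3 → ℝ) :
    Tendsto (fun n : ℕ => n * ∫ y, Q1 σ (lam n δ α) α (pz σ δ α n ζ) y ^ 2 / qF σ (lam n δ α) α y) atTop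
      (𝓝 (ζ 0 ^ 2 + ζ 1 ^ 2 + ζ 2 ^ 2)) := by
  obtain ⟨c, l1, hl1, h⟩ := exists_LB hσ hα hα2
  have hl := tendsto_lam hδ hα2
  have hκ := kappa0_pos hσ hδ hα hα2
  have hLB : ∀ᶠ n in atTop, LB σ α c (lam n δ α) := hl.eventually (eventually_LB hl1 h)
  have h0 : ∀ᶠ n : ℕ in atTop, 0 < n := eventually_gt_atTop 0
  have hL : ∀ᶠ n : ℕ in atTop, 0 < LL n := tendsto_LL.eventually_gt_atTop 0
  have T1 := ((info11 hσ hα hα2).comp hl).const_mul (ζ 0 ^ 2 / 2)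
  have T2 := infoJ' hσ hδ hα hα2 (ζ 1) (α * ζ 2)
  have T3 : Tendsto (fun n : ℕ => 2 * n * (ζ 0 / √(2 * n)) * (rate n α / √(kappa0 σ δ α)) *
     ∫ y, Q1 σ (lam n δ α) α ![1, 0, 0] y * EE σ (lam n δ α) α (ζ 1 + α * ζ 2 * mm σ α n) (α * ζ 2) y / qF σ (lam n δ α) α y) atTop (𝓝 0) := by
    have t := (TT_exp_zero hσ hα2 (α / 2 + 1) (show 0 < (2 - α) / 8 by linarith)).const_mul
      (2 * (|ζ 0| / √2 / √(kappa0 σ δ α)) * CX σ α c * (|ζ 1| + |α * ζ 2|) * (δ ^ α) ^ (3 / 4 : ℝ) * ((σ * (2 - α) ^ (1 / 2 : ℝ)) ^ (α / 2))⁻¹)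
    rw [mul_zero] at t
    refine squeeze_zero_norm' ?_ t
    filter_upwards [hLB, h0, hL, mm_le hσ hα2] with n hn h0 hL hm
    have hT := TT_pos hσ hα2 hL
    have h2 : 0 < 2 - α := by linarith
    obtain ⟨-, hb⟩ := cross hσ hα hα2 hn (ζ 1 + α * ζ 2 * mm σ α n) (α * ζ 2)
    have hCX : 0 ≤ CX σ α c * (lam n δ α) ^ (3 / 4 : ℝ) := by
      obtain ⟨-, hb1⟩ := cross hσ hα hα2 hn 1 0
      have := (abs_nonneg _).trans hb1
      simpa using this
    have hρ : 0 ≤ rate n α := by rw [rate_exp h0]; positivity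
    have e1 : |ζ 1 + α * ζ 2 * mm σ α n| + |α * ζ 2| ≤ (|ζ 1| + |α * ζ 2|) * TT σ α n := by
      have a1 := abs_add_le (ζ 1) (α * ζ 2 * mm σ α n)
      rw [abs_mul (α * ζ 2)] at a1
      have b1 := abs_nonneg (ζ 1)
      have b2 := abs_nonneg (α * ζ 2)
      have b3 := abs_nonneg (mm σ α n)
      nlinarith
    rw [Real.norm_eq_abs, abs_mul]
    have hn0 : (0:ℝ) < n := by exact_mod_cast h0
    have e2 : |2 * (n:ℝ) * (ζ 0 / √(2 * n)) * (rate n α / √(kappa0 σ δ α))| = 2 * (|ζ 0| / √2 / √(kappa0 σ δ α)) * (√n * rate n α) := by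
      rw [abs_mul, abs_mul, abs_mul, abs_div, abs_div, abs_of_nonneg hρ, abs_of_nonneg (Real.sqrt_nonneg _), abs_of_nonneg (Real.sqrt_nonneg _),
        abs_of_pos hn0, Real.sqrt_mul (by norm_num : (0:ℝ) ≤ 2), abs_of_pos (by norm_num : (0:ℝ) < 2)]
      have : √(n:ℝ) ≠ 0 := by positivity
      nth_rewrite 1 [← Real.mul_self_sqrt hn0.le]
      field_simp
    have e3 : √(n:ℝ) * rate n α * (lam n δ α) ^ (3 / 4 : ℝ) = (δ ^ α) ^ (3 / 4 : ℝ) * ((σ * (2 - α) ^ (1 / 2 : ℝ)) ^ (α / 2))⁻¹ * TT σ α n ^ (α / 2) * Real.exp (-((2 - α) / 8) * LL n) := by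
      rw [TT_rpow hσ hα2 hL, rate_exp h0, lam_exp h0, Real.sqrt_eq_rpow, n_rpow h0, Real.mul_rpow (by positivity) (by positivity), ← Real.exp_mul,
        show α / 2 / 2 = α / 4 by ring]
      have hz : (σ * (2 - α) ^ (1 / 2 : ℝ)) ^ (α / 2) ≠ 0 := by positivity
      have : Real.exp (-((2 - α) / 8) * LL n) = Real.exp (1 / 2 * LL n) * Real.exp (-(α / 4) * LL n) * Real.exp (-(1 - α / 2) * LL n * (3 / 4)) := by
        rw [← Real.exp_add, ← Real.exp_add]; congr 1; ring
      rw [this]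
      field_simp
    have e4 : TT σ α n ^ (α / 2 + 1) = TT σ α n ^ (α / 2) * TT σ α n := by rw [Real.rpow_add hT, Real.rpow_one]
    rw [e2, e4]
    calc _ ≤ 2 * (|ζ 0| / √2 / √(kappa0 σ δ α)) * (√n * rate n α) * (CX σ α c * (|ζ 1 + α * ζ 2 * mm σ α n| + |α * ζ 2|) * lam n δ α ^ (3 / 4 : ℝ)) := by gcongr
      _ = 2 * (|ζ 0| / √2 / √(kappa0 σ δ α)) * (√n * rate n α) * ((CX σ α c * lam n δ α ^ (3 / 4 : ℝ)) * (|ζ 1 + α * ζ 2 * mm σ α n| + |α * ζ 2|)) := by ring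
      _ ≤ 2 * (|ζ 0| / √2 / √(kappa0 σ δ α)) * (√n * rate n α) * ((CX σ α c * lam n δ α ^ (3 / 4 : ℝ)) * ((|ζ 1| + |α * ζ 2|) * TT σ α n)) := by gcongr
      _ = 2 * (|ζ 0| / √2 / √(kappa0 σ δ α)) * CX σ α c * (|ζ 1| + |α * ζ 2|) * TT σ α n * (√(n:ℝ) * rate n α * (lam n δ α) ^ (3 / 4 : ℝ)) := by ring
      _ = _ := by rw [e3]; ring
  have T := (T1.add T3).add T2
  have lim : ζ 0 ^ 2 / 2 * 2 + 0 + (ζ 1 ^ 2 + (α * ζ 2) ^ 2 / α ^ 2) = ζ 0 ^ 2 + ζ 1 ^ 2 + ζ 2 ^ 2 := by field_simp; ring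
  rw [lim] at T
  refine T.congr' ?_
  filter_upwards [hLB, h0] with n hn h0
  have hn0 : (0:ℝ) < n := by exact_mod_cast h0
  have hS := hn.sm
  set l := lam n δ α
  set u := ζ 0 / √(2 * n) with hu
  set v := rate n α / √(kappa0 σ δ α) with hv
  set a' := ζ 1 + α * ζ 2 * mm σ α n with ha'
  obtain ⟨ic, -⟩ := cross hσ hα hα2 hn a' (α * ζ 2)
  have iA : Integrable fun y => Q1 σ l α ![1, 0, 0] y ^ 2 / qF σ l α y := by
    refine mom_sq hσ hα hn (measurable_Q1 _ _ _ _) (A := |CG σ|) (B := |CQ σ α|) (abs_nonneg _) (abs_nonneg _) fun y => ?_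
    have e1 := Env1_nonneg σ y
    have e2 := Env2_nonneg α hS.pos.le y
    refine (Q1e0_le hσ hS hα hα2 y).trans ?_
    gcongr <;> exact le_abs_self _
  have iE : Integrable fun y => EE σ l α a' (α * ζ 2) y ^ 2 / qF σ l α y := by
    refine mom_sq hσ hα hn (measurable_EE _ _ _ _ _) (A := 0) (B := |CQ σ α| * (|a'| + |α * ζ 2|)) le_rfl (by positivity) fun y => ?_
    have e2 := Env2_nonneg α hS.pos.le y
    refine (EE_le hσ hS hα hα2 _ _ y).trans ?_
    rw [zero_mul, zero_add]
    gcongr; exact le_abs_self _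
  have key : ∀ y, Q1 σ l α (pz σ δ α n ζ) y ^ 2 / qF σ l α y = u ^ 2 * (Q1 σ l α ![1, 0, 0] y ^ 2 / qF σ l α y) +
      2 * u * v * (Q1 σ l α ![1, 0, 0] y * EE σ l α a' (α * ζ 2) y / qF σ l α y) + v ^ 2 * (EE σ l α a' (α * ζ 2) y ^ 2 / qF σ l α y) := by
    intro y
    have e : Q1 σ l α (pz σ δ α n ζ) y = u * Q1 σ l α ![1, 0, 0] y + v * EE σ l α a' (α * ζ 2) y := by
      rw [Q1_lin hσ hS hα hα2]
      simp only [pz, EE, Matrix.cons_val_zero, Matrix.cons_val_one, Matrix.cons_val]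
      rw [← hu, ← hv, ← ha']; ring
    rw [e]; ring
  simp_rw [key]
  have iAc : Integrable fun y => u ^ 2 * (Q1 σ l α ![1, 0, 0] y ^ 2 / qF σ l α y) +
      2 * u * v * (Q1 σ l α ![1, 0, 0] y * EE σ l α a' (α * ζ 2) y / qF σ l α y) := (iA.const_mul _).add (ic.const_mul _)
  rw [integral_add iAc (iE.const_mul _), integral_add (iA.const_mul _) (ic.const_mul _),
    integral_const_mul, integral_const_mul, integral_const_mul]
  have e1 : (n:ℝ) * u ^ 2 = ζ 0 ^ 2 / 2 := by
    rw [hu, div_pow, Real.sq_sqrt (by positivity)]; field_simp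
  have e2 : (n:ℝ) * v ^ 2 = pref σ δ α n := by
    rw [hv, div_pow, Real.sq_sqrt hκ.le, pref]; ring
  simp only [Function.comp]
  rw [← e1, ← e2]; ring

/-- the one-observation law -/
def nuM (n : ℕ) (θ : Fin 3 → ℝ) : Measure ℝ :=
  MeasureTheory.volume.withDensity fun y => ENNReal.ofReal (pdens n θ y)

lemma nuM_eq (hσ : 0 < σ) (hδ : 0 < δ) (hα : 0 < α) (hα2 : α < 2) {n : ℕ} (hn : 0 < n) :
    nuM n ![σ, δ, α] = MeasureTheory.volume.withDensity fun x => ENNReal.ofReal (√n * qF σ (lam n δ α) α (√n * x)) := by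
  unfold nuM
  congr 1; ext x
  rw [pdens_eq n hn _ (by simpa using hσ) (by simpa using hδ) (by simpa using hα)]
  simp

lemma nuM_integral {c : ℝ} (hσ : 0 < σ) (hδ : 0 < δ) (hα : 0 < α) (hα2 : α < 2) {n : ℕ} (hn : 0 < n) (h : LB σ α c (lam n δ α))
    (F : ℝ → ℝ) :
    (Integrable (fun y => F y * qF σ (lam n δ α) α y) → Integrable (fun x => F (√n * x)) (nuM n ![σ, δ, α])) ∧
    ∫ x, F (√n * x) ∂(nuM n ![σ, δ, α]) = ∫ y, F y * qF σ (lam n δ α) α y := by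
  have hn0 : (0:ℝ) < √n := Real.sqrt_pos.2 (by exact_mod_cast hn)
  have hm : Measurable fun x : ℝ => ENNReal.ofReal (√n * qF σ (lam n δ α) α (√n * x)) := by
    have := measurable_qF (α := α) hσ h.sm.pos.le
    fun_prop
  have hfin : ∀ᵐ x : ℝ, ENNReal.ofReal (√n * qF σ (lam n δ α) α (√n * x)) < ⊤ := Eventually.of_forall fun _ => ENNReal.ofReal_lt_top
  have e : ∀ x : ℝ, (ENNReal.ofReal (√n * qF σ (lam n δ α) α (√n * x))).toReal • F (√n * x) = √n * (fun y => F y * qF σ (lam n δ α) α y) (√n * x) := by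
    intro x
    rw [ENNReal.toReal_ofReal (mul_pos hn0 (h.qpos _)).le, smul_eq_mul]; ring
  rw [nuM_eq hσ hδ hα hα2 hn]
  constructor
  · intro hi
    rw [integrable_withDensity_iff_integrable_smul' hm hfin]
    simp_rw [e]
    exact (hi.comp_mul_left' hn0.ne').const_mul _
  · rw [integral_withDensity_eq_integral_toReal_smul hm hfin]
    simp only [e]
    have := Measure.integral_comp_mul_left (fun y => F y * qF σ (lam n δ α) α y) (√n)
    rw [integral_const_mul, this]
    rw [abs_of_pos (by positivity), smul_eq_mul, ← mul_assoc, mul_inv_cancel₀ hn0.ne', one_mul]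

lemma nuM_prob {c : ℝ} (hσ : 0 < σ) (hδ : 0 < δ) (hα : 0 < α) (hα2 : α < 2) {n : ℕ} (hn : 0 < n) (h : LB σ α c (lam n δ α)) :
    IsProbabilityMeasure (nuM n ![σ, δ, α]) := by
  have hi := (nuM_integral hσ hδ hα hα2 hn h (fun _ => 1)).1 (by simpa using integrable_qF hσ h.sm hα hα2)
  have he := (nuM_integral hσ hδ hα hα2 hn h (fun _ => 1)).2
  simp only [one_mul, integral_qF hσ h.sm hα hα2] at he
  have : IsFiniteMeasure (nuM n ![σ, δ, α]) := by
    rw [integrable_const_iff] at hi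
    simpa using hi
  constructor
  rw [integral_const, smul_eq_mul, mul_one] at he
  rwa [← ENNReal.toReal_eq_one_iff]

end PartO

section PartP

/-! ### Part P: the local expansion packaged -/

/-- Local expansion data for one observation. -/
structure Blk (n : ℕ) (ν : Measure ℝ) (R τ : ℝ) (ξ : Fin 3 → ℝ → ℝ) (η : Fin 6 → ℝ → ℝ) (e : ℕ → ℝ → ℝ)
    (cf : (Fin 3 → ℝ) → Fin 6 → ℝ) (r : (Fin 3 → ℝ) → ℝ → ℝ) : Prop where
  prob : IsProbabilityMeasure ν
  one_le : 1 ≤ R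
  mξ : ∀ i, Measurable (ξ i)
  mη : ∀ k, Measurable (η k)
  me : ∀ j, Measurable (e j)
  cr : ∀ x, Continuous fun ζ => r ζ x
  mr : ∀ ζ, Measurable (r ζ)
  e0 : ∀ x, 0 ≤ e 3 x
  e32 : ∀ x, e 3 x ≤ e 2 x
  e21 : ∀ x, e 2 x ≤ e 1 x
  ξle : ∀ ζ : Fin 3 → ℝ, (∀ i, |ζ i| ≤ R) → ∀ x, |∑ i, ζ i * ξ i x| ≤ e 1 x
  cfle : ∀ ζ : Fin 3 → ℝ, (∀ i, |ζ i| ≤ R) → ∀ k, |cf ζ k| ≤ 3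
  ηle : ∀ ζ : Fin 3 → ℝ, (∀ i, |ζ i| ≤ R) → ∀ x, |∑ k, cf ζ k * η k x| ≤ e 2 x
  rem : ∀ ζ : Fin 3 → ℝ, (∀ i, |ζ i| ≤ R) → ∀ x, |r ζ x - (∑ i, ζ i * ξ i x) - (1 / 2) * ∑ k, cf ζ k * η k x| ≤ e 3 x
  ξ0 : ∀ i, ∫ x, ξ i x ∂ν = 0
  η0 : ∀ k, ∫ x, η k x ∂ν = 0
  iη : ∀ k, Integrable (fun x => η k x ^ 2) ν
  bη : ∀ k, n * ∫ x, η k x ^ 2 ∂ν ≤ τ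
  i3 : Integrable (e 3) ν
  b3 : n * ∫ x, e 3 x ∂ν ≤ τ
  i13 : Integrable (fun x => e 1 x ^ 3) ν
  b13 : n * ∫ x, e 1 x ^ 3 ∂ν ≤ τ
  i14 : Integrable (fun x => e 1 x ^ 4) ν
  b14 : n * ∫ x, e 1 x ^ 4 ∂ν ≤ τ
  i12 : Integrable (fun x => e 1 x * e 2 x) ν
  b12 : n * ∫ x, e 1 x * e 2 x ∂ν ≤ τ

/-- scale for the Gaussian parameter -/
def xs (α : ℝ) (n : ℕ) : ℝ := Real.exp (-(1 / 2 - α / 64) * LL n)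
/-- scale for the jump parameters -/
def ss (α : ℝ) (n : ℕ) : ℝ := Real.exp (-(α / 4 - α / 64) * LL n)

/-- envelope numerators -/
def eN (σ δ α : ℝ) (n : ℕ) (j : ℕ) (y : ℝ) : ℝ :=
  CE σ α * (xs α n ^ j * Env1 σ y + ss α n ^ j * Env2 (lam n δ α) α y)

/-- the six directions -/
def DD (α : ℝ) (n : ℕ) : Fin 6 → Fin 3 → ℝ :=
  ![![xs α n, 0, 0], ![0, ss α n, 0], ![0, 0, ss α n], ![xs α n, ss α n, 0], ![xs α n, 0, ss α n], ![0, ss α n, ss α n]]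

/-- coefficients of the quadratic form -/
def cfA (a b c : ℝ) : Fin 6 → ℝ :=
  ![a ^ 2 - a * b - a * c, b ^ 2 - a * b - b * c, c ^ 2 - a * c - b * c, a * b, a * c, b * c]

def cfF (σ δ α : ℝ) (n : ℕ) (ζ : Fin 3 → ℝ) : Fin 6 → ℝ :=
  cfA (pz σ δ α n ζ 0 / xs α n) (pz σ δ α n ζ 1 / ss α n) (pz σ δ α n ζ 2 / ss α n)

def xiF (σ δ α : ℝ) (n : ℕ) (i : Fin 3) (x : ℝ) : ℝ :=
  Q1 σ (lam n δ α) α (pz σ δ α n (Pi.single i 1)) (√n * x) / qF σ (lam n δ α) α (√n * x)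

def etaF (σ δ α : ℝ) (n : ℕ) (k : Fin 6) (x : ℝ) : ℝ :=
  Q2 σ (lam n δ α) α (DD α n k) (√n * x) / qF σ (lam n δ α) α (√n * x)

def eF (σ δ α : ℝ) (n : ℕ) (j : ℕ) (x : ℝ) : ℝ := eN σ δ α n j (√n * x) / qF σ (lam n δ α) α (√n * x)

def rF (σ δ α : ℝ) (n : ℕ) (ζ : Fin 3 → ℝ) (x : ℝ) : ℝ :=
  qP σ (lam n δ α) α (pz σ δ α n ζ) (√n * x) / qF σ (lam n δ α) α (√n * x) - 1

lemma xs_pos (α : ℝ) (n : ℕ) : 0 < xs α n := Real.exp_pos _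
lemma ss_pos (α : ℝ) (n : ℕ) : 0 < ss α n := Real.exp_pos _

variable {σ δ α : ℝ}

lemma xs_le_ss (hα2 : α < 2) {n : ℕ} (hL : 0 < LL n) : xs α n ≤ ss α n := by
  unfold xs ss
  rw [Real.exp_le_exp]
  nlinarith

lemma tendsto_ss (hα : 0 < α) : Tendsto (ss α) atTop (𝓝 0) := by
  have := pow_exp_zero 0 (show 0 < α / 4 - α / 64 by linarith)
  simp only [Real.rpow_zero, one_mul] at this
  exact this

lemma pz_lin (σ δ α : ℝ) (n : ℕ) (ζ : Fin 3 → ℝ) : pz σ δ α n ζ = ζ 0 • pz σ δ α n (Pi.single 0 1) + ζ 1 • pz σ δ α n (Pi.single 1 1) +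
    ζ 2 • pz σ δ α n (Pi.single 2 1) := by
  ext i; fin_cases i
  · simp [pz]; ring
  · simp [pz]; ring
  · simp [pz]; ring

lemma pz_small (hσ : 0 < σ) (hδ : 0 < δ) (hα : 0 < α) (hα2 : α < 2) : ∀ᶠ n in atTop, ∀ ζ : Fin 3 → ℝ, (∀ i, |ζ i| ≤ LL n) →
    |pz σ δ α n ζ 0| ≤ xs α n ∧ |pz σ δ α n ζ 1| ≤ ss α n ∧ |pz σ δ α n ζ 2| ≤ ss α n := by
  have hκ := kappa0_pos hσ hδ hα hα2
  have h0 : ∀ᶠ n : ℕ in atTop, 0 < n := eventually_gt_atTop 0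
  have hL : ∀ᶠ n : ℕ in atTop, 0 < LL n := tendsto_LL.eventually_gt_atTop 0
  have t1 := pow_exp_zero 1 (show 0 < α / 64 by linarith)
  have t2 := (TT_exp_zero hσ hα2 (α / 2 + 3) (show 0 < α / 64 by linarith)).const_mul
    ((1 + α) / √(kappa0 σ δ α) * ((σ * (2 - α) ^ (1 / 2 : ℝ)) ^ (α / 2 + 2))⁻¹)
  rw [mul_zero] at t2
  filter_upwards [h0, hL, t1.eventually_le_const (show (0:ℝ) < 1 by norm_num), t2.eventually_le_const (show (0:ℝ) < 1 by norm_num),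
    mm_le hσ hα2] with n h0 hL t1 t2 hm ζ hζ
  have hn0 : (0:ℝ) < n := by exact_mod_cast h0
  have hT := TT_pos hσ hα2 hL
  have h2 : 0 < 2 - α := by linarith
  rw [Real.rpow_one] at t1
  have hρ : 0 ≤ rate n α := by rw [rate_exp h0]; positivity
  have b3 := abs_nonneg (mm σ α n)
  have hTT : 1 ≤ TT σ α n := by linarith
  -- main bound
  have M : rate n α / √(kappa0 σ δ α) * ((1 + α) * LL n * TT σ α n) ≤ ss α n := by
    have e1 : TT σ α n ^ (α / 2 + 3) = (σ * (2 - α) ^ (1 / 2 : ℝ)) ^ (α / 2 + 2) * LL n ^ (α / 4) * LL n * TT σ α n := by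
      rw [show α / 2 + 3 = (α / 2 + 2) + 1 by ring, Real.rpow_add hT, Real.rpow_one, TT_rpow hσ hα2 hL,
        show (α / 2 + 2) / 2 = α / 4 + 1 by ring, Real.rpow_add hL, Real.rpow_one]; ring
    have e2 : Real.exp (-(α / 4) * LL n) = ss α n * Real.exp (-(α / 64) * LL n) := by
      unfold ss; rw [← Real.exp_add]; congr 1; ring
    have hz : (σ * (2 - α) ^ (1 / 2 : ℝ)) ^ (α / 2 + 2) ≠ 0 := by positivity
    rw [e1] at t2
    rw [rate_exp h0, e2]
    calc _ = ss α n * ((1 + α) / √(kappa0 σ δ α) * ((σ * (2 - α) ^ (1 / 2 : ℝ)) ^ (α / 2 + 2))⁻¹ * ((σ * (2 - α) ^ (1 / 2 : ℝ)) ^ (α / 2 + 2) * LL n ^ (α / 4) * LL n * TT σ α n * Real.exp (-(α / 64) * LL n))) := by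
          field_simp
      _ ≤ ss α n * 1 := by gcongr; exact (ss_pos α n).le
      _ = _ := mul_one _
  refine ⟨?_, ?_, ?_⟩
  · simp only [pz, Matrix.cons_val_zero]
    rw [abs_div, abs_of_nonneg (Real.sqrt_nonneg _), div_le_iff₀ (by positivity)]
    have e1 : √(2 * (n:ℝ)) = √2 * Real.exp (1 / 2 * LL n) := by
      rw [Real.sqrt_mul (by norm_num : (0:ℝ) ≤ 2), Real.sqrt_eq_rpow (n:ℝ), n_rpow h0]
    have e2 : xs α n = Real.exp (-(1 / 2 * LL n)) * Real.exp (α / 64 * LL n) := by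
      unfold xs; rw [← Real.exp_add]; congr 1; ring
    have e3 : xs α n * √(2 * (n:ℝ)) = √2 * Real.exp (α / 64 * LL n) := by
      rw [e1, e2, Real.exp_neg]
      have := (Real.exp_pos (1 / 2 * LL n)).ne'
      field_simp
    rw [e3]
    have : LL n ≤ Real.exp (α / 64 * LL n) := by
      rw [neg_mul, Real.exp_neg, ← div_eq_mul_inv, div_le_one (Real.exp_pos _)] at t1
      exact t1
    have h2 : (1:ℝ) ≤ √2 := by rw [Real.one_le_sqrt]; norm_num
    have := Real.exp_pos (α / 64 * LL n)
    nlinarith [hζ 0]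
  · simp only [pz, Matrix.cons_val_one, Matrix.cons_val_zero]
    rw [abs_mul, abs_of_nonneg (by positivity)]
    refine le_trans ?_ M
    gcongr
    refine (abs_add_le _ _).trans ?_
    rw [abs_mul, abs_mul, abs_of_pos hα]
    have h1 := hζ 1
    have h2 := hζ 2
    calc |ζ 1| + α * |ζ 2| * |mm σ α n| ≤ LL n * 1 + α * LL n * TT σ α n := by
          rw [mul_one]; gcongr; linarith
      _ ≤ LL n * TT σ α n + α * LL n * TT σ α n := by gcongr
      _ = _ := by ring
  · simp only [pz, Matrix.cons_val]
    rw [abs_mul, abs_of_nonneg (by positivity)]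
    refine le_trans ?_ M
    gcongr
    rw [abs_mul, abs_of_pos hα]
    have h2 := hζ 2
    calc α * |ζ 2| ≤ (1 + α) * LL n * 1 := by rw [mul_one]; gcongr; linarith
      _ ≤ _ := by gcongr

lemma cfA_le {a b c : ℝ} (ha : |a| ≤ 1) (hb : |b| ≤ 1) (hc : |c| ≤ 1) (k : Fin 6) : |cfA a b c k| ≤ 3 := by
  have m : ∀ u v : ℝ, |u| ≤ 1 → |v| ≤ 1 → |u * v| ≤ 1 := fun u v hu hv => by
    rw [abs_mul]; exact mul_le_one₀ hu (abs_nonneg _) hv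
  have h1 := abs_le.1 (m a b ha hb)
  have h2 := abs_le.1 (m a c ha hc)
  have h3 := abs_le.1 (m b c hb hc)
  have h4 := abs_le.1 (m a a ha ha)
  have h5 := abs_le.1 (m b b hb hb)
  have h6 := abs_le.1 (m c c hc hc)
  rw [abs_le]
  fin_cases k <;> simp [cfA] <;> constructor <;> nlinarith

end PartP

section PartQ

/-! ### Part Q: the local expansion holds for the model -/

variable {σ δ α : ℝ}

/-- the constant in the error bound -/
def CT (σ α c : ℝ) : ℝ := 8 * (1 + c⁻¹) ^ 3 * (1 + CE σ α) ^ 4 * ((∫ y, g1 σ y) + ∫ y, g2 α y)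

def tauF (σ δ α c : ℝ) (n : ℕ) : ℝ := CT σ α c * (n * (xs α n ^ 2 * ss α n) + n * (ss α n ^ 3 * lam n δ α))

lemma tendsto_tau (hα : 0 < α) (c : ℝ) : Tendsto (tauF σ δ α c) atTop (𝓝 0) := by
  have h0 : ∀ᶠ n : ℕ in atTop, 0 < n := eventually_gt_atTop 0
  have t1 := pow_exp_zero 0 (show 0 < α / 4 - 3 * α / 64 by linarith)
  have t2 := (pow_exp_zero 0 (show 0 < α / 4 - 3 * α / 64 by linarith)).const_mul (δ ^ α)
  have t := (t1.add t2).const_mul (CT σ α c)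
  simp only [mul_zero, add_zero] at t
  refine t.congr' ?_
  filter_upwards [h0] with n h0
  unfold tauF xs ss
  rw [lam_exp h0, Real.rpow_zero, one_mul, ← Real.exp_nat_mul, ← Real.exp_nat_mul, ← exp_LL h0]
  congr 2
  · rw [← Real.exp_add, ← Real.exp_add]; congr 1; push_cast; ring
  · rw [← mul_assoc, ← mul_assoc, mul_comm _ (δ ^ α), ← mul_assoc, mul_assoc (δ ^ α), mul_assoc (δ ^ α), ← Real.exp_add, ← Real.exp_add]
    congr 2; push_cast; ring

lemma CT_bound (hσ : 0 < σ) (hα : 0 < α) (hα2 : α < 2) {c : ℝ} (hc : 0 < c) {k : ℕ} (hk : k ≤ 3) :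
    2 ^ k * (c⁻¹) ^ k * CE σ α ^ (k + 1) * (∫ y, g1 σ y) ≤ CT σ α c ∧
    2 ^ k * (c⁻¹) ^ k * CE σ α ^ (k + 1) * (∫ y, g2 α y) ≤ CT σ α c := by
  have hCE := CE_nonneg hσ hα hα2
  have i1 : 0 ≤ ∫ y, g1 σ y := integral_nonneg fun y => (g1_pos σ y).le
  have i2 : 0 ≤ ∫ y, g2 α y := integral_nonneg fun y => (g2_pos α y).le
  have hci : 0 < c⁻¹ := by positivity
  have a1 : (2:ℝ) ^ k ≤ 8 := by
    calc (2:ℝ) ^ k ≤ 2 ^ 3 := pow_le_pow_right₀ (by norm_num) hk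
      _ = 8 := by norm_num
  have a2 : (c⁻¹) ^ k ≤ (1 + c⁻¹) ^ 3 := (pow_le_pow_left₀ hci.le (by linarith) k).trans (pow_le_pow_right₀ (by linarith) hk)
  have a3 : CE σ α ^ (k + 1) ≤ (1 + CE σ α) ^ 4 := (pow_le_pow_left₀ hCE (by linarith) _).trans (pow_le_pow_right₀ (by linarith) (by omega))
  unfold CT
  constructor <;> gcongr <;> linarith

lemma pow_small {x s : ℝ} (hx : 0 < x) (hxs : x ≤ s) (hs : s ≤ 1) {m : ℕ} (hm : 3 ≤ m) : x ^ m ≤ x ^ 2 * s ∧ s ^ m ≤ s ^ 3 := by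
  constructor
  · calc x ^ m ≤ x ^ 3 := pow_le_pow_of_le_one hx.le (hxs.trans hs) hm
      _ = x ^ 2 * x := by ring
      _ ≤ _ := by gcongr
  · exact pow_le_pow_of_le_one (hx.le.trans hxs) hs hm

lemma eN_nonneg (hσ : 0 < σ) (hα : 0 < α) (hα2 : α < 2) {n : ℕ} (hl : 0 ≤ lam n δ α) (j : ℕ) (y : ℝ) : 0 ≤ eN σ δ α n j y := by
  have hCE := CE_nonneg hσ hα hα2
  have e1 := Env1_nonneg σ y
  have e2 := Env2_nonneg α hl y
  have := xs_pos α n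
  have := ss_pos α n
  unfold eN; positivity

lemma measurable_eN (σ δ α : ℝ) (n j : ℕ) : Measurable (eN σ δ α n j) := by
  unfold eN Env1 Env2
  have := measurable_YY σ
  fun_prop

/-- moments in terms of the dominating numerator -/
lemma mom_tau (hσ : 0 < σ) (hδ : 0 < δ) (hα : 0 < α) (hα2 : α < 2) {c : ℝ} {n : ℕ} (h0 : 0 < n) (h : LB σ α c (lam n δ α))
    (hxs : xs α n ≤ ss α n) (hs1 : ss α n ≤ 1)
    {f : ℝ → ℝ} (hf : Measurable f) {j k : ℕ} (hb : ∀ y, |f y| ≤ eN σ δ α n j y) (hk : k ≤ 3) (hjk : 3 ≤ j * (k + 1)) :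
    Integrable (fun x => |f (√n * x) / qF σ (lam n δ α) α (√n * x)| ^ (k + 1)) (nuM n ![σ, δ, α]) ∧
    n * ∫ x, |f (√n * x) / qF σ (lam n δ α) α (√n * x)| ^ (k + 1) ∂(nuM n ![σ, δ, α]) ≤ tauF σ δ α c n := by
  have hCE := CE_nonneg hσ hα hα2
  have hx := xs_pos α n
  have hs := ss_pos α n
  have hl := h.sm.pos
  obtain ⟨m1, m2⟩ := mom hσ hα h hf (A := CE σ α * xs α n ^ j) (B := CE σ α * ss α n ^ j) (by positivity) (by positivity)
    (fun y => (hb y).trans_eq (by unfold eN; ring)) hk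
  obtain ⟨i1, i2⟩ := nuM_integral hσ hδ hα hα2 h0 h (fun y => |f y / qF σ (lam n δ α) α y| ^ (k + 1))
  have e : ∀ y, |f y / qF σ (lam n δ α) α y| ^ (k + 1) * qF σ (lam n δ α) α y = |f y| ^ (k + 1) / qF σ (lam n δ α) α y ^ k := by
    intro y
    have hq := h.qpos y
    rw [abs_div, abs_of_pos hq, div_pow]
    field_simp
    ring
  simp_rw [e] at i1 i2
  refine ⟨i1 m1, ?_⟩
  rw [i2]
  obtain ⟨c1, c2⟩ := CT_bound hσ hα hα2 h.cpos hk
  obtain ⟨p1, p2⟩ := pow_small hx hxs hs1 hjk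
  have hCT : 0 ≤ CT σ α c := by
    have i1 : 0 ≤ ∫ y, g1 σ y := integral_nonneg fun y => (g1_pos σ y).le
    have hc := h.cpos
    exact le_trans (by positivity) c1
  calc n * ∫ y, |f y| ^ (k + 1) / qF σ (lam n δ α) α y ^ k
      ≤ n * (2 ^ k * (c⁻¹) ^ k * ((CE σ α * xs α n ^ j) ^ (k + 1) * (∫ y, g1 σ y) + (CE σ α * ss α n ^ j) ^ (k + 1) * (lam n δ α * ∫ y, g2 α y))) := by gcongr
    _ = (2 ^ k * (c⁻¹) ^ k * CE σ α ^ (k + 1) * (∫ y, g1 σ y)) * (n * xs α n ^ (j * (k + 1))) +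
        (2 ^ k * (c⁻¹) ^ k * CE σ α ^ (k + 1) * (∫ y, g2 α y)) * (n * (ss α n ^ (j * (k + 1)) * lam n δ α)) := by
        rw [mul_pow, mul_pow, ← pow_mul, ← pow_mul]; ring
    _ ≤ CT σ α c * (n * (xs α n ^ 2 * ss α n)) + CT σ α c * (n * (ss α n ^ 3 * lam n δ α)) := by gcongr
    _ = _ := by unfold tauF; ring

lemma mom12 (hσ : 0 < σ) (hδ : 0 < δ) (hα : 0 < α) (hα2 : α < 2) {c : ℝ} {n : ℕ} (h0 : 0 < n) (h : LB σ α c (lam n δ α))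
    (hxs : xs α n ≤ ss α n) :
    Integrable (fun x => eF σ δ α n 1 x * eF σ δ α n 2 x) (nuM n ![σ, δ, α]) ∧
    n * ∫ x, eF σ δ α n 1 x * eF σ δ α n 2 x ∂(nuM n ![σ, δ, α]) ≤ tauF σ δ α c n := by
  have hCE := CE_nonneg hσ hα hα2
  have hx := xs_pos α n
  have hs := ss_pos α n
  have hl := h.sm.pos
  have hci : 0 < c⁻¹ := by have := h.cpos; positivity
  obtain ⟨i1, i2⟩ := nuM_integral hσ hδ hα hα2 h0 h (fun y => eN σ δ α n 1 y / qF σ (lam n δ α) α y * (eN σ δ α n 2 y / qF σ (lam n δ α) α y))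
  have e : ∀ y, eN σ δ α n 1 y / qF σ (lam n δ α) α y * (eN σ δ α n 2 y / qF σ (lam n δ α) α y) * qF σ (lam n δ α) α y =
      eN σ δ α n 1 y * eN σ δ α n 2 y / qF σ (lam n δ α) α y := by
    intro y
    have hq := h.qpos y
    field_simp
  simp_rw [e] at i1 i2
  set x := xs α n with hxd
  set s := ss α n with hsd
  have bound : ∀ y, eN σ δ α n 1 y * eN σ δ α n 2 y / qF σ (lam n δ α) α y ≤
      2 * c⁻¹ * CE σ α ^ 2 * (x ^ 2 * s * g1 σ y + s ^ 3 * (lam n δ α * g2 α y)) := by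
    intro y
    have hq := h.qpos y
    have m1 := h.m1 y (k := 1) (by norm_num)
    have m2 := h.m2 hα y (k := 1) (by norm_num)
    have E1 := Env1_nonneg σ y
    have E2 := Env2_nonneg α hl.le y
    simp only [pow_one] at m1 m2
    norm_num at m1 m2
    have key : eN σ δ α n 1 y * eN σ δ α n 2 y ≤ 2 * CE σ α ^ 2 * (x ^ 2 * s * Env1 σ y ^ 2 + s ^ 3 * Env2 (lam n δ α) α y ^ 2) := by
      unfold eN
      rw [← hxd, ← hsd]
      set E := Env1 σ y
      set H := Env2 (lam n δ α) α y
      have : (x ^ 1 * E + s ^ 1 * H) * (x ^ 2 * E + s ^ 2 * H) ≤ 2 * (x ^ 2 * s * E ^ 2 + s ^ 3 * H ^ 2) := by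
        have a1 : x ^ 3 * E ^ 2 ≤ x ^ 2 * s * E ^ 2 := by
          have : x ^ 3 = x ^ 2 * x := by ring
          rw [this]; gcongr
        have a2 : x ^ 2 * s * (E * H) ≤ x * s ^ 2 * (E * H) := by
          have : x ^ 2 * s = x * s * x := by ring
          have e' : x * s ^ 2 = x * s * s := by ring
          rw [this, e']; gcongr
        have a3 : 0 ≤ s * (x * E - s * H) ^ 2 := by positivity
        nlinarith
      calc _ = CE σ α ^ 2 * ((x ^ 1 * E + s ^ 1 * H) * (x ^ 2 * E + s ^ 2 * H)) := by ring
        _ ≤ CE σ α ^ 2 * (2 * (x ^ 2 * s * E ^ 2 + s ^ 3 * H ^ 2)) := by gcongr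
        _ = _ := by ring
    calc _ ≤ 2 * CE σ α ^ 2 * (x ^ 2 * s * Env1 σ y ^ 2 + s ^ 3 * Env2 (lam n δ α) α y ^ 2) / qF σ (lam n δ α) α y := by gcongr
      _ = 2 * CE σ α ^ 2 * (x ^ 2 * s * (Env1 σ y ^ 2 / qF σ (lam n δ α) α y) + s ^ 3 * (Env2 (lam n δ α) α y ^ 2 / qF σ (lam n δ α) α y)) := by ring
      _ ≤ 2 * CE σ α ^ 2 * (x ^ 2 * s * (c⁻¹ * g1 σ y) + s ^ 3 * (c⁻¹ * (lam n δ α * g2 α y))) := by gcongr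
      _ = _ := by ring
  have j1 := (integrable_g1 hσ).const_mul (x ^ 2 * s)
  have j2 := ((integrable_g2 hα).const_mul (lam n δ α)).const_mul (s ^ 3)
  have ib := (j1.add j2).const_mul (2 * c⁻¹ * CE σ α ^ 2)
  have hi : Integrable (fun y => eN σ δ α n 1 y * eN σ δ α n 2 y / qF σ (lam n δ α) α y) := by
    refine ib.mono' ?_ (Eventually.of_forall fun y => ?_)
    · have a1 := measurable_eN σ δ α n 1
      have a2 := measurable_eN σ δ α n 2
      have a3 := measurable_qF (α := α) hσ hl.le
      exact Measurable.aestronglyMeasurable (by fun_prop)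
    · have hq := h.qpos y
      have a1 := eN_nonneg hσ hα hα2 hl.le 1 y
      have a2 := eN_nonneg hσ hα hα2 hl.le 2 y
      rw [Real.norm_of_nonneg (by positivity)]
      exact bound y
  refine ⟨i1 hi, ?_⟩
  have i2' : ∫ x, eF σ δ α n 1 x * eF σ δ α n 2 x ∂(nuM n ![σ, δ, α]) = _ := i2
  rw [i2']
  have hle := integral_mono hi ib bound
  simp only [Pi.add_apply] at hle
  rw [integral_const_mul, integral_add j1 j2, integral_const_mul, integral_const_mul, integral_const_mul] at hle
  obtain ⟨c1, c2⟩ := CT_bound hσ hα hα2 h.cpos (show 1 ≤ 3 by norm_num)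
  norm_num at c1 c2
  calc _ ≤ n * (2 * c⁻¹ * CE σ α ^ 2 * (x ^ 2 * s * (∫ y, g1 σ y) + s ^ 3 * (lam n δ α * ∫ y, g2 α y))) := by gcongr
    _ = (2 * c⁻¹ * CE σ α ^ 2 * (∫ y, g1 σ y)) * (n * (x ^ 2 * s)) + (2 * c⁻¹ * CE σ α ^ 2 * (∫ y, g2 α y)) * (n * (s ^ 3 * lam n δ α)) := by ring
    _ ≤ CT σ α c * (n * (x ^ 2 * s)) + CT σ α c * (n * (s ^ 3 * lam n δ α)) := by gcongr
    _ = _ := by unfold tauF; ring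

lemma DD_le (α : ℝ) (n : ℕ) (k : Fin 6) : |DD α n k 0| ≤ xs α n ∧ |DD α n k 1| ≤ ss α n ∧ |DD α n k 2| ≤ ss α n := by
  have hx := xs_pos α n
  have hs := ss_pos α n
  fin_cases k <;> simp [DD, abs_of_pos hx, abs_of_pos hs, hx.le, hs.le]

lemma Q2_cf (hσ : 0 < σ) (hα : 0 < α) (hα2 : α < 2) {n : ℕ} (hS : Sm σ (lam n δ α)) (ζ : Fin 3 → ℝ) (y : ℝ) :
    Q2 σ (lam n δ α) α (pz σ δ α n ζ) y = ∑ k, cfF σ δ α n ζ k * Q2 σ (lam n δ α) α (DD α n k) y := by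
  have hx := (xs_pos α n).ne'
  have hs := (ss_pos α n).ne'
  have := Q2_polar hσ hS hα hα2 (xs α n) (ss α n) (pz σ δ α n ζ 0 / xs α n) (pz σ δ α n ζ 1 / ss α n) (pz σ δ α n ζ 2 / ss α n) y
  rw [mul_div_cancel₀ _ hx, mul_div_cancel₀ _ hs, mul_div_cancel₀ _ hs] at this
  have e : pz σ δ α n ζ = ![pz σ δ α n ζ 0, pz σ δ α n ζ 1, pz σ δ α n ζ 2] := by
    ext i; fin_cases i <;> rfl
  rw [e, this]
  simp [Fin.sum_univ_six, cfF, cfA, DD]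

end PartQ

section PartR

/-! ### Part R: concrete block -/

variable {σ δ α : ℝ}

lemma measurable_eF (hσ : 0 < σ) {n : ℕ} (hl : 0 ≤ lam n δ α) (j : ℕ) : Measurable (eF σ δ α n j) := by
  have a1 := measurable_eN σ δ α n j
  have a3 := measurable_qF (α := α) hσ hl
  unfold eF
  fun_prop

lemma xi_sum (hσ : 0 < σ) (hα : 0 < α) (hα2 : α < 2) {n : ℕ} (hS : Sm σ (lam n δ α)) (ζ : Fin 3 → ℝ) (x : ℝ) :
    ∑ i, ζ i * xiF σ δ α n i x = Q1 σ (lam n δ α) α (pz σ δ α n ζ) (√n * x) / qF σ (lam n δ α) α (√n * x) := by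
  rw [pz_lin σ δ α n ζ, Q1_add hσ hS hα hα2, Q1_add hσ hS hα hα2, Q1_smul, Q1_smul, Q1_smul, Fin.sum_univ_three]
  unfold xiF; ring

lemma eta_sum (hσ : 0 < σ) (hα : 0 < α) (hα2 : α < 2) {n : ℕ} (hS : Sm σ (lam n δ α)) (ζ : Fin 3 → ℝ) (x : ℝ) :
    ∑ k, cfF σ δ α n ζ k * etaF σ δ α n k x = Q2 σ (lam n δ α) α (pz σ δ α n ζ) (√n * x) / qF σ (lam n δ α) α (√n * x) := by
  rw [Q2_cf hσ hα hα2 hS, Finset.sum_div]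
  unfold etaF
  refine Finset.sum_congr rfl fun k _ => ?_
  ring

lemma continuous_pz (σ δ α : ℝ) (n : ℕ) : Continuous (pz σ δ α n) := by
  unfold pz
  refine continuous_pi fun i => ?_
  fin_cases i <;> simp <;> fun_prop

lemma continuous_qP1 (hσ : 0 < σ) {l : ℝ} (hl : 0 ≤ l) (p : Fin 3 → ℝ) : Continuous (fun y => qP σ l α p y) := by
  have h : Continuous fun y : ℝ => (p, y) := by fun_prop
  have h2 := Continuous.comp (continuous_qP σ l α hσ hl) h
  simp only [Function.comp_def] at h2
  exact h2

lemma continuous_qP2 (hσ : 0 < σ) {l : ℝ} (hl : 0 ≤ l) (y : ℝ) : Continuous (fun p => qP σ l α p y) := by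
  have h : Continuous fun p : Fin 3 → ℝ => (p, y) := by fun_prop
  have h2 := Continuous.comp (continuous_qP σ l α hσ hl) h
  simp only [Function.comp_def] at h2
  exact h2

lemma blk_concrete (hσ : 0 < σ) (hδ : 0 < δ) (hα : 0 < α) (hα2 : α < 2) :
    ∃ τ : ℕ → ℝ, Tendsto τ atTop (𝓝 0) ∧ ∀ᶠ n in atTop, (0 < n ∧ Sm σ (lam n δ α) ∧ (∀ y, 0 < qF σ (lam n δ α) α y) ∧ ss α n ≤ r0 α / 2 ∧ xs α n ≤ ss α n ∧
      ∀ ζ : Fin 3 → ℝ, (∀ i, |ζ i| ≤ LL n) →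
        |pz σ δ α n ζ 0| ≤ xs α n ∧ |pz σ δ α n ζ 1| ≤ ss α n ∧ |pz σ δ α n ζ 2| ≤ ss α n) ∧ Blk n (nuM n ![σ, δ, α]) (LL n) (τ n)
      (xiF σ δ α n) (etaF σ δ α n) (eF σ δ α n) (cfF σ δ α n) (rF σ δ α n) := by
  obtain ⟨c, l1, hl1, h⟩ := exists_LB hσ hα hα2
  have hLB : ∀ᶠ n in atTop, LB σ α c (lam n δ α) := (tendsto_lam hδ hα2).eventually (eventually_LB hl1 h)
  have h0 : ∀ᶠ n : ℕ in atTop, 0 < n := eventually_gt_atTop 0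
  have hL : ∀ᶠ n : ℕ in atTop, 1 ≤ LL n := tendsto_LL.eventually_ge_atTop 1
  have hr0 := r0_pos hα hα2
  obtain ⟨hr1, -, -⟩ := r0_le hα hα2
  have hss : ∀ᶠ n in atTop, ss α n ≤ r0 α / 2 := (tendsto_ss hα).eventually_le_const (by linarith)
  refine ⟨tauF σ δ α c, tendsto_tau hα c, ?_⟩
  filter_upwards [hLB, h0, hL, hss, pz_small hσ hδ hα hα2] with n hn h0 hL hs hp
  have hL0 : 0 < LL n := by linarith
  have hxs := xs_le_ss hα2 hL0
  have hs1 : ss α n ≤ 1 := by linarith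
  have hx1 : xs α n ≤ 1 := hxs.trans hs1
  have hx0 := xs_pos α n
  have hs0 := ss_pos α n
  have hS := hn.sm
  have hl := hS.pos
  have hCE := CE_nonneg hσ hα hα2
  have mq := measurable_qF (α := α) hσ hl.le
  have hsg : ∀ i : Fin 3, ∀ j : Fin 3, |(Pi.single i (1:ℝ) : Fin 3 → ℝ) j| ≤ LL n := by
    intro i j
    by_cases hij : j = i
    · subst hij; simpa using hL
    · simp [Pi.single_eq_of_ne hij, hL0.le]
  refine ⟨⟨h0, hS, hn.qpos, hs, hxs, hp⟩, ?_⟩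
  have eF_nonneg : ∀ j x, 0 ≤ eF σ δ α n j x := fun j x => div_nonneg (eN_nonneg hσ hα hα2 hl.le j _) (hn.qpos _).le
  have eF_mono : ∀ j x, eF σ δ α n (j + 1) x ≤ eF σ δ α n j x := by
    intro j x
    have hq := hn.qpos (√n * x)
    have e1 := Env1_nonneg σ (√n * x)
    have e2 := Env2_nonneg α hl.le (√n * x)
    have p1 := pow_le_pow_of_le_one hx0.le hx1 (Nat.le_succ j)
    have p2 := pow_le_pow_of_le_one hs0.le hs1 (Nat.le_succ j)
    unfold eF eN
    simp only [Nat.succ_eq_add_one] at p1 p2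
    gcongr
  have mt := fun {f : ℝ → ℝ} (hf : Measurable f) {j k : ℕ} (hb : ∀ y, |f y| ≤ eN σ δ α n j y) (hk : k ≤ 3) (hjk : 3 ≤ j * (k + 1)) =>
    mom_tau hσ hδ hα hα2 h0 hn hxs hs1 hf hb hk hjk
  have eNabs : ∀ j y, |eN σ δ α n j y| ≤ eN σ δ α n j y := fun j y => (abs_of_nonneg (eN_nonneg hσ hα hα2 hl.le j y)).le
  have meanzero : ∀ f : ℝ → ℝ, ∫ y, f y = 0 → ∫ x, f (√n * x) / qF σ (lam n δ α) α (√n * x) ∂(nuM n ![σ, δ, α]) = 0 := by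
    intro f hf
    rw [(nuM_integral hσ hδ hα hα2 h0 hn (fun y => f y / qF σ (lam n δ α) α y)).2, ← hf]
    refine integral_congr_ae (Eventually.of_forall fun y => ?_)
    exact div_mul_cancel₀ _ (hn.qpos y).ne'
  have eFabs : ∀ j x, |eN σ δ α n j (√n * x) / qF σ (lam n δ α) α (√n * x)| = eF σ δ α n j x := fun j x => abs_of_nonneg (eF_nonneg j x)
  have M3 := mt (measurable_eN σ δ α n 3) (eNabs 3) (k := 0) (by norm_num) (by norm_num)
  have M13 := mt (measurable_eN σ δ α n 1) (eNabs 1) (k := 2) (by norm_num) (by norm_num)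
  have M14 := mt (measurable_eN σ δ α n 1) (eNabs 1) (k := 3) (by norm_num) (by norm_num)
  simp only [eFabs, zero_add, pow_one] at M3 M13 M14
  have Mη : ∀ k, Integrable (fun x => etaF σ δ α n k x ^ 2) (nuM n ![σ, δ, α]) ∧ n * ∫ x, etaF σ δ α n k x ^ 2 ∂(nuM n ![σ, δ, α]) ≤ tauF σ δ α c n := by
    intro k
    obtain ⟨d0, d1, d2⟩ := DD_le α n k
    have := mt (measurable_Q2 σ (lam n δ α) α (DD α n k)) (j := 2) (k := 1)
      (fun y => (expand hσ hS hα hα2 hx0 hxs hs d0 d1 d2 y).2.1) (by norm_num) (by norm_num)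
    simp only [sq_abs, show 1 + 1 = 2 by rfl] at this
    exact this
  refine
    { prob := nuM_prob hσ hδ hα hα2 h0 hn
      one_le := hL
      mξ := fun i => ?_
      mη := fun k => ?_
      me := measurable_eF hσ hl.le
      cr := fun x => ?_
      mr := fun ζ => ?_
      e0 := eF_nonneg 3
      e32 := eF_mono 2
      e21 := eF_mono 1
      ξle := fun ζ hζ x => ?_
      cfle := fun ζ hζ k => ?_
      ηle := fun ζ hζ x => ?_
      rem := fun ζ hζ x => ?_
      ξ0 := fun i => ?_
      η0 := fun k => ?_
      iη := fun k => (Mη k).1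
      bη := fun k => (Mη k).2
      i3 := M3.1
      b3 := M3.2
      i13 := M13.1
      b13 := M13.2
      i14 := M14.1
      b14 := M14.2
      i12 := (mom12 hσ hδ hα hα2 h0 hn hxs).1
      b12 := (mom12 hσ hδ hα hα2 h0 hn hxs).2 }
  · have := measurable_Q1 σ (lam n δ α) α (pz σ δ α n (Pi.single i 1))
    unfold xiF; fun_prop
  · have := measurable_Q2 σ (lam n δ α) α (DD α n k)
    unfold etaF; fun_prop
  · unfold rF
    have c2 : Continuous fun ζ : Fin 3 → ℝ => qP σ (lam n δ α) α (pz σ δ α n ζ) (√n * x) :=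
      (continuous_qP2 hσ hl.le (√n * x)).comp (continuous_pz σ δ α n)
    exact (c2.div_const _).sub continuous_const
  · unfold rF
    have c2 := (continuous_qP1 (α := α) hσ hl.le (pz σ δ α n ζ)).measurable
    exact ((c2.comp (measurable_const_mul (√n))).div (mq.comp (measurable_const_mul (√n)))).sub_const 1
  · obtain ⟨d0, d1, d2⟩ := hp ζ hζ
    have hq := hn.qpos (√n * x)
    rw [xi_sum hσ hα hα2 hS, abs_div, abs_of_pos hq]
    unfold eF eN
    simp only [pow_one]
    gcongr
    exact (expand hσ hS hα hα2 hx0 hxs hs d0 d1 d2 _).1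
  · obtain ⟨d0, d1, d2⟩ := hp ζ hζ
    refine cfA_le ?_ ?_ ?_ k
    · rw [abs_div, abs_of_pos hx0, div_le_one hx0]; exact d0
    · rw [abs_div, abs_of_pos hs0, div_le_one hs0]; exact d1
    · rw [abs_div, abs_of_pos hs0, div_le_one hs0]; exact d2
  · obtain ⟨d0, d1, d2⟩ := hp ζ hζ
    have hq := hn.qpos (√n * x)
    rw [eta_sum hσ hα hα2 hS, abs_div, abs_of_pos hq]
    unfold eF eN
    gcongr
    exact (expand hσ hS hα hα2 hx0 hxs hs d0 d1 d2 _).2.1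
  · obtain ⟨d0, d1, d2⟩ := hp ζ hζ
    have hq := hn.qpos (√n * x)
    rw [eta_sum hσ hα hα2 hS, xi_sum hσ hα hα2 hS]
    have := (expand hσ hS hα hα2 hx0 hxs hs d0 d1 d2 (√n * x)).2.2
    unfold eF eN rF
    rw [le_div_iff₀ hq]
    calc _ = |(qP σ (lam n δ α) α (pz σ δ α n ζ) (√n * x) / qF σ (lam n δ α) α (√n * x) - 1 -
          Q1 σ (lam n δ α) α (pz σ δ α n ζ) (√n * x) / qF σ (lam n δ α) α (√n * x) -
        1 / 2 * (Q2 σ (lam n δ α) α (pz σ δ α n ζ) (√n * x) / qF σ (lam n δ α) α (√n * x))) * qF σ (lam n δ α) α (√n * x)| := by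
          rw [abs_mul, abs_of_pos hq]
      _ = |qP σ (lam n δ α) α (pz σ δ α n ζ) (√n * x) - qF σ (lam n δ α) α (√n * x) - Q1 σ (lam n δ α) α (pz σ δ α n ζ) (√n * x) - (1 / 2) * Q2 σ (lam n δ α) α (pz σ δ α n ζ) (√n * x)| := by
          congr 1; field_simp
      _ ≤ _ := this
  · obtain ⟨d0, d1, d2⟩ := hp _ (hsg i)
    exact meanzero _ (integral_Q hσ hS hα hα2 hx0 hxs hs d0 d1 d2).1
  · obtain ⟨d0, d1, d2⟩ := DD_le α n k
    exact meanzero _ (integral_Q hσ hS hα hα2 hx0 hxs hs d0 d1 d2).2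

lemma gram_concrete (hσ : 0 < σ) (hδ : 0 < δ) (hα : 0 < α) (hα2 : α < 2) (ζ : Fin 3 → ℝ) :
    Tendsto (fun n : ℕ => n * ∫ x, (∑ i, ζ i * xiF σ δ α n i x) ^ 2 ∂(nuM n ![σ, δ, α])) atTop (𝓝 (∑ i, ζ i ^ 2)) := by
  obtain ⟨c, l1, hl1, h⟩ := exists_LB hσ hα hα2
  have hLB : ∀ᶠ n in atTop, LB σ α c (lam n δ α) := (tendsto_lam hδ hα2).eventually (eventually_LB hl1 h)
  have h0 : ∀ᶠ n : ℕ in atTop, 0 < n := eventually_gt_atTop 0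
  rw [Fin.sum_univ_three]
  refine (gram hσ hδ hα hα2 ζ).congr' ?_
  filter_upwards [hLB, h0] with n hn h0
  simp_rw [xi_sum hσ hα hα2 hn.sm]
  rw [(nuM_integral hσ hδ hα hα2 h0 hn (fun y => (Q1 σ (lam n δ α) α (pz σ δ α n ζ) y / qF σ (lam n δ α) α y) ^ 2)).2]
  congr 1
  refine integral_congr_ae (Eventually.of_forall fun y => ?_)
  have hq := hn.qpos y
  simp only
  field_simp

end PartR

section PartS

/-! ### A measurable argmax -/

lemma measurable_sup_compact {T Ω : Type*} [TopologicalSpace T] [CompactSpace T]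
    [TopologicalSpace.SeparableSpace T] [Nonempty T] [MeasurableSpace Ω] (g : T → Ω → ℝ)
    (hc : ∀ x, Continuous (fun t => g t x)) (hm : ∀ t, Measurable (g t)) :
    Measurable (fun x => ⨆ t, g t x) := by
  have hb : ∀ x, BddAbove (range (fun t => g t x)) := fun x =>
    (isCompact_range (hc x)).bddAbove
  have hb2 : ∀ x, BddAbove (range (fun m => g (TopologicalSpace.denseSeq T m) x)) := fun x =>
    (hb x).mono (by rintro _ ⟨m, rfl⟩; exact ⟨_, rfl⟩)
  have : (fun x => ⨆ t, g t x) = fun x => ⨆ m : ℕ, g (TopologicalSpace.denseSeq T m) x := by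
    funext x
    apply le_antisymm
    · apply ciSup_le
      intro t
      have hcl : IsClosed {t | g t x ≤ ⨆ m : ℕ, g (TopologicalSpace.denseSeq T m) x} :=
        isClosed_le (hc x) continuous_const
      have hd := TopologicalSpace.denseRange_denseSeq T
      exact hd.induction_on (p := fun t => g t x ≤ ⨆ m : ℕ, g (TopologicalSpace.denseSeq T m) x)
        t hcl (fun m => le_ciSup (hb2 x) m)
    · apply ciSup_le
      intro m
      exact le_ciSup (hb x) _
  rw [this]
  exact Measurable.iSup (fun m => hm _)

lemma argmax_real {Ω : Type*} [MeasurableSpace Ω] (C : Set ℝ) (hC : IsCompact C) (hne : C.Nonempty)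
    (g : C → Ω → ℝ) (hc : ∀ x, Continuous (fun t => g t x)) (hm : ∀ t, Measurable (g t)) :
    ∃ s : Ω → C, Measurable s ∧ ∀ x t, g t x ≤ g (s x) x := by
  have : CompactSpace C := isCompact_iff_compactSpace.mp hC
  have : Nonempty C := hne.to_subtype
  have hb : ∀ x, BddAbove (range (fun t => g t x)) := fun x =>
    (isCompact_range (hc x)).bddAbove
  have hex : ∀ x, ∃ t : C, (∀ u, g u x ≤ g t x) ∧ ∀ t' : C, (∀ u, g u x ≤ g t' x) → t.1 ≤ t'.1 := by
    intro x
    have hcl : IsClosed {t : C | ∀ u, g u x ≤ g t x} := by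
      simp only [setOf_forall]
      exact isClosed_iInter (fun u => isClosed_le continuous_const (hc x))
    have hne2 : {t : C | ∀ u, g u x ≤ g t x}.Nonempty := by
      obtain ⟨t, -, ht⟩ := isCompact_univ.exists_isMaxOn (univ_nonempty (α := C)) (hc x).continuousOn
      exact ⟨t, fun u => ht (mem_univ u)⟩
    obtain ⟨t, ht, ht2⟩ := hcl.isCompact.exists_isMinOn hne2 (f := fun t : C => t.1)
      continuous_subtype_val.continuousOn
    exact ⟨t, ht, fun t' h' => ht2 h'⟩
  choose s hs1 hs2 using hex
  refine ⟨s, ?_, fun x t => hs1 x t⟩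
  have hv : Measurable (fun x => (s x).1) := by
    apply measurable_of_Iic
    intro c
    by_cases hcn : (C ∩ Iic c).Nonempty
    · have hC2 : IsCompact (C ∩ Iic c) := hC.inter_right isClosed_Iic
      have : CompactSpace ↥(C ∩ Iic c) := isCompact_iff_compactSpace.mp hC2
      have : Nonempty ↥(C ∩ Iic c) := hcn.to_subtype
      have hc2 : ∀ x, Continuous (fun t : ↥(C ∩ Iic c) => g ⟨t.1, t.2.1⟩ x) := fun x =>
        (hc x).comp (Continuous.subtype_mk continuous_subtype_val _)
      have hS1 := measurable_sup_compact g hc hm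
      have hS2 := measurable_sup_compact (fun t : ↥(C ∩ Iic c) => g ⟨t.1, t.2.1⟩) hc2
        (fun t => hm _)
      have : (fun x => (s x).1) ⁻¹' Iic c =
          {x | (⨆ t, g t x) ≤ ⨆ t : ↥(C ∩ Iic c), g ⟨t.1, t.2.1⟩ x} := by
        ext x
        simp only [mem_preimage, mem_Iic, mem_setOf_eq]
        constructor
        · intro h
          apply ciSup_le
          intro t
          have hbx : BddAbove (range (fun t : ↥(C ∩ Iic c) => g ⟨t.1, t.2.1⟩ x)) :=
            (isCompact_range (hc2 x)).bddAbove
          exact (hs1 x t).trans (le_ciSup hbx ⟨(s x).1, (s x).2, h⟩)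
        · intro h
          obtain ⟨t, -, ht⟩ := isCompact_univ.exists_isMaxOn
            (univ_nonempty (α := ↥(C ∩ Iic c))) (hc2 x).continuousOn
          have h3 : (⨆ t : ↥(C ∩ Iic c), g ⟨t.1, t.2.1⟩ x) ≤ g ⟨t.1, t.2.1⟩ x :=
            ciSup_le (fun u => ht (mem_univ u))
          have h4 := hs2 x ⟨t.1, t.2.1⟩ (fun u => ((le_ciSup (hb x) u).trans h).trans h3)
          exact h4.trans t.2.2
      rw [this]
      exact measurableSet_le hS1 hS2
    · have : (fun x => (s x).1) ⁻¹' Iic c = ∅ := by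
        ext x
        simp only [mem_preimage, mem_Iic, mem_empty_iff_false, iff_false]
        intro h
        exact hcn ⟨_, (s x).2, h⟩
      rw [this]; exact MeasurableSet.empty
  exact hv.subtype_mk

lemma argmax_cube {Ω : Type*} [MeasurableSpace Ω] (R : ℝ) (hR : 0 ≤ R)
    (g : (Fin 3 → ℝ) → Ω → ℝ) (hc : ∀ x, Continuous (fun t => g t x)) (hm : ∀ t, Measurable (g t)) :
    ∃ s : Ω → (Fin 3 → ℝ), Measurable s ∧ (∀ x i, |s x i| ≤ R) ∧
      ∀ x t, (∀ i, |t i| ≤ R) → g t x ≤ g (s x) x := by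
  let K : Set (Fin 3 → ℝ) := Icc (fun _ => -R) (fun _ => R)
  have hK : IsCompact K := isCompact_Icc
  have : CompactSpace K := isCompact_iff_compactSpace.mp hK
  have : Nonempty K := ⟨⟨fun _ => 0, by
    constructor <;> intro i <;> simp [hR]⟩⟩
  obtain ⟨f, hf, hfs⟩ := exists_nat_bool_continuous_surjective_of_compact K
  let φ : cantorSet → K := fun t => f (cantorSetHomeomorphNatToBool t)
  have hφ : Continuous φ := hf.comp cantorSetHomeomorphNatToBool.continuous
  have hφs : Function.Surjective φ := hfs.comp cantorSetHomeomorphNatToBool.surjective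
  have hφ1 : Continuous (fun t => (φ t).1) := continuous_subtype_val.comp hφ
  obtain ⟨s, hs, hmax⟩ := argmax_real cantorSet isCompact_cantorSet ⟨0, zero_mem_cantorSet⟩
    (fun t x => g (φ t).1 x) (fun x => (hc x).comp hφ1) (fun t => hm _)
  refine ⟨fun x => (φ (s x)).1, hφ1.measurable.comp hs, ?_, ?_⟩
  · intro x i
    have := (φ (s x)).2
    exact abs_le.mpr ⟨this.1 i, this.2 i⟩
  · intro x t ht
    obtain ⟨u, hu⟩ := hφs ⟨t, fun i => (abs_le.mp (ht i)).1, fun i => (abs_le.mp (ht i)).2⟩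
    have := hmax x u
    simp only [hu] at this
    exact this

end PartS

section PartT

/-! ### Deterministic quadratic approximation -/

/-- the score statistic -/
def Dl {n : ℕ} (ξ : Fin 3 → ℝ → ℝ) (x : Fin n → ℝ) (i : Fin 3) : ℝ := ∑ j, ξ i (x j)

/-- Gram discrepancy -/
def Gd {n : ℕ} (ξ : Fin 3 → ℝ → ℝ) (x : Fin n → ℝ) (i k : Fin 3) : ℝ :=
  (∑ j, ξ i (x j) * ξ k (x j)) - if i = k then 1 else 0

/-- total error statistic -/
def SS {n : ℕ} (ξ : Fin 3 → ℝ → ℝ) (η : Fin 6 → ℝ → ℝ) (e : ℕ → ℝ → ℝ) (x : Fin n → ℝ) : ℝ :=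
  (∑ k, |∑ j, η k (x j)|) + (∑ j, e 3 (x j)) + (∑ j, e 1 (x j) * e 2 (x j)) + (∑ j, e 1 (x j) ^ 3)
    + ∑ i, ∑ k, |Gd ξ x i k|

/-- truncated log-likelihood ratio -/
def Lr {n : ℕ} (r : (Fin 3 → ℝ) → ℝ → ℝ) (ζ : Fin 3 → ℝ) (x : Fin n → ℝ) : ℝ :=
  ∑ j, Real.log (1 + max (r ζ (x j)) (-1 / 2))

lemma log_expand {r a b e1 e2 e3 : ℝ} (h0 : 0 ≤ e3) (h32 : e3 ≤ e2) (h21 : e2 ≤ e1) (h1 : e1 ≤ 1 / 6)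
    (ha : |a| ≤ e1) (hb : |b| ≤ e2) (hr : |r - a - (1 / 2) * b| ≤ e3) :
    |r| ≤ 1 / 2 ∧
    |Real.log (1 + max r (-1 / 2)) - a - (1 / 2) * b + (1 / 2) * a ^ 2|
      ≤ e3 + 3 * (e1 * e2) + 54 * e1 ^ 3 := by
  have hra : |r - a| ≤ 3 / 2 * e2 := by
    rw [abs_le] at hb hr ⊢
    constructor <;> linarith
  have hr3 : |r| ≤ 3 * e1 := by
    rw [abs_le] at hra ha ⊢
    constructor <;> linarith
  have hrp : |r + a| ≤ 4 * e1 := by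
    rw [abs_le] at hr3 ha ⊢
    constructor <;> linarith
  have hr2 : |r| ≤ 1 / 2 := by linarith
  refine ⟨hr2, ?_⟩
  have hmax : max r (-1 / 2) = r := max_eq_left (by have := (abs_le.mp hr2).1; linarith)
  rw [hmax]
  have hl := Real.abs_log_sub_add_sum_range_le (x := -r) (by rw [abs_neg]; linarith) 2
  simp only [Finset.sum_range_succ, Finset.sum_range_zero, abs_neg, sub_neg_eq_add] at hl
  norm_num at hl
  have hl2 : |r| ^ 3 / (1 - |r|) ≤ 54 * e1 ^ 3 := by
    rw [div_le_iff₀ (by linarith)]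
    have h27 : |r| ^ 3 ≤ (3 * e1) ^ 3 := pow_le_pow_left₀ (abs_nonneg _) hr3 3
    have he : 0 ≤ e1 ^ 3 := by have := (abs_nonneg a).trans ha; positivity
    nlinarith
  have hsq : |r ^ 2 - a ^ 2| ≤ 6 * (e1 * e2) := by
    have : r ^ 2 - a ^ 2 = (r - a) * (r + a) := by ring
    rw [this, abs_mul]
    have he : 0 ≤ e2 := by linarith
    calc |r - a| * |r + a| ≤ (3 / 2 * e2) * (4 * e1) :=
          mul_le_mul hra hrp (abs_nonneg _) (by positivity)
      _ = _ := by ring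
  have hl3 := hl.trans hl2
  rw [abs_le] at hl3 hsq hr ⊢
  constructor <;> linarith [hl3.1, hl3.2]

lemma quad_gram {n : ℕ} (ξ : Fin 3 → ℝ → ℝ) (x : Fin n → ℝ) (ζ : Fin 3 → ℝ) :
    |(∑ j, (∑ i, ζ i * ξ i (x j)) ^ 2) - ∑ i, ζ i ^ 2| ≤
      (∑ i, ζ i ^ 2) * ∑ i, ∑ k, |Gd ξ x i k| := by
  have h1 : (∑ j, (∑ i, ζ i * ξ i (x j)) ^ 2) - ∑ i, ζ i ^ 2
      = ∑ i, ∑ k, ζ i * ζ k * Gd ξ x i k := by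
    have : ∑ j, (∑ i, ζ i * ξ i (x j)) ^ 2 =
        ∑ i, ∑ k, ζ i * ζ k * ∑ j, ξ i (x j) * ξ k (x j) := by
      simp only [pow_two, Finset.sum_mul_sum]
      simp only [Finset.mul_sum]
      rw [Finset.sum_comm]
      refine Finset.sum_congr rfl (fun i _ => ?_)
      rw [Finset.sum_comm]
      refine Finset.sum_congr rfl (fun k _ => ?_)
      refine Finset.sum_congr rfl (fun j _ => ?_)
      ring
    rw [this]
    simp only [Gd, mul_sub, Finset.sum_sub_distrib]
    congr 1
    simp [pow_two]
  rw [h1, Finset.mul_sum]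
  refine (Finset.abs_sum_le_sum_abs _ _).trans (Finset.sum_le_sum fun i _ => ?_)
  rw [Finset.mul_sum]
  refine (Finset.abs_sum_le_sum_abs _ _).trans (Finset.sum_le_sum fun k _ => ?_)
  rw [abs_mul]
  refine mul_le_mul_of_nonneg_right ?_ (abs_nonneg _)
  have hi : ζ i ^ 2 ≤ ∑ i, ζ i ^ 2 := Finset.single_le_sum (f := fun i => ζ i ^ 2)
    (fun i _ => sq_nonneg _) (Finset.mem_univ i)
  have hk : ζ k ^ 2 ≤ ∑ i, ζ i ^ 2 := Finset.single_le_sum (f := fun i => ζ i ^ 2)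
    (fun i _ => sq_nonneg _) (Finset.mem_univ k)
  rw [abs_mul]
  nlinarith [sq_nonneg (|ζ i| - |ζ k|), sq_abs (ζ i), sq_abs (ζ k)]

variable {n : ℕ} {ν : Measure ℝ} {R τ : ℝ} {ξ : Fin 3 → ℝ → ℝ} {η : Fin 6 → ℝ → ℝ} {e : ℕ → ℝ → ℝ}
  {cf : (Fin 3 → ℝ) → Fin 6 → ℝ} {r : (Fin 3 → ℝ) → ℝ → ℝ}

lemma Blk.e1_nn (hB : Blk n ν R τ ξ η e cf r) (y : ℝ) : 0 ≤ e 1 y :=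
  ((hB.e0 y).trans (hB.e32 y)).trans (hB.e21 y)
lemma Blk.e2_nn (hB : Blk n ν R τ ξ η e cf r) (y : ℝ) : 0 ≤ e 2 y :=
  ((hB.e0 y).trans (hB.e32 y))

lemma Blk.SS_nn (hB : Blk n ν R τ ξ η e cf r) (x : Fin n → ℝ) : 0 ≤ SS ξ η e x := by
  unfold SS
  have h1 : 0 ≤ ∑ k, |∑ j, η k (x j)| := Finset.sum_nonneg fun _ _ => abs_nonneg _
  have h2 : 0 ≤ ∑ j, e 3 (x j) := Finset.sum_nonneg fun _ _ => hB.e0 _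
  have h3 : 0 ≤ ∑ j, e 1 (x j) * e 2 (x j) :=
    Finset.sum_nonneg fun _ _ => mul_nonneg (hB.e1_nn _) (hB.e2_nn _)
  have h4 : 0 ≤ ∑ j, e 1 (x j) ^ 3 := Finset.sum_nonneg fun _ _ => pow_nonneg (hB.e1_nn _) _
  have h5 : 0 ≤ ∑ i, ∑ k, |Gd ξ x i k| :=
    Finset.sum_nonneg fun _ _ => Finset.sum_nonneg fun _ _ => abs_nonneg _
  linarith

lemma Blk.e1_small (hB : Blk n ν R τ ξ η e cf r) (x : Fin n → ℝ) (h : SS ξ η e x ≤ 1 / 432)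
    (j : Fin n) : e 1 (x j) ≤ 1 / 6 := by
  have h1 : 0 ≤ ∑ k, |∑ j, η k (x j)| := Finset.sum_nonneg fun _ _ => abs_nonneg _
  have h2 : 0 ≤ ∑ j, e 3 (x j) := Finset.sum_nonneg fun _ _ => hB.e0 _
  have h3 : 0 ≤ ∑ j, e 1 (x j) * e 2 (x j) :=
    Finset.sum_nonneg fun _ _ => mul_nonneg (hB.e1_nn _) (hB.e2_nn _)
  have h5 : 0 ≤ ∑ i, ∑ k, |Gd ξ x i k| :=
    Finset.sum_nonneg fun _ _ => Finset.sum_nonneg fun _ _ => abs_nonneg _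
  have h4 : e 1 (x j) ^ 3 ≤ ∑ j, e 1 (x j) ^ 3 :=
    Finset.single_le_sum (f := fun j => e 1 (x j) ^ 3) (fun _ _ => pow_nonneg (hB.e1_nn _) _)
      (Finset.mem_univ j)
  unfold SS at h
  by_contra hc
  push Not at hc
  have : (1 / 6 : ℝ) ^ 3 < e 1 (x j) ^ 3 := pow_lt_pow_left₀ hc (by norm_num) (by norm_num)
  norm_num at this
  linarith

lemma Blk.quad (hB : Blk n ν R τ ξ η e cf r) (x : Fin n → ℝ) (h : SS ξ η e x ≤ 1 / 432)
    (ζ : Fin 3 → ℝ) (hζ : ∀ i, |ζ i| ≤ R) :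
    |Lr r ζ x - (∑ i, ζ i * Dl ξ x i) + (1 / 2) * ∑ i, ζ i ^ 2| ≤
      54 * SS ξ η e x * (1 + ∑ i, ζ i ^ 2) := by
  have hj := fun j => (log_expand (hB.e0 (x j)) (hB.e32 _) (hB.e21 _) (hB.e1_small x h j)
    (hB.ξle ζ hζ _) (hB.ηle ζ hζ _) (hB.rem ζ hζ _)).2
  have hsum : |Lr r ζ x - (∑ i, ζ i * Dl ξ x i) - (1 / 2) * (∑ k, cf ζ k * ∑ j, η k (x j))
      + (1 / 2) * ∑ j, (∑ i, ζ i * ξ i (x j)) ^ 2| ≤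
      (∑ j, e 3 (x j)) + 3 * (∑ j, e 1 (x j) * e 2 (x j)) + 54 * ∑ j, e 1 (x j) ^ 3 := by
    have h1 : ∑ i, ζ i * Dl ξ x i = ∑ j, ∑ i, ζ i * ξ i (x j) := by
      simp only [Dl, Finset.mul_sum]; rw [Finset.sum_comm]
    have h2 : ∑ k, cf ζ k * ∑ j, η k (x j) = ∑ j, ∑ k, cf ζ k * η k (x j) := by
      simp only [Finset.mul_sum]; rw [Finset.sum_comm]
    rw [h1, h2, Lr, Finset.mul_sum, Finset.mul_sum, Finset.mul_sum, Finset.mul_sum,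
      ← Finset.sum_sub_distrib, ← Finset.sum_sub_distrib, ← Finset.sum_add_distrib,
      ← Finset.sum_add_distrib, ← Finset.sum_add_distrib]
    exact (Finset.abs_sum_le_sum_abs _ _).trans (Finset.sum_le_sum fun j _ => hj j)
  have hH : |∑ k, cf ζ k * ∑ j, η k (x j)| ≤ 3 * ∑ k, |∑ j, η k (x j)| := by
    rw [Finset.mul_sum]
    refine (Finset.abs_sum_le_sum_abs _ _).trans (Finset.sum_le_sum fun k _ => ?_)
    rw [abs_mul]
    exact mul_le_mul_of_nonneg_right (hB.cfle ζ hζ k) (abs_nonneg _)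
  have hQ := quad_gram ξ x ζ
  have h1 : 0 ≤ ∑ k, |∑ j, η k (x j)| := Finset.sum_nonneg fun _ _ => abs_nonneg _
  have h2 : 0 ≤ ∑ j, e 3 (x j) := Finset.sum_nonneg fun _ _ => hB.e0 _
  have h3 : 0 ≤ ∑ j, e 1 (x j) * e 2 (x j) :=
    Finset.sum_nonneg fun _ _ => mul_nonneg (hB.e1_nn _) (hB.e2_nn _)
  have h4 : 0 ≤ ∑ j, e 1 (x j) ^ 3 := Finset.sum_nonneg fun _ _ => pow_nonneg (hB.e1_nn _) _
  have h5 : 0 ≤ ∑ i, ∑ k, |Gd ξ x i k| :=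
    Finset.sum_nonneg fun _ _ => Finset.sum_nonneg fun _ _ => abs_nonneg _
  have h6 : 0 ≤ ∑ i, ζ i ^ 2 := Finset.sum_nonneg fun _ _ => sq_nonneg _
  unfold SS
  generalize (∑ k, |∑ j, η k (x j)|) = s1 at *
  generalize (∑ j, e 3 (x j)) = s2 at *
  generalize (∑ j, e 1 (x j) * e 2 (x j)) = s3 at *
  generalize (∑ j, e 1 (x j) ^ 3) = s4 at *
  generalize (∑ i, ∑ k, |Gd ξ x i k|) = s5 at *
  generalize (∑ i, ζ i ^ 2) = z at *
  generalize (∑ j, (∑ i, ζ i * ξ i (x j)) ^ 2) = q at *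
  generalize (∑ k, cf ζ k * ∑ j, η k (x j)) = b at *
  generalize (∑ i, ζ i * Dl ξ x i) = a at *
  generalize Lr r ζ x = L at *
  have m1 := mul_nonneg h1 h6
  have m2 := mul_nonneg h2 h6
  have m3 := mul_nonneg h3 h6
  have m4 := mul_nonneg h4 h6
  have m5 := mul_nonneg h6 h5
  rw [abs_le] at hsum hH hQ ⊢
  constructor <;> nlinarith [hsum.1, hsum.2, hH.1, hH.2, hQ.1, hQ.2]

lemma Blk.argmax_close (hB : Blk n ν R τ ξ η e cf r) (x : Fin n → ℝ) (h : SS ξ η e x ≤ 1 / 432)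
    (hΔ : ∀ i, |Dl ξ x i| ≤ R) (ζ : Fin 3 → ℝ) (hζ : ∀ i, |ζ i| ≤ R)
    (hmax : Lr r (Dl ξ x) x ≤ Lr r ζ x) :
    ∑ i, (ζ i - Dl ξ x i) ^ 2 ≤ 216 * SS ξ η e x * (2 + 3 * ∑ i, Dl ξ x i ^ 2) := by
  have q1 := hB.quad x h ζ hζ
  have q2 := hB.quad x h (Dl ξ x) hΔ
  have hs := hB.SS_nn x
  generalize SS ξ η e x = S at *
  generalize Lr r ζ x = L1 at *
  generalize Lr r (Dl ξ x) x = L2 at *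
  generalize hd : Dl ξ x = d at *
  clear hd hΔ hζ
  simp only [Fin.sum_univ_three] at *
  have e1 : (ζ 0 - d 0) ^ 2 + (ζ 1 - d 1) ^ 2 + (ζ 2 - d 2) ^ 2 =
     (ζ 0 ^ 2 + ζ 1 ^ 2 + ζ 2 ^ 2) + (d 0 ^ 2 + d 1 ^ 2 + d 2 ^ 2)
      - 2 * (ζ 0 * d 0 + ζ 1 * d 1 + ζ 2 * d 2) := by ring
  have e2 : d 0 * d 0 + d 1 * d 1 + d 2 * d 2 = d 0 ^ 2 + d 1 ^ 2 + d 2 ^ 2 := by ring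
  have e3 : (ζ 0 ^ 2 + ζ 1 ^ 2 + ζ 2 ^ 2) ≤
    2 * ((ζ 0 - d 0) ^ 2 + (ζ 1 - d 1) ^ 2 + (ζ 2 - d 2) ^ 2) + 2 * (d 0 ^ 2 + d 1 ^ 2 + d 2 ^ 2) := by
    nlinarith [sq_nonneg (ζ 0 - 2 * d 0), sq_nonneg (ζ 1 - 2 * d 1), sq_nonneg (ζ 2 - 2 * d 2)]
  have hw : 0 ≤ (ζ 0 - d 0) ^ 2 + (ζ 1 - d 1) ^ 2 + (ζ 2 - d 2) ^ 2 := by positivity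
  rw [e2] at q2
  generalize (ζ 0 - d 0) ^ 2 + (ζ 1 - d 1) ^ 2 + (ζ 2 - d 2) ^ 2 = w at *
  generalize (ζ 0 ^ 2 + ζ 1 ^ 2 + ζ 2 ^ 2) = z at *
  generalize (d 0 ^ 2 + d 1 ^ 2 + d 2 ^ 2) = D at *
  generalize (ζ 0 * d 0 + ζ 1 * d 1 + ζ 2 * d 2) = a at *
  have h1 := (abs_le.mp q1).2
  have h2 := (abs_le.mp q2).1
  have h3 : (1 / 2) * w ≤ 54 * S * (2 + z + D) := by nlinarith
  have h4 : 54 * S * (2 + z + D) ≤ 54 * S * (2 + 2 * w + 3 * D) :=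
    mul_le_mul_of_nonneg_left (by linarith) (by linarith)
  have h5 : S * w ≤ 1 / 432 * w := mul_le_mul_of_nonneg_right h hw
  nlinarith

end PartT

section PartU

/-! ### Convergence in probability -/

lemma pi_integral_sum {n : ℕ} (ν : Measure ℝ) [IsProbabilityMeasure ν] (f : ℝ → ℝ)
    (hf : Integrable f ν) :
    ∫ x : Fin n → ℝ, ∑ j, f (x j) ∂(Measure.pi fun _ => ν) = n * ∫ y, f y ∂ν := by
  rw [integral_finsetSum _ (fun j _ => integrable_comp_eval (μ := fun _ : Fin n => ν) hf)]
  simp only [integral_comp_eval (μ := fun _ : Fin n => ν) hf.1]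
  simp

lemma markov_pi {n : ℕ} (ν : Measure ℝ) [IsProbabilityMeasure ν] (f : ℝ → ℝ)
    (h0 : ∀ y, 0 ≤ f y) (hf : Integrable f ν) (ε : ℝ) (hε : 0 < ε) :
    (Measure.pi fun _ : Fin n => ν) {x | ε ≤ |∑ j, f (x j)|} ≤
      ENNReal.ofReal (n * (∫ y, f y ∂ν) / ε) := by
  have hnn : ∀ x : Fin n → ℝ, 0 ≤ ∑ j, f (x j) := fun x => Finset.sum_nonneg fun _ _ => h0 _
  have hi : Integrable (fun x : Fin n → ℝ => ∑ j, f (x j)) (Measure.pi fun _ => ν) :=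
    integrable_finsetSum _ (fun j _ => integrable_comp_eval (μ := fun _ : Fin n => ν) hf)
  have := mul_meas_ge_le_integral_of_nonneg (ae_of_all _ hnn) hi ε
  rw [pi_integral_sum ν f hf] at this
  simp only [abs_of_nonneg (hnn _)]
  rw [← ofReal_measureReal]
  apply ENNReal.ofReal_le_ofReal
  rw [le_div_iff₀ hε]
  linarith

lemma cheb_pi {n : ℕ} (ν : Measure ℝ) [IsProbabilityMeasure ν] (f : ℝ → ℝ)
    (hm : Measurable f) (hf : Integrable (fun y => f y ^ 2) ν) (ε : ℝ) (hε : 0 < ε) :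
    (Measure.pi fun _ : Fin n => ν) {x | ε ≤ |∑ j, f (x j) - n * ∫ y, f y ∂ν|} ≤
      ENNReal.ofReal (n * (∫ y, f y ^ 2 ∂ν) / ε ^ 2) := by
  have hL : MemLp f 2 ν := (memLp_two_iff_integrable_sq hm.aestronglyMeasurable).mpr hf
  have hX : MemLp (∑ j : Fin n, fun x : Fin n → ℝ => f (x j)) 2 (Measure.pi fun _ => ν) :=
    memLp_finsetSum' _ (fun j _ =>
      hL.comp_measurePreserving (measurePreserving_eval (fun _ : Fin n => ν) j))
  have h1 := ProbabilityTheory.meas_ge_le_variance_div_sq hX hε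
  have h2 := ProbabilityTheory.variance_sum_pi (μ := fun _ : Fin n => ν) (X := fun _ => f)
    (fun _ => hL)
  rw [h2] at h1
  have h3 := pi_integral_sum (n := n) ν f (hL.integrable (by norm_num))
  simp only [Finset.sum_apply] at h1
  rw [h3] at h1
  refine h1.trans (ENNReal.ofReal_le_ofReal ?_)
  have h4 := ProbabilityTheory.variance_le_expectation_sq (μ := ν) hm.aestronglyMeasurable
  simp only [Finset.sum_const, Finset.card_univ, Fintype.card_fin, nsmul_eq_mul]
  gcongr
  exact h4

/-- convergence to zero in probability -/
def P0 (P : ∀ n : ℕ, Measure (Fin n → ℝ)) (Y : ∀ n : ℕ, (Fin n → ℝ) → ℝ) : Prop :=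
  ∀ ε : ℝ, 0 < ε → Tendsto (fun n => P n {x | ε ≤ |Y n x|}) atTop (𝓝 0)

/-- tightness -/
def Tg (P : ∀ n : ℕ, Measure (Fin n → ℝ)) (Y : ∀ n : ℕ, (Fin n → ℝ) → ℝ) : Prop :=
  ∀ ε : ENNReal, 0 < ε → ∃ K : ℝ, 0 < K ∧ ∀ᶠ n in atTop, P n {x | K ≤ |Y n x|} ≤ ε

variable {P : ∀ n : ℕ, Measure (Fin n → ℝ)} {Y Z : ∀ n : ℕ, (Fin n → ℝ) → ℝ}

lemma enn_squeeze {a b : ℕ → ENNReal} (hb : Tendsto b atTop (𝓝 0)) (h : ∀ᶠ n in atTop, a n ≤ b n) :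
    Tendsto a atTop (𝓝 0) :=
  tendsto_of_tendsto_of_tendsto_of_le_of_le' tendsto_const_nhds hb
    (Eventually.of_forall fun _ => bot_le) h

lemma P0.mono (hZ : P0 P Z) (h : ∀ᶠ n in atTop, ∀ x, |Y n x| ≤ |Z n x|) : P0 P Y := by
  intro ε hε
  refine enn_squeeze (hZ ε hε) (h.mono fun n hn => measure_mono fun x hx => ?_)
  exact le_trans hx (hn x)

lemma P0.add (hY : P0 P Y) (hZ : P0 P Z) : P0 P (fun n x => Y n x + Z n x) := by
  intro ε hε
  have h1 := (hY (ε / 2) (by linarith)).add (hZ (ε / 2) (by linarith))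
  rw [add_zero] at h1
  refine enn_squeeze h1 (Eventually.of_forall fun n => ?_)
  refine le_trans (measure_mono ?_) (measure_union_le _ _)
  intro x hx
  by_contra hc
  simp only [mem_union, mem_ofPred_eq, not_or, not_le] at hc hx
  have := abs_add_le (Y n x) (Z n x)
  linarith [hc.1, hc.2]

lemma P0.det {c : ℕ → ℝ} (hc : Tendsto c atTop (𝓝 0)) : P0 P (fun n _ => c n) := by
  intro ε hε
  refine enn_squeeze (b := fun _ => 0) tendsto_const_nhds ?_
  have := (hc.abs).eventually (Iio_mem_nhds (show |(0:ℝ)| < ε by simpa using hε))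
  filter_upwards [this] with n hn
  have hn : |c n| < ε := hn
  have : {x : Fin n → ℝ | ε ≤ |c n|} = ∅ := by
    ext x; simp [hn]
  rw [this]; simp

lemma P0.sum {ι : Type*} (s : Finset ι) {W : ι → ∀ n : ℕ, (Fin n → ℝ) → ℝ}
    (h : ∀ i ∈ s, P0 P (W i)) : P0 P (fun n x => ∑ i ∈ s, W i n x) := by
  classical
  induction s using Finset.induction_on with
  | empty => simpa using P0.det (P := P) (c := fun _ => 0) tendsto_const_nhds
  | insert a s ha ih =>
    simp only [Finset.sum_insert ha]
    exact (h a (Finset.mem_insert_self _ _)).add (ih fun i hi => h i (Finset.mem_insert_of_mem hi))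

lemma P0.abs (h : P0 P Y) : P0 P (fun n x => |Y n x|) :=
  h.mono (Eventually.of_forall fun n x => by simp)

lemma P0.mul_tight (hY : P0 P Y) (hZ : Tg P Z) : P0 P (fun n x => Y n x * Z n x) := by
  intro ε hε
  rw [ENNReal.tendsto_nhds_zero]
  intro η hη
  obtain ⟨K, hK, hK2⟩ := hZ (η / 2) (ENNReal.half_pos hη.ne')
  have h1 := (ENNReal.tendsto_nhds_zero.mp (hY (ε / K) (by positivity))) (η / 2)
    (ENNReal.half_pos hη.ne')
  filter_upwards [hK2, h1] with n h2 h3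
  rw [← ENNReal.add_halves η]
  refine le_trans (le_trans (measure_mono ?_) (measure_union_le _ _)) (add_le_add h2 h3)
  intro x hx
  by_contra hc
  simp only [mem_union, mem_ofPred_eq, not_or, not_le] at hc hx
  rw [abs_mul] at hx
  have h5 : |Y n x| * |Z n x| ≤ |Y n x| * K := mul_le_mul_of_nonneg_left hc.1.le (abs_nonneg _)
  have h6 := hc.2
  rw [lt_div_iff₀ hK] at h6
  linarith

lemma Tg.of_P0 (hY : P0 P Y) : Tg P Y := fun ε hε =>
  ⟨1, one_pos, (ENNReal.tendsto_nhds_zero.mp (hY 1 one_pos)) ε hε⟩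

lemma Tg.add (hY : Tg P Y) (hZ : Tg P Z) : Tg P (fun n x => Y n x + Z n x) := by
  intro ε hε
  obtain ⟨K, hK, hK2⟩ := hY (ε / 2) (ENNReal.half_pos hε.ne')
  obtain ⟨M, hM, hM2⟩ := hZ (ε / 2) (ENNReal.half_pos hε.ne')
  refine ⟨K + M, by linarith, ?_⟩
  filter_upwards [hK2, hM2] with n h2 h3
  rw [← ENNReal.add_halves ε]
  refine le_trans (le_trans (measure_mono ?_) (measure_union_le _ _)) (add_le_add h2 h3)
  intro x hx
  by_contra hc
  simp only [mem_union, mem_ofPred_eq, not_or, not_le] at hc hx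
  have := abs_add_le (Y n x) (Z n x)
  linarith [hc.1, hc.2]

lemma Tg.mul (hY : Tg P Y) (hZ : Tg P Z) : Tg P (fun n x => Y n x * Z n x) := by
  intro ε hε
  obtain ⟨K, hK, hK2⟩ := hY (ε / 2) (ENNReal.half_pos hε.ne')
  obtain ⟨M, hM, hM2⟩ := hZ (ε / 2) (ENNReal.half_pos hε.ne')
  refine ⟨K * M, by positivity, ?_⟩
  filter_upwards [hK2, hM2] with n h2 h3
  rw [← ENNReal.add_halves ε]
  refine le_trans (le_trans (measure_mono ?_) (measure_union_le _ _)) (add_le_add h2 h3)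
  intro x hx
  by_contra hc
  simp only [mem_union, mem_ofPred_eq, not_or, not_le] at hc hx
  rw [abs_mul] at hx
  have h5 : |Y n x| * |Z n x| < K * M :=
    mul_lt_mul'' hc.1 hc.2 (abs_nonneg _) (abs_nonneg _)
  linarith

lemma Tg.const (c : ℝ) : Tg P (fun _ _ => c) := by
  intro ε hε
  refine ⟨|c| + 1, by positivity, Eventually.of_forall fun n => ?_⟩
  have : {x : Fin n → ℝ | |c| + 1 ≤ |c|} = ∅ := by ext x; simp
  rw [this]; simp

lemma Tg.escape (hY : Tg P Y) {R : ℕ → ℝ} (hR : Tendsto R atTop atTop) :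
    Tendsto (fun n => P n {x | R n ≤ |Y n x|}) atTop (𝓝 0) := by
  rw [ENNReal.tendsto_nhds_zero]
  intro η hη
  obtain ⟨K, hK, hK2⟩ := hY η hη
  filter_upwards [hK2, hR.eventually_ge_atTop K] with n h1 h2
  exact (measure_mono fun x hx => le_trans h2 hx).trans h1

/-- the abstract sequence of experiments -/
structure Sq (ν : ℕ → Measure ℝ) (R τ : ℕ → ℝ) (ξ : ℕ → Fin 3 → ℝ → ℝ) (η : ℕ → Fin 6 → ℝ → ℝ)
    (e : ℕ → ℕ → ℝ → ℝ) (cf : ℕ → (Fin 3 → ℝ) → Fin 6 → ℝ) (r : ℕ → (Fin 3 → ℝ) → ℝ → ℝ) : Prop where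
  blk : ∀ᶠ n in atTop, Blk n (ν n) (R n) (τ n) (ξ n) (η n) (e n) (cf n) (r n)
  τ0 : Tendsto τ atTop (𝓝 0)
  RT : Tendsto R atTop atTop
  gram : ∀ ζ : Fin 3 → ℝ, Tendsto (fun n : ℕ => n * ∫ x, (∑ i, ζ i * ξ n i x) ^ 2 ∂(ν n)) atTop
    (𝓝 (∑ i, ζ i ^ 2))

/-- product measures -/
def PP (ν : ℕ → Measure ℝ) (n : ℕ) : Measure (Fin n → ℝ) := Measure.pi fun _ => ν n

variable {ν : ℕ → Measure ℝ} {R τ : ℕ → ℝ} {ξ : ℕ → Fin 3 → ℝ → ℝ} {η : ℕ → Fin 6 → ℝ → ℝ}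
  {e : ℕ → ℕ → ℝ → ℝ} {cf : ℕ → (Fin 3 → ℝ) → Fin 6 → ℝ} {r : ℕ → (Fin 3 → ℝ) → ℝ → ℝ}

lemma ofReal_zero {a : ℕ → ℝ} (h : Tendsto a atTop (𝓝 0)) (c : ℝ) :
    Tendsto (fun n => ENNReal.ofReal (a n / c)) atTop (𝓝 0) := by
  have := ENNReal.tendsto_ofReal (h.div_const c)
  simpa using this

lemma P0_markov (hτ : Tendsto τ atTop (𝓝 0)) (f : ℕ → ℝ → ℝ)
    (h : ∀ᶠ n : ℕ in atTop, IsProbabilityMeasure (ν n) ∧ (∀ y, 0 ≤ f n y) ∧ Integrable (f n) (ν n) ∧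
      n * ∫ y, f n y ∂(ν n) ≤ τ n) : P0 (PP ν) (fun n x => ∑ j, f n (x j)) := by
  intro ε hε
  refine enn_squeeze (ofReal_zero hτ ε) ?_
  filter_upwards [h] with n ⟨h1, h2, h3, h4⟩
  refine (markov_pi (ν n) (f n) h2 h3 ε hε).trans (ENNReal.ofReal_le_ofReal ?_)
  gcongr

lemma P0_cheb (hτ : Tendsto τ atTop (𝓝 0)) (f : ℕ → ℝ → ℝ)
    (h : ∀ᶠ n : ℕ in atTop, IsProbabilityMeasure (ν n) ∧ Measurable (f n) ∧
      Integrable (fun y => f n y ^ 2) (ν n) ∧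
      n * ∫ y, f n y ^ 2 ∂(ν n) ≤ τ n) :
    P0 (PP ν) (fun n x => ∑ j, f n (x j) - n * ∫ y, f n y ∂(ν n)) := by
  intro ε hε
  refine enn_squeeze (ofReal_zero hτ (ε ^ 2)) ?_
  filter_upwards [h] with n ⟨h1, h2, h3, h4⟩
  refine (cheb_pi (ν n) (f n) h2 h3 ε hε).trans (ENNReal.ofReal_le_ofReal ?_)
  gcongr

lemma Blk.xi_le {n : ℕ} {ν : Measure ℝ} {R τ : ℝ} {ξ : Fin 3 → ℝ → ℝ} {η : Fin 6 → ℝ → ℝ}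
    {e : ℕ → ℝ → ℝ} {cf : (Fin 3 → ℝ) → Fin 6 → ℝ} {r : (Fin 3 → ℝ) → ℝ → ℝ}
    (hB : Blk n ν R τ ξ η e cf r) (i : Fin 3) (y : ℝ) : |ξ i y| ≤ e 1 y := by
  have := hB.ξle (Pi.single i 1) (fun k => by
    by_cases h : k = i
    · subst h; simpa using hB.one_le
    · simpa [h] using zero_le_one.trans hB.one_le) y
  simpa [Pi.single_apply] using this

lemma Blk.xixi {n : ℕ} {ν : Measure ℝ} {R τ : ℝ} {ξ : Fin 3 → ℝ → ℝ} {η : Fin 6 → ℝ → ℝ}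
    {e : ℕ → ℝ → ℝ} {cf : (Fin 3 → ℝ) → Fin 6 → ℝ} {r : (Fin 3 → ℝ) → ℝ → ℝ}
    (hB : Blk n ν R τ ξ η e cf r) (i k : Fin 3) :
    Integrable (fun y => ξ i y * ξ k y) ν ∧ Integrable (fun y => (ξ i y * ξ k y) ^ 2) ν ∧
      n * ∫ y, (ξ i y * ξ k y) ^ 2 ∂ν ≤ τ := by
  have := hB.prob
  have hp : ∀ y, |ξ i y * ξ k y| ≤ e 1 y ^ 2 := fun y => by
    rw [abs_mul, pow_two]
    exact mul_le_mul (hB.xi_le i y) (hB.xi_le k y) (abs_nonneg _) (hB.e1_nn y)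
  have hq : ∀ y, (ξ i y * ξ k y) ^ 2 ≤ e 1 y ^ 4 := fun y => by
    have := pow_le_pow_left₀ (abs_nonneg _) (hp y) 2
    rw [sq_abs] at this
    calc _ ≤ _ := this
      _ = _ := by ring
  have hm : Measurable (fun y => ξ i y * ξ k y) := (hB.mξ i).mul (hB.mξ k)
  have i2 : Integrable (fun y => (ξ i y * ξ k y) ^ 2) ν := by
    refine hB.i14.mono' (hm.pow_const 2).aestronglyMeasurable (ae_of_all _ fun y => ?_)
    rw [Real.norm_eq_abs, abs_of_nonneg (sq_nonneg _)]
    exact hq y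
  refine ⟨?_, i2, ?_⟩
  · exact ((memLp_two_iff_integrable_sq hm.aestronglyMeasurable).mpr i2).integrable (by norm_num)
  · refine le_trans ?_ hB.b14
    refine mul_le_mul_of_nonneg_left (integral_mono i2 hB.i14 hq) (Nat.cast_nonneg _)

lemma Sq.gram2 (hS : Sq ν R τ ξ η e cf r) (i k : Fin 3) :
    Tendsto (fun n : ℕ => n * ∫ y, ξ n i y * ξ n k y ∂(ν n)) atTop (𝓝 (if i = k then 1 else 0)) := by
  have h1 := hS.gram (Pi.single i 1 + Pi.single k 1)
  have h2 := hS.gram (Pi.single i 1 - Pi.single k 1)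
  have h3 := (h1.sub h2).const_mul (1 / 4)
  have hlim : (1 / 4 : ℝ) * ((∑ j, (Pi.single i 1 + Pi.single k 1 : Fin 3 → ℝ) j ^ 2)
      - ∑ j, (Pi.single i 1 - Pi.single k 1 : Fin 3 → ℝ) j ^ 2) = if i = k then 1 else 0 := by
    fin_cases i <;> fin_cases k <;> simp [Fin.sum_univ_three, Pi.single_apply] <;> norm_num
  rw [hlim] at h3
  refine h3.congr' ?_
  filter_upwards [hS.blk] with n hB
  have hs1 : ∀ y, (∑ j, (Pi.single i 1 + Pi.single k 1 : Fin 3 → ℝ) j * ξ n j y) = ξ n i y + ξ n k y := by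
    intro y; simp [add_mul, Finset.sum_add_distrib, Pi.single_apply]
  have hs2 : ∀ y, (∑ j, (Pi.single i 1 - Pi.single k 1 : Fin 3 → ℝ) j * ξ n j y) = ξ n i y - ξ n k y := by
    intro y; simp [sub_mul, Finset.sum_sub_distrib, Pi.single_apply]
  simp only [hs1, hs2]
  have a1 := (hB.xixi i i).1
  have a2 := (hB.xixi k k).1
  have a3 := (hB.xixi i k).1
  have j1 : Integrable (fun y => (ξ n i y + ξ n k y) ^ 2) (ν n) := by
    refine ((a1.add a2).add (a3.const_mul 2)).congr (ae_of_all _ fun y => ?_)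
    simp only [Pi.add_apply]; ring
  have j2 : Integrable (fun y => (ξ n i y - ξ n k y) ^ 2) (ν n) := by
    refine ((a1.add a2).sub (a3.const_mul 2)).congr (ae_of_all _ fun y => ?_)
    simp only [Pi.add_apply, Pi.sub_apply]; ring
  rw [← mul_sub, ← integral_sub j1 j2]
  have : ∀ y, (ξ n i y + ξ n k y) ^ 2 - (ξ n i y - ξ n k y) ^ 2 = 4 * (ξ n i y * ξ n k y) := by
    intro y; ring
  simp only [this]
  rw [integral_const_mul]; ring

lemma Sq.SS0 (hS : Sq ν R τ ξ η e cf r) : P0 (PP ν) (fun n x => SS (ξ n) (η n) (e n) x) := by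
  have h1 : ∀ k, P0 (PP ν) (fun n x => ∑ j, η n k (x j)) := by
    intro k
    have := P0_cheb (ν := ν) hS.τ0 (fun n => η n k) (hS.blk.mono fun n hB =>
      ⟨hB.prob, hB.mη k, hB.iη k, hB.bη k⟩)
    refine this.mono (hS.blk.mono fun n hB x => ?_)
    rw [hB.η0 k]; simp
  have h2 : P0 (PP ν) (fun n x => ∑ j, e n 3 (x j)) :=
    P0_markov hS.τ0 (fun n => e n 3) (hS.blk.mono fun n hB => ⟨hB.prob, hB.e0, hB.i3, hB.b3⟩)
  have h3 : P0 (PP ν) (fun n x => ∑ j, e n 1 (x j) * e n 2 (x j)) :=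
    P0_markov hS.τ0 (fun n y => e n 1 y * e n 2 y) (hS.blk.mono fun n hB =>
      ⟨hB.prob, fun y => mul_nonneg (hB.e1_nn y) (hB.e2_nn y), hB.i12, hB.b12⟩)
  have h4 : P0 (PP ν) (fun n x => ∑ j, e n 1 (x j) ^ 3) :=
    P0_markov hS.τ0 (fun n y => e n 1 y ^ 3) (hS.blk.mono fun n hB =>
      ⟨hB.prob, fun y => pow_nonneg (hB.e1_nn y) _, hB.i13, hB.b13⟩)
  have h5 : ∀ i k, P0 (PP ν) (fun n x => Gd (ξ n) x i k) := by
    intro i k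
    have g1 := P0_cheb (ν := ν) hS.τ0 (fun n y => ξ n i y * ξ n k y) (hS.blk.mono fun n hB =>
      ⟨hB.prob, (hB.mξ i).mul (hB.mξ k), (hB.xixi i k).2⟩)
    have g2 := (hS.gram2 i k).sub_const (if i = k then 1 else 0)
    rw [sub_self] at g2
    refine (g1.add (P0.det g2)).mono (Eventually.of_forall fun n x => le_of_eq ?_)
    unfold Gd
    congr 1
    ring
  unfold SS
  exact ((((P0.sum _ fun k _ => (h1 k).abs).add h2).add h3).add h4).add
    (P0.sum _ fun i _ => P0.sum _ fun k _ => (h5 i k).abs)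

lemma Sq.Dl_tight (hS : Sq ν R τ ξ η e cf r) (i : Fin 3) :
    Tg (PP ν) (fun n x => Dl (ξ n) x i) := by
  intro ε hε
  have hg := hS.gram2 i i
  simp only [if_true] at hg
  have hK : Tendsto (fun K : ℝ => ENNReal.ofReal (2 / K ^ 2)) atTop (𝓝 0) := by
    have : Tendsto (fun K : ℝ => 2 / K ^ 2) atTop (𝓝 0) :=
      tendsto_const_nhds.div_atTop (tendsto_pow_atTop (by norm_num))
    simpa using ENNReal.tendsto_ofReal this
  obtain ⟨K, hK1, hK2⟩ := ((ENNReal.tendsto_nhds_zero.mp hK ε hε).and (eventually_gt_atTop 0)).exists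
  refine ⟨K, hK2, ?_⟩
  filter_upwards [hS.blk, hg.eventually (Iio_mem_nhds (show (1:ℝ) < 2 by norm_num))] with n hB h2
  have := hB.prob
  have hi : Integrable (fun y => ξ n i y ^ 2) (ν n) := by
    simpa only [pow_two] using (hB.xixi i i).1
  have hc := cheb_pi (n := n) (ν n) (ξ n i) (hB.mξ i) hi K hK2
  rw [hB.ξ0 i] at hc
  simp only [mul_zero, sub_zero] at hc
  refine hc.trans (le_trans (ENNReal.ofReal_le_ofReal ?_) hK1)
  gcongr
  simpa only [pow_two] using h2.le

lemma Sq.close (hS : Sq ν R τ ξ η e cf r) (z : ∀ n : ℕ, (Fin n → ℝ) → (Fin 3 → ℝ))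
    (hz : ∀ᶠ n in atTop, ∀ x, (∀ i, |z n x i| ≤ R n) ∧
      ∀ ζ : Fin 3 → ℝ, (∀ i, |ζ i| ≤ R n) → Lr (r n) ζ x ≤ Lr (r n) (z n x) x) (i : Fin 3) :
    P0 (PP ν) (fun n x => z n x i - Dl (ξ n) x i) := by
  have hT : Tg (PP ν) (fun n x => 216 * (2 + 3 * ∑ i, Dl (ξ n) x i ^ 2)) := by
    have := fun i => (hS.Dl_tight i).mul (hS.Dl_tight i)
    have h2 := (Tg.const (P := PP ν) 216).mul ((Tg.const (P := PP ν) 2).add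
      ((Tg.const (P := PP ν) 3).mul (((this 0).add (this 1)).add (this 2))))
    simpa only [Fin.sum_univ_three, pow_two] using h2
  have hm := hS.SS0.mul_tight hT
  intro ε hε
  have h1 := hm (ε ^ 2) (by positivity)
  have h2 := hS.SS0 (1 / 432) (by norm_num)
  have h3 := fun i => (hS.Dl_tight i).escape hS.RT
  have h4 := (((h1.add h2).add (h3 0)).add (h3 1)).add (h3 2)
  simp only [add_zero] at h4
  refine enn_squeeze h4 ?_
  filter_upwards [hS.blk, hz] with n hB hzn
  refine le_trans (measure_mono ?_) (le_trans (measure_union_le _ _) (add_le_add_left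
    (le_trans (measure_union_le _ _) (add_le_add_left (le_trans (measure_union_le _ _)
      (add_le_add_left (measure_union_le _ _) _)) _)) _))
  intro x hx
  by_contra hc
  simp only [mem_union, mem_ofPred_eq, not_or, not_le] at hc hx
  obtain ⟨⟨⟨⟨c1, c2⟩, d0⟩, d1⟩, d2⟩ := hc
  have hD : ∀ i, |Dl (ξ n) x i| ≤ R n := by
    intro i; fin_cases i
    · exact d0.le
    · exact d1.le
    · exact d2.le
  have hcl := hB.argmax_close x ((le_abs_self _).trans c2.le) hD (z n x) (hzn x).1
    ((hzn x).2 _ hD)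
  have hsi : (z n x i - Dl (ξ n) x i) ^ 2 ≤ ∑ i, (z n x i - Dl (ξ n) x i) ^ 2 :=
    Finset.single_le_sum (f := fun i => (z n x i - Dl (ξ n) x i) ^ 2)
      (fun _ _ => sq_nonneg _) (Finset.mem_univ i)
  have h6 : ε ^ 2 ≤ (z n x i - Dl (ξ n) x i) ^ 2 := by
    rw [← sq_abs (z n x i - _)]
    exact pow_le_pow_left₀ hε.le hx 2
  have h7 := le_abs_self (SS (ξ n) (η n) (e n) x * (216 * (2 + 3 * ∑ i, Dl (ξ n) x i ^ 2)))
  linarith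

lemma Sq.z_tight (hS : Sq ν R τ ξ η e cf r) (z : ∀ n : ℕ, (Fin n → ℝ) → (Fin 3 → ℝ))
    (hz : ∀ᶠ n in atTop, ∀ x, (∀ i, |z n x i| ≤ R n) ∧
      ∀ ζ : Fin 3 → ℝ, (∀ i, |ζ i| ≤ R n) → Lr (r n) ζ x ≤ Lr (r n) (z n x) x) (i : Fin 3) :
    Tg (PP ν) (fun n x => z n x i) := by
  have := (Tg.of_P0 (hS.close z hz i)).add (hS.Dl_tight i)
  simpa using this

end PartU

section PartV

/-! ### Central limit theorem through characteristic functions -/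

lemma exp_taylor3 (x : ℝ) :
    ‖Complex.exp (Complex.I * x) - (1 + Complex.I * x - x ^ 2 / 2)‖ ≤ 4 * |x| ^ 3 := by
  by_cases hx : |x| ≤ 1
  · have hn : ‖Complex.I * (x : ℂ)‖ = |x| := by simp
    have h := Complex.exp_bound (x := Complex.I * x) (by rw [hn]; exact hx) (n := 3) (by norm_num)
    simp only [Finset.sum_range_succ, Finset.sum_range_zero] at h
    rw [hn] at h
    have e1 : (0 : ℂ) + (Complex.I * x) ^ 0 / ((0 : ℕ).factorial : ℂ) + (Complex.I * x) ^ 1 / ((1 : ℕ).factorial : ℂ)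
        + (Complex.I * x) ^ 2 / ((2 : ℕ).factorial : ℂ) = 1 + Complex.I * x - x ^ 2 / 2 := by
      simp [Nat.factorial, mul_pow]
      ring
    rw [e1] at h
    refine h.trans ?_
    have : 0 ≤ |x| ^ 3 := by positivity
    norm_num [Nat.factorial]
    nlinarith
  · push Not at hx
    have h1 : ‖Complex.exp (Complex.I * x) - (1 + Complex.I * x - x ^ 2 / 2)‖ ≤
        1 + (1 + |x| + |x| ^ 2 / 2) := by
      refine (norm_sub_le _ _).trans ?_
      rw [Complex.norm_exp_I_mul_ofReal]
      gcongr
      refine (norm_sub_le _ _).trans (add_le_add ((norm_add_le _ _).trans ?_) ?_)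
      · simp
      · simp
    refine h1.trans ?_
    nlinarith [mul_pos (sub_pos.mpr hx) (sub_pos.mpr hx), pow_pos (lt_trans zero_lt_one hx) 2, pow_pos (lt_trans zero_lt_one hx) 3]

lemma charfun_pi_pow {n : ℕ} (ν : Measure ℝ) [IsProbabilityMeasure ν] (f : ℝ → ℝ) :
    ∫ x : Fin n → ℝ, Complex.exp (Complex.I * ((∑ j, f (x j) : ℝ) : ℂ)) ∂(Measure.pi fun _ => ν) =
      (∫ y, Complex.exp (Complex.I * (f y : ℂ)) ∂ν) ^ n := by
  have := integral_fintype_prod_eq_pow (ι := Fin n) (μ := ν)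
    (fun y => Complex.exp (Complex.I * (f y : ℂ)))
  rw [Fintype.card_fin] at this
  rw [← this]
  congr 1
  funext x
  rw [← Complex.exp_sum, Complex.ofReal_sum, Finset.mul_sum]

variable {ν : ℕ → Measure ℝ} {R τ : ℕ → ℝ} {ξ : ℕ → Fin 3 → ℝ → ℝ} {η : ℕ → Fin 6 → ℝ → ℝ}
  {e : ℕ → ℕ → ℝ → ℝ} {cf : ℕ → (Fin 3 → ℝ) → Fin 6 → ℝ} {r : ℕ → (Fin 3 → ℝ) → ℝ → ℝ}

lemma Blk.lin_cube {n : ℕ} {ν : Measure ℝ} {R τ : ℝ} {ξ : Fin 3 → ℝ → ℝ} {η : Fin 6 → ℝ → ℝ}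
    {e : ℕ → ℝ → ℝ} {cf : (Fin 3 → ℝ) → Fin 6 → ℝ} {r : (Fin 3 → ℝ) → ℝ → ℝ}
    (hB : Blk n ν R τ ξ η e cf r) (t : Fin 3 → ℝ) (y : ℝ) :
    |∑ i, t i * ξ i y| ≤ (∑ i, |t i|) * e 1 y := by
  rw [Finset.sum_mul]
  refine (Finset.abs_sum_le_sum_abs _ _).trans (Finset.sum_le_sum fun i _ => ?_)
  rw [abs_mul]
  exact mul_le_mul_of_nonneg_left (hB.xi_le i y) (abs_nonneg _)

lemma Sq.clt (hS : Sq ν R τ ξ η e cf r) (t : Fin 3 → ℝ) :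
    Tendsto (fun n => ∫ x, Complex.exp (Complex.I * ((∑ i, t i * Dl (ξ n) x i : ℝ) : ℂ)) ∂(PP ν n)) atTop
      (𝓝 (Complex.exp (((-(∑ i, t i ^ 2) / 2 : ℝ)) : ℂ))) := by
  set X : ℕ → ℝ → ℝ := fun n y => ∑ i, t i * ξ n i y with hX
  set g : ℕ → ℂ := fun n => (∫ y, Complex.exp (Complex.I * (X n y : ℂ)) ∂(ν n)) - 1 with hg
  have hmain : Tendsto (fun n : ℕ => (n : ℂ) * g n) atTop (𝓝 (((-(∑ i, t i ^ 2) / 2 : ℝ)) : ℂ)) := by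
    have h1 : Tendsto (fun n : ℕ => (((-(n * ∫ y, X n y ^ 2 ∂(ν n)) / 2 : ℝ)) : ℂ)) atTop
        (𝓝 (((-(∑ i, t i ^ 2) / 2 : ℝ)) : ℂ)) :=
      (Complex.continuous_ofReal.tendsto _).comp ((hS.gram t).neg.div_const 2)
    have h2 : Tendsto (fun n : ℕ => (n : ℂ) * g n - (((-(n * ∫ y, X n y ^ 2 ∂(ν n)) / 2 : ℝ)) : ℂ)) atTop
        (𝓝 0) := by
      rw [tendsto_zero_iff_norm_tendsto_zero]
      have hb : Tendsto (fun n => 4 * (∑ i, |t i|) ^ 3 * τ n) atTop (𝓝 0) := by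
        simpa using hS.τ0.const_mul (4 * (∑ i, |t i|) ^ 3)
      refine squeeze_zero' (Eventually.of_forall fun _ => norm_nonneg _) ?_ hb
      filter_upwards [hS.blk] with n hB
      have := hB.prob
      have mX : Measurable (X n) := Finset.measurable_sum _ fun i _ => (hB.mξ i).const_mul (t i)
      have iX2 : Integrable (fun y => X n y ^ 2) (ν n) := by
        have : (fun y => X n y ^ 2) = fun y => ∑ i, ∑ k, (t i * t k) * (ξ n i y * ξ n k y) := by
          funext y
          simp only [hX, pow_two, Finset.sum_mul_sum]
          refine Finset.sum_congr rfl fun i _ => Finset.sum_congr rfl fun k _ => ?_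
          ring
        rw [this]
        exact integrable_finsetSum _ fun i _ => integrable_finsetSum _ fun k _ =>
          ((hB.xixi i k).1).const_mul _
      have iξ : ∀ i, Integrable (ξ n i) (ν n) := fun i =>
        ((memLp_two_iff_integrable_sq (hB.mξ i).aestronglyMeasurable).mpr (by
          simpa only [pow_two] using (hB.xixi i i).1)).integrable (by norm_num)
      have iX : Integrable (X n) (ν n) := integrable_finsetSum _ fun i _ => (iξ i).const_mul _
      have EX : ∫ y, X n y ∂(ν n) = 0 := by
        simp only [hX]
        rw [integral_finsetSum _ fun i _ => (iξ i).const_mul _]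
        simp only [integral_const_mul, hB.ξ0, mul_zero, Finset.sum_const_zero]
      have iE : Integrable (fun y => Complex.exp (Complex.I * (X n y : ℂ))) (ν n) := by
        refine (integrable_const (1 : ℝ)).mono' ?_ (ae_of_all _ fun y => ?_)
        · exact (Complex.measurable_exp.comp ((Complex.measurable_ofReal.comp mX).const_mul _)).aestronglyMeasurable
        · rw [Complex.norm_exp_I_mul_ofReal]
      have iXc : Integrable (fun y => Complex.I * (X n y : ℂ)) (ν n) := iX.ofReal.const_mul _
      have iX2c : Integrable (fun y => ((X n y : ℂ)) ^ 2 / 2) (ν n) := by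
        have := iX2.ofReal (𝕜 := ℂ)
        simpa using this.div_const 2
      have i1 : Integrable (fun _ : ℝ => (1 : ℂ)) (ν n) := integrable_const _
      have iT : Integrable (fun y => 1 + Complex.I * (X n y : ℂ) - (X n y : ℂ) ^ 2 / 2) (ν n) :=
        (i1.add iXc).sub iX2c
      have i1X : Integrable (fun y => 1 + Complex.I * (X n y : ℂ)) (ν n) := i1.add iXc
      have eT : ∫ y, (1 + Complex.I * (X n y : ℂ) - (X n y : ℂ) ^ 2 / 2) ∂(ν n) =
          1 - (((∫ y, X n y ^ 2 ∂(ν n)) / 2 : ℝ) : ℂ) := by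
        rw [integral_sub i1X iX2c, integral_add i1 iXc, integral_const_mul,
          integral_complex_ofReal, EX, integral_div]
        have : ∫ y, (X n y : ℂ) ^ 2 ∂(ν n) = ((∫ y, X n y ^ 2 ∂(ν n) : ℝ) : ℂ) := by
          rw [← integral_complex_ofReal]; simp
        rw [this]; simp
      have hdiff : (n : ℂ) * g n - (((-(n * ∫ y, X n y ^ 2 ∂(ν n)) / 2 : ℝ)) : ℂ) =
          n * ∫ y, (Complex.exp (Complex.I * (X n y : ℂ)) -
            (1 + Complex.I * (X n y : ℂ) - (X n y : ℂ) ^ 2 / 2)) ∂(ν n) := by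
        rw [integral_sub iE iT, eT]
        simp only [hg]
        push_cast
        ring
      rw [hdiff, norm_mul, Complex.norm_natCast]
      have i3 : Integrable (fun y => 4 * (∑ i, |t i|) ^ 3 * e n 1 y ^ 3) (ν n) := hB.i13.const_mul _
      have hle : ‖∫ y, (Complex.exp (Complex.I * (X n y : ℂ)) -
            (1 + Complex.I * (X n y : ℂ) - (X n y : ℂ) ^ 2 / 2)) ∂(ν n)‖ ≤
            ∫ y, 4 * (∑ i, |t i|) ^ 3 * e n 1 y ^ 3 ∂(ν n) := by
        refine norm_integral_le_of_norm_le i3 (ae_of_all _ fun y => ?_)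
        refine (exp_taylor3 (X n y)).trans ?_
        rw [mul_assoc, ← mul_pow]
        exact mul_le_mul_of_nonneg_left (pow_le_pow_left₀ (abs_nonneg _) (hB.lin_cube t y) 3) (by norm_num)
      rw [integral_const_mul] at hle
      have h3 : 0 ≤ 4 * (∑ i, |t i|) ^ 3 := by
        have : 0 ≤ ∑ i, |t i| := Finset.sum_nonneg fun _ _ => abs_nonneg _
        positivity
      calc (n : ℝ) * _ ≤ n * (4 * (∑ i, |t i|) ^ 3 * ∫ y, e n 1 y ^ 3 ∂(ν n)) :=
            mul_le_mul_of_nonneg_left hle (Nat.cast_nonneg _)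
        _ = 4 * (∑ i, |t i|) ^ 3 * (n * ∫ y, e n 1 y ^ 3 ∂(ν n)) := by ring
        _ ≤ _ := mul_le_mul_of_nonneg_left hB.b13 h3
    simpa using h2.add h1
  have h3 := Complex.tendsto_one_add_pow_exp_of_tendsto hmain
  refine h3.congr' ?_
  filter_upwards [hS.blk] with n hB
  have := hB.prob
  have h4 := charfun_pi_pow (n := n) (ν n) (X n)
  have h5 : ∀ x : Fin n → ℝ, ∑ j, X n (x j) = ∑ i, t i * Dl (ξ n) x i := by
    intro x
    simp only [hX, Dl, Finset.mul_sum]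
    rw [Finset.sum_comm]
  simp only [h5] at h4
  rw [PP, h4]
  simp [hg]

lemma slutsky {P : ∀ n : ℕ, Measure (Fin n → ℝ)} {U V : ∀ n : ℕ, (Fin n → ℝ) → ℝ} {L : ℂ}
    (hP : ∀ᶠ n in atTop, IsProbabilityMeasure (P n) ∧ Measurable (U n) ∧ Measurable (V n))
    (hU : Tendsto (fun n => ∫ x, Complex.exp (Complex.I * (U n x : ℂ)) ∂(P n)) atTop (𝓝 L))
    (hUV : P0 P (fun n x => V n x - U n x)) :
    Tendsto (fun n => ∫ x, Complex.exp (Complex.I * (V n x : ℂ)) ∂(P n)) atTop (𝓝 L) := by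
  have hd : Tendsto (fun n => (∫ x, Complex.exp (Complex.I * (V n x : ℂ)) ∂(P n)) -
      ∫ x, Complex.exp (Complex.I * (U n x : ℂ)) ∂(P n)) atTop (𝓝 0) := by
    rw [Metric.tendsto_nhds]
    intro ε hε
    have h1 := (ENNReal.tendsto_toReal ENNReal.zero_ne_top).comp (hUV (ε / 4) (by linarith))
    simp only [ENNReal.toReal_zero] at h1
    have h2 := h1.eventually (Iio_mem_nhds (show (0 : ℝ) < ε / 4 by linarith))
    filter_upwards [hP, h2] with n ⟨hp, mU, mV⟩ h3
    have h3' : (P n).real {x | ε / 4 ≤ |V n x - U n x|} < ε / 4 := h3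
    set S := {x | ε / 4 ≤ |V n x - U n x|} with hS
    have mS : MeasurableSet S := measurableSet_le measurable_const (mV.sub mU).abs
    have iE : ∀ W : (Fin n → ℝ) → ℝ, Measurable W →
        Integrable (fun y => Complex.exp (Complex.I * (W y : ℂ))) (P n) := fun W mW => by
      refine (integrable_const (1 : ℝ)).mono' ?_ (ae_of_all _ fun y => ?_)
      · exact (Complex.measurable_exp.comp ((Complex.measurable_ofReal.comp mW).const_mul _)).aestronglyMeasurable
      · rw [Complex.norm_exp_I_mul_ofReal]
    rw [dist_zero_right, ← integral_sub (iE _ mV) (iE _ mU)]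
    have ii : Integrable (S.indicator fun _ => (2 : ℝ)) (P n) := (integrable_const _).indicator mS
    have hle : ‖∫ x, (Complex.exp (Complex.I * (V n x : ℂ)) - Complex.exp (Complex.I * (U n x : ℂ))) ∂(P n)‖ ≤
        ∫ x, (ε / 4 + S.indicator (fun _ => (2 : ℝ)) x) ∂(P n) := by
      refine norm_integral_le_of_norm_le ((integrable_const _).add ii) (ae_of_all _ fun x => ?_)
      by_cases hx : x ∈ S
      · rw [indicator_of_mem hx]
        refine (norm_sub_le _ _).trans ?_
        rw [Complex.norm_exp_I_mul_ofReal, Complex.norm_exp_I_mul_ofReal]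
        linarith
      · rw [indicator_of_notMem hx, add_zero]
        have e1 : Complex.exp (Complex.I * (V n x : ℂ)) - Complex.exp (Complex.I * (U n x : ℂ)) =
            Complex.exp (Complex.I * (U n x : ℂ)) *
              (Complex.exp (Complex.I * ((V n x - U n x : ℝ) : ℂ)) - 1) := by
          rw [mul_sub, ← Complex.exp_add, mul_one]
          congr 2
          push_cast; ring
        rw [e1, norm_mul, Complex.norm_exp_I_mul_ofReal, one_mul]
        refine Real.norm_exp_I_mul_ofReal_sub_one_le.trans ?_
        rw [Real.norm_eq_abs]
        exact (not_le.mp hx).le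
    rw [integral_add (integrable_const _) ii, integral_indicator mS] at hle
    simp only [integral_const, smul_eq_mul, probReal_univ, one_mul,
      measureReal_restrict_apply_univ] at hle
    linarith
  simpa using hd.add hU

end PartV

section PartW

/-! ### Local parametrisation -/

variable {σ δ α : ℝ}

/-- the parameter corresponding to the local coordinate -/
def thz (σ δ α : ℝ) (n : ℕ) (ζ : Fin 3 → ℝ) : Fin 3 → ℝ :=
  ![σ * Real.exp (pz σ δ α n ζ 0),
    Real.exp ((pz σ δ α n ζ 1 + α * Real.log δ - pz σ δ α n ζ 2 / 2 * LL n) / (α + pz σ δ α n ζ 2)),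
    α + pz σ δ α n ζ 2]

/-- inverse of the local parametrisation -/
def zth (σ δ α : ℝ) (n : ℕ) (θ : Fin 3 → ℝ) : Fin 3 → ℝ :=
  ![√(2 * n) * Real.log (θ 0 / σ),
    ((θ 2 - α) / 2 * LL n + θ 2 * Real.log (θ 1) - α * Real.log δ) / (rate n α / √(kappa0 σ δ α))
      - (θ 2 - α) / (rate n α / √(kappa0 σ δ α)) * mm σ α n,
    (θ 2 - α) / (rate n α / √(kappa0 σ δ α)) / α]

lemma pz_zth {n : ℕ} (hn : 0 < n) (hα : 0 < α) (hc : 0 < rate n α / √(kappa0 σ δ α)) (θ : Fin 3 → ℝ) :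
    pz σ δ α n (zth σ δ α n θ) = ![Real.log (θ 0 / σ),
      (θ 2 - α) / 2 * LL n + θ 2 * Real.log (θ 1) - α * Real.log δ, θ 2 - α] := by
  have h2 : (0 : ℝ) < √(2 * n) := Real.sqrt_pos.mpr (by positivity)
  unfold pz zth
  simp only [Matrix.cons_val_zero, Matrix.cons_val_one, Matrix.cons_val]
  generalize rate n α / √(kappa0 σ δ α) = c at *
  congr 1
  · field_simp
  congr 1
  · field_simp; ring
  congr 1
  · field_simp

lemma thz_zth {n : ℕ} (hn : 0 < n) (hσ : 0 < σ) (hα : 0 < α) (hc : 0 < rate n α / √(kappa0 σ δ α)) (θ : Fin 3 → ℝ)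
    (h0 : 0 < θ 0) (h1 : 0 < θ 1) (h2 : 0 < θ 2) :
    thz σ δ α n (zth σ δ α n θ) = θ := by
  unfold thz
  rw [pz_zth hn hα hc]
  simp only [Matrix.cons_val_zero, Matrix.cons_val_one, Matrix.cons_val]
  ext i; fin_cases i
  · simp only [Fin.zero_eta, Matrix.cons_val_zero]
    rw [Real.exp_log (by positivity)]; field_simp
  · simp only [Fin.mk_one, Matrix.cons_val_one, Matrix.cons_val_zero]
    have : ((θ 2 - α) / 2 * LL n + θ 2 * Real.log (θ 1) - α * Real.log δ + α * Real.log δ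
      - (θ 2 - α) / 2 * LL n) / (α + (θ 2 - α)) = Real.log (θ 1) := by
      have : α + (θ 2 - α) = θ 2 := by ring
      rw [this]; field_simp; ring
    rw [this, Real.exp_log h1]
  · simp

lemma zth_thz {n : ℕ} (hn : 0 < n) (hσ : 0 < σ) (hα : 0 < α) (hc : 0 < rate n α / √(kappa0 σ δ α)) (ζ : Fin 3 → ℝ)
    (h2 : 0 < α + pz σ δ α n ζ 2) :
    zth σ δ α n (thz σ δ α n ζ) = ζ := by
  have hs : (0 : ℝ) < √(2 * n) := Real.sqrt_pos.mpr (by positivity)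
  have e0 : thz σ δ α n ζ 0 = σ * Real.exp (pz σ δ α n ζ 0) := rfl
  have e1 : Real.log (thz σ δ α n ζ 1) = (pz σ δ α n ζ 1 + α * Real.log δ - pz σ δ α n ζ 2 / 2 * LL n) / (α + pz σ δ α n ζ 2) :=
    Real.log_exp _
  have e2 : thz σ δ α n ζ 2 = α + pz σ δ α n ζ 2 := rfl
  have e4 : (α + pz σ δ α n ζ 2) * ((pz σ δ α n ζ 1 + α * Real.log δ - pz σ δ α n ζ 2 / 2 * LL n) / (α + pz σ δ α n ζ 2))
    = pz σ δ α n ζ 1 + α * Real.log δ - pz σ δ α n ζ 2 / 2 * LL n := by field_simp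
  have e5 : Real.log (σ * Real.exp (pz σ δ α n ζ 0) / σ) = pz σ δ α n ζ 0 := by
    rw [mul_div_assoc, mul_comm, div_mul_cancel₀ _ hσ.ne', Real.log_exp]
  unfold zth
  rw [e1, e0, e2, e4, e5]
  have p0 : pz σ δ α n ζ 0 = ζ 0 / √(2 * n) := rfl
  have p1 : pz σ δ α n ζ 1 = rate n α / √(kappa0 σ δ α) * (ζ 1 + α * ζ 2 * mm σ α n) := rfl
  have p2 : pz σ δ α n ζ 2 = rate n α / √(kappa0 σ δ α) * (α * ζ 2) := rfl
  rw [p0, p1, p2]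
  generalize rate n α / √(kappa0 σ δ α) = c at *
  ext i; fin_cases i
  · simp only [Fin.zero_eta, Matrix.cons_val_zero]; field_simp
  · simp only [Fin.mk_one, Matrix.cons_val_one, Matrix.cons_val_zero]; field_simp; ring
  · simp only [Fin.reduceFinMk, Matrix.cons_val]; field_simp; ring

lemma zth_cont {n : ℕ} (hσ : 0 < σ) (θ : Fin 3 → ℝ) (h0 : 0 < θ 0) (h1 : 0 < θ 1) :
    ContinuousAt (zth σ δ α n) θ := by
  have hl0 : ContinuousAt (fun θ : Fin 3 → ℝ => Real.log (θ 0 / σ)) θ :=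
    ContinuousAt.log (ContinuousAt.div_const (f := fun θ : Fin 3 → ℝ => θ 0) (continuous_apply (0 : Fin 3)).continuousAt σ) (by positivity)
  have hl1 : ContinuousAt (fun θ : Fin 3 → ℝ => Real.log (θ 1)) θ :=
    ContinuousAt.log (continuous_apply (1 : Fin 3)).continuousAt h1.ne'
  have h2 : ContinuousAt (fun θ : Fin 3 → ℝ => θ 2) θ := (continuous_apply (2 : Fin 3)).continuousAt
  rw [continuousAt_pi]
  intro i; fin_cases i
  · exact continuousAt_const.mul hl0
  · exact (((((h2.sub continuousAt_const).div_const 2).mul_const _).add (h2.mul hl1)).sub continuousAt_const).div_const _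
      |>.sub (((h2.sub continuousAt_const).div_const _).mul_const _)
  · exact ((h2.sub continuousAt_const).div_const _).div_const _

lemma pdens_thz {n : ℕ} (hn : 0 < n) (hσ : 0 < σ) (hδ : 0 < δ) (ζ : Fin 3 → ℝ)
    (h2 : 0 < α + pz σ δ α n ζ 2) (x : ℝ) :
    pdens n (thz σ δ α n ζ) x = √n * qP σ (lam n δ α) α (pz σ δ α n ζ) (√n * x) := by
  have e0 : thz σ δ α n ζ 0 = σ * Real.exp (pz σ δ α n ζ 0) := rfl
  have e1 : thz σ δ α n ζ 1 = Real.exp ((pz σ δ α n ζ 1 + α * Real.log δ - pz σ δ α n ζ 2 / 2 * LL n) / (α + pz σ δ α n ζ 2)) := rfl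
  have e2 : thz σ δ α n ζ 2 = α + pz σ δ α n ζ 2 := rfl
  rw [pdens_eq n hn _ (by rw [e0]; positivity) (by rw [e1]; positivity) (by rw [e2]; exact h2)]
  unfold qP
  rw [e0, e2]
  congr 2
  rw [lam_exp hn, lam_exp hn, e1, ← Real.exp_mul, Real.rpow_def_of_pos hδ, ← Real.exp_add,
    ← Real.exp_add, ← Real.exp_add]
  congr 1
  rw [div_mul_cancel₀ _ h2.ne']
  ring

lemma logLik_thz {n : ℕ} (hn : 0 < n) (hσ : 0 < σ) (hδ : 0 < δ)
    (hq : ∀ y, 0 < qF σ (lam n δ α) α y) (ζ : Fin 3 → ℝ)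
    (h2 : 0 < α + pz σ δ α n ζ 2) (x : Fin n → ℝ) (hr : ∀ j, |rF σ δ α n ζ (x j)| ≤ 1 / 2) :
    logLik n (thz σ δ α n ζ) x = (∑ j, Real.log (√n * qF σ (lam n δ α) α (√n * x j))) +
      Lr (rF σ δ α n) ζ x := by
  unfold logLik Lr
  rw [← Finset.sum_add_distrib]
  refine Finset.sum_congr rfl fun j _ => ?_
  have hj := (abs_le.mp (hr j)).1
  rw [max_eq_left (by linarith), pdens_thz hn hσ hδ ζ h2]
  have hs : (0 : ℝ) < √n := Real.sqrt_pos.mpr (by positivity)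
  have hqj := hq (√n * x j)
  rw [← Real.log_mul (by positivity) (by linarith)]
  congr 1
  unfold rF
  field_simp
  ring

lemma isLocalMax_thz {n : ℕ} (hn : 0 < n) (hσ : 0 < σ) (hδ : 0 < δ) (hα : 0 < α) {R : ℝ}
    (hc : 0 < rate n α / √(kappa0 σ δ α))
    (hq : ∀ y, 0 < qF σ (lam n δ α) α y) (x : Fin n → ℝ)
    (hcube : ∀ ζ : Fin 3 → ℝ, (∀ i, |ζ i| ≤ R) → 0 < α + pz σ δ α n ζ 2 ∧ ∀ j, |rF σ δ α n ζ (x j)| ≤ 1 / 2)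
    (z : Fin 3 → ℝ) (hz : ∀ i, |z i| < R)
    (hmax : ∀ ζ : Fin 3 → ℝ, (∀ i, |ζ i| ≤ R) → Lr (rF σ δ α n) ζ x ≤ Lr (rF σ δ α n) z x) :
    IsLocalMax (fun θ => logLik n θ x) (thz σ δ α n z) := by
  have hz' := hcube z (fun i => (hz i).le)
  have e0 : thz σ δ α n z 0 = σ * Real.exp (pz σ δ α n z 0) := rfl
  have e1 : thz σ δ α n z 1 = Real.exp ((pz σ δ α n z 1 + α * Real.log δ - pz σ δ α n z 2 / 2 * LL n) / (α + pz σ δ α n z 2)) := rfl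
  have e2 : thz σ δ α n z 2 = α + pz σ δ α n z 2 := rfl
  have p0 : 0 < thz σ δ α n z 0 := by rw [e0]; positivity
  have p1 : 0 < thz σ δ α n z 1 := by rw [e1]; positivity
  have p2 : 0 < thz σ δ α n z 2 := by rw [e2]; exact hz'.1
  have hcont := zth_cont (δ := δ) (α := α) (n := n) hσ _ p0 p1
  have hzz := zth_thz hn hσ hα hc z hz'.1
  have hn1 : ∀ᶠ θ in 𝓝 (thz σ δ α n z), ∀ i, |zth σ δ α n θ i| < R := by
    rw [eventually_all]
    intro i
    have hci : ContinuousAt (fun θ => |zth σ δ α n θ i|) (thz σ δ α n z) :=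
      ((continuous_apply i).continuousAt.comp hcont).abs
    refine hci.eventually_lt continuousAt_const ?_
    simpa only [hzz] using hz i
  have hc0 : ∀ i : Fin 3, ContinuousAt (fun θ : Fin 3 → ℝ => θ i) (thz σ δ α n z) := fun i => (continuous_apply i).continuousAt
  have q0 := continuousAt_const.eventually_lt (hc0 0) p0
  have q1 := continuousAt_const.eventually_lt (hc0 1) p1
  have q2 := continuousAt_const.eventually_lt (hc0 2) p2
  filter_upwards [hn1, q0, q1, q2] with θ h1 h2 h3 h4
  have hθ := thz_zth hn hσ hα hc θ h2 h3 h4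
  have hc1 := hcube _ (fun i => (h1 i).le)
  rw [← hθ, logLik_thz hn hσ hδ hq _ hc1.1 x hc1.2, logLik_thz hn hσ hδ hq _ hz'.1 x hz'.2]
  have := hmax _ (fun i => (h1 i).le)
  linarith

/-! ### The normalised deviation -/

lemma dev_bound {s k1 K ρ L l ζ1 ζ2 : ℝ} (hα : 0 < α) (hδ : 0 < δ) (hs : 0 < s) (hK : 0 ≤ K) (hρ : 0 < ρ)
    (hL : 1 ≤ L) (hl : 0 ≤ l) (hlL : l ≤ L) (h1 : |ζ1| ≤ K) (h2 : |ζ2| ≤ K)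
    (ha : ρ / s * K ≤ 1 / 2) (hw : 2 / α * (ρ / s) * (K * (1 + α * (1 + |k1|)) * L) ≤ 1) :
    |δ * (Real.exp ((ρ / s * (ζ1 + α * ζ2 * (l / 2 - L / 2 - k1))) / (α + ρ / s * (α * ζ2))) - 1) / ρ
      + δ / (2 * α) * (L - l) * ((ρ / s * (α * ζ2)) / ρ) - δ / s * (ζ1 / α - k1 * ζ2)| ≤
     (4 * δ * (K * (1 + α * (1 + |k1|))) ^ 2 / (α ^ 2 * s ^ 2)
      + 2 * δ * (K * (1 + α * (1 + |k1|))) * K / (α * s ^ 2)) * (ρ * L ^ 2) := by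
  set C := K * (1 + α * (1 + |k1|)) with hC
  have hC0 : 0 ≤ C := by positivity
  set g := ζ1 + α * ζ2 * (l / 2 - L / 2 - k1) with hg
  set a := ρ / s * (α * ζ2) with hadef
  set w := (ρ / s * g) / (α + a) with hwdef
  have hgb : |g| ≤ C * L := by
    have : |l / 2 - L / 2 - k1| ≤ L * (1 + |k1|) := by
      have h3 : |l / 2 - L / 2| ≤ L := by rw [abs_le]; constructor <;> linarith
      have h4 := abs_sub (l / 2 - L / 2) k1
      have h5 : |k1| ≤ L * |k1| := le_mul_of_one_le_left (abs_nonneg _) hL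
      linarith
    calc |g| ≤ |ζ1| + |α * ζ2 * (l / 2 - L / 2 - k1)| := abs_add_le _ _
      _ = |ζ1| + α * |ζ2| * |l / 2 - L / 2 - k1| := by rw [abs_mul, abs_mul, abs_of_pos hα]
      _ ≤ K * L + α * K * (L * (1 + |k1|)) := by
          refine add_le_add (h1.trans (le_mul_of_one_le_right hK hL)) ?_
          exact mul_le_mul (mul_le_mul_of_nonneg_left h2 hα.le) this (abs_nonneg _) (by positivity)
      _ = C * L := by rw [hC]; ring
  have hρs : 0 < ρ / s := by positivity
  have hab : |a| ≤ ρ / s * (α * K) := by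
    rw [hadef, abs_mul, abs_mul, abs_of_pos hρs, abs_of_pos hα]
    exact mul_le_mul_of_nonneg_left (mul_le_mul_of_nonneg_left h2 hα.le) hρs.le
  have ha2 : |a| ≤ α / 2 := by
    have : ρ / s * (α * K) = α * (ρ / s * K) := by ring
    nlinarith
  have hden : α / 2 ≤ α + a := by have := (abs_le.mp ha2).1; linarith
  have hdp : 0 < α + a := by linarith
  have hwb : |w| ≤ 2 / α * (ρ / s) * (C * L) := by
    rw [hwdef, abs_div, abs_mul, abs_of_pos hρs, abs_of_pos hdp, div_le_iff₀ hdp]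
    have h5 : 2 / α * (ρ / s) * (C * L) * (α / 2) ≤ 2 / α * (ρ / s) * (C * L) * (α + a) :=
      mul_le_mul_of_nonneg_left hden (by positivity)
    have h6 : 2 / α * (ρ / s) * (C * L) * (α / 2) = ρ / s * (C * L) := by field_simp
    have h7 : ρ / s * |g| ≤ ρ / s * (C * L) := mul_le_mul_of_nonneg_left hgb hρs.le
    linarith
  have hexp := Real.abs_exp_sub_one_sub_id_le (hwb.trans hw)
  have hw2 : w ^ 2 ≤ (2 / α * (ρ / s) * (C * L)) ^ 2 := by
    rw [← sq_abs]; exact pow_le_pow_left₀ (abs_nonneg _) hwb 2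
  have hid : δ * (Real.exp w - 1) / ρ + δ / (2 * α) * (L - l) * (a / ρ) - δ / s * (ζ1 / α - k1 * ζ2)
      = δ / ρ * (Real.exp w - 1 - w) - δ / s * (g * a / (α * (α + a))) := by
    have e1 : w = ρ / s * g / α - ρ / s * (g * a / (α * (α + a))) := by
      rw [hwdef]; field_simp; ring
    have e2 : δ * (Real.exp w - 1) / ρ = δ / ρ * (Real.exp w - 1 - w) + δ / ρ * w := by ring
    have e3 : a / ρ = α * ζ2 / s := by rw [hadef]; field_simp
    have e4 : δ / ρ * w = δ / s * (g / α) - δ / s * (g * a / (α * (α + a))) := by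
      rw [e1]
      generalize g * a / (α * (α + a)) = q
      field_simp
    rw [e2, e4, e3, hg]
    generalize (ζ1 + α * ζ2 * (l / 2 - L / 2 - k1)) * a / (α * (α + a)) = q
    field_simp
    ring
  rw [hid]
  have t1 : |δ / ρ * (Real.exp w - 1 - w)| ≤ 4 * δ * C ^ 2 / (α ^ 2 * s ^ 2) * (ρ * L ^ 2) := by
    rw [abs_mul, abs_of_pos (by positivity : 0 < δ / ρ)]
    calc δ / ρ * |Real.exp w - 1 - w| ≤ δ / ρ * (2 / α * (ρ / s) * (C * L)) ^ 2 :=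
          mul_le_mul_of_nonneg_left (hexp.trans hw2) (by positivity)
      _ = _ := by field_simp; ring
  have t2 : |δ / s * (g * a / (α * (α + a)))| ≤ 2 * δ * C * K / (α * s ^ 2) * (ρ * L ^ 2) := by
    rw [abs_mul, abs_of_pos (by positivity : 0 < δ / s), abs_div, abs_mul,
      abs_of_pos (by positivity : 0 < α * (α + a))]
    have h5 : |g| * |a| / (α * (α + a)) ≤ (C * L) * (ρ / s * (α * K)) / (α * (α / 2)) := by
      gcongr
    calc δ / s * (|g| * |a| / (α * (α + a))) ≤ δ / s * ((C * L) * (ρ / s * (α * K)) / (α * (α / 2))) :=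
          mul_le_mul_of_nonneg_left h5 (by positivity)
      _ = 2 * δ * C * K / (α * s ^ 2) * (ρ * L) := by field_simp
      _ ≤ 2 * δ * C * K / (α * s ^ 2) * (ρ * L ^ 2) := by
          gcongr
          nlinarith
  calc _ ≤ |δ / ρ * (Real.exp w - 1 - w)| + |δ / s * (g * a / (α * (α + a)))| := abs_sub _ _
    _ ≤ _ := (add_le_add t1 t2).trans (le_of_eq (by ring))

end PartW

section PartX

variable {σ δ α : ℝ}

lemma un_inv_mulVec {n : ℕ} (hn : 0 < n) (hα : 0 < α) (hρ : 0 < rate n α) (v : Fin 3 → ℝ) :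
    (un n ![σ, δ, α])⁻¹.mulVec v = ![√n * v 0,
      v 1 / rate n α + δ / (2 * α) * (LL n - Real.log (LL n)) * (v 2 / rate n α), v 2 / rate n α] := by
  have hs : (0 : ℝ) < √n := Real.sqrt_pos.mpr (by positivity)
  have h1 : (un n ![σ, δ, α])⁻¹ = !![√n, 0, 0; 0, 1 / rate n α, δ / (2 * α) * (LL n - Real.log (LL n)) / rate n α;
      0, 0, 1 / rate n α] := by
    refine Matrix.inv_eq_left_inv ?_
    unfold un LL
    ext i j
    fin_cases i <;> fin_cases j <;> simp [Matrix.mul_apply, Fin.sum_univ_three] <;> field_simp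
    ring
  rw [h1]
  ext i
  fin_cases i <;> simp [Matrix.mulVec, dotProduct, Fin.sum_univ_three]
  · ring
  · ring

/-- limiting linear map -/
def Amat (σ δ α : ℝ) : Matrix (Fin 3) (Fin 3) ℝ :=
  !![σ / √2, 0, 0; 0, δ / (α * √(kappa0 σ δ α)), -(δ * kappa1 σ δ α / √(kappa0 σ δ α)); 0, 0, α / √(kappa0 σ δ α)]

lemma Amat_inv (hσ : 0 < σ) (hδ : 0 < δ) (hα : 0 < α) (hα2 : α < 2) :
    Amat σ δ α * (Amat σ δ α)ᵀ = (Imat ![σ, δ, α])⁻¹ := by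
  symm
  have hk := kappa0_pos hσ hδ hα hα2
  have hs : 0 < √(kappa0 σ δ α) := Real.sqrt_pos.mpr hk
  have hsq : √(kappa0 σ δ α) ^ 2 = kappa0 σ δ α := Real.sq_sqrt hk.le
  have h22 : (√2 : ℝ) ^ 2 = 2 := Real.sq_sqrt (by norm_num)
  have h2p : (0 : ℝ) < √2 := by positivity
  refine Matrix.inv_eq_left_inv ?_
  unfold Amat Imat
  simp only [Matrix.cons_val_zero, Matrix.cons_val_one, Matrix.cons_val]
  rw [← hsq]
  simp only [Real.sqrt_sq hs.le]
  generalize √(kappa0 σ δ α) = s at *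
  generalize kappa1 σ δ α = k
  have h1 : !![σ / √2, 0, 0; 0, δ / (α * s), -(δ * k / s); 0, 0, α / s] *
      !![σ / √2, 0, 0; 0, δ / (α * s), -(δ * k / s); 0, 0, α / s]ᵀ =
      !![σ ^ 2 / 2, 0, 0; 0, δ ^ 2 / (α * s) ^ 2 + (δ * k / s) ^ 2, -(δ * k / s) * (α / s);
        0, -(δ * k / s) * (α / s), (α / s) ^ 2] := by
    ext i j
    rw [Matrix.mul_apply, Fin.sum_univ_three]
    simp only [Matrix.transpose_apply]
    fin_cases i <;> fin_cases j <;> simp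
    · rw [div_mul_div_comm, ← sq, ← sq, h22]
    · ring
    · ring
    · ring
  rw [h1]
  ext i j
  rw [Matrix.mul_apply, Fin.sum_univ_three]
  fin_cases i <;> fin_cases j <;> simp <;> field_simp <;> ring

lemma Amat_mulVec (ζ : Fin 3 → ℝ) : (Amat σ δ α).mulVec ζ = ![σ / √2 * ζ 0,
    δ / √(kappa0 σ δ α) * (ζ 1 / α - kappa1 σ δ α * ζ 2), α / √(kappa0 σ δ α) * ζ 2] := by
  ext i
  fin_cases i <;> simp [Amat, Matrix.mulVec, dotProduct, Fin.sum_univ_three]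
  ring

lemma mm_eq (hσ : 0 < σ) (hδ : 0 < δ) (hα : 0 < α) (hα2 : α < 2) {n : ℕ} (hn : 0 < LL n) :
    mm σ α n - Real.log δ = Real.log (LL n) / 2 - kappa1 σ δ α := by
  have h2 : 0 < 2 - α := by linarith
  unfold mm kappa1 TT Mn
  change Real.log (σ * √((2 - α) * LL n)) - _ + _ - _ = _
  rw [deriv_cAlpha hα hα2, cAlpha_eq hα hα2, Real.log_mul hσ.ne' (by positivity), Real.log_sqrt (by positivity),
    Real.log_mul h2.ne' hn.ne', Real.log_div hδ.ne' hσ.ne']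
  ring

lemma thz_one (hσ : 0 < σ) (hδ : 0 < δ) (hα : 0 < α) (hα2 : α < 2) {n : ℕ} (hn : 0 < LL n) (ζ : Fin 3 → ℝ)
    (h : 0 < α + pz σ δ α n ζ 2) :
    thz σ δ α n ζ 1 = δ * Real.exp ((rate n α / √(kappa0 σ δ α) * (ζ 1 + α * ζ 2 *
      (Real.log (LL n) / 2 - LL n / 2 - kappa1 σ δ α))) / (α + rate n α / √(kappa0 σ δ α) * (α * ζ 2))) := by
  have e1 : thz σ δ α n ζ 1 = Real.exp ((pz σ δ α n ζ 1 + α * Real.log δ - pz σ δ α n ζ 2 / 2 * LL n) / (α + pz σ δ α n ζ 2)) := rfl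
  have p1 : pz σ δ α n ζ 1 = rate n α / √(kappa0 σ δ α) * (ζ 1 + α * ζ 2 * mm σ α n) := rfl
  have p2 : pz σ δ α n ζ 2 = rate n α / √(kappa0 σ δ α) * (α * ζ 2) := rfl
  have hm := mm_eq hσ hδ hα hα2 hn
  have hm' : mm σ α n = Real.log (LL n) / 2 - kappa1 σ δ α + Real.log δ := by linarith
  rw [e1, ← p2]
  have he : ∀ u, δ * Real.exp u = Real.exp (Real.log δ + u) := fun u => by rw [Real.exp_add, Real.exp_log hδ]
  rw [he]
  congr 1
  rw [p1, hm']
  rw [div_eq_iff h.ne', add_mul, div_mul_cancel₀ _ h.ne', p2]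
  ring

lemma rate_sq_zero (hα : 0 < α) : Tendsto (fun n : ℕ => rate n α * LL n ^ 2) atTop (𝓝 0) := by
  refine (pow_exp_zero (α / 4 + 2) (by positivity : 0 < α / 4)).congr' ?_
  filter_upwards [eventually_gt_atTop 0, tendsto_LL.eventually_gt_atTop 0] with n hn hl
  rw [rate_exp hn, Real.rpow_add hl, Real.rpow_two]
  ring

lemma rate_pos {n : ℕ} (hn : 0 < n) (hl : 0 < LL n) (α : ℝ) : 0 < rate n α := by
  rw [rate_exp hn]; positivity

lemma sqrt_inv_zero : Tendsto (fun n : ℕ => 1 / √(n : ℝ)) atTop (𝓝 0) := by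
  have := Real.tendsto_sqrt_atTop.comp (tendsto_natCast_atTop_atTop (R := ℝ))
  refine this.inv_tendsto_atTop.congr fun n => ?_
  simp

set_option maxHeartbeats 1000000 in
lemma thz_dev (hσ : 0 < σ) (hδ : 0 < δ) (hα : 0 < α) (hα2 : α < 2) {K ε : ℝ} (hK : 0 ≤ K) (hε : 0 < ε) :
    ∀ᶠ n : ℕ in atTop, ∀ ζ : Fin 3 → ℝ, (∀ i, |ζ i| ≤ K) → ∀ i,
      |(un n ![σ, δ, α])⁻¹.mulVec (thz σ δ α n ζ - ![σ, δ, α]) i - (Amat σ δ α).mulVec ζ i| ≤ ε ∧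
      |thz σ δ α n ζ i - ![σ, δ, α] i| ≤ ε := by
  have hs : 0 < √(kappa0 σ δ α) := Real.sqrt_pos.mpr (kappa0_pos hσ hδ hα hα2)
  have hq : ∀ C b : ℝ, 0 < b → ∀ᶠ n : ℕ in atTop, C * (rate n α * LL n ^ 2) ≤ b := by
    intro C b hb
    have h1 := (rate_sq_zero hα).const_mul C
    rw [mul_zero] at h1
    filter_upwards [h1.eventually (Iio_mem_nhds hb)] with n hn using le_of_lt hn
  have hq' : ∀ C b : ℝ, 0 < b → ∀ᶠ n : ℕ in atTop, C * (1 / √(n : ℝ)) ≤ b := by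
    intro C b hb
    have h1 := sqrt_inv_zero.const_mul C
    rw [mul_zero] at h1
    filter_upwards [h1.eventually (Iio_mem_nhds hb)] with n hn using le_of_lt hn
  set s := √(kappa0 σ δ α) with hsd
  set k1 := kappa1 σ δ α with hk1
  set C := K * (1 + α * (1 + |k1|)) with hC
  have hC0 : 0 ≤ C := by positivity
  filter_upwards [eventually_gt_atTop 0, tendsto_LL.eventually_ge_atTop 1, hq' K 1 one_pos, hq' (σ * K ^ 2) ε hε,
    hq' (2 * σ * K) ε hε, hq (K / s) (1 / 2) (by norm_num), hq (2 / α * C / s) 1 one_pos,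
    hq (4 * δ * C ^ 2 / (α ^ 2 * s ^ 2) + 2 * δ * C * K / (α * s ^ 2)) ε hε,
    hq (ε + δ / (2 * α) * (α * K / s) + δ / s * (K / α + |k1| * K)) ε hε, hq (α * K / s) ε hε]
    with n hn hL b1 b2 b3 b4 b5 b6 b7 b8 ζ hζ
  have hL0 : 0 < LL n := by linarith
  have hρ : 0 < rate n α := rate_pos hn hL0 α
  have hsn : (0 : ℝ) < √n := Real.sqrt_pos.mpr (by positivity)
  have hl : 0 ≤ Real.log (LL n) := Real.log_nonneg hL
  have hlL : Real.log (LL n) ≤ LL n := (Real.log_le_sub_one_of_pos hL0).trans (by linarith)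
  have hL2 : 1 ≤ LL n ^ 2 := one_le_pow₀ hL
  have hLL2 : LL n ≤ LL n ^ 2 := by nlinarith
  have hρL : rate n α ≤ rate n α * LL n ^ 2 := le_mul_of_one_le_right hρ.le hL2
  have hρL' : rate n α * LL n ≤ rate n α * LL n ^ 2 := mul_le_mul_of_nonneg_left hLL2 hρ.le
  rw [un_inv_mulVec hn hα hρ, Amat_mulVec, ← hsd, ← hk1]
  have p2 : pz σ δ α n ζ 2 = rate n α / s * (α * ζ 2) := rfl
  have ha : rate n α / s * K ≤ 1 / 2 := by
    refine le_trans ?_ b4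
    calc rate n α / s * K = K / s * rate n α := by ring
      _ ≤ _ := mul_le_mul_of_nonneg_left hρL (by positivity)
  have hw : 2 / α * (rate n α / s) * (C * LL n) ≤ 1 := by
    refine le_trans ?_ b5
    calc 2 / α * (rate n α / s) * (C * LL n) = 2 / α * C / s * (rate n α * LL n) := by ring
      _ ≤ _ := mul_le_mul_of_nonneg_left hρL' (by positivity)
  have hab : |pz σ δ α n ζ 2| ≤ rate n α / s * (α * K) := by
    rw [p2, abs_mul, abs_mul, abs_of_pos (by positivity : 0 < rate n α / s), abs_of_pos hα]
    exact mul_le_mul_of_nonneg_left (mul_le_mul_of_nonneg_left (hζ 2) hα.le) (by positivity)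
  have ha2 : |pz σ δ α n ζ 2| ≤ α / 2 := by
    have : rate n α / s * (α * K) = α * (rate n α / s * K) := by ring
    nlinarith
  have hp2 : 0 < α + pz σ δ α n ζ 2 := by have := (abs_le.mp ha2).1; linarith
  have e1 := thz_one hσ hδ hα hα2 hL0 ζ hp2
  rw [← hsd, ← hk1] at e1
  have e0 : thz σ δ α n ζ 0 = σ * Real.exp (pz σ δ α n ζ 0) := rfl
  have e2 : thz σ δ α n ζ 2 = α + rate n α / s * (α * ζ 2) := rfl
  have db := dev_bound (δ := δ) hα hδ hs hK hρ hL hl hlL (hζ 1) (hζ 2) ha hw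
  have db2 := db.trans b6
  have p0 : pz σ δ α n ζ 0 = ζ 0 / √(2 * n) := rfl
  have hsq : √(2 * (n : ℝ)) = √2 * √n := Real.sqrt_mul (by norm_num) _
  have h21 : (1 : ℝ) ≤ √2 := Real.one_le_sqrt.mpr (by norm_num)
  have h2p : (0 : ℝ) < √2 := by positivity
  have hh : |pz σ δ α n ζ 0| ≤ K * (1 / √n) := by
    rw [p0, hsq, abs_div, abs_of_pos (by positivity : 0 < √2 * √(n : ℝ)), div_le_iff₀ (by positivity)]
    have : K * (1 / √n) * (√2 * √n) = K * √2 := by field_simp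
    rw [this]
    exact (hζ 0).trans (le_mul_of_one_le_right hK h21)
  have hex := Real.abs_exp_sub_one_sub_id_le (hh.trans b1)
  have hsqb : (pz σ δ α n ζ 0) ^ 2 ≤ (K * (1 / √n)) ^ 2 := by
    rw [← sq_abs]; exact pow_le_pow_left₀ (abs_nonneg _) hh 2
  intro i
  fin_cases i
  · simp only [Fin.zero_eta, Matrix.cons_val_zero, Pi.sub_apply]
    rw [e0]
    constructor
    · have : √n * (σ * Real.exp (pz σ δ α n ζ 0) - σ) - σ / √2 * ζ 0
        = √n * σ * (Real.exp (pz σ δ α n ζ 0) - 1 - pz σ δ α n ζ 0) := by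
        have : √n * pz σ δ α n ζ 0 = ζ 0 / √2 := by rw [p0, hsq]; field_simp
        have h5 : √n * σ * (Real.exp (pz σ δ α n ζ 0) - 1 - pz σ δ α n ζ 0) =
          √n * σ * (Real.exp (pz σ δ α n ζ 0) - 1) - σ * (√n * pz σ δ α n ζ 0) := by ring
        rw [h5, this]; ring
      rw [this, abs_mul, abs_of_pos (by positivity : 0 < √n * σ)]
      refine le_trans ?_ b2
      calc √n * σ * |Real.exp (pz σ δ α n ζ 0) - 1 - pz σ δ α n ζ 0| ≤ √n * σ * (K * (1 / √n)) ^ 2 :=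
            mul_le_mul_of_nonneg_left (hex.trans hsqb) (by positivity)
        _ = σ * K ^ 2 * (1 / √n) := by field_simp
    · have : σ * Real.exp (pz σ δ α n ζ 0) - σ = σ * ((Real.exp (pz σ δ α n ζ 0) - 1 - pz σ δ α n ζ 0) + pz σ δ α n ζ 0) := by ring
      rw [this, abs_mul, abs_of_pos hσ]
      refine le_trans ?_ b3
      have h6 : (K * (1 / √n)) ^ 2 ≤ K * (1 / √n) := by
        have : 0 ≤ K * (1 / √(n : ℝ)) := by positivity
        nlinarith
      have h7 := abs_add_le (Real.exp (pz σ δ α n ζ 0) - 1 - pz σ δ α n ζ 0) (pz σ δ α n ζ 0)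
      have h8 : |Real.exp (pz σ δ α n ζ 0) - 1 - pz σ δ α n ζ 0 + pz σ δ α n ζ 0| ≤ 2 * (K * (1 / √n)) := by linarith
      calc _ ≤ σ * (2 * (K * (1 / √n))) := mul_le_mul_of_nonneg_left h8 hσ.le
        _ = _ := by ring
  · simp only [Fin.mk_one, Matrix.cons_val_one, Matrix.cons_val_zero, Pi.sub_apply, Matrix.cons_val]
    have e2' : thz σ δ α n ζ 2 - α = rate n α / s * (α * ζ 2) := by rw [e2]; ring
    rw [e1, e2']
    set E := Real.exp ((rate n α / s * (ζ 1 + α * ζ 2 *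
      (Real.log (LL n) / 2 - LL n / 2 - k1))) / (α + rate n α / s * (α * ζ 2))) with hE
    have h5 : δ * E - δ = δ * (E - 1) := by ring
    rw [h5]
    refine ⟨db2, ?_⟩
    have h6 : rate n α / s * (α * ζ 2) / rate n α = α * ζ 2 / s := by field_simp
    rw [h6] at db2
    have h7 : |δ / (2 * α) * (LL n - Real.log (LL n)) * (α * ζ 2 / s)| ≤ δ / (2 * α) * (α * K / s) * LL n := by
      rw [abs_mul, abs_mul, abs_of_pos (by positivity : 0 < δ / (2 * α)), abs_div, abs_mul, abs_of_pos hα, abs_of_pos hs,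
        abs_of_nonneg (by linarith : 0 ≤ LL n - Real.log (LL n))]
      have h9 : LL n - Real.log (LL n) ≤ LL n := by linarith
      have := hζ 2
      calc δ / (2 * α) * (LL n - Real.log (LL n)) * (α * |ζ 2| / s) ≤ δ / (2 * α) * LL n * (α * K / s) := by
            gcongr
        _ = _ := by ring
    have h8 : |δ / s * (ζ 1 / α - k1 * ζ 2)| ≤ δ / s * (K / α + |k1| * K) := by
      rw [abs_mul, abs_of_pos (by positivity : 0 < δ / s)]
      refine mul_le_mul_of_nonneg_left ?_ (by positivity)
      refine (abs_sub _ _).trans ?_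
      rw [abs_div, abs_mul, abs_of_pos hα]
      have h1 := hζ 1
      have h2 := hζ 2
      gcongr
    have h9 : |δ * (E - 1) / rate n α| ≤ (ε + δ / (2 * α) * (α * K / s) + δ / s * (K / α + |k1| * K)) * LL n := by
      have d1 := abs_le.mp db2
      have d2 := abs_le.mp h7
      have d3 := abs_le.mp h8
      have d4 : ε ≤ ε * LL n := le_mul_of_one_le_right hε.le hL
      have d5 : δ / s * (K / α + |k1| * K) ≤ δ / s * (K / α + |k1| * K) * LL n :=
        le_mul_of_one_le_right (by positivity) hL
      rw [abs_le]
      constructor <;> linarith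
    rw [abs_div, abs_of_pos hρ, div_le_iff₀ hρ] at h9
    refine h9.trans (le_trans ?_ b7)
    rw [mul_assoc]
    refine mul_le_mul_of_nonneg_left ?_ (by positivity)
    linarith
  · simp only [Fin.reduceFinMk, Pi.sub_apply, Matrix.cons_val]
    have e2' : thz σ δ α n ζ 2 - α = rate n α / s * (α * ζ 2) := by rw [e2]; ring
    rw [e2']
    constructor
    · have : rate n α / s * (α * ζ 2) / rate n α - α / s * ζ 2 = 0 := by field_simp; ring
      rw [this, abs_zero]; exact hε.le
    · rw [← p2]
      refine hab.trans (le_trans ?_ b8)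
      calc rate n α / s * (α * K) = α * K / s * rate n α := by ring
        _ ≤ _ := mul_le_mul_of_nonneg_left hρL (by positivity)

end PartX

section PartY

variable {σ δ α : ℝ}

/-! ### Weak convergence from characteristic functions -/

lemma sum_mulVec (B : Matrix (Fin 3) (Fin 3) ℝ) (s v : Fin 3 → ℝ) :
    ∑ i, s i * B.mulVec v i = ∑ j, (Bᵀ.mulVec s) j * v j := by
  change s ⬝ᵥ (B *ᵥ v) = (Bᵀ *ᵥ s) ⬝ᵥ v
  rw [Matrix.dotProduct_mulVec, Matrix.mulVec_transpose]

lemma sum_sq_mulVec (B : Matrix (Fin 3) (Fin 3) ℝ) (s : Fin 3 → ℝ) :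
    ∑ j, (Bᵀ.mulVec s) j ^ 2 = s ⬝ᵥ ((B * Bᵀ) *ᵥ s) := by
  rw [← Matrix.mulVec_mulVec]
  change _ = ∑ i, s i * B.mulVec (Bᵀ *ᵥ s) i
  rw [sum_mulVec]
  exact Finset.sum_congr rfl fun j _ => by ring

instance : IsProbabilityMeasure stdGauss3 := by unfold stdGauss3; infer_instance

lemma gauss3_char (s : Fin 3 → ℝ) :
    ∫ v, Complex.exp (Complex.I * ((∑ i, s i * v i : ℝ) : ℂ)) ∂stdGauss3 =
      Complex.exp (((-(∑ i, s i ^ 2) / 2 : ℝ)) : ℂ) := by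
  have h1 : ∀ v : Fin 3 → ℝ, Complex.exp (Complex.I * ((∑ i, s i * v i : ℝ) : ℂ)) =
      ∏ i, Complex.exp ((s i : ℂ) * (v i : ℂ) * Complex.I) := by
    intro v
    rw [← Complex.exp_sum]
    congr 1
    push_cast
    rw [Finset.mul_sum]
    exact Finset.sum_congr rfl fun i _ => by ring
  simp_rw [h1]
  unfold stdGauss3
  rw [integral_fintype_prod_eq_prod (𝕜 := ℂ) (fun i (y : ℝ) => Complex.exp ((s i : ℂ) * (y : ℂ) * Complex.I))]
  have h2 : ∀ i, ∫ y : ℝ, Complex.exp ((s i : ℂ) * (y : ℂ) * Complex.I) ∂(ProbabilityTheory.gaussianReal 0 1) =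
      Complex.exp (((-(s i ^ 2) / 2 : ℝ)) : ℂ) := by
    intro i
    have h3 := ProbabilityTheory.charFun_gaussianReal (μ := 0) (v := 1) (s i)
    rw [charFun_apply_real] at h3
    rw [h3]
    congr 1
    push_cast
    ring
  simp_rw [h2]
  rw [← Complex.exp_sum]
  congr 1
  push_cast
  rw [neg_div, Finset.sum_div, ← Finset.sum_neg_distrib]
  exact Finset.sum_congr rfl fun i _ => by ring

lemma measurable_toLp3 {Ω : Type*} [MeasurableSpace Ω] {V : Ω → Fin 3 → ℝ} (hV : Measurable V) :
    Measurable (fun x => (WithLp.toLp 2 (V x) : EuclideanSpace ℝ (Fin 3))) :=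
  (WithLp.measurable_toLp 2 (Fin 3 → ℝ)).comp hV

lemma charFun_toLp {Ω : Type*} [MeasurableSpace Ω] (Q : Measure Ω) {V : Ω → Fin 3 → ℝ} (hV : Measurable V)
    (t : EuclideanSpace ℝ (Fin 3)) :
    charFun (Q.map (fun x => (WithLp.toLp 2 (V x) : EuclideanSpace ℝ (Fin 3)))) t =
      ∫ x, Complex.exp (Complex.I * ((∑ i, t i * V x i : ℝ) : ℂ)) ∂Q := by
  rw [charFun_apply, integral_map (φ := fun x => (WithLp.toLp 2 (V x) : EuclideanSpace ℝ (Fin 3)))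
    (measurable_toLp3 hV).aemeasurable
    (Continuous.aestronglyMeasurable (by fun_prop))]
  refine integral_congr_ae (Eventually.of_forall fun v => ?_)
  simp only
  rw [PiLp.inner_apply, mul_comm]
  simp

lemma integral_toLp {Ω : Type*} [MeasurableSpace Ω] (Q : Measure Ω) {V : Ω → Fin 3 → ℝ} (hV : Measurable V)
    (F : BoundedContinuousFunction (Fin 3 → ℝ) ℝ) (hcF : Continuous fun x : EuclideanSpace ℝ (Fin 3) => (WithLp.ofLp x : Fin 3 → ℝ)) :
    ∫ x, (F.compContinuous ⟨_, hcF⟩) x ∂(Q.map (fun x => (WithLp.toLp 2 (V x) : EuclideanSpace ℝ (Fin 3)))) =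
      ∫ x, F (V x) ∂Q := by
  rw [integral_map (φ := fun x => (WithLp.toLp 2 (V x) : EuclideanSpace ℝ (Fin 3)))
    (measurable_toLp3 hV).aemeasurable
    (BoundedContinuousFunction.continuous _).aestronglyMeasurable]
  rfl

lemma weak_conv {P : ∀ n : ℕ, Measure (Fin n → ℝ)} {W : ∀ n : ℕ, (Fin n → ℝ) → (Fin 3 → ℝ)}
    (hP : ∀ᶠ n in atTop, IsProbabilityMeasure (P n)) (hW : ∀ n, Measurable (W n))
    (B : Matrix (Fin 3) (Fin 3) ℝ)
    (h : ∀ s : Fin 3 → ℝ, Tendsto (fun n => ∫ x, Complex.exp (Complex.I * ((∑ i, s i * W n x i : ℝ) : ℂ)) ∂(P n))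
      atTop (𝓝 (Complex.exp (((-(∑ j, (Bᵀ.mulVec s) j ^ 2) / 2 : ℝ)) : ℂ))))
    (F : BoundedContinuousFunction (Fin 3 → ℝ) ℝ) :
    Tendsto (fun n => ∫ x, F (W n x) ∂(P n)) atTop (𝓝 (∫ v, F v ∂ stdGauss3.map B.mulVec)) := by
  have hB : Measurable (B.mulVec) := (Continuous.matrix_mulVec continuous_const continuous_id).measurable
  have hex : ∀ n, ∃ μ : ProbabilityMeasure (EuclideanSpace ℝ (Fin 3)), IsProbabilityMeasure (P n) →
      (μ : Measure _) = (P n).map (fun x => (WithLp.toLp 2 (W n x) : EuclideanSpace ℝ (Fin 3))) := by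
    intro n
    by_cases hp : IsProbabilityMeasure (P n)
    · exact ⟨⟨_, Measure.isProbabilityMeasure_map (measurable_toLp3 (hW n)).aemeasurable⟩, fun _ => rfl⟩
    · exact ⟨⟨Measure.dirac 0, inferInstance⟩, fun h => absurd h hp⟩
  choose μ hμ using hex
  obtain ⟨μ0, hμ0⟩ : ∃ μ0 : ProbabilityMeasure (EuclideanSpace ℝ (Fin 3)), (μ0 : Measure _) =
      stdGauss3.map (fun v => (WithLp.toLp 2 (B.mulVec v) : EuclideanSpace ℝ (Fin 3))) :=
    ⟨⟨_, Measure.isProbabilityMeasure_map (measurable_toLp3 hB).aemeasurable⟩, rfl⟩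
  have hconv : Tendsto μ atTop (𝓝 μ0) := by
    rw [ProbabilityMeasure.tendsto_iff_tendsto_charFun]
    intro t
    rw [hμ0, charFun_toLp _ hB]
    simp_rw [sum_mulVec]
    rw [gauss3_char]
    refine (h (WithLp.ofLp t)).congr' ?_
    filter_upwards [hP] with n hn
    rw [hμ n hn, charFun_toLp _ (hW n)]
  rw [ProbabilityMeasure.tendsto_iff_forall_integral_tendsto] at hconv
  have hcF : Continuous fun x : EuclideanSpace ℝ (Fin 3) => (WithLp.ofLp x : Fin 3 → ℝ) := PiLp.continuous_ofLp 2 _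
  have := hconv (F.compContinuous ⟨_, hcF⟩)
  rw [hμ0, integral_toLp _ hB] at this
  rw [integral_map hB.aemeasurable F.continuous.aestronglyMeasurable]
  refine this.congr' ?_
  filter_upwards [hP] with n hn
  rw [hμ n hn, integral_toLp _ (hW n)]

/-! ### The main theorem, assembled -/

lemma measurable_thz (σ δ α : ℝ) (n : ℕ) : Measurable (thz σ δ α n) := by
  have hp := (continuous_pz σ δ α n).measurable
  have hpi : ∀ i, Measurable fun ζ => pz σ δ α n ζ i := fun i => (measurable_pi_apply i).comp hp
  refine measurable_pi_iff.mpr fun i => ?_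
  fin_cases i
  · exact measurable_const.mul (hpi 0).exp
  · exact ((((hpi 1).add measurable_const).sub (((hpi 2).div_const 2).mul_const _)).div (measurable_const.add (hpi 2))).exp
  · exact measurable_const.add (hpi 2)

lemma measurable_Lr {n : ℕ} {r : (Fin 3 → ℝ) → ℝ → ℝ} (hr : ∀ ζ, Measurable (r ζ)) (ζ : Fin 3 → ℝ) :
    Measurable (fun x : Fin n → ℝ => Lr r ζ x) := by
  unfold Lr
  refine Finset.measurable_sum _ fun j _ => ?_
  exact (measurable_const.add (((hr ζ).comp (measurable_pi_apply j)).max measurable_const)).log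

lemma continuous_Lr {n : ℕ} {r : (Fin 3 → ℝ) → ℝ → ℝ} (hr : ∀ x, Continuous fun ζ => r ζ x) (x : Fin n → ℝ) :
    Continuous (fun ζ => Lr r ζ x) := by
  unfold Lr
  refine continuous_finsetSum _ fun j _ => ?_
  refine Continuous.log (continuous_const.add ((hr (x j)).max continuous_const)) fun ζ => ?_
  have := le_max_right (r ζ (x j)) (-1 / 2)
  have : 0 < 1 + max (r ζ (x j)) (-1 / 2) := by linarith
  exact this.ne'

lemma exists_z {ν : ℕ → Measure ℝ} {R τ : ℕ → ℝ} {ξ : ℕ → Fin 3 → ℝ → ℝ} {η : ℕ → Fin 6 → ℝ → ℝ}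
    {e : ℕ → ℕ → ℝ → ℝ} {cf : ℕ → (Fin 3 → ℝ) → Fin 6 → ℝ} {r : ℕ → (Fin 3 → ℝ) → ℝ → ℝ}
    (hS : Sq ν R τ ξ η e cf r) : ∃ z : ∀ n : ℕ, (Fin n → ℝ) → (Fin 3 → ℝ), (∀ n, Measurable (z n)) ∧
      ∀ᶠ n in atTop, ∀ x, (∀ i, |z n x i| ≤ R n) ∧
      ∀ ζ : Fin 3 → ℝ, (∀ i, |ζ i| ≤ R n) → Lr (r n) ζ x ≤ Lr (r n) (z n x) x := by
  classical
  have hex : ∀ n, ∃ s : (Fin n → ℝ) → (Fin 3 → ℝ), Measurable s ∧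
      (Blk n (ν n) (R n) (τ n) (ξ n) (η n) (e n) (cf n) (r n) → ∀ x, (∀ i, |s x i| ≤ R n) ∧
      ∀ ζ : Fin 3 → ℝ, (∀ i, |ζ i| ≤ R n) → Lr (r n) ζ x ≤ Lr (r n) (s x) x) := by
    intro n
    by_cases hB : Blk n (ν n) (R n) (τ n) (ξ n) (η n) (e n) (cf n) (r n)
    · obtain ⟨s, h1, h2, h3⟩ := argmax_cube (R n) (zero_le_one.trans hB.one_le) (fun ζ (x : Fin n → ℝ) => Lr (r n) ζ x)
        (continuous_Lr hB.cr) (measurable_Lr hB.mr)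
      exact ⟨s, h1, fun _ x => ⟨h2 x, h3 x⟩⟩
    · exact ⟨fun _ => 0, measurable_const, fun h => absurd h hB⟩
  choose z h1 h2 using hex
  exact ⟨z, h1, hS.blk.mono fun n hB => h2 n hB⟩

lemma P0_of_unif {P : ∀ n : ℕ, Measure (Fin n → ℝ)} {z : ∀ n : ℕ, (Fin n → ℝ) → (Fin 3 → ℝ)}
    (hz : ∀ i, Tg P (fun n x => z n x i)) (D : ℕ → (Fin 3 → ℝ) → ℝ)
    (hD : ∀ K ε : ℝ, 0 ≤ K → 0 < ε → ∀ᶠ n in atTop, ∀ ζ : Fin 3 → ℝ, (∀ i, |ζ i| ≤ K) → |D n ζ| ≤ ε) :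
    P0 P (fun n x => D n (z n x)) := by
  intro ε hε
  rw [ENNReal.tendsto_nhds_zero]
  intro η hη
  have h3 : 0 < η / 3 := ENNReal.div_pos hη.ne' (by norm_num)
  choose K hK hK2 using fun i => hz i (η / 3) h3
  have hsum : ∀ i, K i ≤ ∑ i, K i := fun i => Finset.single_le_sum (fun i _ => (hK i).le) (Finset.mem_univ i)
  filter_upwards [hD (∑ i, K i) (ε / 2) (Finset.sum_nonneg fun i _ => (hK i).le) (by linarith), hK2 0, hK2 1, hK2 2]
    with n hn k0 k1 k2
  calc P n {x | ε ≤ |D n (z n x)|} ≤ P n (({x | K 0 ≤ |z n x 0|} ∪ {x | K 1 ≤ |z n x 1|}) ∪ {x | K 2 ≤ |z n x 2|}) := by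
        refine measure_mono fun x hx => ?_
        by_contra hcon
        simp only [Set.mem_union, Set.mem_ofPred_eq, not_or, not_le] at hcon
        have := hn (z n x) (fun i => by
          fin_cases i
          · exact (hcon.1.1.le).trans (hsum 0)
          · exact (hcon.1.2.le).trans (hsum 1)
          · exact (hcon.2.le).trans (hsum 2))
        have hx' : ε ≤ |D n (z n x)| := hx
        linarith
    _ ≤ η / 3 + η / 3 + η / 3 := (measure_union_le _ _).trans (add_le_add ((measure_union_le _ _).trans (add_le_add k0 k1)) k2)
    _ = η := ENNReal.add_thirds η

lemma prob_one {P : ∀ n : ℕ, Measure (Fin n → ℝ)} (hP : ∀ᶠ n in atTop, IsProbabilityMeasure (P n))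
    {S : ∀ n : ℕ, Set (Fin n → ℝ)} (h : Tendsto (fun n => P n (S n)ᶜ) atTop (𝓝 0)) :
    Tendsto (fun n => P n (S n)) atTop (𝓝 1) := by
  have h1 : Tendsto (fun n => 1 - P n (S n)ᶜ) atTop (𝓝 (1 - 0)) :=
    ENNReal.Tendsto.sub tendsto_const_nhds h (Or.inl ENNReal.one_ne_top)
  rw [tsub_zero] at h1
  refine tendsto_of_tendsto_of_tendsto_of_le_of_le' h1 tendsto_const_nhds ?_ ?_
  · filter_upwards [hP] with n hn
    rw [tsub_le_iff_right]
    calc (1 : ENNReal) = P n (S n ∪ (S n)ᶜ) := by rw [Set.union_compl_self]; exact hn.measure_univ.symm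
      _ ≤ _ := measure_union_le _ _
  · filter_upwards [hP] with n hn using prob_le_one

lemma vecNorm_le (v : Fin 3 → ℝ) : vecNorm v ≤ ∑ i, |v i| := by
  unfold vecNorm
  have h0 : 0 ≤ ∑ i, |v i| := Finset.sum_nonneg fun i _ => abs_nonneg _
  refine Real.sqrt_le_iff.mpr ⟨h0, ?_⟩
  rw [Fin.sum_univ_three, Fin.sum_univ_three]
  have a := abs_nonneg (v 0)
  have b := abs_nonneg (v 1)
  have c := abs_nonneg (v 2)
  rw [← sq_abs (v 0), ← sq_abs (v 1), ← sq_abs (v 2)]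
  nlinarith [mul_nonneg a b, mul_nonneg a c, mul_nonneg b c]

lemma main_thm (hσ : 0 < σ) (hδ : 0 < δ) (hα : 0 < α) (hα2 : α < 2) :
    ∃ est : (n : ℕ) → (Fin n → ℝ) → (Fin 3 → ℝ),
      (∀ n : ℕ, Measurable (est n)) ∧
      Tendsto
        (fun n : ℕ => Pn n ![σ, δ, α]
          {x | IsLocalMax (fun θ : Fin 3 → ℝ => logLik n θ x) (est n x)})
        atTop (𝓝 1) ∧
      (∀ ε > (0 : ℝ),
        Tendsto
          (fun n : ℕ => Pn n ![σ, δ, α] {x | ε < vecNorm (est n x - ![σ, δ, α])})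
          atTop (𝓝 0)) ∧
      (∀ B : Matrix (Fin 3) (Fin 3) ℝ, B * Bᵀ = (Imat ![σ, δ, α])⁻¹ →
        ∀ F : BoundedContinuousFunction (Fin 3 → ℝ) ℝ,
          Tendsto
            (fun n : ℕ =>
              ∫ x, F ((un n ![σ, δ, α])⁻¹.mulVec (est n x - ![σ, δ, α]))
                ∂ Pn n ![σ, δ, α])
            atTop (𝓝 (∫ v, F v ∂ stdGauss3.map B.mulVec))) := by
  obtain ⟨τ, hτ, hev⟩ := blk_concrete hσ hδ hα hα2
  set ν : ℕ → Measure ℝ := fun n => nuM n ![σ, δ, α] with hν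
  have hPP : ∀ n, Pn n ![σ, δ, α] = PP ν n := fun n => rfl
  have hS : Sq ν LL τ (xiF σ δ α) (etaF σ δ α) (eF σ δ α) (cfF σ δ α) (rF σ δ α) :=
    ⟨hev.mono fun n h => h.2, hτ, tendsto_LL, fun ζ => gram_concrete hσ hδ hα hα2 ζ⟩
  obtain ⟨z, hzm, hz⟩ := exists_z hS
  have hprob : ∀ᶠ n in atTop, IsProbabilityMeasure (PP ν n) := hS.blk.mono fun n hB => by
    have := hB.prob
    unfold PP; infer_instance
  have hzt := hS.z_tight z hz
  have hs : 0 < √(kappa0 σ δ α) := Real.sqrt_pos.mpr (kappa0_pos hσ hδ hα hα2)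
  have hem : ∀ n, Measurable (fun x => thz σ δ α n (z n x)) := fun n => (measurable_thz σ δ α n).comp (hzm n)
  simp only [hPP]
  refine ⟨fun n x => thz σ δ α n (z n x), hem, ?_, ?_, ?_⟩
  · refine prob_one hprob ?_
    have h1 := hS.SS0 (1 / 432) (by norm_num)
    have h2 := fun i => (hzt i).escape tendsto_LL
    have h3 := ((h1.add (h2 0)).add (h2 1)).add (h2 2)
    simp only [add_zero] at h3
    refine enn_squeeze h3 ?_
    filter_upwards [hev, hz, tendsto_LL.eventually_ge_atTop 1] with n ⟨⟨hn, hSm, hq, hss, hxs, hcube⟩, hB⟩ hzn hL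
    refine le_trans ?_ ((measure_union_le _ _).trans (add_le_add ((measure_union_le _ _).trans
      (add_le_add (measure_union_le _ _) le_rfl)) le_rfl))
    refine measure_mono fun x hx => ?_
    by_contra hcon
    simp only [Set.mem_union, Set.mem_ofPred_eq, not_or, not_le] at hcon
    obtain ⟨⟨⟨c1, c2⟩, c3⟩, c4⟩ := hcon
    apply hx
    have hc : 0 < rate n α / √(kappa0 σ δ α) := div_pos (rate_pos hn (by linarith) α) hs
    have hsmall := hB.e1_small x ((le_abs_self _).trans c1.le)
    refine isLocalMax_thz (R := LL n) hn hσ hδ hα hc hq x (fun ζ hζ => ⟨?_, fun j => ?_⟩) (z n x) (fun i => ?_) (hzn x).2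
    · exact (p2_range hα hα2 ((hcube ζ hζ).2.2.trans hss)).1
    · exact (log_expand (hB.e0 _) (hB.e32 _) (hB.e21 _) (hsmall j) (hB.ξle ζ hζ _) (hB.ηle ζ hζ _) (hB.rem ζ hζ _)).1
    · fin_cases i
      · exact c2
      · exact c3
      · exact c4
  · intro ε hε
    have h1 : ∀ i, P0 (PP ν) (fun n x => (fun ζ => thz σ δ α n ζ i - ![σ, δ, α] i) (z n x)) := fun i =>
      P0_of_unif hzt (fun n ζ => thz σ δ α n ζ i - ![σ, δ, α] i) (fun K ε hK hε =>
        (thz_dev hσ hδ hα hα2 hK hε).mono fun n hn ζ hζ => (hn ζ hζ i).2)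
    have h2 := P0.sum Finset.univ (fun i _ => (h1 i).abs)
    refine enn_squeeze (h2 ε hε) (Eventually.of_forall fun n => measure_mono fun x hx => ?_)
    have hx' : ε < vecNorm (thz σ δ α n (z n x) - ![σ, δ, α]) := hx
    have := vecNorm_le (thz σ δ α n (z n x) - ![σ, δ, α])
    exact (hx'.le.trans this).trans (le_abs_self _)
  · intro B hBB F
    have hWm : ∀ n, Measurable (fun x => (un n ![σ, δ, α])⁻¹.mulVec (thz σ δ α n (z n x) - ![σ, δ, α])) := fun n => by
      have hc : Measurable ((un n ![σ, δ, α])⁻¹.mulVec) :=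
        (Continuous.matrix_mulVec continuous_const continuous_id).measurable
      exact hc.comp ((hem n).sub measurable_const)
    refine weak_conv hprob hWm B (fun s => ?_) F
    have hAB : ∑ j, (Bᵀ.mulVec s) j ^ 2 = ∑ j, ((Amat σ δ α)ᵀ.mulVec s) j ^ 2 := by
      rw [sum_sq_mulVec, sum_sq_mulVec, hBB, Amat_inv hσ hδ hα hα2]
    rw [hAB]
    refine slutsky ?_ (hS.clt ((Amat σ δ α)ᵀ.mulVec s)) ?_
    · filter_upwards [hprob, hS.blk] with n hn hB
      refine ⟨hn, ?_, ?_⟩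
      · refine Finset.measurable_sum _ fun i _ => measurable_const.mul ?_
        unfold Dl
        exact Finset.measurable_sum _ fun j _ => (hB.mξ i).comp (measurable_pi_apply j)
      · exact Finset.measurable_sum _ fun i _ => measurable_const.mul ((measurable_pi_apply i).comp (hWm n))
    · have h1 : ∀ i, P0 (PP ν) (fun n x => (fun ζ => (un n ![σ, δ, α])⁻¹.mulVec (thz σ δ α n ζ - ![σ, δ, α]) i
          - (Amat σ δ α).mulVec ζ i) (z n x)) := fun i =>
        P0_of_unif hzt (fun n ζ => (un n ![σ, δ, α])⁻¹.mulVec (thz σ δ α n ζ - ![σ, δ, α]) i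
          - (Amat σ δ α).mulVec ζ i) (fun K ε hK hε =>
          (thz_dev hσ hδ hα hα2 hK hε).mono fun n hn ζ hζ => (hn ζ hζ i).1)
      have h2 : P0 (PP ν) (fun n x => ∑ i, ((un n ![σ, δ, α])⁻¹.mulVec (thz σ δ α n (z n x) - ![σ, δ, α]) i
          - (Amat σ δ α).mulVec (z n x) i) * s i) :=
        P0.sum Finset.univ (fun i _ => (h1 i).mul_tight (Tg.const (s i)))
      have h3 : P0 (PP ν) (fun n x => ∑ i, (z n x i - Dl (xiF σ δ α n) x i) * ((Amat σ δ α)ᵀ.mulVec s) i) :=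
        P0.sum Finset.univ (fun i _ => (hS.close z hz i).mul_tight (Tg.const _))
      refine (h2.add h3).mono (Eventually.of_forall fun n x => le_of_eq ?_)
      congr 1
      have h4 := sum_mulVec (Amat σ δ α) s (z n x)
      simp only [sub_mul, Finset.sum_sub_distrib]
      have h5 : ∑ i, (Amat σ δ α).mulVec (z n x) i * s i = ∑ i, z n x i * ((Amat σ δ α)ᵀ.mulVec s) i := by
        simp only [mul_comm] at h4 ⊢
        exact h4
      rw [h5]
      simp only [mul_comm]
      ring

end PartY

/-- existence and asymptotic normality of a local maximum likelihood estimator. -/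
theorem statement4 (σ₀ δ₀ α₀ : ℝ) (hσ : 0 < σ₀) (hδ : 0 < δ₀) (hα : α₀ ∈ Set.Ioo (0 : ℝ) 2) :
    ∃ est : (n : ℕ) → (Fin n → ℝ) → (Fin 3 → ℝ),
      (∀ n : ℕ, Measurable (est n)) ∧
      Tendsto
        (fun n : ℕ => Pn n ![σ₀, δ₀, α₀]
          {x | IsLocalMax (fun θ : Fin 3 → ℝ => logLik n θ x) (est n x)})
        atTop (𝓝 1) ∧
      (∀ ε > (0 : ℝ),
        Tendsto
          (fun n : ℕ => Pn n ![σ₀, δ₀, α₀] {x | ε < vecNorm (est n x - ![σ₀, δ₀, α₀])})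
          atTop (𝓝 0)) ∧
      (∀ B : Matrix (Fin 3) (Fin 3) ℝ, B * Bᵀ = (Imat ![σ₀, δ₀, α₀])⁻¹ →
        ∀ F : BoundedContinuousFunction (Fin 3 → ℝ) ℝ,
          Tendsto
            (fun n : ℕ =>
              ∫ x, F ((un n ![σ₀, δ₀, α₀])⁻¹.mulVec (est n x - ![σ₀, δ₀, α₀]))
                ∂ Pn n ![σ₀, δ₀, α₀])
            atTop (𝓝 (∫ v, F v ∂ stdGauss3.map B.mulVec))) := by
  exact main_thm hσ hδ hα.1 hα.2

end LevyLAN
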